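/- Let p > 2, let a : Ω → [γ, L] (0 < γ < L < ∞) be Dini continuous with modulus ω, and let w ∈ W^{1,p}_{loc}(Ω; Λ^k ℝ^n ⊗ ℝ^N) be a local weak solution of δ(a(x)|dw|^{p−2} dw) = 0 and δw = 0 in Ω. Then there exist a constant c = c(n,N,k,p,γ,L,ω(·)) ≥ 1 and a radius R₁ = R₁(n,N,k,p,γ,L,ω(·)) > 0 such that the pointwise estimate |dw(x)| ≤ c (⨍_{B(x,R)} |dw|^p)^{1/p} holds whenever B(x,2R) ⊂ Ω, 2R ≤ R₁ and x is a Lebesgue point of dw. If a is constant, the estimate holds with no restriction on R. -/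

import Mathlib

open MeasureTheory Metric Filter
open scoped ENNReal NNReal

noncomputable section

/-- Euclidean space `ℝ^n`. -/
abbrev En (n : ℕ) : Type := EuclideanSpace ℝ (Fin n)

/-- Index set for the coefficients of a `k`-form on `ℝ^n`: increasing multi-indices,
identified with `k`-element subsets of `Fin n`. -/
abbrev FormIdx (n k : ℕ) : Type := {s : Finset (Fin n) // s.card = k}

/-- An `ℝ^N`-valued `k`-covector on `ℝ^n`, described by its coefficients. -/
abbrev Form (n N k : ℕ) : Type := FormIdx n k × Fin N → ℝ

variable {n N k : ℕ}

/-- Euclidean inner product of two (vector-valued) forms. -/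
def finner (v w : Form n N k) : ℝ := ∑ q, v q * w q

/-- Euclidean norm of a (vector-valued) form. -/
def fnorm (v : Form n N k) : ℝ := Real.sqrt (∑ q, v q ^ 2)

/-- Euclidean norm of a full array of partial derivatives (a gradient). -/
def gnorm (H : Fin n → Form n N k) : ℝ := Real.sqrt (∑ i, ∑ q, H i q ^ 2)

/-- The pointwise exterior derivative of a `k`-form, assembled from the array
`G i = ∂_i u` of its partial derivatives. -/
def extD (G : Fin n → Form n N k) : Form n N (k + 1) := fun q =>
  ∑ i : Fin n,
    if h : i ∈ q.1.1 then
      (-1 : ℝ) ^ (q.1.1.filter (fun j => j < i)).card *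
        G i (⟨q.1.1.erase i, by simp [Finset.card_erase_of_mem h, q.1.2]⟩, q.2)
    else 0

/-- The pointwise codifferential of a `(k+1)`-form, assembled from the array
`G i = ∂_i u` of its partial derivatives. -/
def codiff (G : Fin n → Form n N (k + 1)) : Form n N k := fun q =>
  -∑ i : Fin n,
      if h : i ∈ q.1.1 then 0
      else
        (-1 : ℝ) ^ (q.1.1.filter (fun j => j < i)).card *
          G i (⟨insert i q.1.1, by simp [Finset.card_insert_of_notMem h, q.1.2]⟩, q.2)

/-- The nonlinearity `z ↦ t |z|^{p-2} z`. -/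
def nl (p t : ℝ) (z : Form n N k) : Form n N k := fun q => t * fnorm z ^ (p - 2) * z q

/-- The auxiliary map `V(z) = |z|^{(p-2)/2} z`. -/
def Vform (p : ℝ) (z : Form n N k) : Form n N k := fun q => fnorm z ^ ((p - 2) / 2) * z q

/-- The `i`-th standard basis vector of `ℝ^n`. -/
def basisVec (i : Fin n) : En n := EuclideanSpace.single i 1

/-- Scalar test functions: smooth and compactly supported inside `Ω`. -/
def IsTestFun (Ω : Set (En n)) (φ : En n → ℝ) : Prop :=
  ContDiff ℝ (⊤ : ℕ∞) φ ∧ HasCompactSupport φ ∧ tsupport φ ⊆ Ω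

/-- Test `k`-forms: componentwise smooth and compactly supported inside `Ω`. -/
def IsTestForm (Ω : Set (En n)) (φ : En n → Form n N k) : Prop :=
  (∀ q, ContDiff ℝ (⊤ : ℕ∞) fun x => φ x q) ∧ HasCompactSupport φ ∧ tsupport φ ⊆ Ω

/-- The (classical) array of partial derivatives of a form-valued map. -/
def smoothGrad (φ : En n → Form n N k) (x : En n) : Fin n → Form n N k := fun i q =>
  fderiv ℝ (fun y => φ y q) x (basisVec i)

/-- `g` is the weak (distributional) `i`-th partial derivative of `u` on `Ω`. -/
def HasWeakPartial (Ω : Set (En n)) (u g : En n → ℝ) (i : Fin n) : Prop :=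
  ∀ φ : En n → ℝ, IsTestFun Ω φ →
    ∫ x in Ω, u x * fderiv ℝ φ x (basisVec i) = -∫ x in Ω, g x * φ x

/-- `G` is the weak gradient (array of weak partial derivatives) of the form `u` on `Ω`. -/
def HasWeakGrad (Ω : Set (En n)) (u : En n → Form n N k)
    (G : En n → Fin n → Form n N k) : Prop :=
  ∀ i q, HasWeakPartial Ω (fun x => u x q) (fun x => G x i q) i

/-- Membership in `W^{1,p}(Ω)` for a form `u` with weak gradient `G`. -/
def MemW1p (Ω : Set (En n)) (p : ℝ) (u : En n → Form n N k)
    (G : En n → Fin n → Form n N k) : Prop :=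
  HasWeakGrad Ω u G ∧
    (∀ q, AEStronglyMeasurable (fun x => u x q) (volume.restrict Ω)) ∧
    (∀ i q, AEStronglyMeasurable (fun x => G x i q) (volume.restrict Ω)) ∧
    IntegrableOn (fun x => fnorm (u x) ^ p) Ω volume ∧
    IntegrableOn (fun x => gnorm (G x) ^ p) Ω volume

/-- Membership in `W^{1,p}_loc(Ω)` for a form `u` with weak gradient `G`. -/
def MemW1pLoc (Ω : Set (En n)) (p : ℝ) (u : En n → Form n N k)
    (G : En n → Fin n → Form n N k) : Prop :=
  HasWeakGrad Ω u G ∧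
    (∀ q, AEStronglyMeasurable (fun x => u x q) (volume.restrict Ω)) ∧
    (∀ i q, AEStronglyMeasurable (fun x => G x i q) (volume.restrict Ω)) ∧
    ∀ K, K ⊆ Ω → IsCompact K →
      IntegrableOn (fun x => fnorm (u x) ^ p) K volume ∧
      IntegrableOn (fun x => gnorm (G x) ^ p) K volume

/-- `δ f = 0` on `Ω` in the sense of distributions: `∫ ⟨f, dψ⟩ = 0` for every smooth
compactly supported form `ψ` of degree one less. (Vacuous for `0`-forms.) -/
def WeaklyCoclosed (Ω : Set (En n)) (f : En n → Form n N k) : Prop :=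
  ∀ (j : ℕ) (h : j + 1 = k) (ψ : En n → Form n N j), IsTestForm Ω ψ →
    ∫ x in Ω, finner (f x) (cast (congrArg (Form n N) h) (extD (smoothGrad ψ x))) = 0

/-- Weak formulation of the vanishing of the tangential part `ν ∧ u = 0` on `∂B`:
the integration-by-parts formula `∫_B ⟨du, ψ⟩ = ∫_B ⟨u, δψ⟩` holds without boundary
contribution for every smooth `(k+1)`-form `ψ`. -/
def TangentialZero (B : Set (En n)) (u : En n → Form n N k)
    (G : En n → Fin n → Form n N k) : Prop :=
  ∀ ψ : En n → Form n N (k + 1), (∀ q, ContDiff ℝ (⊤ : ℕ∞) fun x => ψ x q) →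
    ∫ x in B, finner (extD (G x)) (ψ x) = ∫ x in B, finner (u x) (codiff (smoothGrad ψ x))

/-- The space `W^{1,p}_{δ,T}(B)`: `W^{1,p}` forms which are weakly coclosed in `B` and
have vanishing tangential part on `∂B`. -/
def MemWdeltaT (B : Set (En n)) (p : ℝ) (u : En n → Form n N k)
    (G : En n → Fin n → Form n N k) : Prop :=
  MemW1p B p u G ∧ WeaklyCoclosed B u ∧ TangentialZero B u G

/-- `u` (with weak gradient `G`) is a local weak solution of
`δ(a(x) |du|^{p-2} du) = f` on `Ω`. -/
def IsLocalWeakSolution (Ω : Set (En n)) (p : ℝ) (a : En n → ℝ)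
    (u : En n → Form n N k) (G : En n → Fin n → Form n N k)
    (f : En n → Form n N k) : Prop :=
  ∀ φ : En n → Form n N k, IsTestForm Ω φ →
    ∫ x in Ω, finner (nl p (a x) (extD (G x))) (extD (smoothGrad φ x)) =
      ∫ x in Ω, finner (f x) (φ x)

/-- The Lorentz (quasi-)norm `‖g‖_{L^{(p,θ)}(μ)}`. -/
def lorentzNorm {α : Type*} [MeasurableSpace α] (μ : Measure α) (p : ℝ) (θ : ℝ≥0∞)
    (g : α → ℝ) : ℝ≥0∞ :=
  if θ = ⊤ then
    (⨆ t : ℝ, if 0 < t then ENNReal.ofReal (t ^ p) * μ {x | t < |g x|} else 0) ^ (1 / p)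
  else
    (∫⁻ t in Set.Ioi (0 : ℝ),
        (ENNReal.ofReal (t ^ p) * μ {x | t < |g x|}) ^ (θ.toReal / p) / ENNReal.ofReal t) ^
      (1 / θ.toReal)

/-- Membership in the Lorentz space `L^{(p,θ)}(s)`. -/
def MemLorentzOn {α : Type*} [MeasurableSpace α] (μ : Measure α) (p : ℝ) (θ : ℝ≥0∞)
    (g : α → ℝ) (s : Set α) : Prop :=
  AEStronglyMeasurable g (μ.restrict s) ∧ lorentzNorm (μ.restrict s) p θ g ≠ ⊤

/-- Local membership in the Lorentz space `L^{(p,θ)}` on the open set `Ω`. -/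
def MemLorentzLoc (p : ℝ) (θ : ℝ≥0∞) (g : En n → ℝ) (Ω : Set (En n)) : Prop :=
  ∀ K, K ⊆ Ω → IsCompact K → MemLorentzOn volume p θ g K

/-- The `L^s` norm of a scalar function on a set, valued in `ℝ≥0∞`. -/
def lpNormOn (s : ℝ) (g : En n → ℝ) (A : Set (En n)) : ℝ≥0∞ :=
  (∫⁻ x in A, ENNReal.ofReal (|g x| ^ s)) ^ (1 / s)

/-- A Dini modulus of continuity. -/
def IsDiniModulus (ω : ℝ → ℝ) : Prop :=
  (∀ t, 0 ≤ ω t) ∧ MonotoneOn ω (Set.Ici 0) ∧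
    IntegrableOn (fun t => ω t / t) (Set.Ioc 0 1) volume ∧
    Tendsto ω (nhdsWithin 0 (Set.Ioi 0)) (nhds 0)

/-- `ω` is a modulus of continuity for `a` on `Ω`. -/
def IsModulusFor (ω : ℝ → ℝ) (a : En n → ℝ) (Ω : Set (En n)) : Prop :=
  ∀ x ∈ Ω, ∀ y ∈ Ω, |a x - a y| ≤ ω ‖x - y‖

/-- Dini continuity on `Ω`. -/
def DiniContinuousOn (a : En n → ℝ) (Ω : Set (En n)) : Prop :=
  ∃ ω, IsDiniModulus ω ∧ IsModulusFor ω a Ω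

/-- `a` is `α`-Hölder with constant `C` on `s`. -/
def HolderOn (α C : ℝ) (a : En n → ℝ) (s : Set (En n)) : Prop :=
  ∀ x ∈ s, ∀ y ∈ s, |a x - a y| ≤ C * ‖x - y‖ ^ α

/-- `g` agrees a.e. on `Ω` with a function continuous on `Ω`. -/
def HasContinuousRepOn {V : Type*} [TopologicalSpace V] (Ω : Set (En n)) (g : En n → V) :
    Prop :=
  ∃ v : En n → V, ContinuousOn v Ω ∧ ∀ᵐ x ∂volume.restrict Ω, g x = v x

/-- `g` has locally vanishing mean oscillation in `Ω`. -/
def LocallyVMOOn {V : Type*} [NormedAddCommGroup V] [NormedSpace ℝ V] (Ω : Set (En n))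
    (g : En n → V) : Prop :=
  ∀ K, K ⊆ Ω → IsCompact K → ∀ ε > 0, ∃ r₀ > 0, ∀ x ∈ K, ∀ r, 0 < r → r ≤ r₀ →
    (⨍ y in ball x r, ‖g y - ⨍ z in ball x r, g z‖) ≤ ε

/-- `g` has locally bounded mean oscillation in `Ω`. -/
def LocallyBMOOn {V : Type*} [NormedAddCommGroup V] [NormedSpace ℝ V] (Ω : Set (En n))
    (g : En n → V) : Prop :=
  ∀ K, K ⊆ Ω → IsCompact K → ∃ C : ℝ, ∃ r₀ > 0, ∀ x ∈ K, ∀ r, 0 < r → r ≤ r₀ →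
    (⨍ y in ball x r, ‖g y - ⨍ z in ball x r, g z‖) ≤ C

/-- The `p`-th power of the Campanato seminorm `[u]^p_{𝓛^{p,λ}(s)}`, valued in `ℝ≥0∞`. -/
def campanatoSemi {V : Type*} [NormedAddCommGroup V] [NormedSpace ℝ V] (p lam : ℝ)
    (s : Set (En n)) (u : En n → V) : ℝ≥0∞ :=
  ⨆ (x₀ : En n) (_ : x₀ ∈ closure s) (ρ : ℝ) (_ : 0 < ρ),
    ENNReal.ofReal
      (ρ ^ (-lam) * ∫ y in ball x₀ ρ ∩ s, ‖u y - ⨍ z in ball x₀ ρ ∩ s, u z‖ ^ p)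

/-- The Campanato norm `‖u‖_{𝓛^{p,λ}(s)} = ‖u‖_{L^p(s)} + [u]_{𝓛^{p,λ}(s)}`. -/
def campanatoNorm {V : Type*} [NormedAddCommGroup V] [NormedSpace ℝ V] (p lam : ℝ)
    (s : Set (En n)) (u : En n → V) : ℝ≥0∞ :=
  (∫⁻ y in s, ENNReal.ofReal (‖u y‖ ^ p)) ^ (1 / p) + campanatoSemi p lam s u ^ (1 / p)

/-- Membership in the Campanato space `𝓛^{p,λ}(s)`. -/
def MemCampanatoOn {V : Type*} [NormedAddCommGroup V] [NormedSpace ℝ V] (p lam : ℝ)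
    (s : Set (En n)) (u : En n → V) : Prop :=
  AEStronglyMeasurable u (volume.restrict s) ∧
    IntegrableOn (fun y => ‖u y‖ ^ p) s volume ∧ campanatoSemi p lam s u ≠ ⊤

/-- Local membership in the Campanato space `𝓛^{p,λ}` on `Ω`. -/
def MemCampanatoLoc {V : Type*} [NormedAddCommGroup V] [NormedSpace ℝ V] (p lam : ℝ)
    (Ω : Set (En n)) (u : En n → V) : Prop :=
  ∀ K, K ⊆ Ω → IsCompact K → MemCampanatoOn p lam K u

/-- `v` is of class `C^{1,θ}` locally on `Ω`. -/
def C1HolderLocOn {V : Type*} [NormedAddCommGroup V] [NormedSpace ℝ V] (θ : ℝ)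
    (Ω : Set (En n)) (v : En n → V) : Prop :=
  ∃ Dv : En n → En n →L[ℝ] V, (∀ x ∈ Ω, HasFDerivAt v (Dv x) x) ∧
    ∀ K, K ⊆ Ω → IsCompact K →
      ∃ C : ℝ, 0 ≤ C ∧ ∀ x ∈ K, ∀ y ∈ K, ‖Dv x - Dv y‖ ≤ C * ‖x - y‖ ^ θ

/-- Local membership in `L^q` for a form-valued map. -/
def MemLqLoc (q : ℝ) (f : En n → Form n N k) (Ω : Set (En n)) : Prop :=
  (∀ r, AEStronglyMeasurable (fun x => f x r) (volume.restrict Ω)) ∧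
    ∀ K, K ⊆ Ω → IsCompact K → IntegrableOn (fun x => fnorm (f x) ^ q) K volume

/-- `x` is a Lebesgue point of the form-valued map `g`. -/
def IsLebesguePoint (g : En n → Form n N k) (x : En n) : Prop :=
  Tendsto (fun r => ⨍ y in ball x r, fnorm (g y - g x)) (nhdsWithin 0 (Set.Ioi 0)) (nhds 0)

/-- The hypotheses of the homogeneous Dini-coefficient problem: `a : Ω → [γ,L]` with
modulus of continuity `ω`, and `w ∈ W^{1,p}_loc` a local weak solution of
`δ(a(x)|dw|^{p-2}dw) = 0`, `δw = 0` in `Ω`. -/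
def HomogeneousDiniSetting (n N k : ℕ) (p γ L : ℝ) (ω : ℝ → ℝ) (Ω : Set (En n))
    (a : En n → ℝ) (w : En n → Form n N k) (Gw : En n → Fin n → Form n N k) : Prop :=
  IsOpen Ω ∧ IsModulusFor ω a Ω ∧ (∀ x ∈ Ω, a x ∈ Set.Icc γ L) ∧
    MemW1pLoc Ω p w Gw ∧
    IsLocalWeakSolution Ω p a w Gw (fun _ => (0 : Form n N k)) ∧
    WeaklyCoclosed Ω w

namespace DP
set_option linter.unusedSectionVars false
set_option linter.unusedVariables false
open Set
open scoped RealInnerProductSpace Topology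

/-- structural conditions on the scalar nonlinearity `g` -/
structure GFun (q : ℝ) (g : ℝ → ℝ) : Prop where
  hq : 0 < q
  nonneg : ∀ s, 0 ≤ s → 0 ≤ g s
  mono : MonotoneOn g (Ici 0)
  cont : ContinuousOn g (Ici 0)
  ratio : ∀ s₁ s₂, 0 ≤ s₁ → s₁ ≤ s₂ → 0 < s₂ → (s₁ / s₂) ^ q * g s₂ ≤ g s₁

section alg
variable {W : Type*} [NormedAddCommGroup W] [InnerProductSpace ℝ W]

def gA (g : ℝ → ℝ) (z : W) : W := g (‖z‖ ^ 2) • z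
def gV (g : ℝ → ℝ) (z : W) : W := √(g (‖z‖ ^ 2)) • z
def gG (g : ℝ → ℝ) (s : ℝ) : ℝ := ∫ t in (0:ℝ)..s, g t
def gΓ (g : ℝ → ℝ) (z : W) : ℝ := gG g (‖z‖ ^ 2) / 2

variable {q : ℝ} {g : ℝ → ℝ}

theorem GFun.intble (h : GFun q g) {a b : ℝ} (ha : 0 ≤ a) (hb : 0 ≤ b) :
    IntervalIntegrable g volume a b := by
  apply ContinuousOn.intervalIntegrable
  exact h.cont.mono (fun x hx => le_trans (le_min ha hb) hx.1)

theorem GFun.G_sub (h : GFun q g) {a b : ℝ} (ha : 0 ≤ a) (hb : 0 ≤ b) :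
    g a * (b - a) ≤ gG g b - gG g a := by
  unfold gG
  rw [intervalIntegral.integral_interval_sub_left (h.intble le_rfl hb) (h.intble le_rfl ha)]
  rcases le_total a b with hab | hab
  · have := intervalIntegral.integral_mono_on (μ := volume) hab (f := fun _ => g a) (g := g)
      (by simp) (h.intble ha hb) (fun x hx => h.mono ha (le_trans ha hx.1) hx.1)
    simp only [intervalIntegral.integral_const, smul_eq_mul] at this
    linarith
  · have := intervalIntegral.integral_mono_on (μ := volume) hab (f := g) (g := fun _ => g a)
      (h.intble hb ha) (by simp) (fun x hx => h.mono (le_trans hb hx.1) ha hx.2)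
    simp only [intervalIntegral.integral_const, smul_eq_mul] at this
    rw [intervalIntegral.integral_symm]
    linarith

theorem gG_zero : gG g 0 = 0 := by simp [gG]
theorem gΓ_zero : gΓ g (0 : W) = 0 := by simp [gΓ, gG_zero]
theorem gA_zero : gA g (0 : W) = 0 := by simp [gA]
theorem gV_zero : gV g (0 : W) = 0 := by simp [gV]

theorem GFun.G_nonneg (h : GFun q g) {a : ℝ} (ha : 0 ≤ a) : 0 ≤ gG g a :=
  intervalIntegral.integral_nonneg ha (fun x hx => h.nonneg x hx.1)

theorem GFun.Γ_nonneg (h : GFun q g) (z : W) : 0 ≤ gΓ g z :=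
  div_nonneg (h.G_nonneg (sq_nonneg _)) (by norm_num)

theorem GFun.gs_nonneg (h : GFun q g) (z : W) : 0 ≤ g (‖z‖ ^ 2) := h.nonneg _ (sq_nonneg _)

theorem GFun.G_le (h : GFun q g) {a : ℝ} (ha : 0 ≤ a) : gG g a ≤ g a * a := by
  have := h.G_sub ha le_rfl
  rw [gG_zero] at this; linarith

theorem norm_gV (h : GFun q g) (z : W) : ‖gV g z‖ = √(g (‖z‖ ^ 2)) * ‖z‖ := by
  rw [gV, norm_smul, Real.norm_of_nonneg (Real.sqrt_nonneg _)]

theorem norm_gV_sq (h : GFun q g) (z : W) : ‖gV g z‖ ^ 2 = g (‖z‖ ^ 2) * ‖z‖ ^ 2 := by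
  rw [norm_gV h, mul_pow, Real.sq_sqrt (h.gs_nonneg z)]

theorem norm_gA (h : GFun q g) (z : W) : ‖gA g z‖ = g (‖z‖ ^ 2) * ‖z‖ := by
  rw [gA, norm_smul, Real.norm_of_nonneg (h.gs_nonneg z)]

theorem GFun.Γ_le (h : GFun q g) (z : W) : gΓ g z ≤ ‖gV g z‖ ^ 2 / 2 := by
  rw [norm_gV_sq h, gΓ]
  have := h.G_le (sq_nonneg ‖z‖)
  linarith

theorem GFun.breg1 (h : GFun q g) (a b : W) :
    g (‖a‖ ^ 2) / 2 * ‖b - a‖ ^ 2 ≤ gΓ g b - gΓ g a - ⟪gA g a, b - a⟫ := by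
  have h1 := h.G_sub (sq_nonneg ‖a‖) (sq_nonneg ‖b‖)
  have h2 : ‖b - a‖ ^ 2 = ‖b‖ ^ 2 - 2 * ⟪a, b⟫ + ‖a‖ ^ 2 := by
    rw [norm_sub_sq_real, real_inner_comm]
  have h3 : ⟪gA g a, b - a⟫ = g (‖a‖ ^ 2) * (⟪a, b⟫ - ‖a‖ ^ 2) := by
    rw [gA, inner_smul_left, inner_sub_right, real_inner_self_eq_norm_sq]; simp
  rw [h2, h3, gΓ, gΓ]
  linarith

theorem GFun.mono_A (h : GFun q g) (a b : W) :
    (g (‖a‖ ^ 2) + g (‖b‖ ^ 2)) / 2 * ‖b - a‖ ^ 2 ≤ ⟪gA g b - gA g a, b - a⟫ := by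
  have h1 := h.breg1 a b
  have h2 := h.breg1 b a
  rw [norm_sub_rev] at h2
  have : ⟪gA g b, a - b⟫ = - ⟪gA g b, b - a⟫ := by rw [← inner_neg_right, neg_sub]
  rw [this] at h2
  rw [inner_sub_left]
  linarith

theorem GFun.breg_nonneg (h : GFun q g) (a b : W) : 0 ≤ gΓ g b - gΓ g a - ⟪gA g a, b - a⟫ :=
  le_trans (mul_nonneg (div_nonneg (h.gs_nonneg a) (by norm_num)) (sq_nonneg _)) (h.breg1 a b)

theorem GFun.ratio' (h : GFun q g) {x y t : ℝ} (hx : 0 ≤ x) (hy : 0 ≤ y) (ht : 0 < t) (ht1 : t ≤ 1)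
    (hxy : t * y ≤ x) : t ^ (2 * q) * g (y ^ 2) ≤ g (x ^ 2) := by
  have hty : 0 ≤ t * y := mul_nonneg ht.le hy
  have h0 : g ((t * y) ^ 2) ≤ g (x ^ 2) := h.mono (mem_Ici.2 (sq_nonneg _)) (mem_Ici.2 (sq_nonneg _)) (by gcongr)
  refine le_trans ?_ h0
  rcases hy.eq_or_lt with rfl | hy
  · have : t ^ (2 * q) ≤ 1 := Real.rpow_le_one ht.le ht1 (by linarith [h.hq])
    have h3 := h.nonneg 0 le_rfl
    simp only [mul_zero, ne_eq, OfNat.ofNat_ne_zero, not_false_eq_true, zero_pow]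
    nlinarith
  · have := h.ratio ((t * y) ^ 2) (y ^ 2) (sq_nonneg _) (by
      have : t * y ≤ y := by nlinarith
      gcongr) (by positivity)
    have e : (t * y) ^ 2 / y ^ 2 = t ^ (2:ℝ) := by
      rw [Real.rpow_two]; field_simp
    rw [e, ← Real.rpow_mul ht.le] at this
    exact this

/-- lower bound of the Bregman distance -/
theorem GFun.breg2 (h : GFun q g) (a b : W) :
    (1 / 8) * (1 / 4 : ℝ) ^ (2 * q) * (g (max ‖a‖ ‖b‖ ^ 2) * ‖b - a‖ ^ 2) ≤
      gΓ g b - gΓ g a - ⟪gA g a, b - a⟫ := by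
  have hd : 0 ≤ ‖b - a‖ ^ 2 := sq_nonneg _
  by_cases hab : ‖b‖ / 2 ≤ ‖a‖
  · have h1 := h.breg1 a b
    have h2 := h.ratio' (norm_nonneg a) (le_max_of_le_left (norm_nonneg a) : 0 ≤ max ‖a‖ ‖b‖)
      (t := 1/4) (by norm_num) (by norm_num) (by
        rcases max_cases ‖a‖ ‖b‖ with hm | hm <;> rw [hm.1] <;> linarith [norm_nonneg a, norm_nonneg b])
    have h3 := mul_le_mul_of_nonneg_right h2 hd
    nlinarith [mul_nonneg (h.gs_nonneg a) hd]
  · push Not at hab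
    set m : W := (1/2 : ℝ) • (a + b) with hm
    have hma : m - a = (1/2 : ℝ) • (b - a) := by rw [hm]; module
    have hbm : b - m = (1/2 : ℝ) • (b - a) := by rw [hm]; module
    have h1 := h.breg1 m b
    have h2 := h.breg_nonneg a m
    have h3 := h.mono_A a m
    have h3' : 0 ≤ ⟪gA g m - gA g a, m - a⟫ := le_trans (mul_nonneg (by
      linarith [h.gs_nonneg a, h.gs_nonneg m]) (sq_nonneg _)) h3
    rw [hbm] at h1
    rw [hma] at h2 h3'
    have e1 : ‖(1/2 : ℝ) • (b - a)‖ ^ 2 = ‖b - a‖ ^ 2 / 4 := by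
      rw [norm_smul, mul_pow]; norm_num; ring
    rw [e1] at h1
    simp only [inner_smul_right, inner_sub_left] at h1 h2 h3'
    have hmn : ‖b‖ / 4 ≤ ‖m‖ := by
      rw [hm, norm_smul]
      have := norm_sub_norm_le b (-a)
      rw [norm_neg, sub_neg_eq_add, add_comm b a] at this
      norm_num
      linarith
    have hmax : max ‖a‖ ‖b‖ = ‖b‖ := max_eq_right (by linarith [norm_nonneg b, norm_nonneg a])
    have h4 := h.ratio' (norm_nonneg m) (norm_nonneg b) (t := 1/4) (by norm_num) (by norm_num)
      (by linarith)
    have h5 := mul_le_mul_of_nonneg_right h4 hd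
    rw [hmax]
    nlinarith

theorem bern {q t : ℝ} (hq : 0 < q) (ht : 0 ≤ t) (ht1 : t ≤ 1) : 1 - t ^ q ≤ (1 + q) * (1 - t) := by
  have h1 := one_add_mul_self_le_rpow_one_add (s := t - 1) (by linarith) (p := 1 + q) (by linarith)
  have h2 : t ^ (1 + q) ≤ t ^ q := by
    rcases ht.eq_or_lt with rfl | h0
    · rw [Real.zero_rpow (by linarith), Real.zero_rpow (by linarith)]
    · exact Real.rpow_le_rpow_of_exponent_ge h0 ht1 (by linarith)
  have : 1 + (t - 1) = t := by ring
  rw [this] at h1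
  linarith

theorem aux_diff {κ Q x y : ℝ} {φ : ℝ → ℝ} (hκ : 0 < κ) (hx : 0 ≤ x) (hxy : x ≤ y) (hy : 0 ≤ Q)
    (hr : 0 < y → (x / y) ^ κ * Q ≤ φ x) (hle : φ x ≤ Q) : |Q - φ x| * x ≤ (1 + κ) * Q * (y - x) := by
  rw [abs_of_nonneg (by linarith)]
  rcases (le_trans hx hxy).eq_or_lt with h0 | h0
  · have : x = 0 := by linarith
    subst this; rw [← h0]; simp
  · have h1 := bern hκ (div_nonneg hx h0.le) ((div_le_one h0).2 hxy)
    have h2 := hr h0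
    have h3 : Q - φ x ≤ Q * ((1 + κ) * (1 - x / y)) := by nlinarith
    have h4 : (1 - x / y) * x ≤ y - x := by
      have : (1 - x / y) = (y - x) / y := by field_simp
      rw [this, div_mul_eq_mul_div, div_le_iff₀ h0]
      nlinarith
    calc (Q - φ x) * x ≤ Q * ((1 + κ) * (1 - x / y)) * x := mul_le_mul_of_nonneg_right h3 hx
      _ = (1 + κ) * Q * ((1 - x / y) * x) := by ring
      _ ≤ _ := mul_le_mul_of_nonneg_left h4 (by positivity)

theorem GFun.A_lip' (h : GFun q g) (a b : W) (hab : ‖a‖ ≤ ‖b‖) :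
    ‖gA g b - gA g a‖ ≤ (2 + 2 * q) * (g (‖b‖ ^ 2) * ‖b - a‖) := by
  have hq := h.hq
  have e : gA g b - gA g a = g (‖b‖ ^ 2) • (b - a) + (g (‖b‖ ^ 2) - g (‖a‖ ^ 2)) • a := by
    unfold gA; module
  have h1 := aux_diff (κ := 2 * q) (x := ‖a‖) (y := ‖b‖) (Q := g (‖b‖ ^ 2)) (φ := fun x => g (x ^ 2))
    (by linarith) (norm_nonneg a) hab (h.gs_nonneg b) (by
      intro hb
      have := h.ratio (‖a‖ ^ 2) (‖b‖ ^ 2) (sq_nonneg _) (by gcongr) (by positivity)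
      rwa [← div_pow, ← Real.rpow_two, ← Real.rpow_mul (by positivity)] at this)
    (h.mono (mem_Ici.2 (sq_nonneg _)) (mem_Ici.2 (sq_nonneg _)) (by gcongr))
  rw [e]
  refine le_trans (norm_add_le _ _) ?_
  rw [norm_smul, norm_smul, Real.norm_of_nonneg (h.gs_nonneg b), Real.norm_eq_abs]
  have h2 : ‖b‖ - ‖a‖ ≤ ‖b - a‖ := norm_sub_norm_le b a
  have h3 := h.gs_nonneg b
  have h4 : (1 + 2 * q) * g (‖b‖ ^ 2) * (‖b‖ - ‖a‖) ≤ (1 + 2 * q) * g (‖b‖ ^ 2) * ‖b - a‖ := by gcongr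
  linarith

theorem GFun.V_lip' (h : GFun q g) (a b : W) (hab : ‖a‖ ≤ ‖b‖) :
    ‖gV g b - gV g a‖ ≤ (2 + q) * (√(g (‖b‖ ^ 2)) * ‖b - a‖) := by
  have hq := h.hq
  have e : gV g b - gV g a = √(g (‖b‖ ^ 2)) • (b - a) + (√(g (‖b‖ ^ 2)) - √(g (‖a‖ ^ 2))) • a := by
    unfold gV; module
  have h1 := aux_diff (κ := q) (x := ‖a‖) (y := ‖b‖) (Q := √(g (‖b‖ ^ 2))) (φ := fun x => √(g (x ^ 2)))
    hq (norm_nonneg a) hab (Real.sqrt_nonneg _) (by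
      intro hb
      have := h.ratio (‖a‖ ^ 2) (‖b‖ ^ 2) (sq_nonneg _) (by gcongr) (by positivity)
      have h5 : (‖a‖ / ‖b‖) ^ q * √(g (‖b‖ ^ 2)) = √((‖a‖ ^ 2 / ‖b‖ ^ 2) ^ q * g (‖b‖ ^ 2)) := by
        rw [Real.sqrt_mul (by positivity)]
        congr 1
        rw [← div_pow, ← Real.rpow_two, ← Real.rpow_mul (by positivity), mul_comm 2 q,
          Real.rpow_mul (by positivity), Real.rpow_two, Real.sqrt_sq (by positivity)]
      rw [h5]
      exact Real.sqrt_le_sqrt this)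
    (Real.sqrt_le_sqrt (h.mono (mem_Ici.2 (sq_nonneg _)) (mem_Ici.2 (sq_nonneg _)) (by gcongr)))
  rw [e]
  refine le_trans (norm_add_le _ _) ?_
  rw [norm_smul, norm_smul, Real.norm_of_nonneg (Real.sqrt_nonneg _), Real.norm_eq_abs]
  have h2 : ‖b‖ - ‖a‖ ≤ ‖b - a‖ := norm_sub_norm_le b a
  have h3 := Real.sqrt_nonneg (g (‖b‖ ^ 2))
  have h4 : (1 + q) * √(g (‖b‖ ^ 2)) * (‖b‖ - ‖a‖) ≤ (1 + q) * √(g (‖b‖ ^ 2)) * ‖b - a‖ := by gcongr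
  linarith

theorem GFun.A_lip (h : GFun q g) {Λ : ℝ} (hΛ : ∀ s, 0 ≤ s → g s ≤ Λ) (a b : W) :
    ‖gA g b - gA g a‖ ≤ (2 + 2 * q) * Λ * ‖b - a‖ := by
  have hq := h.hq
  wlog hab : ‖a‖ ≤ ‖b‖ with H
  · rw [norm_sub_rev, norm_sub_rev b]; exact H h hΛ b a hq (le_of_not_ge hab)
  refine (h.A_lip' a b hab).trans ?_
  rw [mul_assoc]
  gcongr
  exact hΛ _ (sq_nonneg _)

def CV (q : ℝ) : ℝ := (2 + q) ^ 2 * (8 * 4 ^ (2 * q))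

theorem CV_pos {q : ℝ} (hq : 0 < q) : 0 < CV q := by unfold CV; positivity

theorem GFun.V_breg (h : GFun q g) (a b : W) :
    ‖gV g b - gV g a‖ ^ 2 ≤ CV q * (gΓ g b - gΓ g a - ⟪gA g a, b - a⟫) := by
  have hq := h.hq
  have h1 := h.breg2 a b
  have h2 : ‖gV g b - gV g a‖ ^ 2 ≤ (2 + q) ^ 2 * (g (max ‖a‖ ‖b‖ ^ 2) * ‖b - a‖ ^ 2) := by
    rcases le_total ‖a‖ ‖b‖ with hab | hab
    · have := h.V_lip' a b hab
      rw [max_eq_right hab]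
      calc _ ≤ ((2 + q) * (√(g (‖b‖ ^ 2)) * ‖b - a‖)) ^ 2 := by gcongr
        _ = _ := by rw [mul_pow, mul_pow, Real.sq_sqrt (h.gs_nonneg b)]
    · have := h.V_lip' b a hab
      rw [max_eq_left hab, norm_sub_rev, norm_sub_rev b]
      calc _ ≤ ((2 + q) * (√(g (‖a‖ ^ 2)) * ‖a - b‖)) ^ 2 := by gcongr
        _ = _ := by rw [mul_pow, mul_pow, Real.sq_sqrt (h.gs_nonneg a)]
  refine h2.trans ?_
  have h3 : (8 * 4 ^ (2 * q)) * ((1 / 8) * (1 / 4 : ℝ) ^ (2 * q)) = 1 := by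
    rw [one_div (4:ℝ), Real.inv_rpow (by norm_num)]
    have : (4:ℝ) ^ (2 * q) ≠ 0 := by positivity
    field_simp
  unfold CV
  rw [mul_assoc]
  refine mul_le_mul_of_nonneg_left ?_ (sq_nonneg _)
  calc g (max ‖a‖ ‖b‖ ^ 2) * ‖b - a‖ ^ 2
      = (8 * 4 ^ (2 * q)) * ((1 / 8) * (1 / 4 : ℝ) ^ (2 * q) * (g (max ‖a‖ ‖b‖ ^ 2) * ‖b - a‖ ^ 2)) := by
        rw [← mul_assoc, h3, one_mul]
    _ ≤ _ := mul_le_mul_of_nonneg_left h1 (by positivity)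

end alg

/-! ### concrete nonlinearities -/
theorem gfun_rpow {q : ℝ} (hq : 0 < q) : GFun q (fun s => s ^ q) where
  hq := hq
  nonneg := fun s hs => Real.rpow_nonneg hs q
  mono := fun a ha b hb hab => Real.rpow_le_rpow ha hab hq.le
  cont := (Real.continuous_rpow_const hq.le).continuousOn
  ratio := fun a b ha hab hb => by
    rw [← Real.mul_rpow (by positivity) hb.le, div_mul_cancel₀ _ hb.ne']

/-- regularised nonlinearity -/
def gR (q ε T : ℝ) (s : ℝ) : ℝ := (ε + s * T / (T + s)) ^ q
def gR' (q ε T : ℝ) (s : ℝ) : ℝ := q * (ε + s * T / (T + s)) ^ (q - 1) * (T ^ 2 / (T + s) ^ 2)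

section reg
variable {q ε T : ℝ} (hq : 0 < q) (hε : 0 < ε) (hT : 0 < T)
include hε hT

theorem gR_base {s : ℝ} (hs : 0 ≤ s) : 0 ≤ s * T / (T + s) ∧ s * T / (T + s) ≤ s ∧ s * T / (T + s) ≤ T := by
  refine ⟨by positivity, ?_, ?_⟩
  · rw [div_le_iff₀ (by positivity)]; nlinarith
  · rw [div_le_iff₀ (by positivity)]; nlinarith

include hq in
theorem gfun_gR : GFun q (gR q ε T) where
  hq := hq
  nonneg := fun s hs => Real.rpow_nonneg (by have := gR_base hε hT hs; linarith) q
  mono := fun a ha b hb hab => by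
    have ha' : 0 ≤ a := ha
    have hb' : 0 ≤ b := hb
    apply Real.rpow_le_rpow (by have := gR_base hε hT ha'; linarith) _ hq.le
    have : a * T / (T + a) ≤ b * T / (T + b) := by
      rw [div_le_div_iff₀ (by positivity) (by positivity)]
      nlinarith [mul_nonneg (sub_nonneg.2 hab) (sq_nonneg T)]
    linarith
  cont := by
    apply ContinuousOn.rpow_const
    · apply ContinuousOn.add continuousOn_const
      apply ContinuousOn.div (by fun_prop) (by fun_prop)
      intro x hx
      have : 0 ≤ x := hx
      positivity
    · intro x _; right; exact hq.le
  ratio := fun a b ha hab hb => by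
    unfold gR
    have h1 := gR_base hε hT hb.le
    have h2 := gR_base hε hT ha
    rw [← Real.mul_rpow (by positivity) (by linarith)]
    apply Real.rpow_le_rpow (mul_nonneg (by positivity) (by linarith)) _ hq.le
    have h3 : a / b ≤ 1 := (div_le_one hb).2 hab
    have h4 : a / b * (b * T / (T + b)) ≤ a * T / (T + a) := by
      have : a / b * (b * T / (T + b)) = a * T / (T + b) := by field_simp
      rw [this]
      gcongr
    nlinarith

include hq in
theorem gR_ge {s : ℝ} (hs : 0 ≤ s) : ε ^ q ≤ gR q ε T s :=
  Real.rpow_le_rpow hε.le (by have := gR_base hε hT hs; linarith) hq.le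

include hq in
theorem gR_le {s : ℝ} (hs : 0 ≤ s) : gR q ε T s ≤ (ε + T) ^ q :=
  Real.rpow_le_rpow (by have := gR_base hε hT hs; linarith) (by have := gR_base hε hT hs; linarith) hq.le

include hq in
theorem gR_le' {s : ℝ} (hs : 0 ≤ s) : gR q ε T s ≤ (ε + s) ^ q :=
  Real.rpow_le_rpow (by have := gR_base hε hT hs; linarith) (by have := gR_base hε hT hs; linarith) hq.le

include hq in
theorem gR_mono_T {s T' : ℝ} (hs : 0 ≤ s) (hTT : T ≤ T') : gR q ε T s ≤ gR q ε T' s := by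
  apply Real.rpow_le_rpow (by have := gR_base hε hT hs; linarith) _ hq.le
  have : s * T / (T + s) ≤ s * T' / (T' + s) := by
    rw [div_le_div_iff₀ (by positivity) (by linarith)]
    nlinarith [mul_nonneg hs hs, mul_nonneg (mul_nonneg hs hs) (sub_nonneg.2 hTT)]
  linarith

theorem gR_deriv {s : ℝ} (hs : 0 ≤ s) : HasDerivAt (gR q ε T) (gR' q ε T s) s := by
  have hb := gR_base hε hT hs
  have h1 : HasDerivAt (fun s => ε + s * T / (T + s)) (T ^ 2 / (T + s) ^ 2) s := by
    have hne : T + s ≠ 0 := by positivity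
    have := (((hasDerivAt_id s).mul_const T).div ((hasDerivAt_id s).const_add T) hne).const_add ε
    have e : T ^ 2 / (T + s) ^ 2 = (1 * T * (T + id s) - id s * T * 1) / (T + id s) ^ 2 := by
      congr 1
      simp only [id]; ring
    rw [e]; exact this
  have := h1.rpow_const (p := q) (Or.inl (by linarith : ε + s * T / (T + s) ≠ 0))
  have e : gR' q ε T s = T ^ 2 / (T + s) ^ 2 * q * (ε + s * T / (T + s)) ^ (q - 1) := by
    unfold gR'; ring
  rw [e]; exact this

include hq in
theorem gR'_nonneg {s : ℝ} (hs : 0 ≤ s) : 0 ≤ gR' q ε T s := by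
  have hb := gR_base hε hT hs
  unfold gR'
  have : 0 ≤ (ε + s * T / (T + s)) ^ (q - 1) := Real.rpow_nonneg (by linarith) _
  positivity

include hq in
theorem gR'_le {s : ℝ} (hs : 0 ≤ s) : s * gR' q ε T s ≤ q * gR q ε T s := by
  have hb := gR_base hε hT hs
  set β := ε + s * T / (T + s) with hβ
  have hβ0 : 0 < β := by linarith
  have e : gR q ε T s = β ^ (q - 1) * β := by
    rw [Real.rpow_sub_one hβ0.ne', div_mul_cancel₀ _ hβ0.ne', gR]
  have h2 : s * (T ^ 2 / (T + s) ^ 2) ≤ β := by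
    have : s * (T ^ 2 / (T + s) ^ 2) = s * T / (T + s) * (T / (T + s)) := by
      field_simp
    rw [this]
    have : T / (T + s) ≤ 1 := (div_le_one (by positivity)).2 (by linarith)
    nlinarith
  rw [e, gR', ← hβ]
  have h3 : 0 ≤ β ^ (q - 1) := Real.rpow_nonneg hβ0.le _
  calc s * (q * β ^ (q - 1) * (T ^ 2 / (T + s) ^ 2)) = q * β ^ (q - 1) * (s * (T ^ 2 / (T + s) ^ 2)) := by ring
    _ ≤ q * β ^ (q - 1) * β := by gcongr
    _ = _ := by ring

theorem gR'_cont : ContinuousOn (gR' q ε T) (Ici 0) := by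
  have h0 : ContinuousOn (fun s : ℝ => ε + s * T / (T + s)) (Ici 0) := by
    apply ContinuousOn.add continuousOn_const
    apply ContinuousOn.div (by fun_prop) (by fun_prop)
    intro x hx
    have : 0 ≤ x := hx
    positivity
  apply ContinuousOn.mul
  · apply ContinuousOn.mul continuousOn_const
    apply h0.rpow_const
    intro x hx; left
    have := gR_base hε hT (show 0 ≤ x from hx)
    linarith
  · apply ContinuousOn.div (by fun_prop) (by fun_prop)
    intro x hx
    have : 0 ≤ x := hx
    positivity
end reg

theorem gR_tendsto {q s : ℝ} (hq : 0 < q) (hs : 0 ≤ s) {ε T : ℕ → ℝ} (hε : Tendsto ε atTop (𝓝 0))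
    (hT : Tendsto T atTop atTop) : Tendsto (fun j => gR q (ε j) (T j) s) atTop (𝓝 (s ^ q)) := by
  apply Tendsto.rpow_const _ (Or.inr hq.le)
  have h1 : Tendsto (fun j => s * T j / (T j + s)) atTop (𝓝 (s * 1)) := by
    have : Tendsto (fun j => 1 - s / (T j + s)) atTop (𝓝 (1 - 0)) :=
      tendsto_const_nhds.sub (Tendsto.div_atTop tendsto_const_nhds (tendsto_atTop_add_const_right _ _ hT))
    rw [sub_zero] at this
    refine (this.const_mul s).congr' ?_
    filter_upwards [hT.eventually_gt_atTop 0] with j hj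
    have : T j + s ≠ 0 := by positivity
    field_simp
    ring
  simpa using hε.add h1

theorem gR_tendsto_T {q s ε : ℝ} (hq : 0 < q) (hs : 0 ≤ s) {T : ℕ → ℝ}
    (hT : Tendsto T atTop atTop) : Tendsto (fun j => gR q ε (T j) s) atTop (𝓝 ((ε + s) ^ q)) := by
  apply Tendsto.rpow_const _ (Or.inr hq.le)
  have h1 : Tendsto (fun j => s * T j / (T j + s)) atTop (𝓝 (s * 1)) := by
    have : Tendsto (fun j => 1 - s / (T j + s)) atTop (𝓝 (1 - 0)) :=
      tendsto_const_nhds.sub (Tendsto.div_atTop tendsto_const_nhds (tendsto_atTop_add_const_right _ _ hT))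
    rw [sub_zero] at this
    refine (this.const_mul s).congr' ?_
    filter_upwards [hT.eventually_gt_atTop 0] with j hj
    have : T j + s ≠ 0 := by positivity
    field_simp
    ring
  simpa using h1.const_add ε

end DP

namespace DP
set_option linter.unusedSectionVars false
set_option linter.unusedVariables false
open Set
open scoped RealInnerProductSpace Topology

section mink
variable {X Y : Type*} [MeasurableSpace X] [MeasurableSpace Y] {W : Type*} [NormedAddCommGroup W]
  [NormedSpace ℝ W]

/-- Minkowski inequality for averages over a probability measure. -/
theorem eLpNorm_avg_le {μ : Measure X} {ν : Measure Y} [SFinite μ] [IsProbabilityMeasure ν]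
    {k : X → Y → W} (hk : AEStronglyMeasurable (Function.uncurry k) (μ.prod ν)) {q : ℝ≥0∞}
    (hq1 : 1 ≤ q) (hq : q ≠ ∞) {C : ℝ≥0∞} (hC : ∀ᵐ y ∂ν, eLpNorm (fun x => k x y) q μ ≤ C) :
    eLpNorm (fun x => ∫ y, k x y ∂ν) q μ ≤ C := by
  have hq0 : q ≠ 0 := (lt_of_lt_of_le zero_lt_one hq1).ne'
  have hr : 0 < q.toReal := ENNReal.toReal_pos hq0 hq
  have h1 : ∀ᵐ x ∂μ, ‖∫ y, k x y ∂ν‖ₑ ^ q.toReal ≤ ∫⁻ y, ‖k x y‖ₑ ^ q.toReal ∂ν := by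
    filter_upwards [hk.prodMk_left] with x hx
    have h2 : ‖∫ y, k x y ∂ν‖ₑ ≤ eLpNorm (k x) 1 ν := by
      rw [eLpNorm_one_eq_lintegral_enorm]; exact enorm_integral_le_lintegral_enorm _
    have h3 := h2.trans (eLpNorm_le_eLpNorm_of_exponent_le hq1 hx)
    rw [eLpNorm_eq_lintegral_rpow_enorm_toReal hq0 hq] at h3
    calc _ ≤ ((∫⁻ y, ‖k x y‖ₑ ^ q.toReal ∂ν) ^ (1 / q.toReal)) ^ q.toReal := by gcongr
      _ = _ := by rw [← ENNReal.rpow_mul, one_div_mul_cancel hr.ne', ENNReal.rpow_one]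
  rw [eLpNorm_eq_lintegral_rpow_enorm_toReal hq0 hq]
  have h4 : ∫⁻ x, ‖∫ y, k x y ∂ν‖ₑ ^ q.toReal ∂μ ≤ C ^ q.toReal := by
    calc _ ≤ ∫⁻ x, ∫⁻ y, ‖k x y‖ₑ ^ q.toReal ∂ν ∂μ := lintegral_mono_ae h1
      _ = ∫⁻ y, ∫⁻ x, ‖k x y‖ₑ ^ q.toReal ∂μ ∂ν := by
        apply lintegral_lintegral_swap
        exact (hk.enorm).pow_const _
      _ ≤ ∫⁻ y, C ^ q.toReal ∂ν := by
        apply lintegral_mono_ae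
        filter_upwards [hC] with y hy
        rw [eLpNorm_eq_lintegral_rpow_enorm_toReal hq0 hq] at hy
        calc _ = ((∫⁻ x, ‖k x y‖ₑ ^ q.toReal ∂μ) ^ (1 / q.toReal)) ^ q.toReal := by
              rw [← ENNReal.rpow_mul, one_div_mul_cancel hr.ne', ENNReal.rpow_one]
          _ ≤ _ := by gcongr
      _ = _ := by simp
  calc _ ≤ (C ^ q.toReal) ^ (1 / q.toReal) := by gcongr
    _ = _ := by rw [← ENNReal.rpow_mul, mul_one_div_cancel hr.ne', ENNReal.rpow_one]
end mink

variable {n : ℕ} {W : Type*} [NormedAddCommGroup W] [NormedSpace ℝ W]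

theorem eLpNorm_trans {f : En n → W} (hf : AEStronglyMeasurable f volume) (q : ℝ≥0∞) (y : En n) :
    eLpNorm (fun x => f (x + y)) q volume = eLpNorm f q volume :=
  eLpNorm_comp_measurePreserving hf (measurePreserving_add_right volume y)

theorem memLp_trans {f : En n → W} {q : ℝ≥0∞} (hf : MemLp f q volume) (y : En n) :
    MemLp (fun x => f (x + y)) q volume :=
  hf.comp_measurePreserving (measurePreserving_add_right volume y)

theorem tendsto_trans {f : En n → W} {q : ℝ≥0∞} (hq1 : 1 ≤ q) (hq : q ≠ ∞) (hf : MemLp f q volume) :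
    Tendsto (fun y => eLpNorm (fun x => f (x + y) - f x) q volume) (𝓝 (0 : En n)) (𝓝 0) := by
  haveI : Fact (1 ≤ q) := ⟨hq1⟩
  have hg : Continuous (fun y : En n => (⟨fun x => x + y, by fun_prop⟩ : C(En n, En n))) := by
    apply ContinuousMap.continuous_of_continuous_uncurry
    simp only [Function.uncurry_def, ContinuousMap.coe_mk]
    fun_prop
  have hgm : ∀ y : En n, MeasurePreserving (⟨fun x => x + y, by fun_prop⟩ : C(En n, En n)) volume volume :=
    fun y => measurePreserving_add_right volume y
  have h1 := Continuous.compMeasurePreservingLp (f := fun _ : En n => hf.toLp f) continuous_const hg hgm hq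
  have h2 := (h1.tendsto 0)
  rw [tendsto_iff_edist_tendsto_0] at h2
  refine h2.congr fun y => ?_
  rw [Lp.toLp_compMeasurePreserving, Lp.toLp_compMeasurePreserving, Lp.edist_toLp_toLp]
  apply eLpNorm_congr_ae
  filter_upwards with x
  simp

/-- smooth probability density supported in a ball of radius `σ` -/
structure IsMol (ρ : En n → ℝ) (σ : ℝ) : Prop where
  smooth : ContDiff ℝ (⊤ : ℕ∞) ρ
  nonneg : ∀ x, 0 ≤ ρ x
  int : ∫ x, ρ x = 1
  supp : ∀ x, ρ x ≠ 0 → ‖x‖ ≤ σ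

theorem IsMol.compact {ρ : En n → ℝ} {σ : ℝ} (h : IsMol ρ σ) : HasCompactSupport ρ :=
  HasCompactSupport.of_support_subset_isCompact (isCompact_closedBall 0 σ)
    (fun x hx => by simpa using h.supp x hx)

theorem IsMol.integrable {ρ : En n → ℝ} {σ : ℝ} (h : IsMol ρ σ) : Integrable ρ :=
  h.smooth.continuous.integrable_of_hasCompactSupport h.compact

theorem exists_mol {σ : ℝ} (hσ : 0 < σ) : ∃ ρ : En n → ℝ, IsMol ρ σ := by
  let b : ContDiffBump (0 : En n) := ⟨σ / 2, σ, by linarith, by linarith⟩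
  refine ⟨b.normed volume, b.contDiff_normed, b.nonneg_normed, b.integral_normed, fun x hx => ?_⟩
  have : x ∈ Function.support (b.normed volume) := hx
  rw [b.support_normed_eq] at this
  have : dist x 0 < σ := this
  rw [dist_zero_right] at this; exact this.le

def mol (ρ : En n → ℝ) (f : En n → W) (x : En n) : W := ∫ t, ρ t • f (x - t)

theorem mol_eq_conv (ρ : En n → ℝ) (f : En n → W) :
    mol ρ f = convolution ρ f (ContinuousLinearMap.lsmul ℝ ℝ) volume := rfl

theorem mol_eq_swap (ρ : En n → ℝ) (f : En n → W) (x : En n) :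
    mol ρ f x = ∫ y, ρ (x - y) • f y := by
  unfold mol
  rw [← integral_sub_left_eq_self _ volume x]
  simp

def molMeas (ρ : En n → ℝ) : Measure (En n) := volume.withDensity (fun t => ENNReal.ofReal (ρ t))

theorem IsMol.prob {ρ : En n → ℝ} {σ : ℝ} (h : IsMol ρ σ) : IsProbabilityMeasure (molMeas ρ) := by
  constructor
  rw [molMeas, withDensity_apply _ MeasurableSet.univ, setLIntegral_univ,
    ← ofReal_integral_eq_lintegral_ofReal h.integrable (Eventually.of_forall h.nonneg), h.int]
  simp

theorem IsMol.integral_molMeas {ρ : En n → ℝ} {σ : ℝ} (h : IsMol ρ σ) (F : En n → W) :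
    ∫ t, F t ∂(molMeas ρ) = ∫ t, ρ t • F t := by
  rw [molMeas, integral_withDensity_eq_integral_toReal_smul
    (h.smooth.continuous.measurable.ennreal_ofReal) (Eventually.of_forall fun _ => ENNReal.ofReal_lt_top)]
  simp only [ENNReal.toReal_ofReal (h.nonneg _)]

theorem IsMol.ae_molMeas {ρ : En n → ℝ} {σ : ℝ} (h : IsMol ρ σ) : ∀ᵐ t ∂(molMeas ρ), ‖t‖ ≤ σ := by
  rw [molMeas, ae_withDensity_iff h.smooth.continuous.measurable.ennreal_ofReal]
  filter_upwards with t ht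
  apply h.supp
  intro h0; simp [h0] at ht

theorem IsMol.aesm {ρ : En n → ℝ} {f : En n → W}
    (hf : AEStronglyMeasurable f volume) :
    AEStronglyMeasurable (Function.uncurry fun x t : En n => f (x - t)) (volume.prod (molMeas ρ)) := by
  have h1 : (volume.prod (molMeas ρ)) ≪ (volume : Measure (En n)).prod volume :=
    Measure.AbsolutelyContinuous.prod Measure.AbsolutelyContinuous.rfl (withDensity_absolutelyContinuous _ _)
  have h2 := hf.comp_quasiMeasurePreserving (quasiMeasurePreserving_sub volume volume)
  exact h2.mono_ac h1

variable [CompleteSpace W]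

theorem IsMol.eLpNorm_le {ρ : En n → ℝ} {σ : ℝ} (h : IsMol ρ σ) {f : En n → W}
    (hf : AEStronglyMeasurable f volume) {q : ℝ≥0∞} (hq1 : 1 ≤ q) (hq : q ≠ ∞) :
    eLpNorm (mol ρ f) q volume ≤ eLpNorm f q volume := by
  haveI := h.prob
  have := eLpNorm_avg_le (μ := volume) (IsMol.aesm (ρ := ρ) hf) hq1 hq (C := eLpNorm f q volume)
    (Eventually.of_forall fun t => by
      simp_rw [sub_eq_add_neg]; exact (eLpNorm_trans hf q _).le)
  simp only [h.integral_molMeas] at this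
  exact this

theorem IsMol.eLpNorm_sub_le {ρ : En n → ℝ} {σ : ℝ} (h : IsMol ρ σ) {f : En n → W}
    {q : ℝ≥0∞} (hq1 : 1 ≤ q) (hq : q ≠ ∞) (hf : MemLp f q volume) {C : ℝ≥0∞}
    (hC : ∀ y : En n, ‖y‖ ≤ σ → eLpNorm (fun x => f (x + y) - f x) q volume ≤ C) :
    eLpNorm (fun x => mol ρ f x - f x) q volume ≤ C := by
  haveI := h.prob
  have hm : AEStronglyMeasurable (Function.uncurry fun x t : En n => f (x - t) - f x)
      (volume.prod (molMeas ρ)) := by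
    refine (IsMol.aesm hf.1).sub ?_
    exact hf.1.comp_fst
  have h1 := eLpNorm_avg_le (μ := volume) hm hq1 hq (C := C) (by
    filter_upwards [h.ae_molMeas] with t ht
    simp_rw [sub_eq_add_neg _ t]
    exact hC _ (by rwa [norm_neg]))
  refine le_trans (eLpNorm_mono_ae ?_) h1
  have h2 : ∀ᵐ x, Integrable (fun t => f (x - t)) (molMeas ρ) := by
    have hl : LocallyIntegrable f volume := hf.locallyIntegrable hq1
    filter_upwards with x
    have := (h.compact.convolutionExists_left (ContinuousLinearMap.lsmul ℝ ℝ) h.smooth.continuous hl) x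
    rw [molMeas, integrable_withDensity_iff_integrable_smul'
      (h.smooth.continuous.measurable.ennreal_ofReal) (Eventually.of_forall fun _ => ENNReal.ofReal_lt_top)]
    simp only [ENNReal.toReal_ofReal (h.nonneg _)]
    exact this
  filter_upwards [h2] with x hx
  rw [integral_sub hx (integrable_const _), h.integral_molMeas, integral_const]
  simp [mol]

/-- mollifiers converge in `L^q` -/
theorem mol_tendsto {f : En n → W} {q : ℝ≥0∞} (hq1 : 1 ≤ q) (hq : q ≠ ∞) (hf : MemLp f q volume)
    {ρ : ℕ → En n → ℝ} {σ : ℕ → ℝ} (hρ : ∀ j, IsMol (ρ j) (σ j)) (hσ : Tendsto σ atTop (𝓝 0)) :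
    Tendsto (fun j => eLpNorm (fun x => mol (ρ j) f x - f x) q volume) atTop (𝓝 0) := by
  rw [ENNReal.tendsto_nhds_zero]
  intro ε hε
  have h1 := ENNReal.tendsto_nhds_zero.1 (tendsto_trans hq1 hq hf) ε hε
  obtain ⟨δ, hδ, hb⟩ := Metric.eventually_nhds_iff.1 h1
  filter_upwards [hσ.eventually_lt_const hδ] with j hj
  refine (hρ j).eLpNorm_sub_le hq1 hq hf fun y hy => hb ?_
  rw [dist_zero_right]; exact lt_of_le_of_lt hy hj

theorem IsMol.contDiff {ρ : En n → ℝ} {σ : ℝ} (h : IsMol ρ σ) {f : En n → W}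
    (hf : LocallyIntegrable f volume) : ContDiff ℝ (⊤ : ℕ∞) (mol ρ f) := by
  rw [mol_eq_conv]
  exact h.compact.contDiff_convolution_left _ h.smooth hf

theorem mol_fderiv {ρ : En n → ℝ} (hρ : ContDiff ℝ (⊤ : ℕ∞) ρ) (hc : HasCompactSupport ρ) {f : En n → W}
    (hf : LocallyIntegrable f volume) (x v : En n) :
    fderiv ℝ (mol ρ f) x v = ∫ y, (fderiv ℝ ρ (x - y) v) • f y := by
  have h1 : ContDiff ℝ 1 ρ := hρ.of_le (by exact_mod_cast le_top)
  have := hc.hasFDerivAt_convolution_left (ContinuousLinearMap.lsmul ℝ ℝ) h1 hf x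
  rw [mol_eq_conv, this.fderiv, convolution_eq_swap]
  have h2 := ((hc.fderiv ℝ).convolutionExists_left
    ((ContinuousLinearMap.lsmul ℝ ℝ).precompL (En n)) (h1.continuous_fderiv one_ne_zero) hf) x
  rw [ContinuousLinearMap.integral_apply]
  · simp
  · exact h2.integrable_swap

theorem IsMol.mol_clm {ρ : En n → ℝ} {σ : ℝ} (h : IsMol ρ σ) {f : En n → W}
    (hf : LocallyIntegrable f volume) {W' : Type*} [NormedAddCommGroup W'] [NormedSpace ℝ W']
    [CompleteSpace W'] (T : W →L[ℝ] W') (x : En n) : mol ρ (fun y => T (f y)) x = T (mol ρ f x) := by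
  unfold mol
  rw [← ContinuousLinearMap.integral_comp_comm]
  · simp
  · exact (h.compact.convolutionExists_left (ContinuousLinearMap.lsmul ℝ ℝ) h.smooth.continuous hf) x

theorem IsMol.mol_fderiv_comm {ρ : En n → ℝ} {σ : ℝ} (h : IsMol ρ σ) {f : En n → W}
    (hf : ContDiff ℝ 1 f) (hc : HasCompactSupport f) (x : En n) :
    fderiv ℝ (mol ρ f) x = mol ρ (fderiv ℝ f) x := by
  have := hc.hasFDerivAt_convolution_right (ContinuousLinearMap.lsmul ℝ ℝ)
    (h.smooth.continuous.locallyIntegrable (μ := volume)) hf x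
  rw [mol_eq_conv, this.fderiv]
  rfl

theorem IsMol.mol_eq_zero {ρ : En n → ℝ} {σ : ℝ} (h : IsMol ρ σ) {f : En n → W} {x : En n}
    (hf : ∀ᵐ y, ‖x - y‖ ≤ σ → f y = 0) : mol ρ f x = 0 := by
  rw [mol_eq_swap]
  apply integral_eq_zero_of_ae
  filter_upwards [hf] with y hy
  by_cases h0 : ρ (x - y) = 0
  · simp [h0]
  · simp [hy (h.supp _ h0)]

theorem IsMol.mol_congr {ρ : En n → ℝ} {σ : ℝ} (h : IsMol ρ σ) {f g : En n → W} {x : En n}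
    (hf : ∀ᵐ y, ‖x - y‖ ≤ σ → f y = g y) : mol ρ f x = mol ρ g x := by
  rw [mol_eq_swap, mol_eq_swap]
  apply integral_congr_ae
  filter_upwards [hf] with y hy
  by_cases h0 : ρ (x - y) = 0
  · simp [h0]
  · simp [hy (h.supp _ h0)]

end DP

namespace DP
set_option linter.unusedSectionVars false
set_option linter.unusedVariables false
open Set
open scoped RealInnerProductSpace Topology

section l2
variable {X : Type*} [MeasurableSpace X] {μ : Measure X} {W : Type*} [NormedAddCommGroup W]
  [InnerProductSpace ℝ W]

theorem inner_intble {f g : X → W} (hf : MemLp f 2 μ) (hg : MemLp g 2 μ) :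
    Integrable (fun x => ⟪f x, g x⟫) μ := by
  have := L2.integrable_inner (𝕜 := ℝ) (hf.toLp f) (hg.toLp g)
  refine this.congr ?_
  filter_upwards [hf.coeFn_toLp, hg.coeFn_toLp] with x h1 h2
  rw [h1, h2]

theorem inner_toLp {f g : X → W} (hf : MemLp f 2 μ) (hg : MemLp g 2 μ) :
    ⟪hf.toLp f, hg.toLp g⟫ = ∫ x, ⟪f x, g x⟫ ∂μ := by
  rw [L2.inner_def]
  apply integral_congr_ae
  filter_upwards [hf.coeFn_toLp, hg.coeFn_toLp] with x h1 h2
  rw [h1, h2]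

theorem normsq_toLp {f : X → W} (hf : MemLp f 2 μ) : ‖hf.toLp f‖ ^ 2 = ∫ x, ‖f x‖ ^ 2 ∂μ := by
  rw [← real_inner_self_eq_norm_sq, inner_toLp]
  simp

theorem eLpNorm_sq {f : X → W} (hf : MemLp f 2 μ) : (eLpNorm f 2 μ).toReal ^ 2 = ∫ x, ‖f x‖ ^ 2 ∂μ := by
  rw [← normsq_toLp hf, Lp.norm_toLp]

theorem normsq_intble {f : X → W} (hf : MemLp f 2 μ) : Integrable (fun x => ‖f x‖ ^ 2) μ := by
  have := inner_intble hf hf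
  simpa using this

/-- convergence in L² -/
def TL (μ : Measure X) (f : ℕ → X → W) (g : X → W) : Prop :=
  Tendsto (fun j => eLpNorm (fun x => f j x - g x) 2 μ) atTop (𝓝 0)

theorem TL.toLp {f : ℕ → X → W} {g : X → W} (h : TL μ f g) (hf : ∀ j, MemLp (f j) 2 μ) (hg : MemLp g 2 μ) :
    Tendsto (fun j => (hf j).toLp (f j)) atTop (𝓝 (hg.toLp g)) :=
  (Lp.tendsto_Lp_iff_tendsto_eLpNorm'' f hf g hg).2 h

theorem TL.inner {f u : ℕ → X → W} {g v : X → W} (h : TL μ f g) (h' : TL μ u v) (hf : ∀ j, MemLp (f j) 2 μ)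
    (hg : MemLp g 2 μ) (hu : ∀ j, MemLp (u j) 2 μ) (hv : MemLp v 2 μ) :
    Tendsto (fun j => ∫ x, ⟪f j x, u j x⟫ ∂μ) atTop (𝓝 (∫ x, ⟪g x, v x⟫ ∂μ)) := by
  have := (h.toLp hf hg).inner (h'.toLp hu hv) (𝕜 := ℝ)
  simpa only [inner_toLp] using this

theorem TL.normsq {f : ℕ → X → W} {g : X → W} (h : TL μ f g) (hf : ∀ j, MemLp (f j) 2 μ)
    (hg : MemLp g 2 μ) :
    Tendsto (fun j => ∫ x, ‖f j x‖ ^ 2 ∂μ) atTop (𝓝 (∫ x, ‖g x‖ ^ 2 ∂μ)) := by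
  simpa using h.inner h hf hg hf hg

theorem TL_const (g : X → W) : TL μ (fun _ => g) g := by simp [TL]

theorem TL.subseq {f : ℕ → X → W} {g : X → W} (h : TL μ f g) (hf : ∀ j, MemLp (f j) 2 μ) (hg : MemLp g 2 μ) :
    ∃ ns : ℕ → ℕ, StrictMono ns ∧ ∀ᵐ x ∂μ, Tendsto (fun i => f (ns i) x) atTop (𝓝 (g x)) :=
  (tendstoInMeasure_of_tendsto_eLpNorm (by norm_num) (fun j => (hf j).1) hg.1 h).exists_seq_tendsto_ae

theorem TL.comp {f : ℕ → X → W} {g : X → W} (h : TL μ f g) {ns : ℕ → ℕ} (hn : StrictMono ns) :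
    TL μ (fun i => f (ns i)) g := by
  have h' : Tendsto (fun j => eLpNorm (fun x => f j x - g x) 2 μ) atTop (𝓝 0) := h
  exact h'.comp hn.tendsto_atTop

theorem TL.add {f u : ℕ → X → W} {g v : X → W} (h : TL μ f g) (h' : TL μ u v) (hf : ∀ j, MemLp (f j) 2 μ)
    (hg : MemLp g 2 μ) (hu : ∀ j, MemLp (u j) 2 μ) (hv : MemLp v 2 μ) :
    TL μ (fun j x => f j x + u j x) (fun x => g x + v x) := by
  have h0 := Tendsto.add h h'
  rw [add_zero] at h0
  refine tendsto_of_tendsto_of_tendsto_of_le_of_le tendsto_const_nhds h0 (fun _ => bot_le) (fun j => ?_)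
  have := eLpNorm_add_le ((hf j).sub hg).1 ((hu j).sub hv).1 (p := 2) (by norm_num)
  refine le_trans (le_of_eq ?_) this
  congr 1; funext x; simp; abel

theorem TL.clm {W' : Type*} [NormedAddCommGroup W'] [InnerProductSpace ℝ W'] {f : ℕ → X → W} {g : X → W}
    (h : TL μ f g) (L : W →L[ℝ] W') : TL μ (fun j x => L (f j x)) (fun x => L (g x)) := by
  have h0 : Tendsto (fun j => ENNReal.ofReal ‖L‖ * eLpNorm (fun x => f j x - g x) 2 μ) atTop (𝓝 0) := by
    have := ENNReal.Tendsto.const_mul (a := ENNReal.ofReal ‖L‖) h (Or.inr ENNReal.ofReal_ne_top)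
    simpa using this
  refine tendsto_of_tendsto_of_tendsto_of_le_of_le tendsto_const_nhds h0 (fun _ => bot_le) (fun j => ?_)
  apply eLpNorm_le_mul_eLpNorm_of_ae_le_mul
  filter_upwards with x
  rw [← map_sub]; exact L.le_opNorm _

theorem aesm_clm_apply {W' : Type*} [NormedAddCommGroup W'] [InnerProductSpace ℝ W'] {m : X → (W →L[ℝ] W')}
    {g : X → W} (hm : AEStronglyMeasurable m μ) (hg : AEStronglyMeasurable g μ) :
    AEStronglyMeasurable (fun x => m x (g x)) μ :=
  (isBoundedBilinearMap_apply (𝕜 := ℝ) (E := W) (F := W')).continuous.comp_aestronglyMeasurable₂ hm hg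

/-- bounded multipliers converging a.e. -/
theorem TL.mul {f : ℕ → X → W} {g : X → W} (h : TL μ f g) (hf : ∀ j, MemLp (f j) 2 μ) (hg : MemLp g 2 μ)
    {W' : Type*} [NormedAddCommGroup W'] [InnerProductSpace ℝ W']
    {m : ℕ → X → (W →L[ℝ] W')} {m₀ : X → (W →L[ℝ] W')} (hm : ∀ j, AEStronglyMeasurable (m j) μ)
    (hm₀ : AEStronglyMeasurable m₀ μ) {C : ℝ} (hC : ∀ j x, ‖m j x‖ ≤ C)
    (hlim : ∀ᵐ x ∂μ, Tendsto (fun j => m j x) atTop (𝓝 (m₀ x))) :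
    TL μ (fun j x => m j x (f j x)) (fun x => m₀ x (g x)) := by
  have hC0 : ∀ᵐ x ∂μ, ‖m₀ x‖ ≤ C := by
    filter_upwards [hlim] with x hx
    exact le_of_tendsto hx.norm (Eventually.of_forall fun j => hC j x)
  have hC' : ∀ x : X, 0 ≤ C := fun x => le_trans (norm_nonneg _) (hC 0 x)
  have a1 : Tendsto (fun j => eLpNorm (fun x => m j x (f j x - g x)) 2 μ) atTop (𝓝 0) := by
    have h0 : Tendsto (fun j => ENNReal.ofReal C * eLpNorm (fun x => f j x - g x) 2 μ) atTop (𝓝 0) := by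
      have := ENNReal.Tendsto.const_mul (a := ENNReal.ofReal C) h (Or.inr ENNReal.ofReal_ne_top)
      simpa using this
    refine tendsto_of_tendsto_of_tendsto_of_le_of_le tendsto_const_nhds h0 (fun _ => bot_le) (fun j => ?_)
    apply eLpNorm_le_mul_eLpNorm_of_ae_le_mul
    filter_upwards with x
    exact ((m j x).le_opNorm _).trans (mul_le_mul_of_nonneg_right (hC j x) (norm_nonneg _))
  have a2 : Tendsto (fun j => eLpNorm (fun x => (m j x - m₀ x) (g x)) 2 μ) atTop (𝓝 0) := by
    have e : ∀ j, eLpNorm (fun x => (m j x - m₀ x) (g x)) 2 μ =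
        (∫⁻ x, ‖(m j x - m₀ x) (g x)‖ₑ ^ (2:ℝ) ∂μ) ^ (1 / (2:ℝ)) := by
      intro j
      rw [eLpNorm_eq_lintegral_rpow_enorm_toReal (by norm_num) (by norm_num)]
      simp
    simp_rw [e]
    have : Tendsto (fun j => ∫⁻ x, ‖(m j x - m₀ x) (g x)‖ₑ ^ (2:ℝ) ∂μ) atTop (𝓝 (∫⁻ x, 0 ∂μ)) := by
      apply tendsto_lintegral_of_dominated_convergence' (fun x => (ENNReal.ofReal (2 * C) * ‖g x‖ₑ) ^ (2:ℝ))
      · intro j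
        exact ((aesm_clm_apply ((hm j).sub hm₀) hg.1).enorm).pow_const _
      · intro j
        filter_upwards [hC0] with x hx
        gcongr
        have : ‖(m j x - m₀ x) (g x)‖ ≤ 2 * C * ‖g x‖ := by
          refine ((m j x - m₀ x).le_opNorm _).trans (mul_le_mul_of_nonneg_right ?_ (norm_nonneg _))
          calc _ ≤ ‖m j x‖ + ‖m₀ x‖ := norm_sub_le _ _
            _ ≤ _ := by linarith [hC j x]
        rw [← ofReal_norm, ← ofReal_norm (g x), ← ENNReal.ofReal_mul (by linarith [hC' x])]
        exact ENNReal.ofReal_le_ofReal this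
      · have h2 : MemLp (fun x => (2 * C) • g x) 2 μ := hg.const_smul _
        have h3 := h2.2
        rw [eLpNorm_lt_top_iff_lintegral_rpow_enorm_lt_top (by norm_num) (by norm_num)] at h3
        refine ne_of_lt (lt_of_le_of_lt (le_of_eq ?_) h3)
        apply lintegral_congr; intro x
        rw [enorm_smul, Real.enorm_of_nonneg (by linarith [hC' x])]
        simp
      · filter_upwards [hlim] with x hx
        have h1 : Tendsto (fun j => (m j x - m₀ x) (g x)) atTop (𝓝 0) := by
          have : Tendsto (fun j => m j x - m₀ x) atTop (𝓝 (m₀ x - m₀ x)) := hx.sub_const _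
          rw [sub_self] at this
          simpa [Function.comp_def] using ((ContinuousLinearMap.apply ℝ W' (g x)).continuous.tendsto _).comp this
        have h2 := (ENNReal.continuous_rpow_const (y := 2)).tendsto _ |>.comp h1.enorm
        simpa [Function.comp_def] using h2
    have h3 := (ENNReal.continuous_rpow_const (y := 1 / 2)).tendsto _ |>.comp this
    simpa [Function.comp_def] using h3
  have h0 := Tendsto.add a1 a2
  rw [add_zero] at h0
  refine tendsto_of_tendsto_of_tendsto_of_le_of_le tendsto_const_nhds h0 (fun _ => bot_le) (fun j => ?_)
  have := eLpNorm_add_le (f := fun x => m j x (f j x - g x)) (g := fun x => (m j x - m₀ x) (g x)) (μ := μ)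
    (aesm_clm_apply (hm j) ((hf j).sub hg).1) (aesm_clm_apply ((hm j).sub hm₀) hg.1) (p := 2) (by norm_num)
  refine le_trans (le_of_eq ?_) this
  congr 1; funext x; simp

theorem memLp_clm_apply {W' : Type*} [NormedAddCommGroup W'] [InnerProductSpace ℝ W'] {m : X → (W →L[ℝ] W')}
    {g : X → W} (hg : MemLp g 2 μ) (hm : AEStronglyMeasurable m μ) {C : ℝ} (hC : ∀ᵐ x ∂μ, ‖m x‖ ≤ C) :
    MemLp (fun x => m x (g x)) 2 μ := by
  refine MemLp.of_le_mul hg (aesm_clm_apply hm hg.1) (c := C) ?_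
  filter_upwards [hC] with x hx
  exact ((m x).le_opNorm _).trans (mul_le_mul_of_nonneg_right hx (norm_nonneg _))

end l2

section hilb
variable {𝓗 : Type*} [NormedAddCommGroup 𝓗] [InnerProductSpace ℝ 𝓗] [CompleteSpace 𝓗]

theorem hilbert_exists (K : Submodule ℝ 𝓗) (hK : IsClosed (K : Set 𝓗)) (A : 𝓗 → 𝓗) {L l : ℝ} (hl : 0 < l)
    (hL : ∀ x y, ‖A x - A y‖ ≤ L * ‖x - y‖) (hm : ∀ x y, l * ‖x - y‖ ^ 2 ≤ ⟪A x - A y, x - y⟫) (f : 𝓗) :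
    ∃ x ∈ K, ∀ y ∈ K, ⟪A (f + x), y⟫ = 0 := by
  have : CompleteSpace K := hK.completeSpace_coe
  set M := |L| + l with hM
  have hMl : l ≤ M := by simp [hM]
  have hM0 : 0 < M := by linarith
  have hLM : ∀ x y, ‖A x - A y‖ ≤ M * ‖x - y‖ := fun x y => (hL x y).trans
    (mul_le_mul_of_nonneg_right (by have := le_abs_self L; linarith) (norm_nonneg _))
  set τ := l / M ^ 2 with hτ
  have hτ0 : 0 < τ := by positivity
  set T : K → K := fun x => K.orthogonalProjectionOnto ((x : 𝓗) - τ • A (f + x)) with hT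
  set c : ℝ := √(1 - l ^ 2 / M ^ 2) with hc
  have hr : l ^ 2 / M ^ 2 ≤ 1 := by rw [div_le_one (by positivity)]; gcongr
  have hr0 : 0 < l ^ 2 / M ^ 2 := by positivity
  have hc1 : c < 1 := by
    rw [hc, Real.sqrt_lt' one_pos]; linarith
  have key : ∀ x y : K, ‖T x - T y‖ ≤ c * ‖x - y‖ := by
    intro x y
    have e : T x - T y = K.orthogonalProjectionOnto (((x : 𝓗) - y) - τ • (A (f + x) - A (f + y))) := by
      simp only [hT]; rw [← map_sub]; congr 1; module
    rw [e]
    refine (Submodule.norm_orthogonalProjectionOnto_apply_le _ _).trans ?_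
    have h1 := hLM (f + x) (f + y)
    have h2 := hm (f + x) (f + y)
    rw [add_sub_add_left_eq_sub] at h1 h2
    have e2 : ‖x - y‖ = ‖(x : 𝓗) - y‖ := rfl
    rw [e2]
    set d := (x : 𝓗) - y
    set D := A (f + x) - A (f + y)
    apply le_of_sq_le_sq _ (by positivity)
    rw [mul_pow, hc, Real.sq_sqrt (by linarith), norm_sub_sq_real, norm_smul, inner_smul_right, real_inner_comm,
      Real.norm_of_nonneg hτ0.le]
    have h3 : ‖D‖ ^ 2 ≤ M ^ 2 * ‖d‖ ^ 2 := by rw [← mul_pow]; gcongr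
    have h4 : (τ * ‖D‖) ^ 2 ≤ τ * l * ‖d‖ ^ 2 := by
      rw [mul_pow]
      calc τ ^ 2 * ‖D‖ ^ 2 ≤ τ ^ 2 * (M ^ 2 * ‖d‖ ^ 2) := by gcongr
        _ = _ := by rw [hτ]; field_simp
    have h5 : l ^ 2 / M ^ 2 = τ * l := by rw [hτ]; ring
    rw [h5]
    nlinarith [mul_le_mul_of_nonneg_left h2 hτ0.le]
  have hct : ContractingWith (Real.toNNReal c) T := by
    refine ⟨?_, ?_⟩
    · rw [← NNReal.coe_lt_coe, Real.coe_toNNReal _ (Real.sqrt_nonneg _)]; exact hc1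
    · apply LipschitzWith.of_dist_le_mul
      intro x y
      rw [dist_eq_norm, dist_eq_norm, Real.coe_toNNReal _ (Real.sqrt_nonneg _)]
      exact key x y
  have hfix := hct.fixedPoint_isFixedPt
  set x := ContractingWith.fixedPoint T hct
  refine ⟨x, x.2, fun y hy => ?_⟩
  have h1 : K.orthogonalProjectionOnto ((x : 𝓗) - τ • A (f + x)) = x := hfix
  have h2 := Submodule.starProjection_inner_eq_zero (K := K) ((x : 𝓗) - τ • A (f + x)) y hy
  have h3 : K.starProjection ((x : 𝓗) - τ • A (f + x)) = x := by
    rw [Submodule.starProjection_apply, h1]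
  rw [h3, sub_sub_cancel_left, inner_neg_left, inner_smul_left] at h2
  simpa [hτ0.ne'] using h2

end hilb
end DP

namespace DP
set_option linter.unusedSectionVars false
set_option linter.unusedVariables false
open Set
open scoped RealInnerProductSpace Topology

/-- algebraic data of an exterior derivative -/
structure Sys (n : ℕ) (W0 W1 : Type*) [NormedAddCommGroup W0] [InnerProductSpace ℝ W0]
    [NormedAddCommGroup W1] [InnerProductSpace ℝ W1] where
  e : Fin n → W0 →L[ℝ] W1
  es : Fin n → W1 →L[ℝ] W0
  adj : ∀ i x y, ⟪e i x, y⟫ = ⟪x, es i y⟫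
  J : ∀ i j s v, e s (es i (e j v)) + e j (es i (e s v)) =
    (if i = s then e j v else 0) + (if i = j then e s v else 0)

section pd
variable {n : ℕ} {W : Type*} [NormedAddCommGroup W] [InnerProductSpace ℝ W]

def pd (i : Fin n) (φ : En n → W) (x : En n) : W := fderiv ℝ φ x (basisVec i)

def TF (B : Set (En n)) (φ : En n → W) : Prop :=
  ContDiff ℝ (⊤ : ℕ∞) φ ∧ HasCompactSupport φ ∧ tsupport φ ⊆ B

theorem TF.mono {B B' : Set (En n)} {φ : En n → W} (h : TF B φ) (hB : B ⊆ B') : TF B' φ :=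
  ⟨h.1, h.2.1, h.2.2.trans hB⟩

theorem TF.memLp {B : Set (En n)} {φ : En n → W} (h : TF B φ) (q : ℝ≥0∞) : MemLp φ q volume :=
  h.1.continuous.memLp_of_hasCompactSupport h.2.1

theorem pd_contDiff {φ : En n → W} {m k : WithTop ℕ∞} (h : ContDiff ℝ m φ) (hk : k + 1 ≤ m) (i : Fin n) :
    ContDiff ℝ k (pd i φ) := by
  unfold pd
  exact (h.fderiv_right hk).clm_apply contDiff_const

theorem pd_tsupport (φ : En n → W) (i : Fin n) : tsupport (pd i φ) ⊆ tsupport φ := by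
  refine (closure_mono ?_).trans (tsupport_fderiv_subset ℝ (f := φ))
  intro x hx
  simp only [Function.mem_support, pd] at hx ⊢
  intro h0; apply hx; rw [h0]; simp

theorem TF.of_sub {W' : Type*} [NormedAddCommGroup W'] [InnerProductSpace ℝ W'] {B : Set (En n)}
    {φ : En n → W} (h : TF B φ) {ψ : En n → W'} (hψ : ContDiff ℝ (⊤ : ℕ∞) ψ) (hs : tsupport ψ ⊆ tsupport φ) :
    TF B ψ := ⟨hψ, h.2.1.of_isClosed_subset (isClosed_tsupport _) hs, hs.trans h.2.2⟩

theorem TF.of_zero {W' : Type*} [NormedAddCommGroup W'] [InnerProductSpace ℝ W'] {B : Set (En n)}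
    {φ : En n → W} (h : TF B φ) {ψ : En n → W'} (hψ : ContDiff ℝ (⊤ : ℕ∞) ψ) (hs : ∀ x, φ x = 0 → ψ x = 0) :
    TF B ψ := h.of_sub hψ (closure_mono fun x hx h0 => hx (hs x h0))

theorem TF.pd {B : Set (En n)} {φ : En n → W} (h : TF B φ) (i : Fin n) : TF B (pd i φ) :=
  h.of_sub (pd_contDiff h.1 (by simp) i) (pd_tsupport φ i)

theorem pd_cont {φ : En n → W} (h : ContDiff ℝ 1 φ) (i : Fin n) : Continuous (pd i φ) :=
  (pd_contDiff (k := 0) h (by norm_num) i).continuous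

theorem pd_compact {φ : En n → W} (h : HasCompactSupport φ) (i : Fin n) : HasCompactSupport (pd i φ) :=
  h.of_isClosed_subset (isClosed_tsupport _) (pd_tsupport φ i)

theorem pd_clm {W' : Type*} [NormedAddCommGroup W'] [InnerProductSpace ℝ W'] {φ : En n → W} {x : En n}
    (h : DifferentiableAt ℝ φ x) (L : W →L[ℝ] W') (i : Fin n) : pd i (fun y => L (φ y)) x = L (pd i φ x) := by
  unfold DP.pd
  have := (L.hasFDerivAt.comp x h.hasFDerivAt).fderiv
  have e : fderiv ℝ (fun y => L (φ y)) x = L.comp (fderiv ℝ φ x) := this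
  rw [e]; rfl

theorem pd_sum {ι : Type*} (s : Finset ι) {φ : ι → En n → W} {x : En n}
    (h : ∀ j ∈ s, DifferentiableAt ℝ (φ j) x) (i : Fin n) :
    DP.pd i (fun y => ∑ j ∈ s, φ j y) x = ∑ j ∈ s, DP.pd i (φ j) x := by
  unfold DP.pd
  rw [fderiv_fun_sum h]
  simp

theorem pd_symm {φ : En n → W} (h : ContDiff ℝ 2 φ) (i j : Fin n) (x : En n) :
    DP.pd i (DP.pd j φ) x = DP.pd j (DP.pd i φ) x := by
  have hs : IsSymmSndFDerivAt ℝ φ x := h.contDiffAt.isSymmSndFDerivAt (by simp)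
  have hd : DifferentiableAt ℝ (fderiv ℝ φ) x :=
    ((h.fderiv_right (m := 1) (by norm_num)).differentiable (by norm_num)).differentiableAt
  have e : ∀ a b : Fin n, DP.pd a (DP.pd b φ) x = fderiv ℝ (fderiv ℝ φ) x (basisVec a) (basisVec b) := by
    intro a b
    unfold DP.pd
    rw [fderiv_clm_apply hd (differentiableAt_const _)]
    simp
  rw [e, e]; exact hs _ _

theorem ibp {f ψ : En n → W} (hf : ContDiff ℝ 1 f) (hψ : ContDiff ℝ 1 ψ) (hc : HasCompactSupport ψ) (i : Fin n) :
    ∫ x, ⟪f x, DP.pd i ψ x⟫ = - ∫ x, ⟪DP.pd i f x, ψ x⟫ := by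
  have := integral_bilinear_fderiv_right_eq_neg_left_of_integrable (μ := volume) (f := f) (g := ψ)
    (v := basisVec i) (B := innerSL ℝ) ?_ ?_ ?_ ?_ ?_
  · exact this
  · apply Continuous.integrable_of_hasCompactSupport
    · exact ((pd_cont hf i).inner hψ.continuous)
    · exact hc.mono (fun x hx h0 => hx (by simp [h0]))
  · apply Continuous.integrable_of_hasCompactSupport
    · exact (hf.continuous.inner (pd_cont hψ i))
    · exact (pd_compact hc i).mono (fun x hx h0 => hx (by
        have : fderiv ℝ ψ x (basisVec i) = 0 := h0
        simp [this]))
  · apply Continuous.integrable_of_hasCompactSupport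
    · exact (hf.continuous.inner hψ.continuous)
    · exact hc.mono (fun x hx h0 => hx (by simp [h0]))
  · exact fun x _ => (hf.differentiable (by norm_num)).differentiableAt
  · exact fun x _ => (hψ.differentiable (by norm_num)).differentiableAt

end pd

section sys
variable {n : ℕ} {W0 W1 : Type*} [NormedAddCommGroup W0] [InnerProductSpace ℝ W0]
    [NormedAddCommGroup W1] [InnerProductSpace ℝ W1] [FiniteDimensional ℝ W0] [FiniteDimensional ℝ W1]
    [CompleteSpace W0] [CompleteSpace W1] (S : Sys n W0 W1)

def Sys.d (φ : En n → W0) (x : En n) : W1 := ∑ i, S.e i (pd i φ x)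

theorem Sys.adj' (i : Fin n) (x : W0) (y : W1) : ⟪y, S.e i x⟫ = ⟪S.es i y, x⟫ := by
  rw [real_inner_comm, S.adj, real_inner_comm]

theorem Sys.d_contDiff {φ : En n → W0} {m k : WithTop ℕ∞} (h : ContDiff ℝ m φ) (hk : k + 1 ≤ m) :
    ContDiff ℝ k (S.d φ) := by
  unfold Sys.d
  exact ContDiff.sum fun i _ => (S.e i).contDiff.comp (pd_contDiff h hk i)

theorem Sys.d_tsupport (φ : En n → W0) : tsupport (S.d φ) ⊆ tsupport φ := by
  refine (closure_mono ?_).trans (tsupport_fderiv_subset ℝ (f := φ))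
  intro x hx
  simp only [Function.mem_support, Sys.d, pd] at hx ⊢
  intro h0; apply hx; rw [h0]; simp

theorem Sys.d_TF {B : Set (En n)} {φ : En n → W0} (h : TF B φ) : TF B (S.d φ) :=
  h.of_sub (S.d_contDiff h.1 (by simp)) (S.d_tsupport φ)

theorem Sys.d_closed {φ : En n → W0} (h : ContDiff ℝ 2 φ) (i : Fin n) (x : En n) :
    ∑ s, S.e s (S.es i (pd s (S.d φ) x)) = pd i (S.d φ) x := by
  have hp : ∀ j, DifferentiableAt ℝ (pd j φ) x := fun j =>
    ((pd_contDiff (k := 1) h (by norm_num) j).differentiable (by norm_num)).differentiableAt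
  have e : ∀ s, pd s (S.d φ) x = ∑ j, S.e j (pd s (pd j φ) x) := by
    intro s
    unfold Sys.d
    rw [pd_sum (φ := fun j y => S.e j (pd j φ y)) _ (fun j _ => (S.e j).differentiableAt.comp x (hp j))]
    exact Finset.sum_congr rfl fun j _ => pd_clm (hp j) _ _
  have h1 : ∑ s, S.e s (S.es i (pd s (S.d φ) x)) = ∑ s, ∑ j, S.e s (S.es i (S.e j (pd s (pd j φ) x))) := by
    simp_rw [e, map_sum]
  have h2 : ∑ s, S.e s (S.es i (pd s (S.d φ) x)) = ∑ s, ∑ j, S.e j (S.es i (S.e s (pd s (pd j φ) x))) := by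
    rw [h1, Finset.sum_comm]
    refine Finset.sum_congr rfl fun a _ => Finset.sum_congr rfl fun b _ => ?_
    rw [pd_symm h]
  have h3 : (2 : ℝ) • ∑ s, S.e s (S.es i (pd s (S.d φ) x)) = (2 : ℝ) • pd i (S.d φ) x := by
    rw [two_smul]
    nth_rw 1 [h1]
    rw [h2, ← Finset.sum_add_distrib]
    simp_rw [← Finset.sum_add_distrib, S.J, Finset.sum_add_distrib]
    rw [e, two_smul]
    congr 1
    · rw [Finset.sum_eq_single i]
      · simp
      · intro b _ hb; simp [hb.symm]
      · simp
    · refine Finset.sum_congr rfl fun s _ => ?_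
      rw [Finset.sum_eq_single i]
      · simp [pd_symm h i s]
      · intro b _ hb; simp [hb.symm]
      · simp
  exact smul_right_injective _ (two_ne_zero (α := ℝ)) h3

/-- closure of exact fields -/
def InX (B : Set (En n)) (X : En n → W1) : Prop :=
  MemLp X 2 volume ∧ ∃ φ : ℕ → En n → W0, (∀ j, TF B (φ j)) ∧ TL volume (fun j => S.d (φ j)) X

theorem InX.of_TF {B : Set (En n)} {φ : En n → W0} (h : TF B φ) : InX S B (S.d φ) :=
  ⟨(S.d_TF h).memLp 2, fun _ => φ, fun _ => h, TL_const _⟩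

theorem InX.orth {B : Set (En n)} {X A : En n → W1} (h : InX S B X) (hA : MemLp A 2 volume)
    (h0 : ∀ φ, TF B φ → ∫ x, ⟪A x, S.d φ x⟫ = 0) : ∫ x, ⟪A x, X x⟫ = 0 := by
  obtain ⟨h1, φ, h2, h3⟩ := h
  have := (TL_const (μ := volume) A).inner h3 (fun _ => hA) hA (fun j => (S.d_TF (h2 j)).memLp 2) h1
  simp_rw [fun j => h0 (φ j) (h2 j)] at this
  exact tendsto_nhds_unique this tendsto_const_nhds

theorem InX.ae_zero {B : Set (En n)} {X : En n → W1} (h : InX S B X) : ∀ᵐ x, x ∉ B → X x = 0 := by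
  obtain ⟨h1, φ, h2, h3⟩ := h
  obtain ⟨ns, -, hns⟩ := h3.subseq (fun j => (S.d_TF (h2 j)).memLp 2) h1
  filter_upwards [hns] with x hx hxB
  refine tendsto_nhds_unique hx ?_
  have : ∀ i, S.d (φ (ns i)) x = 0 := fun i => by
    by_contra h0
    exact hxB ((S.d_TF (h2 (ns i))).2.2 (subset_tsupport _ h0))
  simp [this]

/-- weak closedness on an open set -/
def WC (O : Set (En n)) (f : En n → W1) : Prop :=
  ∀ (i : Fin n) (ψ : En n → W1), TF O ψ →
    ∫ x, ⟪f x, pd i ψ x - ∑ s, S.e i (S.es s (pd s ψ x))⟫ = 0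

/-- classical closedness at a point -/
def CC (F : En n → W1) (x : En n) : Prop := ∀ i, ∑ s, S.e s (S.es i (pd s F x)) = pd i F x

theorem WC_of_CC {O : Set (En n)} {F : En n → W1} (hF : ContDiff ℝ 1 F) (h : ∀ x ∈ O, CC S F x) : WC S O F := by
  intro i ψ hψ
  have h1 : ContDiff ℝ 1 ψ := hψ.1.of_le (by exact_mod_cast le_top)
  have hii : ∀ (u v : En n → W1), Continuous u → Continuous v → HasCompactSupport v →
      Integrable (fun x => ⟪u x, v x⟫) := fun u v hu hv hc =>
    (hu.inner hv).integrable_of_hasCompactSupport (hc.mono (fun x hx h0 => hx (by simp [h0])))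
  have e : ∀ x, ⟪F x, pd i ψ x - ∑ s, S.e i (S.es s (pd s ψ x))⟫ =
      ⟪F x, pd i ψ x⟫ - ∑ s, ⟪S.e s (S.es i (F x)), pd s ψ x⟫ := by
    intro x
    rw [inner_sub_right, inner_sum]
    simp_rw [S.adj', S.adj]
  have hcF : ∀ s, ContDiff ℝ 1 (fun x => S.e s (S.es i (F x))) := fun s =>
    (S.e s).contDiff.comp ((S.es i).contDiff.comp hF)
  simp_rw [e]
  rw [integral_sub, integral_finsetSum]
  · rw [ibp hF h1 hψ.2.1]
    simp_rw [fun s => ibp (hcF s) h1 hψ.2.1 s]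
    rw [Finset.sum_neg_distrib, sub_neg_eq_add, ← integral_finsetSum, neg_add_eq_zero]
    · apply integral_congr_ae
      filter_upwards with x
      by_cases hx : x ∈ O
      · rw [← h x hx i, sum_inner]
        refine Finset.sum_congr rfl fun s _ => ?_
        have := pd_clm ((hF.differentiable (by norm_num)).differentiableAt (x := x)) ((S.e s).comp (S.es i)) s
        simp only [ContinuousLinearMap.comp_apply] at this
        rw [this]
      · have : ψ x = 0 := by
          by_contra h0
          exact hx (hψ.2.2 (subset_tsupport _ h0))
        simp [this]
    · exact fun s _ => hii _ _ (pd_cont (hcF s) s) h1.continuous hψ.2.1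
  · exact fun s _ => hii _ _ (hcF s).continuous (pd_cont h1 s) (pd_compact hψ.2.1 s)
  · exact hii _ _ hF.continuous (pd_cont h1 i) (pd_compact hψ.2.1 i)
  · exact integrable_finsetSum _ fun s _ => hii _ _ (hcF s).continuous (pd_cont h1 s) (pd_compact hψ.2.1 s)

theorem WC_test_TF {O : Set (En n)} {ψ : En n → W1} (hψ : TF O ψ) (i : Fin n) :
    TF O (fun x => pd i ψ x - ∑ s, S.e i (S.es s (pd s ψ x))) := by
  refine hψ.of_sub ?_ ?_
  · refine (hψ.pd i).1.sub (ContDiff.sum fun s _ => ?_)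
    exact (S.e i).contDiff.comp ((S.es s).contDiff.comp (hψ.pd s).1)
  · refine (closure_mono ?_).trans (tsupport_fderiv_subset ℝ (f := ψ))
    intro x hx
    simp only [Function.mem_support, pd] at hx ⊢
    intro h0; apply hx; rw [h0]; simp

theorem WC.limit {O : Set (En n)} {f : ℕ → En n → W1} {F : En n → W1} (h : TL volume f F)
    (hf : ∀ j, MemLp (f j) 2 volume) (hF : MemLp F 2 volume) (hw : ∀ j, WC S O (f j)) : WC S O F := by
  intro i ψ hψ
  have hm := (WC_test_TF S hψ i).memLp 2
  have := h.inner (TL_const (μ := volume) _) hf hF (fun _ => hm) hm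
  simp_rw [fun j => hw j i ψ hψ] at this
  exact tendsto_nhds_unique this tendsto_const_nhds

theorem InX.WC {B O : Set (En n)} {X : En n → W1} (h : InX S B X) : WC S O X := by
  obtain ⟨h1, φ, h2, h3⟩ := h
  refine WC.limit S h3 (fun j => (S.d_TF (h2 j)).memLp 2) h1 (fun j => WC_of_CC S ?_ fun x _ i => S.d_closed ?_ i x)
  · exact (S.d_TF (h2 j)).1.of_le (by exact_mod_cast le_top)
  · exact (h2 j).1.of_le (by norm_cast)

theorem WC.add {O : Set (En n)} {f g : En n → W1} (hf : MemLp f 2 volume) (hg : MemLp g 2 volume)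
    (h1 : WC S O f) (h2 : WC S O g) : WC S O (fun x => f x + g x) := by
  intro i ψ hψ
  have hm := (WC_test_TF S hψ i).memLp 2
  simp_rw [inner_add_left]
  rw [integral_add (inner_intble hf hm) (inner_intble hg hm), h1 i ψ hψ, h2 i ψ hψ, add_zero]

theorem WC.congr {O : Set (En n)} {f g : En n → W1} (h : ∀ᵐ x, x ∈ O → f x = g x)
    (h1 : DP.WC S O f) : DP.WC S O g := by
  intro i ψ hψ
  rw [← h1 i ψ hψ]
  apply integral_congr_ae
  filter_upwards [h] with x hx
  by_cases hxO : x ∈ O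
  · rw [hx hxO]
  · have : (fun x => pd i ψ x - ∑ s, S.e i (S.es s (pd s ψ x))) x = 0 := by
      by_contra h0
      exact hxO ((WC_test_TF S hψ i).2.2 (subset_tsupport _ h0))
    simp only at this
    simp [this]

/-- mollifications of weakly closed fields are closed -/
theorem WC.mol {O : Set (En n)} {f : En n → W1} (hf : LocallyIntegrable f volume) (hw : DP.WC S O f)
    {ρ : En n → ℝ} {σ : ℝ} (hρ : IsMol ρ σ) {x : En n} (hx : closedBall x σ ⊆ O) : CC S (mol ρ f) x := by
  intro i
  apply ext_inner_right ℝ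
  intro v
  set ψ : En n → W1 := fun y => ρ (x - y) • v with hψ
  have hρ1 : Differentiable ℝ ρ := hρ.smooth.differentiable (by simp)
  have hs : tsupport ψ ⊆ closedBall x σ := by
    apply closure_minimal _ isClosed_closedBall
    intro y hy
    have : ρ (x - y) ≠ 0 := fun h0 => hy (by simp [hψ, h0])
    rw [mem_closedBall, dist_comm, dist_eq_norm]
    exact hρ.supp _ this
  have hT : TF O ψ := by
    refine ⟨?_, ?_, hs.trans hx⟩
    · exact (hρ.smooth.comp (contDiff_const.sub contDiff_id)).smul contDiff_const
    · exact (isCompact_closedBall x σ).of_isClosed_subset (isClosed_tsupport _) hs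
  have e1 : ∀ s y, pd s ψ y = -(fderiv ℝ ρ (x - y) (basisVec s) • v) := by
    intro s y
    have h1 : HasFDerivAt (fun y => ρ (x - y)) ((fderiv ℝ ρ (x - y)).comp (-ContinuousLinearMap.id ℝ (En n))) y :=
      (hρ1 (x - y)).hasFDerivAt.comp y ((hasFDerivAt_id y).const_sub x)
    have h2 := (h1.smul_const v).fderiv
    unfold pd
    rw [hψ, h2]
    simp
  have hint : ∀ s (L : W1 →L[ℝ] W1), Integrable (fun y => ⟪L ((fderiv ℝ ρ (x - y) (basisVec s)) • f y), v⟫) ∧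
      ⟪L (pd s (DP.mol ρ f) x), v⟫ = ∫ y, ⟪L ((fderiv ℝ ρ (x - y) (basisVec s)) • f y), v⟫ := by
    intro s L
    have hi : Integrable (fun y => (fderiv ℝ ρ (x - y) (basisVec s)) • f y) := by
      have hcs : HasCompactSupport (fun y => fderiv ℝ ρ (x - y) (basisVec s)) := by
        have := hT.pd s
        refine HasCompactSupport.of_support_subset_isCompact (isCompact_closedBall x σ) ?_
        intro y hy
        by_contra hyc
        have : ‖x - y‖ > σ := by
          rw [mem_closedBall, dist_comm, dist_eq_norm] at hyc; linarith
        have h0 : x - y ∉ tsupport ρ := by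
          intro h1
          have : tsupport ρ ⊆ closedBall 0 σ := closure_minimal (fun z hz => by simpa using hρ.supp z hz) isClosed_closedBall
          have := this h1
          simp at this; linarith
        have := fun h1 => h0 (tsupport_fderiv_subset ℝ (f := ρ) h1)
        have h2 : fderiv ℝ ρ (x - y) = 0 := by
          by_contra h3
          exact this (subset_tsupport _ h3)
        exact hy (by simp [h2])
      have hcc : Continuous (fun y => fderiv ℝ ρ (x - y) (basisVec s)) := by
        have := (pd_cont (hρ.smooth.of_le (by exact_mod_cast le_top)) s).comp
          (continuous_const.sub continuous_id : Continuous fun y : En n => x - y)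
        exact this
      exact hf.integrable_smul_left_of_hasCompactSupport hcc hcs
    have h3 : ∀ u, ⟪L u, v⟫ = ((innerSL ℝ v).comp L) u := fun u => by
      simp [real_inner_comm]
    simp_rw [h3]
    unfold pd
    rw [mol_fderiv hρ.smooth hρ.compact hf, ContinuousLinearMap.integral_comp_comm _ hi]
    exact ⟨ContinuousLinearMap.integrable_comp _ hi, rfl⟩
  have h5 := fun s => hint s ((S.e s).comp (S.es i))
  have h6 := hint i (ContinuousLinearMap.id ℝ W1)
  simp only [ContinuousLinearMap.comp_apply, ContinuousLinearMap.id_apply] at h5 h6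
  rw [sum_inner, h6.2]
  simp_rw [fun s => (h5 s).2]
  rw [← integral_finsetSum _ (fun s _ => (h5 s).1), ← sub_eq_zero,
    ← integral_sub (integrable_finsetSum _ (fun s _ => (h5 s).1)) h6.1, ← hw i ψ hT]
  apply integral_congr_ae
  filter_upwards with y
  simp_rw [e1]
  simp only [map_neg, map_smul, Finset.sum_neg_distrib, inner_sub_right, inner_neg_right, inner_sum,
    inner_smul_left, inner_smul_right, S.adj', S.adj]
  simp
  ring
end sys
end DP

namespace DP
set_option linter.unusedSectionVars false
set_option linter.unusedVariables false
open Set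
open scoped RealInnerProductSpace Topology

section ex
variable {n : ℕ} {W0 W1 : Type*} [NormedAddCommGroup W0] [InnerProductSpace ℝ W0]
    [NormedAddCommGroup W1] [InnerProductSpace ℝ W1] [FiniteDimensional ℝ W0] [FiniteDimensional ℝ W1]
    [CompleteSpace W0] [CompleteSpace W1] (S : Sys n W0 W1)

theorem TF.add {W : Type*} [NormedAddCommGroup W] [InnerProductSpace ℝ W] {B : Set (En n)} {φ ψ : En n → W}
    (h : TF B φ) (h' : TF B ψ) : TF B (fun x => φ x + ψ x) :=
  ⟨h.1.add h'.1, h.2.1.add h'.2.1, (tsupport_add φ ψ).trans (union_subset h.2.2 h'.2.2)⟩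

theorem TF.smul {W : Type*} [NormedAddCommGroup W] [InnerProductSpace ℝ W] {B : Set (En n)} {φ : En n → W}
    (h : TF B φ) (c : ℝ) : TF B (fun x => c • φ x) :=
  h.of_zero (contDiff_const.smul h.1) (fun x hx => by simp [hx])

theorem TF.zero {W : Type*} [NormedAddCommGroup W] [InnerProductSpace ℝ W] {B : Set (En n)} :
    TF B (fun _ : En n => (0 : W)) :=
  ⟨contDiff_const, HasCompactSupport.zero, by simp [tsupport]⟩

theorem TF.diff {W : Type*} [NormedAddCommGroup W] [InnerProductSpace ℝ W] {B : Set (En n)} {φ : En n → W}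
    (h : TF B φ) : Differentiable ℝ φ := h.1.differentiable (by simp)

theorem Sys.d_add {φ ψ : En n → W0} (h : Differentiable ℝ φ) (h' : Differentiable ℝ ψ) (x : En n) :
    S.d (fun x => φ x + ψ x) x = S.d φ x + S.d ψ x := by
  simp only [Sys.d, pd]
  rw [fderiv_fun_add (h x) (h' x)]
  simp [Finset.sum_add_distrib]

theorem Sys.d_smul {φ : En n → W0} (h : Differentiable ℝ φ) (c : ℝ) (x : En n) :
    S.d (fun x => c • φ x) x = c • S.d φ x := by
  simp only [Sys.d, pd]
  rw [fderiv_fun_const_smul (h x) c]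
  simp [Finset.smul_sum]

def exSub (B : Set (En n)) : Submodule ℝ (Lp W1 2 (volume : Measure (En n))) where
  carrier := {u | ∃ φ, TF B φ ∧ (u : En n → W1) =ᵐ[volume] S.d φ}
  add_mem' := by
    rintro u v ⟨φ, h1, h2⟩ ⟨ψ, h3, h4⟩
    refine ⟨_, h1.add h3, ?_⟩
    filter_upwards [Lp.coeFn_add u v, h2, h4] with x a b c
    rw [a, S.d_add h1.diff h3.diff, Pi.add_apply, b, c]
  zero_mem' := by
    refine ⟨_, TF.zero, ?_⟩
    filter_upwards [Lp.coeFn_zero W1 2 (volume : Measure (En n))] with x a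
    rw [a]; simp [Sys.d, pd]
  smul_mem' := by
    rintro c u ⟨φ, h1, h2⟩
    refine ⟨_, h1.smul c, ?_⟩
    filter_upwards [Lp.coeFn_smul c u, h2] with x a b
    rw [a, S.d_smul h1.diff, Pi.smul_apply, b]

theorem GFun.gA_lipschitz {q : ℝ} {g : ℝ → ℝ} (h : GFun q g) {Λ : ℝ} (hΛ : ∀ s, 0 ≤ s → g s ≤ Λ) :
    LipschitzWith (Real.toNNReal ((2 + 2 * q) * Λ)) (gA g : W1 → W1) := by
  apply LipschitzWith.of_dist_le_mul
  intro a b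
  have h0 : 0 ≤ Λ := (h.nonneg 0 le_rfl).trans (hΛ 0 le_rfl)
  rw [dist_eq_norm, dist_eq_norm, Real.coe_toNNReal _ (mul_nonneg (by linarith [h.hq]) h0)]
  exact h.A_lip hΛ b a

theorem GFun.gA_memLp {q : ℝ} {g : ℝ → ℝ} (h : GFun q g) {Λ : ℝ} (hΛ : ∀ s, 0 ≤ s → g s ≤ Λ)
    {f : En n → W1} (hf : MemLp f 2 volume) : MemLp (fun x => gA g (f x)) 2 volume :=
  (h.gA_lipschitz hΛ).comp_memLp gA_zero hf

theorem exists_H {q : ℝ} {g : ℝ → ℝ} (h : GFun q g) {l Λ : ℝ} (hΛ : ∀ s, 0 ≤ s → g s ≤ Λ) (hl : 0 < l)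
    (hgl : ∀ s, 0 ≤ s → l ≤ g s) (B : Set (En n)) {f : En n → W1} (hf : MemLp f 2 volume) :
    ∃ H : En n → W1, MemLp H 2 volume ∧ InX S B (fun x => H x - f x) ∧
      ∀ X, InX S B X → ∫ x, ⟪gA g (H x), X x⟫ = 0 := by
  set LW := h.gA_lipschitz (W1 := W1) hΛ
  set A : Lp W1 2 (volume : Measure (En n)) → Lp W1 2 (volume : Measure (En n)) := LW.compLp gA_zero with hA
  have hAc : ∀ u, A u =ᵐ[volume] (gA g) ∘ u := fun u => LW.coeFn_compLp gA_zero u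
  obtain ⟨x, hx, hy⟩ := hilbert_exists (exSub S B).topologicalClosure (Submodule.isClosed_topologicalClosure _)
    A hl (fun x y => LW.norm_compLp_sub_le gA_zero x y) (fun x y => by
      rw [← real_inner_self_eq_norm_sq, L2.inner_def, L2.inner_def, ← integral_const_mul]
      apply integral_mono_ae
      · exact (L2.integrable_inner (𝕜 := ℝ) (x - y) (x - y)).const_mul _
      · exact L2.integrable_inner (𝕜 := ℝ) _ _
      · filter_upwards [hAc x, hAc y, Lp.coeFn_sub x y, Lp.coeFn_sub (A x) (A y)] with t h1 h2 h3 h4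
        simp only [h3, h4, Pi.sub_apply, h1, h2, Function.comp, real_inner_self_eq_norm_sq]
        refine le_trans ?_ (h.mono_A (y t) (x t))
        apply mul_le_mul_of_nonneg_right _ (sq_nonneg _)
        linarith [hgl _ (sq_nonneg ‖x t‖), hgl _ (sq_nonneg ‖y t‖)]) (hf.toLp f)
  have hH : MemLp (fun t => f t + x t) 2 volume := hf.add (Lp.memLp x)
  refine ⟨fun t => f t + x t, hH, ⟨?_, ?_⟩, fun X hX => ?_⟩
  · simpa using Lp.memLp x
  · have hx' : x ∈ closure (exSub S B : Set (Lp W1 2 (volume : Measure (En n)))) := hx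
    rw [mem_closure_iff_seq_limit] at hx'
    obtain ⟨u, hu, hlim⟩ := hx'
    choose φ hφ hφ' using hu
    refine ⟨φ, hφ, ?_⟩
    rw [Lp.tendsto_Lp_iff_tendsto_eLpNorm'] at hlim
    refine hlim.congr fun j => eLpNorm_congr_ae ?_
    filter_upwards [hφ' j] with t ht
    simp [ht]
  · apply hX.orth S (h.gA_memLp hΛ hH)
    intro φ hφ
    have hm := (S.d_TF hφ).memLp 2
    have := hy (hm.toLp _) ((exSub S B).le_topologicalClosure ⟨φ, hφ, hm.coeFn_toLp⟩)
    rw [L2.inner_def] at this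
    rw [← this]
    apply integral_congr_ae
    filter_upwards [hAc (hf.toLp f + x), hm.coeFn_toLp, Lp.coeFn_add (hf.toLp f) x, hf.coeFn_toLp] with t h1 h2 h3 h4
    rw [h1, h2, Function.comp, h3, Pi.add_apply, h4]

end ex
end DP

namespace DP
set_option linter.unusedSectionVars false
set_option linter.unusedVariables false
open Set
open scoped RealInnerProductSpace Topology

section pwise
variable {W : Type*} [NormedAddCommGroup W] [InnerProductSpace ℝ W]

theorem pw_eq (q : ℝ) (hq : 0 < q) (z : W) : (‖z‖ ^ 2) ^ q * ‖z‖ ^ 2 = ‖z‖ ^ (2 * q + 2) := by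
  rcases (norm_nonneg z).eq_or_lt with h | h
  · rw [← h, Real.zero_rpow (by linarith)]; simp
  · rw [Real.rpow_add h, Real.rpow_mul h.le]; norm_num

theorem pw_eq' (q : ℝ) (hq : 0 < q) (z : W) : (‖z‖ ^ 2) ^ q * ‖z‖ = ‖z‖ ^ (2 * q + 1) := by
  rcases (norm_nonneg z).eq_or_lt with h | h
  · rw [← h, Real.zero_rpow (by linarith)]; simp
  · rw [Real.rpow_add h, Real.rpow_mul h.le]; norm_num

theorem gR_half {q ε T s : ℝ} (hq : 0 < q) (hε : 0 < ε) (hT : 0 < T) (hs : 0 ≤ s) (hsT : s ≤ T) :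
    s ^ q ≤ 2 ^ q * gR q ε T s := by
  unfold gR
  have hb := gR_base hε hT hs
  rw [← Real.mul_rpow (by norm_num) (by linarith)]
  apply Real.rpow_le_rpow hs _ hq.le
  have : s / 2 ≤ s * T / (T + s) := by
    rw [div_le_div_iff₀ (by norm_num) (by linarith)]; nlinarith
  linarith

theorem gR_big {q ε T s : ℝ} (hq : 0 < q) (hε : 0 < ε) (hT : 2 ≤ T) (hsT : T ≤ s) :
    1 ≤ gR q ε T s := by
  unfold gR
  apply Real.one_le_rpow _ hq.le
  have : T / 2 ≤ s * T / (T + s) := by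
    rw [div_le_div_iff₀ (by norm_num) (by linarith)]; nlinarith
  linarith

theorem gH_bound {q : ℝ} {g : ℝ → ℝ} (h : GFun q g) (f H : W) :
    g (‖H‖ ^ 2) * ‖H‖ ^ 2 ≤ 8 * ⟪gA g H - gA g f, H - f⟫ + 4 * 4 ^ q * (g (‖f‖ ^ 2) * ‖f‖ ^ 2) := by
  have hm := h.mono_A f H
  have hgf := h.gs_nonneg f
  have hgH := h.gs_nonneg H
  have hX := sq_nonneg ‖H - f‖
  have h4 : (0:ℝ) < 4 ^ q := by positivity
  by_cases hc : ‖H‖ ≤ 2 * ‖f‖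
  · have h1 : g (‖H‖ ^ 2) ≤ 4 ^ q * g (‖f‖ ^ 2) := by
      have := h.ratio' (norm_nonneg f) (norm_nonneg H) (t := 1 / 2) (by norm_num) (by norm_num) (by linarith)
      have e : (1 / 2 : ℝ) ^ (2 * q) = (4 ^ q)⁻¹ := by
        rw [Real.rpow_mul (by norm_num), ← Real.inv_rpow (by norm_num)]; norm_num
      rw [e, inv_mul_le_iff₀ h4] at this
      exact this
    have h2 : ‖H‖ ^ 2 ≤ 4 * ‖f‖ ^ 2 := by nlinarith [norm_nonneg H, norm_nonneg f]
    have h3 : 0 ≤ ⟪gA g H - gA g f, H - f⟫ := le_trans (by positivity) hm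
    have : g (‖H‖ ^ 2) * ‖H‖ ^ 2 ≤ (4 ^ q * g (‖f‖ ^ 2)) * (4 * ‖f‖ ^ 2) := by gcongr
    nlinarith
  · push Not at hc
    have h1 : ‖H‖ ≤ 2 * ‖H - f‖ := by
      have := norm_sub_norm_le H f
      linarith
    have h2 : ‖H‖ ^ 2 ≤ 4 * ‖H - f‖ ^ 2 := by nlinarith [norm_nonneg H]
    have h3 : g (‖H‖ ^ 2) * ‖H‖ ^ 2 ≤ g (‖H‖ ^ 2) * (4 * ‖H - f‖ ^ 2) := by gcongr
    have h5 : 0 ≤ 4 * 4 ^ q * (g (‖f‖ ^ 2) * ‖f‖ ^ 2) := by positivity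
    have h6 : 0 ≤ g (‖f‖ ^ 2) * ‖H - f‖ ^ 2 := by positivity
    nlinarith

theorem V_mono {q : ℝ} {g : ℝ → ℝ} (h : GFun q g) (f H : W) :
    ‖gV g H - gV g f‖ ^ 2 ≤ CV q * ⟪gA g H - gA g f, H - f⟫ := by
  have h1 := h.V_breg f H
  have h2 := h.breg_nonneg H f
  have h3 := CV_pos h.hq
  have e : ⟪gA g H - gA g f, H - f⟫ = (gΓ g H - gΓ g f - ⟪gA g f, H - f⟫) + (gΓ g f - gΓ g H - ⟪gA g H, f - H⟫) := by
    rw [← neg_sub H f, inner_neg_right, inner_sub_left]; ring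
  rw [e]
  nlinarith

theorem one_add_rpow_le {q s : ℝ} (hq : 0 < q) (hs : 0 ≤ s) : (1 + s) ^ q * s ≤ 2 ^ q * (1 + s ^ q * s) := by
  have h2 : (0:ℝ) < 2 ^ q := by positivity
  have h3 : 0 ≤ s ^ q := Real.rpow_nonneg hs q
  rcases le_total s 1 with h | h
  · have : (1 + s) ^ q ≤ 2 ^ q := Real.rpow_le_rpow (by linarith) (by linarith) hq.le
    have h4 : (1 + s) ^ q * s ≤ 2 ^ q * 1 := by gcongr
    nlinarith [mul_nonneg h3 hs]
  · have : (1 + s) ^ q ≤ 2 ^ q * s ^ q := by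
      rw [← Real.mul_rpow (by norm_num) hs]
      exact Real.rpow_le_rpow (by linarith) (by linarith) hq.le
    have h4 : (1 + s) ^ q * s ≤ (2 ^ q * s ^ q) * s := by gcongr
    nlinarith

theorem young_p {q τ a b : ℝ} (hq : 0 < q) (hτ : 0 < τ) (ha : 0 ≤ a) (hb : 0 ≤ b) :
    a * b ≤ (1 / τ) ^ (1 / (2 * q + 1)) * a ^ ((2 * q + 2) / (2 * q + 1)) + τ * b ^ (2 * q + 2) := by
  have hc0 : 0 ≤ (1 / τ) ^ (1 / (2 * q + 1)) * a ^ ((2 * q + 2) / (2 * q + 1)) := by positivity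
  have hy := Real.young_inequality_of_nonneg (a := (1 / τ) ^ (1 / (2 * q + 2)) * a)
    (b := τ ^ (1 / (2 * q + 2)) * b) (p := (2 * q + 2) / (2 * q + 1)) (q := 2 * q + 2)
    (by positivity) (by positivity) (by
      rw [Real.holderConjugate_iff]
      refine ⟨by rw [lt_div_iff₀ (by linarith)]; linarith, ?_⟩
      field_simp; ring)
  have e1 : (1 / τ) ^ (1 / (2 * q + 2)) * a * (τ ^ (1 / (2 * q + 2)) * b) = a * b := by
    have : (1 / τ) ^ (1 / (2 * q + 2)) * τ ^ (1 / (2 * q + 2)) = 1 := by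
      rw [← Real.mul_rpow (by positivity) hτ.le, one_div_mul_cancel hτ.ne', Real.one_rpow]
    linear_combination (a * b) * this
  rw [e1, Real.mul_rpow (by positivity) ha, Real.mul_rpow (by positivity) hb,
    ← Real.rpow_mul (by positivity), ← Real.rpow_mul hτ.le] at hy
  have e2 : 1 / (2 * q + 2) * ((2 * q + 2) / (2 * q + 1)) = 1 / (2 * q + 1) := by field_simp
  have e3 : 1 / (2 * q + 2) * (2 * q + 2) = 1 := by field_simp
  rw [e2, e3, Real.rpow_one] at hy
  have e4 : (1 / τ) ^ (1 / (2 * q + 1)) * a ^ ((2 * q + 2) / (2 * q + 1)) / ((2 * q + 2) / (2 * q + 1)) ≤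
      (1 / τ) ^ (1 / (2 * q + 1)) * a ^ ((2 * q + 2) / (2 * q + 1)) := by
    apply div_le_self hc0
    rw [le_div_iff₀ (by linarith)]; linarith
  have e5 : τ * b ^ (2 * q + 2) / (2 * q + 2) ≤ τ * b ^ (2 * q + 2) := by
    apply div_le_self (by positivity); linarith
  linarith

theorem sub_pow_le {q : ℝ} (hq : 0 < q) (f H : W) {G : ℝ} (hG : (‖H‖ ^ 2) ^ q ≤ 2 ^ q * G) :
    ‖H - f‖ ^ (2 * q + 2) ≤ 2 ^ (3 * q + 3) * ((‖f‖ ^ 2) ^ q * ‖f‖ ^ 2 + G * ‖H‖ ^ 2) := by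
  have hA2 : (2:ℝ) ^ (3 * q + 3) = 2 ^ (2 * q + 2) * (2 * 2 ^ q) := by
    rw [show 3 * q + 3 = (2 * q + 2) + (1 + q) by ring, Real.rpow_add (by norm_num) (2 * q + 2) (1 + q),
      Real.rpow_add (by norm_num) 1 q, Real.rpow_one]
  have h1q : (1:ℝ) ≤ 2 ^ q := Real.one_le_rpow (by norm_num) hq.le
  have hXle : ‖H - f‖ ≤ ‖H‖ + ‖f‖ := norm_sub_le _ _
  have a1 : ‖H - f‖ ^ (2 * q + 2) ≤ (2 * max ‖H‖ ‖f‖) ^ (2 * q + 2) :=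
    Real.rpow_le_rpow (norm_nonneg _) (by linarith [le_max_left ‖H‖ ‖f‖, le_max_right ‖H‖ ‖f‖]) (by linarith)
  rw [Real.mul_rpow (by norm_num) (by positivity)] at a1
  have a2 : (max ‖H‖ ‖f‖) ^ (2 * q + 2) ≤ ‖H‖ ^ (2 * q + 2) + ‖f‖ ^ (2 * q + 2) := by
    rcases max_choice ‖H‖ ‖f‖ with h' | h' <;> rw [h']
    · linarith [Real.rpow_nonneg (norm_nonneg f) (2 * q + 2)]
    · linarith [Real.rpow_nonneg (norm_nonneg H) (2 * q + 2)]
  rw [← pw_eq q hq, ← pw_eq q hq] at a2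
  have a4 : (‖H‖ ^ 2) ^ q * ‖H‖ ^ 2 ≤ 2 ^ q * G * ‖H‖ ^ 2 := by gcongr
  have hP0 : 0 ≤ (‖f‖ ^ 2) ^ q := Real.rpow_nonneg (sq_nonneg _) q
  have hP1 : 0 ≤ (‖H‖ ^ 2) ^ q := Real.rpow_nonneg (sq_nonneg _) q
  have a5 : 0 ≤ (‖f‖ ^ 2) ^ q * ‖f‖ ^ 2 := by positivity
  have a6 : 0 ≤ (‖H‖ ^ 2) ^ q * ‖H‖ ^ 2 := by positivity
  have a7 : (‖f‖ ^ 2) ^ q * ‖f‖ ^ 2 ≤ 2 ^ q * ((‖f‖ ^ 2) ^ q * ‖f‖ ^ 2) := le_mul_of_one_le_left a5 h1q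
  rw [hA2]
  calc _ ≤ _ := a1
    _ ≤ 2 ^ (2 * q + 2) * (2 * (2 ^ q * ((‖f‖ ^ 2) ^ q * ‖f‖ ^ 2) + 2 ^ q * G * ‖H‖ ^ 2)) := by
      gcongr
      linarith
    _ = _ := by ring

theorem pair1 {P κ A MM Xn fn gf gH : ℝ} (hA : 0 < A) (hP0 : 0 ≤ P) (hPg : P ≤ A * gf)
    (hm : (gf + gH) / 2 * Xn ^ 2 ≤ MM) (hgH : 0 ≤ gH) :
    κ * (P * fn) * Xn ≤ 1 / 2 * MM + A * κ ^ 2 * (P * fn ^ 2) := by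
  have e2 : κ * fn * Xn ≤ (4 * A)⁻¹ * Xn ^ 2 + A * κ ^ 2 * fn ^ 2 := by
    have h6 : 0 ≤ (4 * A)⁻¹ * (Xn - 2 * A * κ * fn) ^ 2 := by positivity
    have h7 : (4 * A)⁻¹ * (Xn - 2 * A * κ * fn) ^ 2 = (4 * A)⁻¹ * Xn ^ 2
      - κ * fn * Xn + A * κ ^ 2 * fn ^ 2 := by field_simp; ring
    linarith
  have e3 : P * ((4 * A)⁻¹ * Xn ^ 2) ≤ gf / 4 * Xn ^ 2 := by
    calc P * ((4 * A)⁻¹ * Xn ^ 2) ≤ (A * gf) * ((4 * A)⁻¹ * Xn ^ 2) := by gcongr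
      _ = _ := by field_simp
  have e4 := mul_le_mul_of_nonneg_left e2 hP0
  have e5 : 0 ≤ gH * Xn ^ 2 := by positivity
  have e6 : (gf + gH) / 2 * Xn ^ 2 = 2 * (gf / 4 * Xn ^ 2) + 1 / 2 * (gH * Xn ^ 2) := by ring
  have e7 : P * (κ * fn * Xn) = κ * (P * fn) * Xn := by ring
  have e8 : P * ((4 * A)⁻¹ * Xn ^ 2 + A * κ ^ 2 * fn ^ 2) = P * ((4 * A)⁻¹ * Xn ^ 2) + A * κ ^ 2 * (P * fn ^ 2) := by ring
  linarith

theorem pair2 {q ε T τ M : ℝ} (hq : 0 < q) (hε : 0 < ε) (hT : 2 ≤ T) (hτ : 0 < τ)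
    (f H D : W) (hf : ‖f‖ ^ 2 ≤ T) (hD : ‖D‖ ≤ M) (hMT : (2 * M / τ) ^ 2 ≤ T) :
    |⟪D, H - f⟫| ≤ (1 / τ) ^ (1 / (2 * q + 1)) * ‖D‖ ^ ((2 * q + 2) / (2 * q + 1)) +
      τ * 2 ^ (3 * q + 3) * ((‖f‖ ^ 2) ^ q * ‖f‖ ^ 2 + gR q ε T (‖H‖ ^ 2) * ‖H‖ ^ 2) := by
  have hT0 : 0 < T := by linarith
  refine (abs_real_inner_le_norm _ _).trans ?_
  have hc0 : 0 ≤ (1 / τ) ^ (1 / (2 * q + 1)) * ‖D‖ ^ ((2 * q + 2) / (2 * q + 1)) := by positivity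
  have hXle : ‖H - f‖ ≤ ‖H‖ + ‖f‖ := norm_sub_le _ _
  by_cases hHT : ‖H‖ ^ 2 ≤ T
  · have hy := young_p hq hτ (norm_nonneg D) (norm_nonneg (H - f))
    have e6 := sub_pow_le hq f H (gR_half hq hε hT0 (sq_nonneg _) hHT)
    have e7 := mul_le_mul_of_nonneg_left e6 hτ.le
    linarith
  · push Not at hHT
    have hg1 : 1 ≤ gR q ε T (‖H‖ ^ 2) := gR_big hq hε hT hHT.le
    have hfH : ‖f‖ ≤ ‖H‖ := le_of_sq_le_sq (by linarith) (norm_nonneg _)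
    have hMH : 2 * M / τ ≤ ‖H‖ := le_of_sq_le_sq (by linarith) (norm_nonneg _)
    rw [div_le_iff₀ hτ] at hMH
    have a1 : ‖D‖ * ‖H - f‖ ≤ M * (2 * ‖H‖) := mul_le_mul hD (by linarith) (norm_nonneg _) ((norm_nonneg _).trans hD)
    have a2 : M * (2 * ‖H‖) ≤ τ * ‖H‖ ^ 2 := by
      have := mul_le_mul_of_nonneg_right hMH (norm_nonneg H)
      calc _ = 2 * M * ‖H‖ := by ring
        _ ≤ _ := this
        _ = _ := by ring
    have a3 : τ * ‖H‖ ^ 2 ≤ τ * 2 ^ (3 * q + 3) * (gR q ε T (‖H‖ ^ 2) * ‖H‖ ^ 2) := by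
      have : (1:ℝ) ≤ 2 ^ (3 * q + 3) := Real.one_le_rpow (by norm_num) (by linarith)
      have b1 : ‖H‖ ^ 2 ≤ gR q ε T (‖H‖ ^ 2) * ‖H‖ ^ 2 := le_mul_of_one_le_left (sq_nonneg _) hg1
      calc τ * ‖H‖ ^ 2 ≤ τ * (2 ^ (3 * q + 3) * (gR q ε T (‖H‖ ^ 2) * ‖H‖ ^ 2)) := by
            gcongr
            exact b1.trans (le_mul_of_one_le_left ((sq_nonneg _).trans b1) this)
        _ = _ := by ring
    have hP0 : 0 ≤ (‖f‖ ^ 2) ^ q := Real.rpow_nonneg (sq_nonneg _) q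
    have a4 : 0 ≤ τ * 2 ^ (3 * q + 3) * ((‖f‖ ^ 2) ^ q * ‖f‖ ^ 2) := by positivity
    rw [mul_add]
    linarith

/-- pointwise estimate of the error pairing -/
theorem pairing {q ε T κ b τ M : ℝ} (hq : 0 < q) (hε : 0 < ε) (hε1 : ε ≤ 1) (hT : 2 ≤ T) (hτ : 0 < τ)
    (hb : |1 - b| ≤ κ) (f H D : W) (hf : ‖f‖ ^ 2 ≤ T) (hD : ‖D‖ ≤ M) (hMT : (2 * M / τ) ^ 2 ≤ T) :
    |⟪(1 - b) • gA (fun s => s ^ q) f + D, H - f⟫| ≤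
      (1 / 2 + 8 * (τ * 2 ^ (3 * q + 3))) * ⟪gA (gR q ε T) H - gA (gR q ε T) f, H - f⟫
      + 2 ^ q * κ ^ 2 * ((‖f‖ ^ 2) ^ q * ‖f‖ ^ 2)
      + (1 / τ) ^ (1 / (2 * q + 1)) * ‖D‖ ^ ((2 * q + 2) / (2 * q + 1))
      + τ * (2 ^ (3 * q + 3) * (1 + 4 * 4 ^ q * 2 ^ q)) * (1 + (‖f‖ ^ 2) ^ q * ‖f‖ ^ 2) := by
  have hT0 : 0 < T := by linarith
  have h := gfun_gR hq hε hT0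
  have hm := h.mono_A f H
  have hH := gH_bound h f H
  have hgf := h.gs_nonneg f
  have hgH := h.gs_nonneg H
  have p2 := pair2 hq hε hT hτ f H D hf hD hMT
  have hP0 : 0 ≤ (‖f‖ ^ 2) ^ q := Real.rpow_nonneg (sq_nonneg _) q
  have hκ : 0 ≤ κ := (abs_nonneg _).trans hb
  have hPg : (‖f‖ ^ 2) ^ q ≤ 2 ^ q * gR q ε T (‖f‖ ^ 2) := gR_half hq hε hT0 (sq_nonneg _) hf
  have h2q : (0:ℝ) < 2 ^ q := by positivity
  have p1 := pair1 (κ := κ) (fn := ‖f‖) h2q hP0 hPg hm hgH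
  have e1 : |⟪(1 - b) • gA (fun s => s ^ q) f, H - f⟫| ≤ κ * ((‖f‖ ^ 2) ^ q * ‖f‖) * ‖H - f‖ := by
    refine (abs_real_inner_le_norm _ _).trans ?_
    rw [norm_smul, norm_gA (gfun_rpow hq), Real.norm_eq_abs]
    gcongr
  have p3 : gR q ε T (‖f‖ ^ 2) * ‖f‖ ^ 2 ≤ 2 ^ q * (1 + (‖f‖ ^ 2) ^ q * ‖f‖ ^ 2) := by
    refine le_trans ?_ (one_add_rpow_le hq (sq_nonneg ‖f‖))
    gcongr
    refine (gR_le' hq hε hT0 (sq_nonneg _)).trans ?_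
    exact Real.rpow_le_rpow (by positivity) (by linarith) hq.le
  rw [inner_add_left]
  refine (abs_add_le _ _).trans ?_
  have h4q : (0:ℝ) < 4 ^ q := by positivity
  have a5 : 0 ≤ (‖f‖ ^ 2) ^ q * ‖f‖ ^ 2 := by positivity
  generalize ⟪gA (gR q ε T) H - gA (gR q ε T) f, H - f⟫ = MM at *
  generalize (‖f‖ ^ 2) ^ q * ‖f‖ ^ 2 = Q at *
  generalize gR q ε T (‖H‖ ^ 2) * ‖H‖ ^ 2 = GH at *
  generalize gR q ε T (‖f‖ ^ 2) * ‖f‖ ^ 2 = Gf at *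
  have p4 : Q + GH ≤ 8 * MM + (1 + 4 * 4 ^ q * 2 ^ q) * (1 + Q) := by
    have := mul_le_mul_of_nonneg_left p3 (by positivity : (0:ℝ) ≤ 4 * 4 ^ q)
    have e : (4 * 4 ^ q * (2 ^ q * (1 + Q)) : ℝ) = 4 * 4 ^ q * 2 ^ q * (1 + Q) := by ring
    rw [add_mul]
    linarith
  have p5 := mul_le_mul_of_nonneg_left p4 (by positivity : 0 ≤ τ * 2 ^ (3 * q + 3))
  have e : τ * 2 ^ (3 * q + 3) * (8 * MM + (1 + 4 * 4 ^ q * 2 ^ q) * (1 + Q)) = 8 * (τ * 2 ^ (3 * q + 3)) * MM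
    + τ * (2 ^ (3 * q + 3) * (1 + 4 * 4 ^ q * 2 ^ q)) * (1 + Q) := by ring
  rw [add_mul]
  linarith

/-- Young-type continuity inequalities -/
theorem young_tau {a M d t : ℝ} (ha : 0 < a) (hM : 0 ≤ M) (hd : 0 ≤ d) (ht : 0 < t) (ht1 : t ≤ 1) {P : ℝ} (hP : a ≤ P) :
    M ^ (P - a) * d ^ a ≤ t ^ a * M ^ P + (1 / t) ^ P * d ^ P := by
  rcases hM.eq_or_lt with h0 | h0
  · subst h0
    have h1 : (0:ℝ) ^ (P - a) * d ^ a ≤ (1 / t) ^ P * d ^ P := by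
      rcases hP.eq_or_lt with h | h
      · subst h; simp
        have : 1 ≤ (t⁻¹) ^ a := Real.one_le_rpow (by rw [one_le_inv₀ ht]; exact ht1) ha.le
        exact le_mul_of_one_le_left (by positivity) this
      · rw [Real.zero_rpow (by linarith)]; simp; positivity
    have : 0 ≤ t ^ a * (0:ℝ) ^ P := by positivity
    linarith
  have e : M ^ P = M ^ (P - a) * M ^ a := by rw [← Real.rpow_add h0]; ring_nf
  by_cases h : d ≤ t * M
  · have h1 : d ^ a ≤ t ^ a * M ^ a := by
      rw [← Real.mul_rpow ht.le hM]; exact Real.rpow_le_rpow hd h ha.le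
    have h2 : M ^ (P - a) * d ^ a ≤ M ^ (P - a) * (t ^ a * M ^ a) := by gcongr
    have : 0 ≤ (1 / t) ^ P * d ^ P := by positivity
    rw [e]; nlinarith
  · push Not at h
    have hd0 : 0 < d := lt_of_le_of_lt (by positivity) h
    have h1 : M ≤ 1 / t * d := by rw [one_div, inv_mul_eq_div, le_div_iff₀ ht]; linarith
    have h2 : M ^ (P - a) ≤ (1 / t) ^ (P - a) * d ^ (P - a) := by
      rw [← Real.mul_rpow (by positivity) hd]; exact Real.rpow_le_rpow hM h1 (by linarith)
    have h3 : (1 / t) ^ (P - a) ≤ (1 / t) ^ P :=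
      Real.rpow_le_rpow_of_exponent_le (by rw [le_div_iff₀ ht]; linarith) (by linarith)
    have h4 : d ^ P = d ^ (P - a) * d ^ a := by rw [← Real.rpow_add hd0]; ring_nf
    have h5 : 0 ≤ t ^ a * M ^ P := by positivity
    calc M ^ (P - a) * d ^ a ≤ ((1 / t) ^ P * d ^ (P - a)) * d ^ a := by gcongr; exact h2.trans (by gcongr)
      _ = (1 / t) ^ P * d ^ P := by rw [h4]; ring
      _ ≤ _ := by linarith

theorem max_rpow_le {P : ℝ} {a b : W} : (max ‖a‖ ‖b‖) ^ P ≤ ‖a‖ ^ P + ‖b‖ ^ P := by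
  rcases max_choice ‖a‖ ‖b‖ with h' | h' <;> rw [h']
  · linarith [Real.rpow_nonneg (norm_nonneg b) P]
  · linarith [Real.rpow_nonneg (norm_nonneg a) P]

theorem V_young {q t : ℝ} (hq : 0 < q) (ht : 0 < t) (ht1 : t ≤ 1) (a b : W) :
    ‖gV (fun s => s ^ q) b - gV (fun s => s ^ q) a‖ ^ 2 ≤
      (2 + q) ^ 2 * (t ^ (2:ℝ) * (‖a‖ ^ (2 * q + 2) + ‖b‖ ^ (2 * q + 2)) + (1 / t) ^ (2 * q + 2) * ‖b - a‖ ^ (2 * q + 2)) := by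
  wlog hab : ‖a‖ ≤ ‖b‖ with H
  · rw [norm_sub_rev, norm_sub_rev b a, add_comm (‖a‖ ^ _)]; exact H hq ht ht1 b a (le_of_not_ge hab)
  have h1 := (gfun_rpow hq).V_lip' a b hab
  have h2 : ‖gV (fun s => s ^ q) b - gV (fun s => s ^ q) a‖ ^ 2 ≤ (2 + q) ^ 2 * (‖b‖ ^ (2 * q + 2 - 2) * ‖b - a‖ ^ (2:ℝ)) := by
    calc _ ≤ ((2 + q) * (√((‖b‖ ^ 2) ^ q) * ‖b - a‖)) ^ 2 := by gcongr
      _ = _ := by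
        rw [mul_pow, mul_pow, Real.sq_sqrt (by positivity), ← Real.rpow_natCast ‖b‖ 2, ← Real.rpow_mul (norm_nonneg _)]
        norm_num
  refine h2.trans ?_
  gcongr
  refine (young_tau (by norm_num) (norm_nonneg _) (norm_nonneg _) ht ht1 (by linarith)).trans ?_
  gcongr
  linarith [Real.rpow_nonneg (norm_nonneg a) (2 * q + 2)]

theorem A_young {q t : ℝ} (hq : 0 < q) (ht : 0 < t) (ht1 : t ≤ 1) (a b : W) :
    ‖gA (fun s => s ^ q) b - gA (fun s => s ^ q) a‖ ^ ((2 * q + 2) / (2 * q + 1)) ≤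
      (2 + 2 * q) ^ ((2 * q + 2) / (2 * q + 1)) * (t ^ ((2 * q + 2) / (2 * q + 1)) * (‖a‖ ^ (2 * q + 2) + ‖b‖ ^ (2 * q + 2)) +
        (1 / t) ^ (2 * q + 2) * ‖b - a‖ ^ (2 * q + 2)) := by
  wlog hab : ‖a‖ ≤ ‖b‖ with H
  · rw [norm_sub_rev, norm_sub_rev b a, add_comm (‖a‖ ^ _)]; exact H hq ht ht1 b a (le_of_not_ge hab)
  have h1 := (gfun_rpow hq).A_lip' a b hab
  set r := (2 * q + 2) / (2 * q + 1) with hr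
  have hr0 : 0 < r := by positivity
  have hr1 : r ≤ 2 * q + 2 := by rw [hr, div_le_iff₀ (by linarith)]; nlinarith
  have h2 : ‖gA (fun s => s ^ q) b - gA (fun s => s ^ q) a‖ ^ r ≤ (2 + 2 * q) ^ r * (‖b‖ ^ (2 * q + 2 - r) * ‖b - a‖ ^ r) := by
    calc _ ≤ ((2 + 2 * q) * ((‖b‖ ^ 2) ^ q * ‖b - a‖)) ^ r := by gcongr
      _ = _ := by
        rw [Real.mul_rpow (by linarith) (by positivity), Real.mul_rpow (by positivity) (by positivity),
          ← Real.rpow_natCast ‖b‖ 2, ← Real.rpow_mul (norm_nonneg _), ← Real.rpow_mul (norm_nonneg _)]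
        congr 3
        rw [hr]; field_simp; push_cast; ring
  refine h2.trans ?_
  gcongr
  refine (young_tau hr0 (norm_nonneg _) (norm_nonneg _) ht ht1 hr1).trans ?_
  gcongr
  linarith [Real.rpow_nonneg (norm_nonneg a) (2 * q + 2)]

end pwise
end DP

namespace DP
set_option linter.unusedSectionVars false
set_option linter.unusedVariables false
open Set
open scoped RealInnerProductSpace Topology

section cmp
variable {n : ℕ} {W0 W1 : Type*} [NormedAddCommGroup W0] [InnerProductSpace ℝ W0]
    [NormedAddCommGroup W1] [InnerProductSpace ℝ W1] [FiniteDimensional ℝ W0] [FiniteDimensional ℝ W1]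
    [CompleteSpace W0] [CompleteSpace W1] (S : Sys n W0 W1)

theorem mol_coclosed {O : Set (En n)} {u : En n → W1} (hu : LocallyIntegrable u volume)
    (hw : ∀ φ, TF O φ → ∫ x, ⟪u x, S.d φ x⟫ = 0)
    {ρ : En n → ℝ} {σ : ℝ} (hρ : IsMol ρ σ) {x : En n} (hx : closedBall x σ ⊆ O) :
    ∑ s, S.es s (pd s (mol ρ u) x) = 0 := by
  apply ext_inner_right ℝ
  intro v
  rw [inner_zero_left]
  set ψ : En n → W0 := fun y => ρ (x - y) • v with hψ
  have hρ1 : Differentiable ℝ ρ := hρ.smooth.differentiable (by simp)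
  have hs : tsupport ψ ⊆ closedBall x σ := by
    apply closure_minimal _ isClosed_closedBall
    intro y hy
    have : ρ (x - y) ≠ 0 := fun h0 => hy (by simp [hψ, h0])
    rw [mem_closedBall, dist_comm, dist_eq_norm]
    exact hρ.supp _ this
  have hT : TF O ψ := by
    refine ⟨?_, ?_, hs.trans hx⟩
    · exact (hρ.smooth.comp (contDiff_const.sub contDiff_id)).smul contDiff_const
    · exact (isCompact_closedBall x σ).of_isClosed_subset (isClosed_tsupport _) hs
  have e1 : ∀ s y, pd s ψ y = -(fderiv ℝ ρ (x - y) (basisVec s) • v) := by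
    intro s y
    have h1 : HasFDerivAt (fun y => ρ (x - y)) ((fderiv ℝ ρ (x - y)).comp (-ContinuousLinearMap.id ℝ (En n))) y :=
      (hρ1 (x - y)).hasFDerivAt.comp y ((hasFDerivAt_id y).const_sub x)
    have h2 := (h1.smul_const v).fderiv
    unfold pd
    rw [hψ, h2]
    simp
  have hint : ∀ s, Integrable (fun y => ⟪S.es s ((fderiv ℝ ρ (x - y) (basisVec s)) • u y), v⟫) ∧
      ⟪S.es s (pd s (DP.mol ρ u) x), v⟫ = ∫ y, ⟪S.es s ((fderiv ℝ ρ (x - y) (basisVec s)) • u y), v⟫ := by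
    intro s
    have hi : Integrable (fun y => (fderiv ℝ ρ (x - y) (basisVec s)) • u y) := by
      have hcs : HasCompactSupport (fun y => fderiv ℝ ρ (x - y) (basisVec s)) := by
        refine HasCompactSupport.of_support_subset_isCompact (isCompact_closedBall x σ) ?_
        intro y hy
        by_contra hyc
        have : ‖x - y‖ > σ := by
          rw [mem_closedBall, dist_comm, dist_eq_norm] at hyc; linarith
        have h0 : x - y ∉ tsupport ρ := by
          intro h1
          have : tsupport ρ ⊆ closedBall 0 σ := closure_minimal (fun z hz => by simpa using hρ.supp z hz) isClosed_closedBall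
          have := this h1
          simp at this; linarith
        have := fun h1 => h0 (tsupport_fderiv_subset ℝ (f := ρ) h1)
        have h2 : fderiv ℝ ρ (x - y) = 0 := by
          by_contra h3
          exact this (subset_tsupport _ h3)
        exact hy (by simp [h2])
      refine hu.integrable_smul_left_of_hasCompactSupport ?_ hcs
      exact (pd_cont (hρ.smooth.of_le (by exact_mod_cast le_top)) s).comp
          (continuous_const.sub continuous_id : Continuous fun y : En n => x - y)
    have h3 : ∀ u, ⟪S.es s u, v⟫ = ((innerSL ℝ v).comp (S.es s)) u := fun u => by
      simp [real_inner_comm]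
    simp_rw [h3]
    unfold pd
    rw [mol_fderiv hρ.smooth hρ.compact hu, ContinuousLinearMap.integral_comp_comm _ hi]
    exact ⟨ContinuousLinearMap.integrable_comp _ hi, rfl⟩
  have h0 := hw ψ hT
  rw [sum_inner]
  calc ∑ s, ⟪S.es s (pd s (DP.mol ρ u) x), v⟫ = ∑ s, ∫ y, ⟪S.es s ((fderiv ℝ ρ (x - y) (basisVec s)) • u y), v⟫ :=
        Finset.sum_congr rfl fun s _ => (hint s).2
    _ = ∫ y, ∑ s, ⟪S.es s ((fderiv ℝ ρ (x - y) (basisVec s)) • u y), v⟫ := (integral_finsetSum _ fun s _ => (hint s).1).symm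
    _ = ∫ y, -⟪u y, S.d ψ y⟫ := by
      congr 1; ext y
      rw [Sys.d, inner_sum, ← Finset.sum_neg_distrib]
      refine Finset.sum_congr rfl fun s _ => ?_
      rw [e1, S.adj']
      simp [inner_smul_left, inner_smul_right]
    _ = 0 := by rw [integral_neg, h0, neg_zero]

theorem coclosed_orth {B : Set (En n)} (hB : MeasurableSet B) {U : En n → W1} (hU : ContDiff ℝ 1 U)
    (h : ∀ x ∈ B, ∑ s, S.es s (pd s U x) = 0) (hL : MemLp (B.indicator U) 2 volume) {X : En n → W1} (hX : InX S B X) :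
    ∫ x, ⟪B.indicator U x, X x⟫ = 0 := by
  apply hX.orth S hL
  intro φ hφ
  have h1 : ContDiff ℝ 1 φ := hφ.1.of_le (by exact_mod_cast le_top)
  have hz : ∀ x, x ∉ B → ∀ s, pd s φ x = 0 := fun x hx s => by
    by_contra h0
    exact hx (hφ.2.2 (pd_tsupport _ s (subset_tsupport _ h0)))
  have e0 : ∀ x, ⟪B.indicator U x, S.d φ x⟫ = ∑ s, ⟪S.es s (U x), pd s φ x⟫ := by
    intro x
    by_cases hx : x ∈ B
    · rw [indicator_of_mem hx, Sys.d, inner_sum]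
      exact Finset.sum_congr rfl fun s _ => S.adj' _ _ _
    · rw [indicator_of_notMem hx, inner_zero_left]
      exact (Finset.sum_eq_zero fun s _ => by rw [hz x hx s, inner_zero_right]).symm
  have hUc : ∀ s, ContDiff ℝ 1 (fun x => S.es s (U x)) := fun s => (S.es s).contDiff.comp hU
  simp_rw [e0]
  rw [integral_finsetSum _ fun s _ => ?_]
  · rw [Finset.sum_congr rfl fun s _ => ibp (hUc s) h1 hφ.2.1 s, Finset.sum_neg_distrib, neg_eq_zero,
      ← integral_finsetSum _ fun s _ => ?_]
    · rw [← integral_zero (α := En n) (μ := volume) (G := ℝ)]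
      congr 1; ext x
      rw [← sum_inner]
      by_cases hx : x ∈ B
      · have := h x hx
        rw [Finset.sum_congr rfl fun s _ => pd_clm (hU.differentiable (by simp) x) (S.es s) s, this, inner_zero_left]
      · have : φ x = 0 := by
          by_contra h0
          exact hx (hφ.2.2 (subset_tsupport _ h0))
        rw [this, inner_zero_right]
    · apply Continuous.integrable_of_hasCompactSupport
      · exact (pd_cont (hUc s) s).inner h1.continuous
      · exact hφ.2.1.mono fun x hx h0 => hx (by simp [h0])
  · apply Continuous.integrable_of_hasCompactSupport
    · exact (hUc s).continuous.inner (pd_cont h1 s)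
    · exact (pd_compact hφ.2.1 s).mono fun x hx h0 => hx (by simp [h0])

end cmp
end DP

namespace DP
set_option linter.unusedSectionVars false
set_option linter.unusedVariables false
open Set
open scoped RealInnerProductSpace Topology

section cmp1
variable {n : ℕ} {W0 W1 : Type*} [NormedAddCommGroup W0] [InnerProductSpace ℝ W0]
    [NormedAddCommGroup W1] [InnerProductSpace ℝ W1] [FiniteDimensional ℝ W0] [FiniteDimensional ℝ W1]
    [CompleteSpace W0] [CompleteSpace W1] (S : Sys n W0 W1)

theorem GFun.gA_cont {q : ℝ} {g : ℝ → ℝ} (h : GFun q g) : Continuous (gA g : W1 → W1) := by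
  unfold gA
  exact (h.cont.comp_continuous (continuous_norm.pow 2) fun z => mem_Ici.2 (sq_nonneg _)).smul continuous_id

theorem GFun.gV_cont {q : ℝ} {g : ℝ → ℝ} (h : GFun q g) : Continuous (gV g : W1 → W1) := by
  unfold gV
  exact (h.cont.comp_continuous (continuous_norm.pow 2) fun z => mem_Ici.2 (sq_nonneg _)).sqrt.smul continuous_id

theorem intOn_bdd {W : Type*} [NormedAddCommGroup W] {B : Set (En n)} (hB : MeasurableSet B) (hfin : volume B < ∞)
    {f : En n → W} (hf : AEStronglyMeasurable f volume) {C : ℝ} (hC : ∀ x ∈ B, ‖f x‖ ≤ C) : IntegrableOn f B := by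
  refine Measure.integrableOn_of_bounded (M := C) hfin.ne hf ?_
  filter_upwards [ae_restrict_mem hB] with x hx using hC x hx

theorem memLp_ind_bdd {W : Type*} [NormedAddCommGroup W] {B : Set (En n)} (hB : MeasurableSet B) (hfin : volume B < ∞)
    {f : En n → W} (hf : AEStronglyMeasurable f volume) {C : ℝ} (hC : ∀ x ∈ B, ‖f x‖ ≤ C) (s : ℝ≥0∞) :
    MemLp (B.indicator f) s volume := by
  rw [memLp_indicator_iff_restrict hB]
  have : IsFiniteMeasure (volume.restrict B) := ⟨by simpa using hfin⟩
  refine MemLp.of_bound hf.restrict C ?_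
  filter_upwards [ae_restrict_mem hB] with x hx using hC x hx

theorem gA_tend {q : ℝ} (hq : 0 < q) {ε T : ℕ → ℝ} (hε : Tendsto ε atTop (𝓝 0))
    (hT : Tendsto T atTop atTop) (z : W1) : Tendsto (fun j => gA (gR q (ε j) (T j)) z) atTop (𝓝 (gA (fun s => s ^ q) z)) :=
  (gR_tendsto hq (sq_nonneg ‖z‖) hε hT).smul_const z

theorem gV_tend {q : ℝ} (hq : 0 < q) {ε T : ℕ → ℝ} (hε : Tendsto ε atTop (𝓝 0))
    (hT : Tendsto T atTop atTop) (z : W1) : Tendsto (fun j => gV (gR q (ε j) (T j)) z) atTop (𝓝 (gV (fun s => s ^ q) z)) :=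
  ((Real.continuous_sqrt.tendsto _).comp (gR_tendsto hq (sq_nonneg ‖z‖) hε hT)).smul_const z

theorem gR_bd {q ε T K : ℝ} (hq : 0 < q) (hε : 0 < ε) (hε1 : ε ≤ 1) (hT : 0 < T) (z : W1) (hz : ‖z‖ ≤ K) :
    gR q ε T (‖z‖ ^ 2) ≤ (1 + K ^ 2) ^ q :=
  (gR_le' hq hε hT (sq_nonneg _)).trans (Real.rpow_le_rpow (by positivity) (by nlinarith [norm_nonneg z]) hq.le)

/-- vanishing of the regularisation error for bounded fields -/
theorem reg_err {q : ℝ} (hq : 0 < q) {B : Set (En n)} (hB : MeasurableSet B) (hfin : volume B < ∞)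
    {G : En n → W1} (hG : Continuous G) {K : ℝ} (hK : ∀ x ∈ B, ‖G x‖ ≤ K) {ε T : ℕ → ℝ}
    (hε : Tendsto ε atTop (𝓝 0)) (hT : Tendsto T atTop atTop) (hε0 : ∀ j, 0 < ε j) (hε1 : ∀ j, ε j ≤ 1)
    (hT0 : ∀ j, 0 < T j) {m : ℝ} (hm : 0 < m) :
    Tendsto (fun j => ∫ x in B, ‖gA (gR q (ε j) (T j)) (G x) - gA (fun s => s ^ q) (G x)‖ ^ m) atTop (𝓝 0) ∧
    Tendsto (fun j => ∫ x in B, ‖gV (gR q (ε j) (T j)) (G x) - gV (fun s => s ^ q) (G x)‖ ^ 2) atTop (𝓝 0) := by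
  have : IsFiniteMeasure (volume.restrict B) := ⟨by simpa using hfin⟩
  have hp : ∀ x ∈ B, (‖G x‖ ^ 2) ^ q ≤ (1 + K ^ 2) ^ q := fun x hx =>
    Real.rpow_le_rpow (by positivity) (by nlinarith [norm_nonneg (G x), hK x hx]) hq.le
  have hgc := fun j => gfun_gR hq (hε0 j) (hT0 j)
  have hgp := gfun_rpow hq
  constructor
  · rw [show (0:ℝ) = ∫ x in B, (0:ℝ) by simp]
    apply tendsto_integral_of_dominated_convergence (fun _ => (2 * ((1 + K ^ 2) ^ q * K)) ^ m)
    · intro j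
      exact ((((hgc j).gA_cont.comp hG).sub (hgp.gA_cont.comp hG)).norm.rpow_const fun _ => Or.inr hm.le).aestronglyMeasurable
    · exact integrable_const _
    · intro j
      filter_upwards [ae_restrict_mem hB] with x hx
      rw [Real.norm_of_nonneg (by positivity)]
      apply Real.rpow_le_rpow (norm_nonneg _) _ hm.le
      refine (norm_sub_le _ _).trans ?_
      rw [norm_gA (hgc j), norm_gA hgp]
      have h1 := gR_bd hq (hε0 j) (hε1 j) (hT0 j) (G x) (hK x hx)
      have h2 := hp x hx
      have h3 : gR q (ε j) (T j) (‖G x‖ ^ 2) * ‖G x‖ ≤ (1 + K ^ 2) ^ q * K := by gcongr; exact hK x hx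
      have h4 : (‖G x‖ ^ 2) ^ q * ‖G x‖ ≤ (1 + K ^ 2) ^ q * K := by gcongr; exact hK x hx
      linarith
    · filter_upwards with x
      have := ((gA_tend hq hε hT (G x)).sub_const (gA (fun s => s ^ q) (G x))).norm.rpow_const (p := m) (Or.inr hm.le)
      simpa [Real.zero_rpow hm.ne'] using this
  · rw [show (0:ℝ) = ∫ x in B, (0:ℝ) by simp]
    apply tendsto_integral_of_dominated_convergence (fun _ => 4 * ((1 + K ^ 2) ^ q * K ^ 2))
    · intro j
      exact ((((hgc j).gV_cont.comp hG).sub (hgp.gV_cont.comp hG)).norm.pow 2).aestronglyMeasurable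
    · exact integrable_const _
    · intro j
      filter_upwards [ae_restrict_mem hB] with x hx
      rw [Real.norm_of_nonneg (by positivity)]
      have h0 := norm_sub_le (gV (gR q (ε j) (T j)) (G x)) (gV (fun s => s ^ q) (G x))
      have e1 := norm_gV_sq (hgc j) (G x)
      have e2 := norm_gV_sq hgp (G x)
      have h1 := gR_bd hq (hε0 j) (hε1 j) (hT0 j) (G x) (hK x hx)
      have h2 := hp x hx
      have h3 : gR q (ε j) (T j) (‖G x‖ ^ 2) * ‖G x‖ ^ 2 ≤ (1 + K ^ 2) ^ q * K ^ 2 := by gcongr; exact hK x hx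
      have h4 : (‖G x‖ ^ 2) ^ q * ‖G x‖ ^ 2 ≤ (1 + K ^ 2) ^ q * K ^ 2 := by gcongr; exact hK x hx
      rw [← e1] at h3
      simp only [← e2] at h4
      have h5 : ‖gV (gR q (ε j) (T j)) (G x) - gV (fun s => s ^ q) (G x)‖ ^ 2 ≤
        2 * ‖gV (gR q (ε j) (T j)) (G x)‖ ^ 2 + 2 * ‖gV (fun s => s ^ q) (G x)‖ ^ 2 := by
        nlinarith [norm_nonneg (gV (gR q (ε j) (T j)) (G x) - gV (fun s => s ^ q) (G x)),
          sq_nonneg (‖gV (gR q (ε j) (T j)) (G x)‖ - ‖gV (fun s => s ^ q) (G x)‖)]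
      linarith
    · filter_upwards with x
      have := ((gV_tend hq hε hT (G x)).sub_const (gV (fun s => s ^ q) (G x))).norm.pow 2
      simpa using this

theorem rpow_add_le2 {m : ℝ} (hm : 0 < m) {a b c : ℝ} (hc : 0 ≤ c) (ha : 0 ≤ a) (hb : 0 ≤ b) (h : c ≤ a + b) :
    c ^ m ≤ 2 ^ m * (a ^ m + b ^ m) := by
  have h1 : c ^ m ≤ (2 * max a b) ^ m :=
    Real.rpow_le_rpow hc (by linarith [le_max_left a b, le_max_right a b]) hm.le
  rw [Real.mul_rpow (by norm_num) (le_max_of_le_left ha)] at h1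
  refine h1.trans ?_
  gcongr
  rcases max_choice a b with h' | h' <;> rw [h']
  · linarith [Real.rpow_nonneg hb m]
  · linarith [Real.rpow_nonneg ha m]

end cmp1
end DP

namespace DP
set_option linter.unusedSectionVars false
set_option linter.unusedVariables false
open Set
open scoped RealInnerProductSpace Topology

section cmp1
variable {n : ℕ} {W0 W1 : Type*} [NormedAddCommGroup W0] [InnerProductSpace ℝ W0]
    [NormedAddCommGroup W1] [InnerProductSpace ℝ W1] [FiniteDimensional ℝ W0] [FiniteDimensional ℝ W1]
    [CompleteSpace W0] [CompleteSpace W1] (S : Sys n W0 W1)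

theorem int4 {X : Type*} [MeasurableSpace X] {μ : Measure X} {f1 f2 f3 f4 : X → ℝ} {c1 c2 c3 c4 : ℝ}
    (h1 : Integrable f1 μ) (h2 : Integrable f2 μ) (h3 : Integrable f3 μ) (h4 : Integrable f4 μ) :
    ∫ x, (c1 * f1 x + c2 * f2 x + c3 * f3 x + c4 * f4 x) ∂μ =
      c1 * (∫ x, f1 x ∂μ) + c2 * (∫ x, f2 x ∂μ) + c3 * (∫ x, f3 x ∂μ) + c4 * ∫ x, f4 x ∂μ := by
  have i1 := h1.const_mul c1
  have i2 := h2.const_mul c2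
  have i3 := h3.const_mul c3
  have i4 := h4.const_mul c4
  have i12 : Integrable (fun x => c1 * f1 x + c2 * f2 x) μ := i1.add i2
  have i123 : Integrable (fun x => c1 * f1 x + c2 * f2 x + c3 * f3 x) μ := i12.add i3
  rw [integral_add i123 i4, integral_add i12 i3, integral_add i1 i2]
  simp only [integral_const_mul]

theorem energy_step {q κ τ ε T K M : ℝ} (hq : 0 < q) (hτ : 0 < τ) (hτ' : 8 * (τ * 2 ^ (3 * q + 3)) ≤ 1 / 4)
    {B : Set (En n)} (hB : MeasurableSet B) (hfin : volume B < ∞) {G U : En n → W1}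
    (hG : Continuous G) (hU : Continuous U)
    (hUL : MemLp (B.indicator U) 2 volume) (hUo : ∀ X, InX S B X → ∫ x, ⟪B.indicator U x, X x⟫ = 0)
    {b : En n → ℝ} (hb : AEStronglyMeasurable b volume)
    (hbk : ∀ x ∈ B, |1 - b x| ≤ κ) (hε : 0 < ε) (hε1 : ε ≤ 1) (hT : 2 ≤ T) (hK : ∀ x ∈ B, ‖G x‖ ≤ K)
    (hKT : K ^ 2 ≤ T)
    (hM : ∀ x ∈ B, ‖(gA (gR q ε T) (G x) - gA (fun s => s ^ q) (G x)) + (b x • gA (fun s => s ^ q) (G x) - U x)‖ ≤ M)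
    (hMT : (2 * M / τ) ^ 2 ≤ T) :
    ∃ H : En n → W1, MemLp H 2 volume ∧ InX S B (fun x => H x - B.indicator G x) ∧
      (∀ X, InX S B X → ∫ x, ⟪gA (gR q ε T) (H x), X x⟫ = 0) ∧
      ∫ x in B, ⟪gA (gR q ε T) (H x) - gA (gR q ε T) (G x), H x - G x⟫ ≤
        4 * (2 ^ q * κ ^ 2 * (∫ x in B, ‖G x‖ ^ (2 * q + 2))
          + (1 / τ) ^ (1 / (2 * q + 1)) * (∫ x in B, ‖(gA (gR q ε T) (G x) - gA (fun s => s ^ q) (G x)) +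
              (b x • gA (fun s => s ^ q) (G x) - U x)‖ ^ ((2 * q + 2) / (2 * q + 1)))
          + τ * (2 ^ (3 * q + 3) * (1 + 4 * 4 ^ q * 2 ^ q)) * (∫ x in B, (1 + ‖G x‖ ^ (2 * q + 2)))) ∧
      IntegrableOn (fun x => ⟪gA (gR q ε T) (H x) - gA (gR q ε T) (G x), H x - G x⟫) B := by
  have hT0 : 0 < T := by linarith
  have hg := gfun_gR hq hε hT0
  have hgp := gfun_rpow hq
  have : IsFiniteMeasure (volume.restrict B) := ⟨by simpa using hfin⟩
  have hfL : MemLp (B.indicator G) 2 volume := memLp_ind_bdd hB hfin hG.aestronglyMeasurable hK 2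
  obtain ⟨H, hH, hX, hHo⟩ := exists_H S hg (fun s hs => gR_le hq hε hT0 hs) (Real.rpow_pos_of_pos hε q)
    (fun s hs => gR_ge hq hε hT0 hs) B hfL
  refine ⟨H, hH, hX, hHo, ?_⟩
  set g := gR q ε T with hgdef
  have hX0 := hX.ae_zero S
  set D : En n → W1 := fun x => (gA g (G x) - gA (fun s => s ^ q) (G x)) + (b x • gA (fun s => s ^ q) (G x) - U x) with hD
  have hDm : AEStronglyMeasurable D volume :=
    ((hg.gA_cont.comp hG).aestronglyMeasurable.sub (hgp.gA_cont.comp hG).aestronglyMeasurable).add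
      ((hb.smul (hgp.gA_cont.comp hG).aestronglyMeasurable).sub hU.aestronglyMeasurable)
  have hAH : MemLp (fun x => gA g (H x)) 2 volume := hg.gA_memLp (fun s hs => gR_le hq hε hT0 hs) hH
  have hAf : MemLp (fun x => gA g (B.indicator G x)) 2 volume := hg.gA_memLp (fun s hs => gR_le hq hε hT0 hs) hfL
  -- the energy identity
  have i1 := inner_intble hAH hX.1
  have i2 := inner_intble hAf hX.1
  have i3 := inner_intble hUL hX.1
  have hE : ∫ x, ⟪gA g (H x) - gA g (B.indicator G x), H x - B.indicator G x⟫
      = - ∫ x, ⟪gA g (B.indicator G x) - B.indicator U x, H x - B.indicator G x⟫ := by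
    simp_rw [inner_sub_left]
    rw [integral_sub i1 i2, integral_sub i2 i3, hHo _ hX, hUo _ hX]; ring
  have iE : Integrable (fun x => ⟪gA g (H x) - gA g (B.indicator G x), H x - B.indicator G x⟫) :=
    inner_intble (hAH.sub hAf) hX.1
  have iR : Integrable (fun x => ⟪gA g (B.indicator G x) - B.indicator U x, H x - B.indicator G x⟫) :=
    inner_intble (hAf.sub hUL) hX.1
  have r1 : ∫ x, ⟪gA g (H x) - gA g (B.indicator G x), H x - B.indicator G x⟫ =
      ∫ x in B, ⟪gA g (H x) - gA g (G x), H x - G x⟫ := by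
    rw [← setIntegral_eq_integral_of_ae_compl_eq_zero (s := B)]
    · apply setIntegral_congr_fun hB
      intro x hx
      simp only [indicator_of_mem hx]
    · filter_upwards [hX0] with x hx hxB
      rw [hx hxB, inner_zero_right]
  have r2 : ∫ x, ⟪gA g (B.indicator G x) - B.indicator U x, H x - B.indicator G x⟫ =
      ∫ x in B, ⟪(1 - b x) • gA (fun s => s ^ q) (G x) + D x, H x - G x⟫ := by
    rw [← setIntegral_eq_integral_of_ae_compl_eq_zero (s := B)]
    · apply setIntegral_congr_fun hB
      intro x hx
      simp only [indicator_of_mem hx, hD]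
      congr 1; module
    · filter_upwards [hX0] with x hx hxB
      rw [hx hxB, inner_zero_right]
  have iE' : IntegrableOn (fun x => ⟪gA g (H x) - gA g (G x), H x - G x⟫) B :=
    iE.integrableOn.congr_fun (fun x hx => by simp only [indicator_of_mem hx]) hB
  have iR' : IntegrableOn (fun x => ⟪(1 - b x) • gA (fun s => s ^ q) (G x) + D x, H x - G x⟫) B :=
    iR.integrableOn.congr_fun (fun x hx => by
      simp only [indicator_of_mem hx, hD]
      congr 1; module) hB
  refine ⟨?_, iE'⟩
  have iP : IntegrableOn (fun x => ‖G x‖ ^ (2 * q + 2)) B := by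
    refine intOn_bdd hB hfin (C := K ^ (2 * q + 2)) (hG.norm.rpow_const fun _ => Or.inr (by linarith)).aestronglyMeasurable ?_
    intro x hx
    rw [Real.norm_of_nonneg (by positivity)]
    exact Real.rpow_le_rpow (norm_nonneg _) (hK x hx) (by linarith)
  have iD : IntegrableOn (fun x => ‖D x‖ ^ ((2 * q + 2) / (2 * q + 1))) B := by
    refine intOn_bdd hB hfin (C := M ^ ((2 * q + 2) / (2 * q + 1))) ?_ ?_
    · exact (hDm.norm.aemeasurable.pow_const _).aestronglyMeasurable
    intro x hx
    rw [Real.norm_of_nonneg (by positivity)]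
    exact Real.rpow_le_rpow (norm_nonneg _) (hM x hx) (by positivity)
  have i1P : IntegrableOn (fun x => (1 : ℝ) + ‖G x‖ ^ (2 * q + 2)) B := (integrable_const _).add iP
  have key : ∫ x in B, |⟪(1 - b x) • gA (fun s => s ^ q) (G x) + D x, H x - G x⟫| ≤
      ∫ x in B, (((3 / 4) * ⟪gA g (H x) - gA g (G x), H x - G x⟫
      + 2 ^ q * κ ^ 2 * (‖G x‖ ^ (2 * q + 2))
      + (1 / τ) ^ (1 / (2 * q + 1)) * ‖D x‖ ^ ((2 * q + 2) / (2 * q + 1)))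
      + τ * (2 ^ (3 * q + 3) * (1 + 4 * 4 ^ q * 2 ^ q)) * (1 + ‖G x‖ ^ (2 * q + 2))) := by
    refine setIntegral_mono_on iR'.abs ((((iE'.const_mul _).add (iP.const_mul _)).add (iD.const_mul _)).add (i1P.const_mul _)) hB ?_
    intro x hx
    have hfT : ‖G x‖ ^ 2 ≤ T := by
      have := hK x hx
      nlinarith [norm_nonneg (G x)]
    have h1 := pairing hq hε hε1 hT hτ (hbk x hx) (G x) (H x) (D x) hfT (hM x hx) hMT
    rw [pw_eq q hq] at h1
    have h2 : 0 ≤ ⟪gA g (H x) - gA g (G x), H x - G x⟫ := by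
      refine le_trans ?_ (hg.mono_A (G x) (H x))
      have := hg.gs_nonneg (G x)
      have := hg.gs_nonneg (H x)
      positivity
    have h3 := mul_le_mul_of_nonneg_right (by linarith : 1 / 2 + 8 * (τ * 2 ^ (3 * q + 3)) ≤ 3 / 4) h2
    linarith
  rw [int4 iE' iP iD i1P] at key
  rw [r1, r2] at hE
  have h5 : -(∫ x in B, ⟪(1 - b x) • gA (fun s => s ^ q) (G x) + D x, H x - G x⟫) ≤
      ∫ x in B, |⟪(1 - b x) • gA (fun s => s ^ q) (G x) + D x, H x - G x⟫| := by
    rw [← integral_neg]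
    exact integral_mono iR'.neg iR'.abs fun x => neg_le_abs _
  linarith

theorem cmp_step {q κ τ η : ℝ} (hq : 0 < q) (hτ : 0 < τ) (hτ' : 8 * (τ * 2 ^ (3 * q + 3)) ≤ 1 / 4) (hη : 0 < η)
    {B : Set (En n)} (hB : MeasurableSet B) (hbd : Bornology.IsBounded B) {G U : En n → W1}
    (hG : ContDiff ℝ 1 G) (hGc : ∀ x ∈ B, CC S G x) (hU : ContDiff ℝ 1 U)
    (hUc : ∀ x ∈ B, ∑ s, S.es s (pd s U x) = 0)
    {b : En n → ℝ} (hb : AEStronglyMeasurable b volume) (hκ : 0 ≤ κ) (hbk : ∀ x ∈ B, |1 - b x| ≤ κ) :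
    ∃ ε T : ℝ, 0 < ε ∧ 0 < T ∧ ∃ H : En n → W1, MemLp H 2 volume ∧ WC S B H ∧
      (∀ X, InX S B X → ∫ x, ⟪gA (gR q ε T) (H x), X x⟫ = 0) ∧
      IntegrableOn (fun x => ‖gV (gR q ε T) (H x) - gV (fun s => s ^ q) (G x)‖ ^ 2) B ∧
      ∫ x in B, ‖gV (gR q ε T) (H x) - gV (fun s => s ^ q) (G x)‖ ^ 2 ≤
        8 * CV q * (2 ^ q * κ ^ 2 * (∫ x in B, ‖G x‖ ^ (2 * q + 2))
          + (1 / τ) ^ (1 / (2 * q + 1)) * (2 ^ ((2 * q + 2) / (2 * q + 1)) *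
            ∫ x in B, ‖b x • gA (fun s => s ^ q) (G x) - U x‖ ^ ((2 * q + 2) / (2 * q + 1)))
          + τ * (2 ^ (3 * q + 3) * (1 + 4 * 4 ^ q * 2 ^ q)) * (∫ x in B, (1 + ‖G x‖ ^ (2 * q + 2)))) + η := by
  have hfin : volume B < ∞ := hbd.measure_lt_top
  have : IsFiniteMeasure (volume.restrict B) := ⟨by simpa using hfin⟩
  have hgp := gfun_rpow hq
  obtain ⟨K, hK0, hK⟩ : ∃ K, 0 ≤ K ∧ ∀ x ∈ B, ‖G x‖ ≤ K := by
    obtain ⟨C, hC⟩ := (hbd.isCompact_closure).exists_bound_of_continuousOn hG.continuous.continuousOn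
    exact ⟨max C 0, le_max_right _ _, fun x hx => (hC x (subset_closure hx)).trans (le_max_left _ _)⟩
  obtain ⟨KU, hKU⟩ : ∃ K, ∀ x ∈ B, ‖U x‖ ≤ K := by
    obtain ⟨C, hC⟩ := (hbd.isCompact_closure).exists_bound_of_continuousOn hU.continuous.continuousOn
    exact ⟨C, fun x hx => hC x (subset_closure hx)⟩
  set m := (2 * q + 2) / (2 * q + 1) with hm
  have hm0 : 0 < m := by positivity
  set ε : ℕ → ℝ := fun j => 1 / ((j:ℝ) + 1) with hεd
  set T : ℕ → ℝ := fun j => (j:ℝ) + 2 with hTd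
  have hε : Tendsto ε atTop (𝓝 0) := tendsto_one_div_add_atTop_nhds_zero_nat
  have hT : Tendsto T atTop atTop := tendsto_natCast_atTop_atTop.atTop_add tendsto_const_nhds
  have hε0 : ∀ j, 0 < ε j := fun j => by positivity
  have hε1 : ∀ j, ε j ≤ 1 := fun j => by
    simp only [hεd]; rw [div_le_iff₀ (by positivity)]; linarith [(Nat.cast_nonneg j : (0:ℝ) ≤ j)]
  have hT2 : ∀ j, 2 ≤ T j := fun j => by simp only [hTd]; linarith [(Nat.cast_nonneg j : (0:ℝ) ≤ j)]
  have hT0 : ∀ j, 0 < T j := fun j => by linarith [hT2 j]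
  obtain ⟨t1, t2⟩ := reg_err hq hB hfin hG.continuous hK hε hT hε0 hε1 hT0 hm0
  set cτ := (1 / τ) ^ (1 / (2 * q + 1)) with hcτ
  have hcτ0 : 0 ≤ cτ := by positivity
  have hCV := CV_pos hq
  set M := (1 + K ^ 2) ^ q * K + (K ^ 2) ^ q * K + ((1 + κ) * ((K ^ 2) ^ q * K) + KU) with hM
  have t1' : Tendsto (fun j => 8 * CV q * (cτ * (2 ^ m * ∫ x in B, ‖gA (gR q (ε j) (T j)) (G x) - gA (fun s => s ^ q) (G x)‖ ^ m)))
      atTop (𝓝 0) := by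
    simpa using ((t1.const_mul (2 ^ m)).const_mul cτ).const_mul (8 * CV q)
  obtain ⟨j, h1, h2, h3, h4⟩ := ((t1'.eventually_le_const (u := η / 2) (by linarith)).and
    ((t2.eventually_le_const (u := η / 4) (by linarith)).and ((hT.eventually_ge_atTop (K ^ 2)).and
      (hT.eventually_ge_atTop ((2 * M / τ) ^ 2))))).exists
  have hg := gfun_gR hq (hε0 j) (hT0 j)
  have hMb : ∀ x ∈ B, ‖(gA (gR q (ε j) (T j)) (G x) - gA (fun s => s ^ q) (G x)) +
      (b x • gA (fun s => s ^ q) (G x) - U x)‖ ≤ M := by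
    intro x hx
    have a1 : ‖gA (gR q (ε j) (T j)) (G x)‖ ≤ (1 + K ^ 2) ^ q * K := by
      rw [norm_gA hg]
      have := gR_bd hq (hε0 j) (hε1 j) (hT0 j) (G x) (hK x hx)
      have := hK x hx
      gcongr
    have a2 : ‖gA (fun s => s ^ q) (G x)‖ ≤ (K ^ 2) ^ q * K := by
      rw [norm_gA hgp]
      have := hK x hx
      gcongr
    have a3 : |b x| ≤ 1 + κ := by
      have := hbk x hx
      rw [abs_le] at this ⊢
      constructor <;> linarith
    have a4 : ‖b x • gA (fun s => s ^ q) (G x)‖ ≤ (1 + κ) * ((K ^ 2) ^ q * K) := by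
      rw [norm_smul, Real.norm_eq_abs]
      gcongr
    refine (norm_add_le _ _).trans ?_
    have := norm_sub_le (gA (gR q (ε j) (T j)) (G x)) (gA (fun s => s ^ q) (G x))
    have := norm_sub_le (b x • gA (fun s => s ^ q) (G x)) (U x)
    have := hKU x hx
    linarith
  have hUL : MemLp (B.indicator U) 2 volume := memLp_ind_bdd hB hfin hU.continuous.aestronglyMeasurable hKU 2
  obtain ⟨H, hH, hX, hHo, hE, hiE⟩ := energy_step S hq hτ hτ' hB hfin hG.continuous hU.continuous hUL
    (fun X hX => coclosed_orth S hB hU hUc hUL hX) hb hbk (hε0 j) (hε1 j) (hT2 j) hK h3 hMb h4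
  have hfL : MemLp (B.indicator G) 2 volume := memLp_ind_bdd hB hfin hG.continuous.aestronglyMeasurable hK 2
  refine ⟨ε j, T j, hε0 j, hT0 j, H, hH, ?_, hHo, ?_⟩
  · have w1 : WC S B G := WC_of_CC S hG hGc
    have w2 : WC S B (B.indicator G) := WC.congr S (Eventually.of_forall fun x hx => (indicator_of_mem hx G).symm) w1
    have w3 := WC.add S hfL hX.1 w2 (hX.WC S)
    refine WC.congr S (Eventually.of_forall fun x hx => ?_) w3
    simp
  set g := gR q (ε j) (T j) with hgd
  have iV : IntegrableOn (fun x => ‖gV g (G x) - gV (fun s => s ^ q) (G x)‖ ^ 2) B := by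
    refine ((((hg.gV_cont.comp hG.continuous).sub (hgp.gV_cont.comp hG.continuous)).norm.pow 2).continuousOn.integrableOn_compact
      hbd.isCompact_closure).mono_set subset_closure
  have iA : IntegrableOn (fun x => ‖gA g (G x) - gA (fun s => s ^ q) (G x)‖ ^ m) B := by
    refine ((((hg.gA_cont.comp hG.continuous).sub (hgp.gA_cont.comp hG.continuous)).norm.rpow_const
      fun _ => Or.inr hm0.le).continuousOn.integrableOn_compact hbd.isCompact_closure).mono_set subset_closure
  have hVm : AEStronglyMeasurable (fun x => ‖gV g (H x) - gV (fun s => s ^ q) (G x)‖ ^ 2) volume :=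
    ((hg.gV_cont.comp_aestronglyMeasurable hH.1).sub (hgp.gV_cont.comp hG.continuous).aestronglyMeasurable).norm.pow 2
  have hpt : ∀ x, ‖gV g (H x) - gV (fun s => s ^ q) (G x)‖ ^ 2 ≤
      2 * CV q * ⟪gA g (H x) - gA g (G x), H x - G x⟫ + 2 * ‖gV g (G x) - gV (fun s => s ^ q) (G x)‖ ^ 2 := by
    intro x
    have a1 := V_mono hg (G x) (H x)
    have a2 := norm_sub_le_norm_sub_add_norm_sub (gV g (H x)) (gV g (G x)) (gV (fun s => s ^ q) (G x))
    nlinarith [norm_nonneg (gV g (H x) - gV (fun s => s ^ q) (G x)),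
      sq_nonneg (‖gV g (H x) - gV g (G x)‖ - ‖gV g (G x) - gV (fun s => s ^ q) (G x)‖)]
  have iS := (hiE.const_mul (2 * CV q)).add (iV.const_mul 2)
  have iL : IntegrableOn (fun x => ‖gV g (H x) - gV (fun s => s ^ q) (G x)‖ ^ 2) B := by
    refine iS.mono' hVm.restrict ?_
    filter_upwards with x
    rw [Real.norm_of_nonneg (sq_nonneg _)]
    exact hpt x
  refine ⟨iL, ?_⟩
  have hI := integral_mono iL iS hpt
  simp only [Pi.add_apply] at hI
  rw [integral_add (hiE.const_mul (2 * CV q)) (iV.const_mul 2), integral_const_mul, integral_const_mul] at hI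
  have iU : IntegrableOn (fun x => ‖b x • gA (fun s => s ^ q) (G x) - U x‖ ^ m) B := by
    refine intOn_bdd hB hfin (C := ((1 + κ) * ((K ^ 2) ^ q * K) + KU) ^ m) ?_ ?_
    · exact (((hb.smul (hgp.gA_cont.comp hG.continuous).aestronglyMeasurable).sub
        hU.continuous.aestronglyMeasurable).norm.aemeasurable.pow_const _).aestronglyMeasurable
    intro x hx
    rw [Real.norm_of_nonneg (by positivity)]
    refine Real.rpow_le_rpow (norm_nonneg _) ?_ hm0.le
    refine (norm_sub_le _ _).trans (add_le_add ?_ (hKU x hx))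
    rw [norm_smul, Real.norm_eq_abs, norm_gA hgp]
    have a3 : |b x| ≤ 1 + κ := by
      have := hbk x hx
      rw [abs_le] at this ⊢
      constructor <;> linarith
    have := hK x hx
    gcongr
  have hDD : ∫ x in B, ‖(gA g (G x) - gA (fun s => s ^ q) (G x)) + (b x • gA (fun s => s ^ q) (G x) - U x)‖ ^ m ≤
      2 ^ m * (∫ x in B, ‖gA g (G x) - gA (fun s => s ^ q) (G x)‖ ^ m) +
      2 ^ m * ∫ x in B, ‖b x • gA (fun s => s ^ q) (G x) - U x‖ ^ m := by
    rw [← mul_add, ← integral_add iA iU, ← integral_const_mul]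
    refine integral_mono_of_nonneg (Eventually.of_forall fun x => by positivity) ((iA.add iU).const_mul _)
      (Eventually.of_forall fun x => ?_)
    exact rpow_add_le2 hm0 (norm_nonneg _) (norm_nonneg _) (norm_nonneg _) (norm_add_le _ _)
  have h6 := mul_le_mul_of_nonneg_left hDD hcτ0
  have h7 := mul_le_mul_of_nonneg_left hE (by positivity : 0 ≤ 2 * CV q)
  have h8 := mul_le_mul_of_nonneg_left h6 (by positivity : 0 ≤ 8 * CV q)
  simp only [mul_add] at *
  linarith

end cmp1
end DP

namespace DP
set_option linter.unusedSectionVars false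
set_option linter.unusedVariables false
open Set
open scoped RealInnerProductSpace Topology

section lpt
variable {X : Type*} [MeasurableSpace X] {μ : Measure X} {W : Type*} [NormedAddCommGroup W]

theorem Lp_int {f : X → W} {s : ℝ} (hs : 1 ≤ s) (hf : MemLp f (ENNReal.ofReal s) μ) :
    ∫ x, ‖f x‖ ^ s ∂μ = (eLpNorm f (ENNReal.ofReal s) μ).toReal ^ s := by
  have h0 : ENNReal.ofReal s ≠ 0 := by simp; linarith
  have hI : 0 ≤ ∫ x, ‖f x‖ ^ s ∂μ := integral_nonneg fun x => by positivity
  rw [hf.eLpNorm_eq_integral_rpow_norm h0 ENNReal.ofReal_ne_top, ENNReal.toReal_ofReal (by positivity),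
    ENNReal.toReal_ofReal (by linarith), ← Real.rpow_mul hI, inv_mul_cancel₀ (by linarith), Real.rpow_one]

theorem Lp_intble {f : X → W} {s : ℝ} (hs : 1 ≤ s) (hf : MemLp f (ENNReal.ofReal s) μ) :
    Integrable (fun x => ‖f x‖ ^ s) μ := by
  have h0 : ENNReal.ofReal s ≠ 0 := by simp; linarith
  have := hf.integrable_norm_rpow h0 ENNReal.ofReal_ne_top
  rwa [ENNReal.toReal_ofReal (by linarith)] at this

theorem Lp_tend {f : ℕ → X → W} {g : X → W} {s : ℝ} (hs : 1 ≤ s) (hf : ∀ j, MemLp (f j) (ENNReal.ofReal s) μ)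
    (hg : MemLp g (ENNReal.ofReal s) μ)
    (h : Tendsto (fun j => eLpNorm (fun x => f j x - g x) (ENNReal.ofReal s) μ) atTop (𝓝 0)) :
    Tendsto (fun j => ∫ x, ‖f j x - g x‖ ^ s ∂μ) atTop (𝓝 0) ∧
    Tendsto (fun j => ∫ x, ‖f j x‖ ^ s ∂μ) atTop (𝓝 (∫ x, ‖g x‖ ^ s ∂μ)) := by
  have : Fact (1 ≤ ENNReal.ofReal s) := ⟨by simpa using hs⟩
  constructor
  · have e : ∀ j, ∫ x, ‖f j x - g x‖ ^ s ∂μ = (eLpNorm (fun x => f j x - g x) (ENNReal.ofReal s) μ).toReal ^ s :=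
      fun j => Lp_int hs ((hf j).sub hg)
    simp_rw [e]
    have h1 := (ENNReal.tendsto_toReal ENNReal.zero_ne_top).comp h
    have h2 := h1.rpow_const (p := s) (Or.inr (by linarith))
    simpa [Real.zero_rpow (by linarith : s ≠ 0)] using h2
  · have h1 : Tendsto (fun j => (hf j).toLp (f j)) atTop (𝓝 (hg.toLp g)) :=
      (Lp.tendsto_Lp_iff_tendsto_eLpNorm'' f hf g hg).2 h
    have h2 := h1.norm.rpow_const (p := s) (Or.inr (by linarith))
    simp only [Lp.norm_toLp] at h2
    rw [Lp_int hs hg]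
    simp_rw [fun j => Lp_int hs (hf j)]
    exact h2

/-- squeeze -/
theorem sq_zero {a d : ℕ → ℝ} {A C s P : ℝ} (hs : 0 < s) (hP : 0 < P) (ha : ∀ j, 0 ≤ a j)
    (hd : Tendsto d atTop (𝓝 0)) (h : ∀ t, 0 < t → t ≤ 1 → ∀ j, a j ≤ C * (t ^ s * A + (1 / t) ^ P * d j)) :
    Tendsto a atTop (𝓝 0) := by
  have hC : Tendsto (fun t : ℝ => C * (t ^ s * A)) (𝓝[>] 0) (𝓝 0) := by
    have : Tendsto (fun t : ℝ => t ^ s) (𝓝[>] 0) (𝓝 0) := by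
      have := (Real.continuousAt_rpow_const 0 s (Or.inr hs.le)).tendsto
      rw [Real.zero_rpow hs.ne'] at this
      exact this.mono_left nhdsWithin_le_nhds
    simpa using (this.mul_const A).const_mul C
  rw [Metric.tendsto_atTop]
  intro e he
  have h1 := hC.eventually_lt_const (u := e / 2) (by linarith)
  have h2 : ∀ᶠ t : ℝ in 𝓝[>] 0, t ∈ Ioc (0:ℝ) 1 := Ioc_mem_nhdsGT (by norm_num)
  obtain ⟨t, ht, ht1⟩ := (h1.and h2).exists
  have h3 : Tendsto (fun j => C * ((1 / t) ^ P * d j)) atTop (𝓝 0) := by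
    simpa using (hd.const_mul ((1 / t) ^ P)).const_mul C
  obtain ⟨N, hN⟩ := eventually_atTop.1 (h3.eventually_lt_const (u := e / 2) (by linarith))
  refine ⟨N, fun j hj => ?_⟩
  rw [Real.dist_eq, sub_zero, abs_of_nonneg (ha j)]
  have h4 := h t ht1.1 ht1.2 j
  have h5 := hN j hj
  rw [mul_add] at h4
  linarith

end lpt

section cmp2
variable {n : ℕ} {W0 W1 : Type*} [NormedAddCommGroup W0] [InnerProductSpace ℝ W0]
    [NormedAddCommGroup W1] [InnerProductSpace ℝ W1] [FiniteDimensional ℝ W0] [FiniteDimensional ℝ W1]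
    [CompleteSpace W0] [CompleteSpace W1] (S : Sys n W0 W1)

theorem gA_pow_m {q : ℝ} (hq : 0 < q) (z : W1) :
    ‖gA (fun s => s ^ q) z‖ ^ ((2 * q + 2) / (2 * q + 1)) = ‖z‖ ^ (2 * q + 2) := by
  rw [norm_gA (gfun_rpow hq), pw_eq' q hq, ← Real.rpow_mul (norm_nonneg _)]
  congr 1
  field_simp

theorem mol_conv {q : ℝ} (hq : 0 < q) {F : En n → W1} (hF : MemLp F (ENNReal.ofReal (2 * q + 2)) volume)
    {ρ : ℕ → En n → ℝ} {σ : ℕ → ℝ} (hρ : ∀ j, IsMol (ρ j) (σ j)) (hσ : Tendsto σ atTop (𝓝 0)) :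
    (∀ j, MemLp (mol (ρ j) F) (ENNReal.ofReal (2 * q + 2)) volume) ∧
    Tendsto (fun j => eLpNorm (fun x => mol (ρ j) F x - F x) (ENNReal.ofReal (2 * q + 2)) volume) atTop (𝓝 0) ∧
    Tendsto (fun j => ∫ x, ‖gV (fun s => s ^ q) (mol (ρ j) F x) - gV (fun s => s ^ q) (F x)‖ ^ 2) atTop (𝓝 0) ∧
    Tendsto (fun j => ∫ x, ‖gA (fun s => s ^ q) (mol (ρ j) F x) - gA (fun s => s ^ q) (F x)‖ ^ ((2 * q + 2) / (2 * q + 1)))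
      atTop (𝓝 0) ∧
    (∀ j, Integrable (fun x => ‖gV (fun s => s ^ q) (mol (ρ j) F x) - gV (fun s => s ^ q) (F x)‖ ^ 2) volume) ∧
    (∀ j, Integrable (fun x => ‖gA (fun s => s ^ q) (mol (ρ j) F x) - gA (fun s => s ^ q) (F x)‖ ^
      ((2 * q + 2) / (2 * q + 1))) volume) := by
  have hp1 : 1 ≤ ENNReal.ofReal (2 * q + 2) := by simp; linarith
  have hp2 : ENNReal.ofReal (2 * q + 2) ≠ ∞ := ENNReal.ofReal_ne_top
  have hgp := gfun_rpow hq
  have hFl : LocallyIntegrable F volume := hF.locallyIntegrable hp1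
  have hG : ∀ j, MemLp (mol (ρ j) F) (ENNReal.ofReal (2 * q + 2)) volume := fun j =>
    ⟨((hρ j).contDiff hFl).continuous.aestronglyMeasurable, ((hρ j).eLpNorm_le hF.1 hp1 hp2).trans_lt hF.2⟩
  have ht := mol_tendsto hp1 hp2 hF hρ hσ
  have hs1 : (1:ℝ) ≤ 2 * q + 2 := by linarith
  obtain ⟨t1, t2⟩ := Lp_tend hs1 hG hF ht
  have iF := Lp_intble hs1 hF
  have iG := fun j => Lp_intble hs1 (hG j)
  have iD := fun j => Lp_intble hs1 ((hG j).sub hF)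
  have hGF : ∀ j, ∫ x, ‖mol (ρ j) F x‖ ^ (2 * q + 2) ≤ ∫ x, ‖F x‖ ^ (2 * q + 2) := by
    intro j
    rw [Lp_int hs1 hF, Lp_int hs1 (hG j)]
    exact Real.rpow_le_rpow ENNReal.toReal_nonneg (ENNReal.toReal_mono hF.2.ne ((hρ j).eLpNorm_le hF.1 hp1 hp2)) (by linarith)
  have hbd : ∀ (c s t : ℝ) j, 0 ≤ c → 0 < t → Integrable (fun x => c * (t ^ s * (‖F x‖ ^ (2 * q + 2) + ‖mol (ρ j) F x‖ ^ (2 * q + 2)) +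
      (1 / t) ^ (2 * q + 2) * ‖mol (ρ j) F x - F x‖ ^ (2 * q + 2))) volume ∧
      ∫ x, c * (t ^ s * (‖F x‖ ^ (2 * q + 2) + ‖mol (ρ j) F x‖ ^ (2 * q + 2)) +
      (1 / t) ^ (2 * q + 2) * ‖mol (ρ j) F x - F x‖ ^ (2 * q + 2)) ≤
      c * (t ^ s * (2 * ∫ x, ‖F x‖ ^ (2 * q + 2)) + (1 / t) ^ (2 * q + 2) * ∫ x, ‖mol (ρ j) F x - F x‖ ^ (2 * q + 2)) := by
    intro c s t j hc ht0
    have j1 := (iF.add (iG j)).const_mul (t ^ s)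
    have j2 := (iD j).const_mul ((1 / t) ^ (2 * q + 2))
    refine ⟨(j1.add j2).const_mul c, ?_⟩
    rw [integral_const_mul]
    refine mul_le_mul_of_nonneg_left ?_ hc
    have e := integral_add j1 j2
    simp only [Pi.add_apply, Pi.sub_apply] at e
    rw [e, integral_const_mul, integral_const_mul, integral_add iF (iG j)]
    have := hGF j
    have h0 : 0 ≤ t ^ s := by positivity
    have := mul_le_mul_of_nonneg_left this h0
    linarith
  have hGm := fun j => (hG j).1
  have mV : ∀ j, AEStronglyMeasurable (fun x => gV (fun s => s ^ q) (mol (ρ j) F x) - gV (fun s => s ^ q) (F x)) volume :=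
    fun j => (hgp.gV_cont.comp_aestronglyMeasurable (hGm j)).sub (hgp.gV_cont.comp_aestronglyMeasurable hF.1)
  have mA : ∀ j, AEStronglyMeasurable (fun x => gA (fun s => s ^ q) (mol (ρ j) F x) - gA (fun s => s ^ q) (F x)) volume :=
    fun j => (hgp.gA_cont.comp_aestronglyMeasurable (hGm j)).sub (hgp.gA_cont.comp_aestronglyMeasurable hF.1)
  have IV : ∀ j, Integrable (fun x => ‖gV (fun s => s ^ q) (mol (ρ j) F x) - gV (fun s => s ^ q) (F x)‖ ^ 2) volume := fun j => by
    refine (hbd ((2 + q) ^ 2) 2 1 j (by positivity) one_pos).1.mono' ((mV j).norm.pow 2) ?_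
    filter_upwards with x
    rw [Real.norm_of_nonneg (by positivity)]
    exact V_young hq one_pos le_rfl _ _
  have IA : ∀ j, Integrable (fun x => ‖gA (fun s => s ^ q) (mol (ρ j) F x) - gA (fun s => s ^ q) (F x)‖ ^
      ((2 * q + 2) / (2 * q + 1))) volume := fun j => by
    refine (hbd ((2 + 2 * q) ^ ((2 * q + 2) / (2 * q + 1))) ((2 * q + 2) / (2 * q + 1)) 1 j (by positivity) one_pos).1.mono'
      ((mA j).norm.aemeasurable.pow_const _).aestronglyMeasurable ?_
    filter_upwards with x
    rw [Real.norm_of_nonneg (by positivity)]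
    exact A_young hq one_pos le_rfl _ _
  refine ⟨hG, ht, ?_, ?_, IV, IA⟩
  · refine sq_zero (s := 2) (P := 2 * q + 2) (C := (2 + q) ^ 2) (by norm_num) (by linarith)
      (fun j => integral_nonneg fun x => by positivity) t1 (fun t h0 h1 j => ?_) (A := 2 * ∫ x, ‖F x‖ ^ (2 * q + 2))
    refine le_trans ?_ (hbd ((2 + q) ^ 2) 2 t j (by positivity) h0).2
    exact integral_mono (IV j) (hbd ((2 + q) ^ 2) 2 t j (by positivity) h0).1 fun x => V_young hq h0 h1 _ _
  · refine sq_zero (s := (2 * q + 2) / (2 * q + 1)) (P := 2 * q + 2) (C := (2 + 2 * q) ^ ((2 * q + 2) / (2 * q + 1)))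
      (by positivity) (by linarith)
      (fun j => integral_nonneg fun x => by positivity) t1 (fun t h0 h1 j => ?_) (A := 2 * ∫ x, ‖F x‖ ^ (2 * q + 2))
    refine le_trans ?_ (hbd _ ((2 * q + 2) / (2 * q + 1)) t j (by positivity) h0).2
    exact integral_mono (IA j) (hbd _ _ t j (by positivity) h0).1 fun x => A_young hq h0 h1 _ _

end cmp2
end DP

namespace DP
set_option linter.unusedSectionVars false
set_option linter.unusedVariables false
open Set
open scoped RealInnerProductSpace Topology

section cmp3
variable {n : ℕ} {W0 W1 : Type*} [NormedAddCommGroup W0] [InnerProductSpace ℝ W0]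
    [NormedAddCommGroup W1] [InnerProductSpace ℝ W1] [FiniteDimensional ℝ W0] [FiniteDimensional ℝ W1]
    [CompleteSpace W0] [CompleteSpace W1] (S : Sys n W0 W1)

theorem u_memLp {q : ℝ} (hq : 0 < q) {F : En n → W1} (hF : MemLp F (ENNReal.ofReal (2 * q + 2)) volume)
    {b : En n → ℝ} (hb : AEStronglyMeasurable b volume) {Cb : ℝ} (hCb : ∀ x, |b x| ≤ Cb) :
    MemLp (fun x => b x • gA (fun s => s ^ q) (F x)) (ENNReal.ofReal ((2 * q + 2) / (2 * q + 1))) volume := by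
  have hA : AEStronglyMeasurable (fun x => gA (fun s => s ^ q) (F x)) volume :=
    (gfun_rpow hq).gA_cont.comp_aestronglyMeasurable hF.1
  have hm : 0 < (2 * q + 2) / (2 * q + 1) := by positivity
  have h1 : MemLp (fun x => gA (fun s => s ^ q) (F x)) (ENNReal.ofReal ((2 * q + 2) / (2 * q + 1))) volume := by
    rw [← integrable_norm_rpow_iff hA (by simpa using hm) ENNReal.ofReal_ne_top, ENNReal.toReal_ofReal hm.le]
    simp_rw [gA_pow_m hq]
    exact Lp_intble (by linarith) hF
  refine (h1.const_smul Cb).mono (hb.smul hA) ?_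
  filter_upwards with x
  rw [Pi.smul_apply, norm_smul, norm_smul]
  refine mul_le_mul_of_nonneg_right ?_ (norm_nonneg _)
  exact (hCb x).trans (le_abs_self _)

theorem compare {q κ r r' Cb : ℝ} (hq : 0 < q) {x : En n} (hr : r < r')
    {F : En n → W1} (hF : MemLp F (ENNReal.ofReal (2 * q + 2)) volume)
    {b : En n → ℝ} (hb : AEStronglyMeasurable b volume) (hCb : ∀ x, |b x| ≤ Cb)
    (hκ : 0 ≤ κ) (hbk : ∀ y ∈ ball x r, |1 - b y| ≤ κ) (hW : WC S (ball x r') F)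
    (hco : ∀ φ, TF (ball x r') φ → ∫ y, ⟪b y • gA (fun s => s ^ q) (F y), S.d φ y⟫ = 0)
    {δ : ℝ} (hδ : 0 < δ) :
    ∃ ε T : ℝ, 0 < ε ∧ 0 < T ∧ ∃ H : En n → W1, MemLp H 2 volume ∧ WC S (ball x r) H ∧
      (∀ X, InX S (ball x r) X → ∫ y, ⟪gA (gR q ε T) (H y), X y⟫ = 0) ∧
      IntegrableOn (fun y => ‖gV (gR q ε T) (H y) - gV (fun s => s ^ q) (F y)‖ ^ 2) (ball x r) ∧
      ∫ y in ball x r, ‖gV (gR q ε T) (H y) - gV (fun s => s ^ q) (F y)‖ ^ 2 ≤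
        16 * CV q * 2 ^ q * κ ^ 2 * (∫ y in ball x r, ‖F y‖ ^ (2 * q + 2)) + δ := by
  have hgp := gfun_rpow hq
  set m : ℝ := (2 * q + 2) / (2 * q + 1) with hm
  have hm1 : 1 ≤ m := by rw [hm, le_div_iff₀ (by linarith)]; linarith
  have hp1 : 1 ≤ ENNReal.ofReal (2 * q + 2) := by simp; linarith
  have hm1' : 1 ≤ ENNReal.ofReal m := by simpa using hm1
  have hs1 : (1:ℝ) ≤ 2 * q + 2 := by linarith
  have hCb0 : 0 ≤ Cb := (abs_nonneg _).trans (hCb x)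
  set σ : ℕ → ℝ := fun j => (r' - r) / ((j : ℝ) + 2) with hσd
  have hσ0 : ∀ j, 0 < σ j := fun j => div_pos (by linarith) (by positivity)
  have hσ1 : ∀ j, σ j < r' - r := fun j => div_lt_self (by linarith) (by linarith [Nat.cast_nonneg (α := ℝ) j])
  have hσ : Tendsto σ atTop (𝓝 0) :=
    Tendsto.div_atTop tendsto_const_nhds (tendsto_atTop_add_const_right _ _ tendsto_natCast_atTop_atTop)
  choose ρ hρ using fun j => exists_mol (n := n) (hσ0 j)
  have hball : ∀ j, ∀ y ∈ ball x r, closedBall y (σ j) ⊆ ball x r' := fun j y hy =>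
    closedBall_subset_ball' (by rw [mem_ball] at hy; linarith [hσ1 j])
  have hFl : LocallyIntegrable F volume := hF.locallyIntegrable hp1
  set u : En n → W1 := fun x => b x • gA (fun s => s ^ q) (F x) with hu
  have huL : MemLp u (ENNReal.ofReal m) volume := u_memLp hq hF hb hCb
  have hul : LocallyIntegrable u volume := huL.locallyIntegrable hm1'
  obtain ⟨c1, c2, c3, c4, c5, c6⟩ := mol_conv hq hF hρ hσ
  have hUL : ∀ j, MemLp (mol (ρ j) u) (ENNReal.ofReal m) volume := fun j =>
    ⟨((hρ j).contDiff hul).continuous.aestronglyMeasurable,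
      ((hρ j).eLpNorm_le huL.1 hm1' ENNReal.ofReal_ne_top).trans_lt huL.2⟩
  have tU := (Lp_tend hm1 hUL huL (mol_tendsto hm1' ENNReal.ofReal_ne_top huL hρ hσ)).1
  have iU := fun j => Lp_intble hm1 ((hUL j).sub huL)
  set B := ball x r with hB
  have hBm : MeasurableSet B := measurableSet_ball
  have hBf : volume B < ∞ := measure_ball_lt_top
  have tP : Tendsto (fun j => ∫ y in B, ‖mol (ρ j) F y‖ ^ (2 * q + 2)) atTop (𝓝 (∫ y in B, ‖F y‖ ^ (2 * q + 2))) := by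
    refine (Lp_tend hs1 (fun j => (c1 j).restrict B) (hF.restrict B) ?_).2
    exact tendsto_of_tendsto_of_tendsto_of_le_of_le tendsto_const_nhds c2 (fun _ => bot_le)
      fun j => eLpNorm_mono_measure _ Measure.restrict_le_self
  set E : ℕ → ℝ := fun j => ∫ y in B, ‖b y • gA (fun s => s ^ q) (mol (ρ j) F y) - mol (ρ j) u y‖ ^ m with hE
  have hEle : ∀ j, E j ≤ 2 ^ m * (Cb ^ m * (∫ y, ‖gA (fun s => s ^ q) (mol (ρ j) F y) - gA (fun s => s ^ q) (F y)‖ ^ m)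
      + ∫ y, ‖mol (ρ j) u y - u y‖ ^ m) := by
    intro j
    have i1 : Integrable (fun y => 2 ^ m * (Cb ^ m * ‖gA (fun s => s ^ q) (mol (ρ j) F y) - gA (fun s => s ^ q) (F y)‖ ^ m
      + ‖mol (ρ j) u y - u y‖ ^ m)) volume := (((c6 j).const_mul (Cb ^ m)).add (iU j)).const_mul _
    have e : ∫ y, 2 ^ m * (Cb ^ m * ‖gA (fun s => s ^ q) (mol (ρ j) F y) - gA (fun s => s ^ q) (F y)‖ ^ m
      + ‖mol (ρ j) u y - u y‖ ^ m) = 2 ^ m * (Cb ^ m * (∫ y, ‖gA (fun s => s ^ q) (mol (ρ j) F y) - gA (fun s => s ^ q) (F y)‖ ^ m)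
      + ∫ y, ‖mol (ρ j) u y - u y‖ ^ m) := by
      rw [integral_const_mul]
      congr 1
      have := integral_add ((c6 j).const_mul (Cb ^ m)) (iU j)
      simp only [Pi.sub_apply] at this
      rw [this, integral_const_mul]
    rw [← e]
    refine le_trans ?_ (setIntegral_le_integral (s := B) i1 (ae_of_all _ fun y => by positivity))
    refine integral_mono_of_nonneg (ae_of_all _ fun y => by positivity) i1.integrableOn (ae_of_all _ fun y => ?_)
    have h1 : (Cb * ‖gA (fun s => s ^ q) (mol (ρ j) F y) - gA (fun s => s ^ q) (F y)‖) ^ m =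
      Cb ^ m * ‖gA (fun s => s ^ q) (mol (ρ j) F y) - gA (fun s => s ^ q) (F y)‖ ^ m :=
      Real.mul_rpow hCb0 (norm_nonneg _)
    simp only []
    rw [← h1]
    refine rpow_add_le2 (by linarith) (norm_nonneg _) (by positivity) (norm_nonneg _) ?_
    have h2 : b y • gA (fun s => s ^ q) (mol (ρ j) F y) - mol (ρ j) u y =
      b y • (gA (fun s => s ^ q) (mol (ρ j) F y) - gA (fun s => s ^ q) (F y)) - (mol (ρ j) u y - u y) := by
      rw [smul_sub]; simp only [hu]; abel
    rw [h2]
    refine (norm_sub_le _ _).trans (add_le_add ?_ le_rfl)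
    rw [norm_smul]
    exact mul_le_mul_of_nonneg_right (hCb y) (norm_nonneg _)
  have tE : Tendsto E atTop (𝓝 0) := by
    refine tendsto_of_tendsto_of_tendsto_of_le_of_le tendsto_const_nhds ?_
      (fun j => integral_nonneg fun y => by positivity) hEle
    simpa using ((c4.const_mul (Cb ^ m)).add tU).const_mul (2 ^ m)
  set P := ∫ y in B, ‖F y‖ ^ (2 * q + 2) with hP
  have hP0 : 0 ≤ P := integral_nonneg fun y => by positivity
  set C' : ℝ := 2 ^ (3 * q + 3) * (1 + 4 * 4 ^ q * 2 ^ q) with hC'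
  have hC'0 : 0 < C' := by positivity
  have hCV := CV_pos hq
  have hKpos : 0 < 16 * CV q * C' * (volume.real B + P + 1) := by
    have : 0 ≤ volume.real B := measureReal_nonneg
    positivity
  obtain ⟨τ, hτ0, hτ1, hτ2⟩ : ∃ τ : ℝ, 0 < τ ∧ 8 * (τ * 2 ^ (3 * q + 3)) ≤ 1 / 4 ∧
      τ * (16 * CV q * C' * (volume.real B + P + 1)) ≤ δ / 4 := by
    have h2 : (0:ℝ) < 2 ^ (3 * q + 3) := by positivity
    refine ⟨min (1 / (32 * 2 ^ (3 * q + 3))) (δ / 4 / (16 * CV q * C' * (volume.real B + P + 1))), by positivity, ?_, ?_⟩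
    · have := min_le_left (1 / (32 * 2 ^ (3 * q + 3))) (δ / 4 / (16 * CV q * C' * (volume.real B + P + 1)))
      rw [le_div_iff₀ (by positivity)] at this
      linarith
    · have := min_le_right (1 / (32 * 2 ^ (3 * q + 3))) (δ / 4 / (16 * CV q * C' * (volume.real B + P + 1)))
      rwa [le_div_iff₀ hKpos] at this
  have tR : Tendsto (fun j => 2 * (8 * CV q * (2 ^ q * κ ^ 2 * (∫ y in B, ‖mol (ρ j) F y‖ ^ (2 * q + 2))
          + (1 / τ) ^ (1 / (2 * q + 1)) * (2 ^ m * E j)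
          + τ * C' * (volume.real B + ∫ y in B, ‖mol (ρ j) F y‖ ^ (2 * q + 2))) + δ / 8) +
          2 * ∫ y, ‖gV (fun s => s ^ q) (mol (ρ j) F y) - gV (fun s => s ^ q) (F y)‖ ^ 2) atTop
      (𝓝 (2 * (8 * CV q * (2 ^ q * κ ^ 2 * P + (1 / τ) ^ (1 / (2 * q + 1)) * (2 ^ m * 0) + τ * C' * (volume.real B + P)) + δ / 8)
        + 2 * 0)) :=
    (((((tP.const_mul _).add ((tE.const_mul _).const_mul _)).add ((tP.const_add _).const_mul _)).const_mul _).add_const _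
      |>.const_mul _).add (c3.const_mul _)
  have hlt : 2 * (8 * CV q * (2 ^ q * κ ^ 2 * P + (1 / τ) ^ (1 / (2 * q + 1)) * (2 ^ m * 0) + τ * C' * (volume.real B + P)) + δ / 8)
        + 2 * 0 < 16 * CV q * 2 ^ q * κ ^ 2 * P + δ := by
    have : 0 < τ * (16 * CV q * C') := by positivity
    nlinarith
  obtain ⟨j, hj⟩ := (tR.eventually_lt_const hlt).exists
  obtain ⟨ε, T, hε, hT, H, h1, h2, h3, h4, h5⟩ := cmp_step S (η := δ / 8) hq hτ0 hτ1 (by linarith) hBm isBounded_ball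
    (((hρ j).contDiff hFl).of_le (by exact_mod_cast le_top)) (fun y hy => WC.mol S hFl hW (hρ j) (hball j y hy))
    (((hρ j).contDiff hul).of_le (by exact_mod_cast le_top)) (fun y hy => mol_coclosed S hul hco (hρ j) (hball j y hy))
    hb hκ hbk
  have hVm : AEStronglyMeasurable (fun y => gV (gR q ε T) (H y) - gV (fun s => s ^ q) (F y)) (volume.restrict B) :=
    (((gfun_gR hq hε hT).gV_cont.comp_aestronglyMeasurable h1.1).sub
      (hgp.gV_cont.comp_aestronglyMeasurable hF.1)).restrict
  have hpt : ∀ y, ‖gV (gR q ε T) (H y) - gV (fun s => s ^ q) (F y)‖ ^ 2 ≤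
      2 * ‖gV (gR q ε T) (H y) - gV (fun s => s ^ q) (mol (ρ j) F y)‖ ^ 2 +
      2 * ‖gV (fun s => s ^ q) (mol (ρ j) F y) - gV (fun s => s ^ q) (F y)‖ ^ 2 := fun y => by
    have := norm_add_le (gV (gR q ε T) (H y) - gV (fun s => s ^ q) (mol (ρ j) F y))
      (gV (fun s => s ^ q) (mol (ρ j) F y) - gV (fun s => s ^ q) (F y))
    rw [sub_add_sub_cancel] at this
    have h0 := norm_nonneg (gV (gR q ε T) (H y) - gV (fun s => s ^ q) (F y))
    nlinarith [sq_nonneg (‖gV (gR q ε T) (H y) - gV (fun s => s ^ q) (mol (ρ j) F y)‖ -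
      ‖gV (fun s => s ^ q) (mol (ρ j) F y) - gV (fun s => s ^ q) (F y)‖), pow_le_pow_left₀ h0 this 2]
  have hI : IntegrableOn (fun y => 2 * ‖gV (gR q ε T) (H y) - gV (fun s => s ^ q) (mol (ρ j) F y)‖ ^ 2 +
      2 * ‖gV (fun s => s ^ q) (mol (ρ j) F y) - gV (fun s => s ^ q) (F y)‖ ^ 2) B :=
    (h4.const_mul 2).add ((c5 j).integrableOn.const_mul 2)
  refine ⟨ε, T, hε, hT, H, h1, h2, h3, ?_, ?_⟩
  · refine hI.mono' (hVm.norm.pow 2) (ae_of_all _ fun y => ?_)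
    rw [Real.norm_of_nonneg (by positivity)]
    exact hpt y
  · refine le_trans (integral_mono_of_nonneg (ae_of_all _ fun y => by positivity) hI (ae_of_all _ hpt)) ?_
    rw [integral_add (h4.const_mul 2) ((c5 j).integrableOn.const_mul 2), integral_const_mul, integral_const_mul]
    have h6 := setIntegral_le_integral (s := B) (c5 j) (ae_of_all _ fun y => by positivity)
    have h7 : ∫ y in B, (1 + ‖mol (ρ j) F y‖ ^ (2 * q + 2)) = volume.real B + ∫ y in B, ‖mol (ρ j) F y‖ ^ (2 * q + 2) := by
      rw [integral_add (integrable_const_iff.2 (Or.inr (isFiniteMeasure_restrict.2 hBf.ne))) ((Lp_intble hs1 (c1 j)).integrableOn)]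
      simp
    rw [h7] at h5
    refine le_trans ?_ hj.le
    refine add_le_add (mul_le_mul_of_nonneg_left h5 (by norm_num)) (mul_le_mul_of_nonneg_left h6 (by norm_num))

end cmp3
end DP

namespace DP
set_option linter.unusedSectionVars false
set_option linter.unusedVariables false
open Set
open scoped RealInnerProductSpace Topology

section sav
variable {n : ℕ} {W : Type*} [NormedAddCommGroup W] [NormedSpace ℝ W]

instance probI : IsProbabilityMeasure (volume.restrict (Icc (0:ℝ) 1)) := ⟨by simp⟩

/-- segment average -/
def sav (h : En n) (G : En n → W) (x : En n) : W := ∫ θ in Icc (0:ℝ) 1, G (x + θ • h)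

theorem sav_cont {G : En n → W} (hG : Continuous G) (h : En n) : Continuous (sav h G) :=
  continuous_parametric_integral_of_continuous (f := fun x (θ : ℝ) => G (x + θ • h)) (by fun_prop) isCompact_Icc

theorem sav_hasFDerivAt [CompleteSpace W] {G : En n → W} (hG : ContDiff ℝ 1 G) (h x : En n) :
    HasFDerivAt (sav h G) (sav h (fderiv ℝ G) x) x := by
  have hD : Continuous (fderiv ℝ G) := hG.continuous_fderiv one_ne_zero
  obtain ⟨C, hC⟩ := (isCompact_closedBall x (1 + ‖h‖)).exists_bound_of_continuousOn hD.continuousOn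
  refine hasFDerivAt_integral_of_dominated_of_fderiv_le (F := fun y (θ : ℝ) => G (y + θ • h))
    (F' := fun y (θ : ℝ) => fderiv ℝ G (y + θ • h))
    (bound := fun _ => C) (s := ball x 1) (ball_mem_nhds x one_pos) ?_ ?_ ?_ ?_ (integrable_const _) ?_
  · exact Eventually.of_forall fun y => by
      have := hG.continuous
      exact Continuous.aestronglyMeasurable (by fun_prop)
  · have := hG.continuous
    exact Continuous.integrableOn_Icc (f := fun θ : ℝ => G (x + θ • h)) (by fun_prop)
  · exact Continuous.aestronglyMeasurable (by fun_prop)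
  · refine (ae_restrict_iff' measurableSet_Icc).2 (ae_of_all _ fun θ hθ y hy => hC _ ?_)
    rw [mem_closedBall, dist_eq_norm]
    rw [mem_ball, dist_eq_norm] at hy
    have : y + θ • h - x = (y - x) + θ • h := by abel
    rw [this]
    refine (norm_add_le _ _).trans (add_le_add hy.le ?_)
    rw [norm_smul, Real.norm_of_nonneg hθ.1]
    exact mul_le_of_le_one_left (norm_nonneg _) hθ.2
  · refine ae_of_all _ fun θ y hy => ?_
    have h1 : HasFDerivAt (fun y : En n => y + θ • h) (ContinuousLinearMap.id ℝ (En n)) y := (hasFDerivAt_id y).add_const _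
    have := (hG.differentiable one_ne_zero (y + θ • h)).hasFDerivAt.comp y h1
    rw [ContinuousLinearMap.comp_id] at this
    exact this

theorem sav_contDiff [CompleteSpace W] {G : En n → W} (hG : ContDiff ℝ 1 G) (h : En n) : ContDiff ℝ 1 (sav h G) :=
  contDiff_one_iff_hasFDerivAt.2 ⟨_, sav_cont (hG.continuous_fderiv one_ne_zero) h, fun x => sav_hasFDerivAt hG h x⟩

theorem sav_eLpNorm {G : En n → W} (hG : Continuous G) (h : En n) {C : ℝ≥0∞} (hC : eLpNorm G 2 volume ≤ C) :
    eLpNorm (sav h G) 2 volume ≤ C := by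
  refine eLpNorm_avg_le (k := fun x (θ : ℝ) => G (x + θ • h)) ?_ (by norm_num) (by norm_num) (ae_of_all _ fun θ => ?_)
  · exact Continuous.aestronglyMeasurable (by simp only [Function.uncurry_def]; fun_prop)
  · rw [eLpNorm_trans hG.aestronglyMeasurable]; exact hC

theorem sav_ftc [CompleteSpace W] {G : En n → W} (hG : ContDiff ℝ 1 G) (h x : En n) :
    sav h (fun y => fderiv ℝ G y h) x = G (x + h) - G x := by
  have hD : Continuous (fderiv ℝ G) := hG.continuous_fderiv one_ne_zero
  rw [sav, integral_Icc_eq_integral_Ioc, ← intervalIntegral.integral_of_le zero_le_one]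
  have := intervalIntegral.integral_eq_sub_of_hasDerivAt (a := 0) (b := 1) (f := fun θ : ℝ => G (x + θ • h))
    (f' := fun θ => fderiv ℝ G (x + θ • h) h) (fun θ _ => ?_) (Continuous.intervalIntegrable (by fun_prop) _ _)
  · rw [this]; simp
  · have h1 : HasDerivAt (fun θ : ℝ => x + θ • h) h θ := by
      simpa using ((hasDerivAt_id θ).smul_const h).const_add x
    exact (hG.differentiable one_ne_zero (x + θ • h)).hasFDerivAt.comp_hasDerivAt θ h1

/-- translation estimate -/
theorem trans_le [CompleteSpace W] {G : En n → W} (hG : ContDiff ℝ 1 G) (h : En n) {C : ℝ≥0∞}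
    (hC : eLpNorm (fun y => fderiv ℝ G y h) 2 volume ≤ C) :
    eLpNorm (fun x => G (x + h) - G x) 2 volume ≤ C := by
  have hD : Continuous (fderiv ℝ G) := hG.continuous_fderiv one_ne_zero
  simp_rw [← sav_ftc hG h]
  exact sav_eLpNorm (G := fun y => fderiv ℝ G y h) (by fun_prop) h hC

end sav

section tf1
variable {n : ℕ} {W0 W1 : Type*} [NormedAddCommGroup W0] [InnerProductSpace ℝ W0]
    [NormedAddCommGroup W1] [InnerProductSpace ℝ W1] [FiniteDimensional ℝ W0] [FiniteDimensional ℝ W1]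
    [CompleteSpace W0] [CompleteSpace W1] (S : Sys n W0 W1)

/-- C¹ test functions -/
def TF1 {W : Type*} [NormedAddCommGroup W] [InnerProductSpace ℝ W] (B : Set (En n)) (φ : En n → W) : Prop :=
  ContDiff ℝ 1 φ ∧ HasCompactSupport φ ∧ tsupport φ ⊆ B

theorem InX.of_TF1 {B : Set (En n)} (hB : IsOpen B) {φ : En n → W0} (h : TF1 B φ) : InX S B (S.d φ) := by
  obtain ⟨h1, h2, h3⟩ := h
  have hd : Continuous (S.d φ) := (S.d_contDiff (m := 1) (k := 0) h1 (by simp)).continuous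
  have hdc : HasCompactSupport (S.d φ) := h2.of_isClosed_subset (isClosed_tsupport _) (S.d_tsupport φ)
  have hdL : MemLp (S.d φ) 2 volume := hd.memLp_of_hasCompactSupport hdc
  obtain ⟨δ, hδ, hδB⟩ := h2.exists_cthickening_subset_open hB h3
  set σ : ℕ → ℝ := fun j => δ / ((j : ℝ) + 2) with hσd
  have hσ0 : ∀ j, 0 < σ j := fun j => div_pos hδ (by positivity)
  have hσ1 : ∀ j, σ j ≤ δ := fun j => div_le_self hδ.le (by linarith [Nat.cast_nonneg (α := ℝ) j])
  have hσ : Tendsto σ atTop (𝓝 0) :=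
    Tendsto.div_atTop tendsto_const_nhds (tendsto_atTop_add_const_right _ _ tendsto_natCast_atTop_atTop)
  choose ρ hρ using fun j => exists_mol (n := n) (hσ0 j)
  have hφl : LocallyIntegrable φ volume := h1.continuous.locallyIntegrable
  refine ⟨hdL, fun j => mol (ρ j) φ, fun j => ?_, ?_⟩
  · have hs : tsupport (mol (ρ j) φ) ⊆ cthickening δ (tsupport φ) := by
      refine closure_minimal (fun x hx => ?_) isClosed_cthickening
      by_contra hx'
      refine hx ((hρ j).mol_eq_zero (ae_of_all _ fun y hy => ?_))
      by_contra h0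
      refine hx' (mem_cthickening_of_dist_le x y δ _ (subset_tsupport _ h0) ?_)
      rw [dist_eq_norm]; exact hy.trans (hσ1 j)
    exact ⟨(hρ j).contDiff hφl, h2.cthickening.of_isClosed_subset (isClosed_tsupport _) hs, hs.trans hδB⟩
  · have e : ∀ j, S.d (mol (ρ j) φ) = mol (ρ j) (S.d φ) := by
      intro j
      funext x
      have hfl : LocallyIntegrable (fderiv ℝ φ) volume := (h1.continuous_fderiv one_ne_zero).locallyIntegrable
      have hL : S.d (mol (ρ j) φ) x = (∑ i, (S.e i).comp (ContinuousLinearMap.apply ℝ W0 (basisVec i))) (fderiv ℝ (mol (ρ j) φ) x) := by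
        simp [Sys.d, pd]
      rw [hL, (hρ j).mol_fderiv_comm h1 h2, ← (hρ j).mol_clm hfl]
      congr 1
      funext y
      simp [Sys.d, pd]
    have := mol_tendsto (by norm_num) (by norm_num) hdL hρ hσ
    simp_rw [← e] at this
    exact this

end tf1
end DP

namespace DP
set_option linter.unusedSectionVars false
set_option linter.unusedVariables false
open Set
open scoped RealInnerProductSpace Topology

section dq
variable {n : ℕ} {W0 W1 : Type*} [NormedAddCommGroup W0] [InnerProductSpace ℝ W0]
    [NormedAddCommGroup W1] [InnerProductSpace ℝ W1] [FiniteDimensional ℝ W0] [FiniteDimensional ℝ W1]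
    [CompleteSpace W0] [CompleteSpace W1] (S : Sys n W0 W1)

theorem cs2 {X : Type*} [MeasurableSpace X] {μ : Measure X} {f g : X → W1} (hf : MemLp f 2 μ) (hg : MemLp g 2 μ) :
    |∫ x, ⟪f x, g x⟫ ∂μ| ≤ (eLpNorm f 2 μ).toReal * (eLpNorm g 2 μ).toReal := by
  have := abs_real_inner_le_norm (hf.toLp f) (hg.toLp g)
  rwa [inner_toLp, Lp.norm_toLp, Lp.norm_toLp] at this

theorem Sys.d_mul {η : En n → ℝ} {v : En n → W0} {x : En n} (hη : DifferentiableAt ℝ η x)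
    (hv : DifferentiableAt ℝ v x) :
    S.d (fun y => η y • v y) x = η x • S.d v x + ∑ i, pd i η x • S.e i (v x) := by
  simp only [Sys.d, pd]
  rw [Finset.smul_sum, ← Finset.sum_add_distrib]
  refine Finset.sum_congr rfl fun i _ => ?_
  rw [fderiv_fun_smul hη hv]
  simp

theorem pd_trans {W : Type*} [NormedAddCommGroup W] [InnerProductSpace ℝ W] (φ : En n → W) (h : En n) (i : Fin n) (x : En n) :
    pd i (fun y => φ (y + h)) x = pd i φ (x + h) := by
  simp only [pd]
  rw [fderiv_comp_add_right]

theorem dsav {G : En n → W1} (hG : ContDiff ℝ 1 G) (s : Fin n) (t : ℝ) (x : En n)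
    (hc : ∀ θ ∈ Icc (0:ℝ) 1, CC S G (x + θ • (t • basisVec s))) :
    S.d (fun y => t • S.es s (sav (t • basisVec s) G y)) x = G (x + t • basisVec s) - G x := by
  set h : En n := t • basisVec s with hh
  have hD : Continuous (fderiv ℝ G) := hG.continuous_fderiv one_ne_zero
  rw [← sav_ftc hG h]
  have h1 : ∀ y, HasFDerivAt (sav h G) (sav h (fderiv ℝ G) y) y := fun y => sav_hasFDerivAt hG h y
  have h2 : ∀ i, pd i (fun y => t • S.es s (sav h G y)) x = t • S.es s (sav h (fderiv ℝ G) x (basisVec i)) := by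
    intro i
    have h4 : HasFDerivAt (fun y => t • S.es s (sav h G y)) (t • (S.es s).comp (sav h (fderiv ℝ G) x)) x :=
      ((S.es s).hasFDerivAt.comp x (h1 x)).const_smul t
    rw [pd, h4.fderiv]
    simp
  simp only [Sys.d, h2]
  have h3 : ∑ i, S.e i (t • S.es s (sav h (fderiv ℝ G) x (basisVec i))) =
      (∑ i, t • ((S.e i).comp ((S.es s).comp (ContinuousLinearMap.apply ℝ W1 (basisVec i))))) (sav h (fderiv ℝ G) x) := by
    simp
  rw [h3, sav, ← ContinuousLinearMap.integral_comp_comm]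
  · refine setIntegral_congr_fun measurableSet_Icc fun θ hθ => ?_
    have := hc θ hθ s
    simp only [pd] at this
    simp only [sum_apply, smul_apply, ContinuousLinearMap.comp_apply, ContinuousLinearMap.apply_apply]
    rw [← Finset.smul_sum, this, hh]
    simp
  · exact Continuous.integrableOn_Icc (by fun_prop)

theorem dq_est {A : W1 → W1} {ν Λ : ℝ} (hν : 0 < ν) (hΛ : 0 ≤ Λ) (hm : ∀ a b, ν * ‖b - a‖ ^ 2 ≤ ⟪A b - A a, b - a⟫)
    (hL : ∀ a b, ‖A b - A a‖ ≤ Λ * ‖b - a‖) {O : Set (En n)} (hO : IsOpen O) {H : En n → W1} (hH : MemLp H 2 volume)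
    (hA : MemLp (fun x => A (H x)) 2 volume) (hW : WC S O H) (ho : ∀ X, InX S O X → ∫ x, ⟪A (H x), X x⟫ = 0)
    {η : En n → ℝ} (hη : TF O η) (s : Fin n) :
    ∃ K t₀ : ℝ, 0 ≤ K ∧ 0 < t₀ ∧ ∀ t, |t| ≤ t₀ →
      (eLpNorm (fun x => η x • (H (x + t • basisVec s) - H x)) 2 volume).toReal ≤ K * |t| := by
  obtain ⟨e1, e2, e3⟩ := hη
  have e1' : ContDiff ℝ 1 η := e1.of_le (by exact_mod_cast le_top)
  obtain ⟨δ, hδ, hδO⟩ := e2.exists_cthickening_subset_open hO e3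
  set σ : ℕ → ℝ := fun j => δ / 3 / ((j : ℝ) + 2) with hσd
  have hσ0 : ∀ j, 0 < σ j := fun j => div_pos (by linarith) (by positivity)
  have hσ1 : ∀ j, σ j ≤ δ / 3 := fun j => div_le_self (by linarith) (by linarith [Nat.cast_nonneg (α := ℝ) j])
  have hσ : Tendsto σ atTop (𝓝 0) :=
    Tendsto.div_atTop tendsto_const_nhds (tendsto_atTop_add_const_right _ _ tendsto_natCast_atTop_atTop)
  choose ρ hρ using fun j => exists_mol (n := n) (hσ0 j)
  have hHl : LocallyIntegrable H volume := hH.locallyIntegrable (by norm_num)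
  set M : En n → (W1 →L[ℝ] W1) := fun x => ∑ i, (pd i η x) • ((S.e i).comp (S.es s)) with hM
  have hMc : Continuous M := continuous_finsetSum _ fun i _ => (pd_cont e1' i).smul continuous_const
  have hMs : HasCompactSupport M := by
    refine e2.of_isClosed_subset (isClosed_tsupport _) (closure_minimal (fun x hx => ?_) (isClosed_tsupport _))
    by_contra h0
    refine hx ?_
    simp only [hM]
    refine Finset.sum_eq_zero fun i _ => ?_
    have : pd i η x = 0 := image_eq_zero_of_notMem_tsupport fun h => h0 (pd_tsupport η i h)
    rw [this, zero_smul]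
  obtain ⟨Ce, hCe⟩ := hMc.bounded_above_of_compact_support hMs
  have hCe0 : 0 ≤ Ce := (norm_nonneg _).trans (hCe 0)
  obtain ⟨Cη, hCη⟩ := e1.continuous.bounded_above_of_compact_support e2
  set N := (eLpNorm H 2 volume).toReal with hN
  have hN0 : 0 ≤ N := ENNReal.toReal_nonneg
  refine ⟨2 * Ce * Λ * N / ν, δ / 3, by positivity, by linarith, fun t ht => ?_⟩
  set h : En n := t • basisVec s with hh
  have hhn : ‖h‖ = |t| := by rw [hh, norm_smul]; simp [basisVec]
  set G := fun j => mol (ρ j) H with hG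
  have hGs : ∀ j, ContDiff ℝ 1 (G j) := fun j => ((hρ j).contDiff hHl).of_le (by exact_mod_cast le_top)
  have hGn : ∀ j, eLpNorm (G j) 2 volume ≤ eLpNorm H 2 volume := fun j => (hρ j).eLpNorm_le hH.1 (by norm_num) (by norm_num)
  have hGL : ∀ j, MemLp (G j) 2 volume := fun j => ⟨(hGs j).continuous.aestronglyMeasurable, (hGn j).trans_lt hH.2⟩
  have tG := mol_tendsto (by norm_num) (by norm_num) hH hρ hσ
  set φ := fun j (x : En n) => (η x ^ 2) • (t • S.es s (sav h (G j) x)) with hφ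
  have hφs : ∀ j, ContDiff ℝ 1 (φ j) := fun j =>
    (e1'.pow 2).smul (((S.es s).contDiff.comp (sav_contDiff (hGs j) h)).const_smul t)
  have hφt : ∀ j, tsupport (φ j) ⊆ tsupport η := fun j => closure_mono fun x hx h0 => hx (by simp [hφ, h0])
  have hφ1 : ∀ j, TF1 O (φ j) := fun j => ⟨hφs j, e2.of_isClosed_subset (isClosed_tsupport _) (hφt j), (hφt j).trans e3⟩
  have hφ2 : ∀ j, TF1 O (fun x => φ j (x + -h)) := fun j => by
    have ht' : tsupport (fun x => φ j (x + -h)) ⊆ cthickening δ (tsupport η) := by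
      refine closure_minimal (fun x hx => ?_) isClosed_cthickening
      refine mem_cthickening_of_dist_le x (x + -h) δ _ (hφt j (subset_tsupport _ hx)) ?_
      rw [dist_eq_norm]
      simp only [sub_add_cancel_left, neg_neg]
      linarith
    exact ⟨(hφs j).comp (contDiff_id.add contDiff_const),
      e2.cthickening.of_isClosed_subset (isClosed_tsupport _) ht', ht'.trans hδO⟩
  have hdφ : ∀ j x, S.d (φ j) x = η x • (η x • (G j (x + h) - G j x) + (2 * t) • M x (sav h (G j) x)) := by
    intro j x
    have hv : DifferentiableAt ℝ (fun y => t • S.es s (sav h (G j) y)) x :=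
      ((S.es s).differentiableAt.comp x (((sav_contDiff (hGs j) h).differentiable one_ne_zero) x)).const_smul t
    have hη2 : DifferentiableAt ℝ (fun y => η y ^ 2) x := ((e1'.pow 2).differentiable one_ne_zero) x
    simp only [hφ]
    rw [S.d_mul hη2 hv]
    have hp : ∀ i, pd i (fun y => η y ^ 2) x = 2 * η x * pd i η x := fun i => by
      simp only [pd]
      rw [fderiv_fun_pow (𝔸 := ℝ) 2 ((e1'.differentiable one_ne_zero) x)]
      simp
    by_cases h0 : η x = 0
    · simp [h0, hp]
    · have hx : x ∈ tsupport η := subset_tsupport _ h0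
      rw [hh, dsav S (hGs j) s t x]
      · simp only [hp, hM, smul_add, smul_smul, sum_apply, Finset.smul_sum, smul_apply,
          ContinuousLinearMap.comp_apply, map_smul]
        rw [← sq]
        congr 1
        refine Finset.sum_congr rfl fun i _ => ?_
        congr 1
        ring
      · intro θ hθ
        refine WC.mol S hHl hW (hρ j) (fun y hy => hδO (mem_cthickening_of_dist_le y x δ _ hx ?_))
        rw [mem_closedBall] at hy
        have : dist (x + θ • t • basisVec s) x ≤ δ / 3 := by
          rw [dist_eq_norm, add_sub_cancel_left, ← hh, norm_smul, hhn, Real.norm_of_nonneg hθ.1]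
          exact (mul_le_of_le_one_left (abs_nonneg _) hθ.2).trans ht
        linarith [dist_triangle y (x + θ • t • basisVec s) x, hσ1 j]
  -- the difference
  set D : En n → W1 := fun x => A (H (x + h)) - A (H x) with hD
  have hDL : MemLp D 2 volume := (memLp_trans hA h).sub hA
  have hΔL : MemLp (fun x => H (x + h) - H x) 2 volume := (memLp_trans hH h).sub hH
  have hmul : ∀ {f : En n → W1}, MemLp f 2 volume → MemLp (fun x => η x • f x) 2 volume := fun {f} hf => by
    refine (hf.const_smul Cη).mono (e1.continuous.aestronglyMeasurable.smul hf.1) (ae_of_all _ fun x => ?_)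
    rw [Pi.smul_apply, norm_smul, norm_smul]
    exact mul_le_mul_of_nonneg_right ((hCη x).trans (le_abs_self _)) (norm_nonneg _)
  have hd0 : ∀ j, ∫ x, ⟪D x, S.d (φ j) x⟫ = 0 := by
    intro j
    have i1 := InX.of_TF1 S hO (hφ1 j)
    have h1 := ho _ i1
    have h2 := ho _ (InX.of_TF1 S hO (hφ2 j))
    have h3 : ∀ x, S.d (fun x => φ j (x + -h)) x = S.d (φ j) (x + -h) := fun x => by
      simp only [Sys.d, pd_trans]
    simp_rw [h3] at h2
    rw [← integral_add_right_eq_self _ h] at h2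
    simp only [add_neg_cancel_right] at h2
    simp only [hD, inner_sub_left]
    rw [integral_sub (inner_intble (memLp_trans hA h) i1.1) (inner_intble hA i1.1), h1, h2, sub_zero]
  have hsL : ∀ j, MemLp (sav h (G j)) 2 volume := fun j =>
    ⟨(sav_cont (hGs j).continuous h).aestronglyMeasurable, (sav_eLpNorm (hGs j).continuous h (hGn j)).trans_lt hH.2⟩
  have hMsL : ∀ j, MemLp (fun x => M x (sav h (G j) x)) 2 volume := fun j =>
    memLp_clm_apply (hsL j) hMc.aestronglyMeasurable (ae_of_all _ hCe)
  have hMsn : ∀ j, (eLpNorm (fun x => M x (sav h (G j) x)) 2 volume).toReal ≤ Ce * N := fun j => by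
    have h1 : eLpNorm (fun x => M x (sav h (G j) x)) 2 volume ≤ ENNReal.ofReal Ce * eLpNorm H 2 volume := by
      refine (eLpNorm_le_mul_eLpNorm_of_ae_le_mul (g := sav h (G j)) (c := Ce) (ae_of_all _ fun x => ?_) 2).trans ?_
      · exact (ContinuousLinearMap.le_opNorm _ _).trans (mul_le_mul_of_nonneg_right (hCe x) (norm_nonneg _))
      · gcongr
        exact sav_eLpNorm (hGs j).continuous h (hGn j)
    have h2 := ENNReal.toReal_mono (ENNReal.mul_ne_top ENNReal.ofReal_ne_top hH.2.ne) h1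
    rwa [ENNReal.toReal_mul, ENNReal.toReal_ofReal hCe0] at h2
  have hΔGL : ∀ j, MemLp (fun x => G j (x + h) - G j x) 2 volume := fun j => (memLp_trans (hGL j) h).sub (hGL j)
  set P := (eLpNorm (fun x => η x • D x) 2 volume).toReal with hP
  have key : ∀ j, ∫ x, ⟪η x • D x, η x • (G j (x + h) - G j x)⟫ ≤ 2 * |t| * (P * (Ce * N)) := by
    intro j
    have h1 := hd0 j
    have h2 : ∀ x, ⟪D x, S.d (φ j) x⟫ = ⟪η x • D x, η x • (G j (x + h) - G j x)⟫ +
        (2 * t) * ⟪η x • D x, M x (sav h (G j) x)⟫ := fun x => by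
      rw [hdφ, inner_smul_right, inner_add_right, inner_smul_right, inner_smul_right, real_inner_smul_left, real_inner_smul_left, inner_smul_right]
      ring
    simp_rw [h2] at h1
    rw [integral_add (inner_intble (hmul hDL) (hmul (hΔGL j))) ((inner_intble (hmul hDL) (hMsL j)).const_mul _),
      integral_const_mul] at h1
    have h3 := cs2 (hmul hDL) (hMsL j)
    have h4 : |∫ x, ⟪η x • D x, M x (sav h (G j) x)⟫| ≤ P * (Ce * N) :=
      h3.trans (mul_le_mul_of_nonneg_left (hMsn j) ENNReal.toReal_nonneg)
    have h5 : -((2 * t) * ∫ x, ⟪η x • D x, M x (sav h (G j) x)⟫) ≤ 2 * |t| * (P * (Ce * N)) := by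
      refine (neg_le_abs _).trans ?_
      rw [abs_mul, abs_mul, abs_two]
      exact mul_le_mul_of_nonneg_left h4 (by positivity)
    linarith
  have tΔ : TL volume (fun j x => G j (x + h) - G j x) (fun x => H (x + h) - H x) := by
    have h1 : ∀ j, eLpNorm (fun x => (G j (x + h) - G j x) - (H (x + h) - H x)) 2 volume ≤
        eLpNorm (fun x => G j x - H x) 2 volume + eLpNorm (fun x => G j x - H x) 2 volume := fun j => by
      have hs : MemLp (fun x => G j x - H x) 2 volume := (hGL j).sub hH
      have h2 : (fun x => (G j (x + h) - G j x) - (H (x + h) - H x)) =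
          (fun x => G j (x + h) - H (x + h)) - (fun x => G j x - H x) := by funext x; simp only [Pi.sub_apply]; abel
      rw [h2]
      refine (eLpNorm_sub_le (memLp_trans hs h).1 hs.1 (by norm_num)).trans (add_le_add ?_ le_rfl)
      exact (eLpNorm_trans hs.1 2 h).le
    refine tendsto_of_tendsto_of_tendsto_of_le_of_le tendsto_const_nhds ?_ (fun _ => bot_le) h1
    simpa using tG.add tG
  have tηΔ : TL volume (fun j x => η x • (G j (x + h) - G j x)) (fun x => η x • (H (x + h) - H x)) := by
    have := TL.mul tΔ hΔGL hΔL (m := fun _ x => η x • ContinuousLinearMap.id ℝ W1)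
      (m₀ := fun x => η x • ContinuousLinearMap.id ℝ W1) (C := |Cη| * ‖ContinuousLinearMap.id ℝ W1‖)
      (fun _ => (e1.continuous.smul continuous_const).aestronglyMeasurable)
      (e1.continuous.smul continuous_const).aestronglyMeasurable
      (fun _ x => by
        rw [norm_smul]
        exact mul_le_mul_of_nonneg_right ((hCη x).trans (le_abs_self _)) (norm_nonneg _))
      (ae_of_all _ fun x => tendsto_const_nhds)
    simpa using this
  have lim := TL.inner (TL_const (μ := volume) (fun x => η x • D x)) tηΔ (fun _ => hmul hDL) (hmul hDL)
    (fun j => hmul (hΔGL j)) (hmul hΔL)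
  have key2 : ∫ x, ⟪η x • D x, η x • (H (x + h) - H x)⟫ ≤ 2 * |t| * (P * (Ce * N)) := le_of_tendsto' lim key
  set Q := (eLpNorm (fun x => η x • (H (x + h) - H x)) 2 volume).toReal with hQ
  have hQ0 : 0 ≤ Q := ENNReal.toReal_nonneg
  have hPQ : P ≤ Λ * Q := by
    have h1 : eLpNorm (fun x => η x • D x) 2 volume ≤ ENNReal.ofReal Λ * eLpNorm (fun x => η x • (H (x + h) - H x)) 2 volume := by
      refine eLpNorm_le_mul_eLpNorm_of_ae_le_mul (ae_of_all _ fun x => ?_) 2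
      rw [norm_smul, norm_smul]
      have := mul_le_mul_of_nonneg_left (hL (H x) (H (x + h))) (norm_nonneg (η x))
      simp only [hD]
      linarith
    have h2 := ENNReal.toReal_mono (ENNReal.mul_ne_top ENNReal.ofReal_ne_top (hmul hΔL).2.ne) h1
    rwa [ENNReal.toReal_mul, ENNReal.toReal_ofReal hΛ] at h2
  have hlow : ν * Q ^ 2 ≤ ∫ x, ⟪η x • D x, η x • (H (x + h) - H x)⟫ := by
    rw [hQ, eLpNorm_sq (hmul hΔL), ← integral_const_mul]
    refine integral_mono ((normsq_intble (hmul hΔL)).const_mul ν) (inner_intble (hmul hDL) (hmul hΔL)) fun x => ?_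
    simp only [norm_smul, inner_smul_right, real_inner_smul_left, mul_pow, Real.norm_eq_abs, sq_abs]
    have := mul_le_mul_of_nonneg_left (hm (H x) (H (x + h))) (sq_nonneg (η x))
    simp only [hD]
    nlinarith
  rw [div_mul_eq_mul_div, le_div_iff₀ hν]
  have h9 : 2 * |t| * (P * (Ce * N)) ≤ 2 * |t| * (Λ * Q * (Ce * N)) := by gcongr
  rcases hQ0.eq_or_lt with h0 | h0
  · rw [← h0]; simp; positivity
  · have : Q * (Q * ν) ≤ Q * (2 * Ce * Λ * N * |t|) := by nlinarith
    exact le_of_mul_le_mul_left this h0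
end dq
end DP

namespace DP
set_option linter.unusedSectionVars false
set_option linter.unusedVariables false
open Set
open scoped RealInnerProductSpace Topology

section wl
variable {𝓗 : Type*} [NormedAddCommGroup 𝓗] [InnerProductSpace ℝ 𝓗] [CompleteSpace 𝓗]

theorem weak_lim {x : ℕ → 𝓗} {K : ℝ} (hx : ∀ j, ‖x j‖ ≤ K) :
    ∃ z : 𝓗, ∀ y, Tendsto (fun j => ⟪x j, y⟫) (hyperfilter ℕ : Filter ℕ) (𝓝 ⟪z, y⟫) := by
  have hc := WeakDual.isCompact_closedBall (𝕜 := ℝ) (E := 𝓗) 0 K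
  set u : ℕ → WeakDual ℝ 𝓗 := fun j => StrongDual.toWeakDual (InnerProductSpace.toDual ℝ 𝓗 (x j)) with hu
  have hmem : ∀ j, u j ∈ WeakDual.toStrongDual ⁻¹' closedBall (0 : StrongDual ℝ 𝓗) K := by
    intro j
    simp only [hu, mem_preimage, mem_closedBall, dist_zero_right]
    have : WeakDual.toStrongDual (StrongDual.toWeakDual (InnerProductSpace.toDual ℝ 𝓗 (x j))) =
      InnerProductSpace.toDual ℝ 𝓗 (x j) := rfl
    rw [this, LinearIsometryEquiv.norm_map]
    exact hx j
  have h1 : (((hyperfilter ℕ).map u : Ultrafilter _) : Filter (WeakDual ℝ 𝓗)) ≤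
      𝓟 (WeakDual.toStrongDual ⁻¹' closedBall (0 : StrongDual ℝ 𝓗) K) := by
    rw [le_principal_iff]
    rw [Ultrafilter.mem_coe, Ultrafilter.mem_map]
    exact Filter.mem_of_superset Filter.univ_mem (fun j _ => hmem j)
  obtain ⟨w, -, hw⟩ := hc.ultrafilter_le_nhds _ h1
  refine ⟨(InnerProductSpace.toDual ℝ 𝓗).symm (WeakDual.toStrongDual w), fun y => ?_⟩
  have h2 : Tendsto u (hyperfilter ℕ : Filter ℕ) (𝓝 w) := hw
  have h3 := ((WeakDual.eval_continuous (𝕜 := ℝ) (E := 𝓗) y).tendsto w).comp h2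
  have e1 : ⟪(InnerProductSpace.toDual ℝ 𝓗).symm (WeakDual.toStrongDual w), y⟫ = w y := by
    rw [InnerProductSpace.toDual_symm_apply]; rfl
  rw [e1]
  exact h3
end wl

section wd
variable {n : ℕ} {W : Type*} [NormedAddCommGroup W] [InnerProductSpace ℝ W] [FiniteDimensional ℝ W] [CompleteSpace W]

def WD (s : Fin n) (Z g : En n → W) : Prop :=
  ∀ ψ : En n → W, TF univ ψ → ∫ x, ⟪Z x, pd s ψ x⟫ = - ∫ x, ⟪g x, ψ x⟫

theorem wd_dq {Z : En n → W} (hZ : MemLp Z 2 volume) (s : Fin n) {ψ : En n → W} (hψ : TF univ ψ)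
    {t : ℕ → ℝ} (ht0 : ∀ j, 0 < t j) (ht1 : ∀ j, t j ≤ 1) (ht : Tendsto t atTop (𝓝 0)) :
    Tendsto (fun j => ∫ x, ⟪(t j)⁻¹ • (Z (x + t j • basisVec s) - Z x), ψ x⟫) atTop
      (𝓝 (- ∫ x, ⟪Z x, pd s ψ x⟫)) := by
  have hψ1 : ContDiff ℝ 1 ψ := hψ.1.of_le (by exact_mod_cast le_top)
  have hb : ‖(basisVec s : En n)‖ = 1 := by simp [basisVec]
  have e0 : ∀ j, ∫ x, ⟪(t j)⁻¹ • (Z (x + t j • basisVec s) - Z x), ψ x⟫ =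
      ∫ x, ⟪Z x, (t j)⁻¹ • (ψ (x - t j • basisVec s) - ψ x)⟫ := by
    intro j
    have m1 := memLp_trans hZ (t j • basisVec s)
    have m2 : MemLp (fun x => ψ (x - t j • basisVec s)) 2 volume := by
      simpa [sub_eq_add_neg] using memLp_trans (hψ.memLp 2) (-(t j • basisVec s))
    have i1 := inner_intble m1 (hψ.memLp 2)
    have i2 := inner_intble hZ (hψ.memLp 2)
    have i3 := inner_intble hZ m2
    simp only [inner_smul_left, inner_smul_right, inner_sub_left, inner_sub_right]
    rw [integral_const_mul, integral_const_mul, integral_sub i1 i2, integral_sub i3 i2]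
    have := integral_add_right_eq_self (μ := (volume : Measure (En n)))
      (fun x => ⟪Z x, ψ (x - t j • basisVec s)⟫) (t j • basisVec s)
    simp only [add_sub_cancel_right] at this
    rw [this]; simp
  simp_rw [e0]
  rw [← integral_neg]
  obtain ⟨C, hC⟩ := hψ1.lipschitzWith_of_hasCompactSupport hψ.2.1 one_ne_zero
  set Kc := cthickening 1 (tsupport ψ) with hKc
  have hKcomp : IsCompact Kc := hψ.2.1.isCompact.cthickening
  have hsm : ∀ a b, ‖ψ a - ψ b‖ ≤ C * ‖a - b‖ := fun a b => by
    have := hC.dist_le_mul a b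
    rwa [dist_eq_norm, dist_eq_norm] at this
  apply tendsto_integral_of_dominated_convergence (fun x => ‖Z x‖ * (Kc.indicator (fun _ => (C:ℝ)) x))
  · intro j
    refine hZ.1.inner (AEStronglyMeasurable.const_smul ?_ _)
    exact (((hψ1.continuous.comp (continuous_id.sub continuous_const)).sub hψ1.continuous)).aestronglyMeasurable
  · have m1 : MemLp (Kc.indicator (fun _ => (C:ℝ))) 2 (volume : Measure (En n)) :=
      memLp_indicator_const 2 hKcomp.measurableSet _ (Or.inr hKcomp.measure_lt_top.ne)
    have := inner_intble hZ.norm m1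
    simpa [mul_comm] using this
  · intro j
    filter_upwards with x
    refine (norm_inner_le_norm _ _).trans ?_
    gcongr
    rw [norm_smul, norm_inv, Real.norm_of_nonneg (ht0 j).le]
    by_cases hx : x ∈ Kc
    · rw [indicator_of_mem hx, inv_mul_le_iff₀ (ht0 j)]
      refine (hsm _ _).trans (le_of_eq ?_)
      simp [norm_smul, hb, abs_of_pos (ht0 j), mul_comm]
    · have h1 : ψ x = 0 := by
        by_contra h; exact hx (self_subset_cthickening _ (subset_tsupport _ h))
      have h2 : ψ (x - t j • basisVec s) = 0 := by
        by_contra h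
        refine hx (mem_cthickening_of_dist_le x _ 1 _ (subset_tsupport _ h) ?_)
        rw [dist_eq_norm]; simp [norm_smul, hb, abs_of_pos (ht0 j), ht1 j]
      simp [h1, h2, hx]
  · filter_upwards with x
    rw [← inner_neg_right]
    have h1 : HasDerivAt (fun r : ℝ => ψ (x - r • basisVec s)) (-(pd s ψ x)) 0 := by
      have h2 : HasDerivAt (fun r : ℝ => x - r • (basisVec s : En n)) (-(basisVec s)) 0 := by
        simpa using ((hasDerivAt_id (0:ℝ)).smul_const (basisVec s : En n)).const_sub x
      have h3 : HasFDerivAt ψ (fderiv ℝ ψ x) (x - (0:ℝ) • basisVec s) := by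
        simpa using (hψ1.differentiable one_ne_zero x).hasFDerivAt
      have := h3.comp_hasDerivAt (0:ℝ) h2
      simpa [pd, Function.comp_def] using this
    have h4 := hasDerivAt_iff_tendsto_slope.1 h1
    have h5 : Tendsto t atTop (𝓝[≠] 0) := tendsto_nhdsWithin_iff.2 ⟨ht, Eventually.of_forall fun j => (ht0 j).ne'⟩
    have h6 := h4.comp h5
    refine Tendsto.inner tendsto_const_nhds ?_
    refine h6.congr fun j => ?_
    simp [slope_def_module]

theorem wd_exists {Z : En n → W} (hZ : MemLp Z 2 volume) (s : Fin n) {K t₀ : ℝ} (hK : 0 ≤ K) (ht₀ : 0 < t₀)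
    (h : ∀ t, |t| ≤ t₀ → (eLpNorm (fun x => Z (x + t • basisVec s) - Z x) 2 volume).toReal ≤ K * |t|) :
    ∃ g, MemLp g 2 volume ∧ WD s Z g := by
  set τ := min t₀ 1 with hτ
  have hτ0 : 0 < τ := lt_min ht₀ one_pos
  set t : ℕ → ℝ := fun j => τ / (j + 1) with htdef
  have ht0 : ∀ j, 0 < t j := fun j => by positivity
  have htτ : ∀ j, t j ≤ τ := fun j => div_le_self hτ0.le (by simp)
  have ht : Tendsto t atTop (𝓝 0) :=
    Tendsto.div_atTop tendsto_const_nhds (tendsto_atTop_add_const_right _ _ tendsto_natCast_atTop_atTop)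
  have hm : ∀ j, MemLp (fun x => (t j)⁻¹ • (Z (x + t j • basisVec s) - Z x)) 2 volume :=
    fun j => ((memLp_trans hZ _).sub hZ).const_smul _
  have hb : ∀ j, ‖(hm j).toLp _‖ ≤ K := by
    intro j
    rw [Lp.norm_toLp]
    have e : (fun x => (t j)⁻¹ • (Z (x + t j • basisVec s) - Z x)) =
      (t j)⁻¹ • (fun x => (Z (x + t j • basisVec s) - Z x)) := rfl
    rw [e, eLpNorm_const_smul, ENNReal.toReal_mul, toReal_enorm, norm_inv, Real.norm_of_nonneg (ht0 j).le,
      inv_mul_le_iff₀ (ht0 j)]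
    have := h (t j) (by rw [abs_of_pos (ht0 j)]; exact (htτ j).trans (min_le_left _ _))
    rw [abs_of_pos (ht0 j)] at this
    linarith
  obtain ⟨z, hz⟩ := weak_lim hb
  refine ⟨z, Lp.memLp z, fun ψ hψ => ?_⟩
  have h1 := hz ((hψ.memLp 2).toLp ψ)
  simp_rw [inner_toLp] at h1
  have h2 := (wd_dq hZ s hψ ht0 (fun j => (htτ j).trans (min_le_right _ _)) ht).mono_left
    (Nat.hyperfilter_le_atTop)
  have h3 := tendsto_nhds_unique h1 h2
  rw [← neg_eq_iff_eq_neg, ← h3, ← inner_toLp (Lp.memLp z) (hψ.memLp 2)]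
  simp

theorem WD.pd_mol {Z g : En n → W} (hZ : LocallyIntegrable Z volume) (hg : LocallyIntegrable g volume) {s : Fin n} (h : WD s Z g)
    {ρ : En n → ℝ} {σ : ℝ} (hρ : IsMol ρ σ) (x : En n) : pd s (mol ρ Z) x = mol ρ g x := by
  apply ext_inner_right ℝ
  intro v
  set ψ : En n → W := fun y => ρ (x - y) • v with hψ
  have hρ1 : Differentiable ℝ ρ := hρ.smooth.differentiable (by simp)
  have hs : tsupport ψ ⊆ closedBall x σ := by
    apply closure_minimal _ isClosed_closedBall
    intro y hy
    have : ρ (x - y) ≠ 0 := fun h0 => hy (by simp [hψ, h0])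
    rw [mem_closedBall, dist_comm, dist_eq_norm]
    exact hρ.supp _ this
  have hT : TF univ ψ := by
    refine ⟨?_, ?_, subset_univ _⟩
    · exact (hρ.smooth.comp (contDiff_const.sub contDiff_id)).smul contDiff_const
    · exact (isCompact_closedBall x σ).of_isClosed_subset (isClosed_tsupport _) hs
  have e1 : ∀ y, pd s ψ y = -(fderiv ℝ ρ (x - y) (basisVec s) • v) := by
    intro y
    have h1 : HasFDerivAt (fun y => ρ (x - y)) ((fderiv ℝ ρ (x - y)).comp (-ContinuousLinearMap.id ℝ (En n))) y :=
      (hρ1 (x - y)).hasFDerivAt.comp y ((hasFDerivAt_id y).const_sub x)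
    have h2 := (h1.smul_const v).fderiv
    unfold pd
    rw [hψ, h2]
    simp
  have hcs : HasCompactSupport (fun y => ρ (x - y)) := by
    refine HasCompactSupport.of_support_subset_isCompact (isCompact_closedBall x σ) fun y hy => ?_
    rw [mem_closedBall, dist_comm, dist_eq_norm]
    exact hρ.supp _ hy
  have hcd : ContDiff ℝ 1 (fun y => ρ (x - y)) :=
    (hρ.smooth.of_le (by exact_mod_cast le_top)).comp (contDiff_const.sub contDiff_id)
  have e2 : ∀ y, pd s (fun y => ρ (x - y)) y = -(fderiv ℝ ρ (x - y) (basisVec s)) := by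
    intro y
    have h1 : HasFDerivAt (fun y => ρ (x - y)) ((fderiv ℝ ρ (x - y)).comp (-ContinuousLinearMap.id ℝ (En n))) y :=
      (hρ1 (x - y)).hasFDerivAt.comp y ((hasFDerivAt_id y).const_sub x)
    unfold pd
    rw [h1.fderiv]
    simp
  have hi1 : Integrable (fun y => (fderiv ℝ ρ (x - y) (basisVec s)) • Z y) := by
    have := hZ.integrable_smul_left_of_hasCompactSupport (pd_cont hcd s).neg (pd_compact hcs s).neg
    simpa [e2] using this
  have hi2 : Integrable (fun y => (ρ (x - y)) • g y) :=
    hg.integrable_smul_left_of_hasCompactSupport hcd.continuous hcs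
  have hL : ∀ u, ⟪u, v⟫ = (innerSL ℝ v) u := fun u => by simp [real_inner_comm]
  rw [hL, hL, mol_eq_swap]
  unfold pd
  rw [mol_fderiv hρ.smooth hρ.compact hZ, ← ContinuousLinearMap.integral_comp_comm _ hi1,
    ← ContinuousLinearMap.integral_comp_comm _ hi2]
  have := h ψ hT
  simp_rw [e1] at this
  rw [← neg_inj, ← integral_neg]
  simp only [innerSL_apply_apply, inner_smul_right]
  simp only [hψ, inner_neg_right, inner_smul_right] at this
  simp_rw [real_inner_comm v] at this
  simpa [real_inner_comm] using this
end wd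
end DP

namespace DP
set_option linter.unusedSectionVars false
set_option linter.unusedVariables false
open Set
open scoped RealInnerProductSpace Topology

section cs
variable {X : Type*} [MeasurableSpace X] {μ : Measure X} {W : Type*} [NormedAddCommGroup W] [InnerProductSpace ℝ W]

theorem common_subseq {ι : Type*} [Fintype ι] {f : ι → ℕ → X → W} {g : ι → X → W} (h : ∀ i, TL μ (f i) (g i))
    (hf : ∀ i j, MemLp (f i j) 2 μ) (hg : ∀ i, MemLp (g i) 2 μ) :
    ∃ ns : ℕ → ℕ, StrictMono ns ∧ ∀ᵐ x ∂μ, ∀ i, Tendsto (fun j => f i (ns j) x) atTop (𝓝 (g i x)) := by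
  classical
  have key : ∀ s : Finset ι, ∃ ns : ℕ → ℕ, StrictMono ns ∧
      ∀ i ∈ s, ∀ᵐ x ∂μ, Tendsto (fun j => f i (ns j) x) atTop (𝓝 (g i x)) := by
    intro s
    induction s using Finset.induction_on with
    | empty => exact ⟨id, strictMono_id, by simp⟩
    | insert a s ha ih =>
      obtain ⟨ns, h1, h2⟩ := ih
      have h3 : TL μ (fun j => f a (ns j)) (g a) := TL.comp (h a) h1
      obtain ⟨ms, h4, h5⟩ := TL.subseq h3 (fun j => hf a _) (hg a)
      refine ⟨ns ∘ ms, h1.comp h4, fun i hi => ?_⟩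
      rcases Finset.mem_insert.1 hi with rfl | hi
      · exact h5
      · filter_upwards [h2 i hi] with x hx
        exact hx.comp h4.tendsto_atTop
  obtain ⟨ns, h1, h2⟩ := key Finset.univ
  exact ⟨ns, h1, ae_all_iff.2 fun i => h2 i (Finset.mem_univ i)⟩
end cs

section reg
variable {n : ℕ} {W0 W1 : Type*} [NormedAddCommGroup W0] [InnerProductSpace ℝ W0] [NormedAddCommGroup W1] [InnerProductSpace ℝ W1] [FiniteDimensional ℝ W0] [FiniteDimensional ℝ W1] [CompleteSpace W0] [CompleteSpace W1] (S : Sys n W0 W1)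

structure Reg (A : W1 → W1) (O : Set (En n)) (Z : En n → W1) (g : Fin n → En n → W1) (Zj : ℕ → En n → W1) : Prop where
  mZ : MemLp Z 2 volume
  mg : ∀ s, MemLp (g s) 2 volume
  sm : ∀ j, ContDiff ℝ 1 (Zj j)
  mZj : ∀ j, MemLp (Zj j) 2 volume
  mgj : ∀ s j, MemLp (pd s (Zj j)) 2 volume
  tZ : TL volume Zj Z
  tg : ∀ s, TL volume (fun j => pd s (Zj j)) (g s)
  ae : ∀ᵐ x, Tendsto (fun j => Zj j x) atTop (𝓝 (Z x))
  closed : ∀ᵐ x, x ∈ O → ∀ i, ∑ s, S.e s (S.es i (g s x)) = g i x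
  eq : ∀ s φ, TF1 O φ → ∫ x, ⟪fderiv ℝ A (Z x) (g s x), S.d φ x⟫ = 0

theorem Z_dq {χ : En n → ℝ} (hχ : TF univ χ) {H : En n → W1} (hH : MemLp H 2 volume) {K t₀ : ℝ} (s : Fin n) (hK : 0 ≤ K)
    (h : ∀ t, |t| ≤ t₀ →
      (eLpNorm (fun x => χ x • (H (x + t • basisVec s) - H x)) 2 volume).toReal ≤ K * |t|) :
    ∃ K', 0 ≤ K' ∧ ∀ t, |t| ≤ t₀ →
      (eLpNorm (fun x => χ (x + t • basisVec s) • H (x + t • basisVec s) - χ x • H x) 2 volume).toReal ≤ K' * |t| := by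
  have hχ1 : ContDiff ℝ 1 χ := hχ.1.of_le (by exact_mod_cast le_top)
  obtain ⟨C, hC⟩ := hχ1.lipschitzWith_of_hasCompactSupport hχ.2.1 one_ne_zero
  have hb : ‖(basisVec s : En n)‖ = 1 := by simp [basisVec]
  obtain ⟨Cb, hCb⟩ := hχ1.continuous.bounded_above_of_compact_support hχ.2.1
  refine ⟨K + C * (eLpNorm H 2 volume).toReal, by positivity, fun t ht => ?_⟩
  have hT := memLp_trans hH (t • basisVec s)
  have hD := hT.sub hH
  have m1 : MemLp (fun x => χ x • (H (x + t • basisVec s) - H x)) 2 volume := by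
    refine (hD.norm.const_mul Cb).mono (hχ1.continuous.aestronglyMeasurable.smul hD.1) ?_
    filter_upwards with x
    rw [norm_smul]
    refine le_trans ?_ (le_abs_self _)
    simp only [Pi.sub_apply]
    gcongr
    exact hCb x
  have hle : ∀ x, ‖(χ (x + t • basisVec s) - χ x) • H (x + t • basisVec s)‖ ≤ (C * |t|) * ‖H (x + t • basisVec s)‖ := by
    intro x
    rw [norm_smul]
    gcongr
    have := hC.dist_le_mul (x + t • basisVec s) x
    rw [dist_eq_norm, dist_eq_norm] at this
    simpa [norm_smul, hb] using this
  have m2 : MemLp (fun x => (χ (x + t • basisVec s) - χ x) • H (x + t • basisVec s)) 2 volume := by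
    refine (hT.norm.const_mul (C * |t|)).mono (((hχ1.continuous.comp (continuous_id.add continuous_const)).sub
      hχ1.continuous).aestronglyMeasurable.smul hT.1) ?_
    filter_upwards with x
    exact (hle x).trans (le_abs_self _)
  have e : (fun x => χ (x + t • basisVec s) • H (x + t • basisVec s) - χ x • H x) =
      (fun x => χ x • (H (x + t • basisVec s) - H x)) + (fun x => (χ (x + t • basisVec s) - χ x) • H (x + t • basisVec s)) := by
    funext x; simp only [Pi.add_apply]; module
  rw [e]
  have h1 := eLpNorm_add_le m1.1 m2.1 (p := 2) (by norm_num)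
  have h2 : eLpNorm (fun x => (χ (x + t • basisVec s) - χ x) • H (x + t • basisVec s)) 2 volume ≤
      ENNReal.ofReal (C * |t|) * eLpNorm H 2 volume := by
    rw [← eLpNorm_trans hH.1 2 (t • basisVec s)]
    exact eLpNorm_le_mul_eLpNorm_of_ae_le_mul (Eventually.of_forall hle) _
  have h3 := ENNReal.toReal_mono (ENNReal.add_ne_top.2 ⟨m1.2.ne, m2.2.ne⟩) h1
  rw [ENNReal.toReal_add m1.2.ne m2.2.ne] at h3
  have h4 := ENNReal.toReal_mono (ENNReal.mul_ne_top ENNReal.ofReal_ne_top hH.2.ne) h2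
  rw [ENNReal.toReal_mul, ENNReal.toReal_ofReal (by positivity)] at h4
  have h5 := h t ht
  nlinarith

theorem reg_exists {A : W1 → W1} (hA1 : ContDiff ℝ 1 A) (hA0 : A 0 = 0) {ν Λ : ℝ} (hν : 0 < ν) (hΛ : 0 ≤ Λ)
    (hm : ∀ a b, ν * ‖b - a‖ ^ 2 ≤ ⟪A b - A a, b - a⟫)
    (hL : ∀ a b, ‖A b - A a‖ ≤ Λ * ‖b - a‖) {O O' : Set (En n)} (hO : IsOpen O) (hO' : IsOpen O') (hOO : O' ⊆ O)
    {H : En n → W1} (hH : MemLp H 2 volume)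
    (hW : WC S O H) (ho : ∀ X, InX S O X → ∫ x, ⟪A (H x), X x⟫ = 0)
    {χ : En n → ℝ} (hχ : TF O χ) (hχ1 : ∀ x ∈ O', χ x = 1) :
    ∃ Z g Zj, Reg S A O' Z g Zj ∧ ∀ x ∈ O', Z x = H x := by
  have hAm : ∀ {f : En n → W1}, MemLp f 2 volume → MemLp (fun x => A (f x)) 2 volume := by
    intro f hf
    refine (hf.norm.const_mul Λ).mono (hA1.continuous.comp_aestronglyMeasurable hf.1) ?_
    filter_upwards with x
    refine le_trans ?_ (le_abs_self _)
    have := hL 0 (f x)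
    simpa [hA0] using this
  obtain ⟨Cb, hCb⟩ := hχ.1.continuous.bounded_above_of_compact_support hχ.2.1
  set Z : En n → W1 := fun x => χ x • H x with hZdef
  have hZ : MemLp Z 2 volume := by
    refine (hH.norm.const_mul Cb).mono (hχ.1.continuous.aestronglyMeasurable.smul hH.1) ?_
    filter_upwards with x
    rw [norm_smul]
    refine le_trans ?_ (le_abs_self _)
    gcongr
    exact hCb x
  have hZH : ∀ x ∈ O', Z x = H x := fun x hx => by simp [hZdef, hχ1 x hx]
  have hwd : ∀ s, ∃ g, MemLp g 2 volume ∧ WD s Z g := by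
    intro s
    obtain ⟨K, t₀, hK, ht₀, h1⟩ := dq_est S hν hΛ hm hL hO hH (hAm hH) hW ho hχ s
    obtain ⟨K', hK', h2⟩ := Z_dq (hχ.mono (subset_univ _)) hH s hK h1
    exact wd_exists hZ s hK' ht₀ h2
  choose g hg hwg using hwd
  set σ : ℕ → ℝ := fun j => 1 / ((j : ℝ) + 1) with hσdef
  have hσ0 : ∀ j, 0 < σ j := fun j => by positivity
  have hσ : Tendsto σ atTop (𝓝 0) :=
    Tendsto.div_atTop tendsto_const_nhds (tendsto_atTop_add_const_right _ _ tendsto_natCast_atTop_atTop)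
  choose ρ hρ using fun j => exists_mol (n := n) (hσ0 j)
  have hZl : LocallyIntegrable Z volume := hZ.locallyIntegrable (by norm_num)
  have hgl : ∀ s, LocallyIntegrable (g s) volume := fun s => (hg s).locallyIntegrable (by norm_num)
  have hpm : ∀ s j, pd s (mol (ρ j) Z) = mol (ρ j) (g s) := fun s j => funext fun x => (hwg s).pd_mol hZl (hgl s) (hρ j) x
  have hmolm : ∀ {f : En n → W1}, MemLp f 2 volume → ∀ j, MemLp (mol (ρ j) f) 2 volume := fun hf j =>
    ⟨((hρ j).contDiff (hf.locallyIntegrable (by norm_num))).continuous.aestronglyMeasurable,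
      ((hρ j).eLpNorm_le hf.1 (by norm_num) (by norm_num)).trans_lt hf.2⟩
  have tZ : TL volume (fun j => mol (ρ j) Z) Z := mol_tendsto (by norm_num) (by norm_num) hZ hρ hσ
  have tg : ∀ s, TL volume (fun j => mol (ρ j) (g s)) (g s) := fun s =>
    mol_tendsto (by norm_num) (by norm_num) (hg s) hρ hσ
  obtain ⟨ns, hns, hae⟩ := common_subseq (ι := Option (Fin n)) (μ := volume)
    (f := fun o j => o.elim (mol (ρ j) Z) (fun s => mol (ρ j) (g s))) (g := fun o => o.elim Z g)
    (fun o => by cases o with | none => exact tZ | some s => exact tg s)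
    (fun o j => by cases o with | none => exact hmolm hZ j | some s => exact hmolm (hg s) j)
    (fun o => by cases o with | none => exact hZ | some s => exact hg s)
  have tZ' : TL volume (fun j => mol (ρ (ns j)) Z) Z := TL.comp tZ hns
  have tg' : ∀ s, TL volume (fun j => pd s (mol (ρ (ns j)) Z)) (g s) := by
    intro s; simp_rw [hpm]; exact TL.comp (tg s) hns
  have mgj : ∀ s j, MemLp (pd s (mol (ρ (ns j)) Z)) 2 volume := fun s j => by rw [hpm]; exact hmolm (hg s) _
  have sm : ∀ j, ContDiff ℝ 1 (mol (ρ (ns j)) Z) := fun j => ((hρ (ns j)).contDiff hZl).of_le (by exact_mod_cast le_top)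
  have haeZ : ∀ᵐ x, Tendsto (fun j => mol (ρ (ns j)) Z x) atTop (𝓝 (Z x)) := by
    filter_upwards [hae] with x hx using hx none
  have hWZ : WC S O' Z := by
    refine WC.congr S (f := H) (Eventually.of_forall fun x hx => (hZH x hx).symm) ?_
    intro i ψ hψ
    exact hW i ψ (hψ.mono hOO)
  have hfA : ∀ z, ‖fderiv ℝ A z‖ ≤ Λ := fun z =>
    norm_fderiv_le_of_lip' ℝ hΛ (Eventually.of_forall fun y => hL z y)
  have hfAc : Continuous (fderiv ℝ A) := hA1.continuous_fderiv one_ne_zero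
  refine ⟨Z, g, fun j => mol (ρ (ns j)) Z, ⟨hZ, hg, sm, fun j => hmolm hZ _, mgj, tZ', tg', haeZ, ?_, ?_⟩, hZH⟩
  · filter_upwards [hae] with x hx hxO i
    obtain ⟨ε, hε, hεO⟩ := Metric.isOpen_iff.1 hO' x hxO
    have h1 : ∀ᶠ j in atTop, σ (ns j) < ε := (hσ.comp hns.tendsto_atTop).eventually (gt_mem_nhds hε)
    have h2 : Tendsto (fun j => ∑ s, S.e s (S.es i (mol (ρ (ns j)) (g s) x))) atTop
        (𝓝 (∑ s, S.e s (S.es i (g s x)))) := by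
      refine tendsto_finsetSum _ fun s _ => ?_
      have h3 := hx (some s)
      exact (((S.e s).comp (S.es i)).continuous.tendsto _).comp h3
    refine tendsto_nhds_unique_of_eventuallyEq h2 (hx (some i)) ?_
    filter_upwards [h1] with j hj
    have h4 := WC.mol S hZl hWZ (hρ (ns j)) (x := x) ((closedBall_subset_ball hj).trans hεO) i
    simp_rw [hpm] at h4
    exact h4
  · intro s φ hφ
    have mA : MemLp (fun x => fderiv ℝ A (Z x) (g s x)) 2 volume :=
      memLp_clm_apply (hg s) (hfAc.comp_aestronglyMeasurable hZ.1) (Eventually.of_forall fun x => hfA _)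
    refine InX.orth S (InX.of_TF1 S hO' hφ) mA fun φ hφ => ?_
    have e1 : S.d (pd s φ) = pd s (S.d φ) := by
      funext x
      unfold Sys.d
      have hd : ∀ i, Differentiable ℝ (pd i φ) := fun i => (pd_contDiff hφ.1 (by norm_cast) i : ContDiff ℝ 1 (pd i φ)).differentiable one_ne_zero
      rw [pd_sum (φ := fun i y => S.e i (pd i φ y)) _ (fun i _ => (S.e i).differentiableAt.comp x (hd i x))]
      refine Finset.sum_congr rfl fun i _ => ?_
      rw [pd_clm (hd i x), pd_symm (hφ.1.of_le (by norm_cast))]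
    have h0 : ∫ x, ⟪A (Z x), pd s (S.d φ) x⟫ = 0 := by
      rw [← ho _ (InX.of_TF S ((hφ.pd s).mono hOO)), e1]
      apply integral_congr_ae
      filter_upwards with x
      by_cases hx : x ∈ O'
      · rw [hZH x hx]
      · have : pd s (S.d φ) x = 0 := by
          by_contra h
          exact hx (((S.d_TF hφ).pd s).2.2 (subset_tsupport _ h))
        simp [this]
    have hT := S.d_TF hφ
    have hT1 : ContDiff ℝ 1 (S.d φ) := hT.1.of_le (by exact_mod_cast le_top)
    have tA : TL volume (fun j x => A (mol (ρ (ns j)) Z x)) (fun x => A (Z x)) := by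
      have h1 : ∀ j, eLpNorm (fun x => A (mol (ρ (ns j)) Z x) - A (Z x)) 2 volume ≤
          ENNReal.ofReal Λ * eLpNorm (fun x => mol (ρ (ns j)) Z x - Z x) 2 volume := fun j =>
        eLpNorm_le_mul_eLpNorm_of_ae_le_mul (Eventually.of_forall fun x => hL _ _) _
      have h2 : Tendsto (fun j => ENNReal.ofReal Λ * eLpNorm (fun x => mol (ρ (ns j)) Z x - Z x) 2 volume) atTop (𝓝 0) := by
        have := ENNReal.Tendsto.const_mul (a := ENNReal.ofReal Λ) (tZ' : Tendsto _ _ _) (Or.inr ENNReal.ofReal_ne_top)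
        simpa using this
      exact tendsto_of_tendsto_of_tendsto_of_le_of_le tendsto_const_nhds h2 (fun _ => bot_le) h1
    have l1 := TL.inner tA (TL_const (pd s (S.d φ))) (fun j => hAm (hmolm hZ _)) (hAm hZ) (fun _ => (hT.pd s).memLp 2) ((hT.pd s).memLp 2)
    have tB : TL volume (fun j x => fderiv ℝ A (mol (ρ (ns j)) Z x) (pd s (mol (ρ (ns j)) Z) x))
        (fun x => fderiv ℝ A (Z x) (g s x)) := by
      refine TL.mul (tg' s) (mgj s) (hg s) (fun j => (hfAc.comp (sm j).continuous).aestronglyMeasurable)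
        (hfAc.comp_aestronglyMeasurable hZ.1) (fun j x => hfA _) ?_
      filter_upwards [haeZ] with x hx
      exact (hfAc.tendsto _).comp hx
    have l2 := TL.inner tB (TL_const (S.d φ)) (fun j => memLp_clm_apply (mgj s j) (hfAc.comp (sm j).continuous).aestronglyMeasurable (Eventually.of_forall fun x => hfA _))
      mA (fun _ => hT.memLp 2) (hT.memLp 2)
    have e2 : ∀ j, ∫ x, ⟪A (mol (ρ (ns j)) Z x), pd s (S.d φ) x⟫ =
        - ∫ x, ⟪fderiv ℝ A (mol (ρ (ns j)) Z x) (pd s (mol (ρ (ns j)) Z) x), S.d φ x⟫ := by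
      intro j
      rw [ibp (f := fun x => A (mol (ρ (ns j)) Z x)) (hA1.comp (sm j)) hT1 hT.2.1 s]
      congr 1
      apply integral_congr_ae
      filter_upwards with x
      have h4 : HasFDerivAt (fun y => A (mol (ρ (ns j)) Z y)) ((fderiv ℝ A (mol (ρ (ns j)) Z x)).comp (fderiv ℝ (mol (ρ (ns j)) Z) x)) x :=
        (hA1.differentiable one_ne_zero _).hasFDerivAt.comp x ((sm j).differentiable one_ne_zero x).hasFDerivAt
      have h5 : pd s (fun x => A (mol (ρ (ns j)) Z x)) x = fderiv ℝ A (mol (ρ (ns j)) Z x) (pd s (mol (ρ (ns j)) Z) x) := by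
        unfold pd
        exact congrArg (fun L => L (basisVec s)) h4.fderiv
      rw [h5]
    have l3 := l2.neg
    simp_rw [← e2] at l3
    have := tendsto_nhds_unique l1 l3
    rw [h0] at this
    linarith
end reg
end DP

namespace DP
set_option linter.unusedSectionVars false
set_option linter.unusedVariables false
open Set
open scoped RealInnerProductSpace Topology

section lamsec
variable {m δ : ℝ}
def lam (m δ u : ℝ) : ℝ := (max (u - m) 0) ^ 2 / (max (u - m) 0 + δ)
def lam' (m δ u : ℝ) : ℝ := max (u - m) 0 * (max (u - m) 0 + 2 * δ) / (max (u - m) 0 + δ) ^ 2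

theorem lam_of_le {u : ℝ} (h : u ≤ m) : lam m δ u = 0 := by simp [lam, max_eq_right (sub_nonpos.2 h)]
theorem lam'_of_le {u : ℝ} (h : u ≤ m) : lam' m δ u = 0 := by simp [lam', max_eq_right (sub_nonpos.2 h)]

theorem lam_facts (hδ : 0 < δ) (hm : 0 ≤ m) {u : ℝ} (hu : 0 ≤ u) :
    0 ≤ lam m δ u ∧ lam m δ u ≤ max (u - m) 0 ∧ 0 ≤ lam' m δ u ∧ lam' m δ u ≤ 1 ∧
    lam m δ u ^ 2 ≤ lam' m δ u * (max (u - m) 0) ^ 2 ∧ max (u - m) 0 - δ ≤ lam m δ u ∧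
    lam m δ u ≤ u * lam' m δ u := by
  unfold lam lam'
  set x := max (u - m) 0 with hx
  have hx0 : 0 ≤ x := le_max_right _ _
  have hxu : x ≤ u := max_le (by linarith) hu
  have hd : 0 < x + δ := by linarith
  have hd2 : 0 < (x + δ) ^ 2 := by positivity
  refine ⟨by positivity, ?_, by positivity, ?_, ?_, ?_, ?_⟩
  · rw [div_le_iff₀ hd]; nlinarith
  · rw [div_le_one hd2]; nlinarith
  · rw [div_pow, div_mul_eq_mul_div]
    apply div_le_div_of_nonneg_right _ hd2.le
    have : 0 ≤ x ^ 3 * δ := by positivity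
    nlinarith
  · rw [le_div_iff₀ hd]; nlinarith [sq_nonneg δ]
  · rw [← mul_div_assoc, div_le_div_iff₀ hd hd2]
    have h1 : x * (x + δ) ≤ u * (x + 2 * δ) := by nlinarith
    have h2 : 0 ≤ x * (x + δ) := by positivity
    nlinarith [mul_le_mul_of_nonneg_left h1 h2]

theorem lam_deriv (hδ : 0 < δ) (u : ℝ) : HasDerivAt (lam m δ) (lam' m δ u) u := by
  rcases lt_trichotomy u m with h | h | h
  · rw [lam'_of_le h.le]
    refine (hasDerivAt_const u (0:ℝ)).congr_of_eventuallyEq ?_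
    filter_upwards [Iio_mem_nhds h] with y hy
    exact lam_of_le (le_of_lt hy)
  · subst h
    rw [lam'_of_le le_rfl, hasDerivAt_iff_isLittleO]
    rw [Asymptotics.isLittleO_iff]
    intro c hc
    filter_upwards [Metric.ball_mem_nhds u (mul_pos hc hδ)] with y hy
    rw [mem_ball, Real.dist_eq] at hy
    rw [lam_of_le (le_refl u)]
    simp only [sub_zero, smul_zero, Real.norm_eq_abs]
    unfold lam
    set x := max (y - u) 0
    have hx0 : 0 ≤ x := le_max_right _ _
    have hx1 : x ≤ |y - u| := max_le (le_abs_self _) (abs_nonneg _)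
    rw [abs_of_nonneg (by positivity), div_le_iff₀ (by positivity)]
    nlinarith [abs_nonneg (y - u), mul_nonneg hc.le (mul_nonneg (abs_nonneg (y-u)) hx0), mul_le_mul hx1 hx1 hx0 (abs_nonneg _)]
  · have e : lam' m δ u = (2 * (u - m) * (u - m + δ) - (u - m) ^ 2 * 1) / (u - m + δ) ^ 2 := by
      unfold lam'; rw [max_eq_left (by linarith)]; ring
    rw [e]
    have h1 : HasDerivAt (fun y => (y - m) ^ 2 / (y - m + δ)) ((2 * (u - m) * (u - m + δ) - (u - m) ^ 2 * 1) / (u - m + δ) ^ 2) u := by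
      have h2 : HasDerivAt (fun y : ℝ => (y - m) ^ 2) (2 * (u - m)) u := by
        simpa using ((hasDerivAt_id u).sub_const m).fun_pow 2
      have h3 : HasDerivAt (fun y : ℝ => y - m + δ) 1 u := ((hasDerivAt_id u).sub_const m).add_const δ
      exact h2.div h3 (by linarith)
    refine h1.congr_of_eventuallyEq ?_
    filter_upwards [Ioi_mem_nhds h] with y hy
    unfold lam
    rw [max_eq_left (by rw [mem_Ioi] at hy; linarith)]

theorem lam_cont (hδ : 0 < δ) : Continuous (lam m δ) :=
  continuous_iff_continuousAt.2 fun u => (lam_deriv hδ u).continuousAt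

theorem lam'_cont (hδ : 0 < δ) : Continuous (lam' m δ) := by
  unfold lam'
  refine Continuous.div (by fun_prop) (by fun_prop) fun u => ?_
  have : 0 ≤ max (u - m) 0 := le_max_right _ _
  positivity

/-- `lam ∘ √` and `lam ∘ √ / √` -/
def Lf (m δ v : ℝ) : ℝ := lam m δ √v
def Lf' (m δ v : ℝ) : ℝ := lam' m δ √v / (2 * max √v m)
def kf (m δ v : ℝ) : ℝ := lam m δ √v / max √v m
def kf' (m δ v : ℝ) : ℝ := (lam' m δ √v * √v - lam m δ √v) / (2 * (max √v m) ^ 3)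

theorem Lf_deriv (hδ : 0 < δ) (hm : 0 < m) (v : ℝ) : HasDerivAt (Lf m δ) (Lf' m δ v) v := by
  rcases lt_or_ge v (m ^ 2) with h | h
  · have h0 : ∀ y < m ^ 2, √y ≤ m := fun y hy => Real.sqrt_le_iff.2 ⟨hm.le, hy.le⟩
    have e : Lf' m δ v = 0 := by simp [Lf', lam'_of_le (h0 v h)]
    rw [e]
    refine (hasDerivAt_const v (0:ℝ)).congr_of_eventuallyEq ?_
    filter_upwards [Iio_mem_nhds h] with y hy
    exact lam_of_le (h0 y hy)
  · have hv : 0 < v := lt_of_lt_of_le (by positivity) h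
    have h1 := (lam_deriv (m := m) hδ √v).comp v (Real.hasDerivAt_sqrt hv.ne')
    have e : Lf' m δ v = lam' m δ √v * (1 / (2 * √v)) := by
      unfold Lf'
      rw [max_eq_left (Real.le_sqrt_of_sq_le h)]; ring
    rw [e]; exact h1

theorem kf_deriv (hδ : 0 < δ) (hm : 0 < m) (v : ℝ) : HasDerivAt (kf m δ) (kf' m δ v) v := by
  rcases lt_or_ge v (m ^ 2) with h | h
  · have h0 : ∀ y < m ^ 2, √y ≤ m := fun y hy => Real.sqrt_le_iff.2 ⟨hm.le, hy.le⟩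
    have e : kf' m δ v = 0 := by simp [kf', lam'_of_le (h0 v h), lam_of_le (h0 v h)]
    rw [e]
    refine (hasDerivAt_const v (0:ℝ)).congr_of_eventuallyEq ?_
    filter_upwards [Iio_mem_nhds h] with y hy
    simp [kf, lam_of_le (h0 y hy)]
  · have hv : 0 < v := lt_of_lt_of_le (by positivity) h
    have hs : 0 < √v := Real.sqrt_pos.2 hv
    have h2 : HasDerivAt (fun u => lam m δ u / u) ((lam' m δ √v * √v - lam m δ √v * 1) / √v ^ 2) √v :=
      (lam_deriv (m := m) hδ √v).div (hasDerivAt_id _) hs.ne'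
    have h1 := h2.comp v (Real.hasDerivAt_sqrt hv.ne')
    have e : kf' m δ v = (lam' m δ √v * √v - lam m δ √v * 1) / √v ^ 2 * (1 / (2 * √v)) := by
      unfold kf'
      rw [max_eq_left (Real.le_sqrt_of_sq_le h)]; field_simp
    rw [e]
    refine h1.congr_of_eventuallyEq ?_
    filter_upwards with y
    simp only [kf, Function.comp]
    rcases le_total √y m with h3 | h3
    · simp [lam_of_le h3]
    · rw [max_eq_left h3]

theorem Lf'_cont (hδ : 0 < δ) (hm : 0 < m) : Continuous (Lf' m δ) := by
  unfold Lf'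
  refine Continuous.div ((lam'_cont hδ).comp Real.continuous_sqrt) (by fun_prop) fun v => ?_
  have : 0 < max √v m := lt_max_of_lt_right hm
  positivity

theorem kf'_cont (hδ : 0 < δ) (hm : 0 < m) : Continuous (kf' m δ) := by
  unfold kf'
  refine Continuous.div ((((lam'_cont hδ).comp Real.continuous_sqrt).mul Real.continuous_sqrt).sub
    ((lam_cont hδ).comp Real.continuous_sqrt)) (by fun_prop) fun v => ?_
  have : 0 < max √v m := lt_max_of_lt_right hm
  positivity

/-- with `v = u^2` -/
theorem kf_facts (hδ : 0 < δ) (hm : 0 < m) {v : ℝ} (hv : 0 ≤ v) :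
    0 ≤ kf m δ v ∧ kf m δ v ≤ 1 ∧ kf m δ v * √v = lam m δ √v ∧ 0 ≤ kf' m δ v ∧
    kf m δ v + 2 * (v * kf' m δ v) = lam' m δ √v ∧ 2 * (v * kf' m δ v) ≤ 1 ∧
    0 ≤ Lf' m δ v ∧ 2 * √v * Lf' m δ v = lam' m δ √v := by
  have hs := Real.sqrt_nonneg v
  obtain ⟨f1, f2, f3, f4, f5, f6, f7⟩ := lam_facts hδ hm.le hs
  have hmx : 0 < max √v m := lt_max_of_lt_right hm
  have k0 : 0 ≤ kf m δ v := div_nonneg f1 hmx.le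
  have key : kf m δ v + 2 * (v * kf' m δ v) = lam' m δ √v := by
    rcases le_total √v m with h3 | h3
    · simp [kf, kf', lam_of_le h3, lam'_of_le h3]
    · have hs0 : 0 < √v := hm.trans_le h3
      unfold kf kf'
      rw [max_eq_left h3]
      have e : v = √v ^ 2 := (Real.sq_sqrt hv).symm
      set u := √v
      rw [e]
      field_simp
      ring
  have k1 : 0 ≤ kf' m δ v := div_nonneg (by nlinarith) (by positivity)
  refine ⟨k0, ?_, ?_, k1, key, by linarith, div_nonneg f3 (by positivity), ?_⟩
  · rw [kf, div_le_one hmx]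
    exact f2.trans (max_le ((sub_le_self _ hm.le).trans (le_max_left _ _)) hmx.le)
  · rcases le_total √v m with h3 | h3
    · simp [kf, lam_of_le h3]
    · rw [kf, max_eq_left h3]
      have : √v ≠ 0 := (hm.trans_le h3).ne'
      field_simp
  · rcases le_total √v m with h3 | h3
    · simp [Lf', lam'_of_le h3]
    · rw [Lf', max_eq_left h3]
      have : √v ≠ 0 := (hm.trans_le h3).ne'
      field_simp
end lamsec

section radial
variable {W : Type*} [NormedAddCommGroup W] [InnerProductSpace ℝ W] 
variable {κ κ' : ℝ → ℝ}

theorem rad_fderiv (h : ∀ s, 0 ≤ s → HasDerivAt κ (κ' s) s) (z : W) :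
    HasFDerivAt (fun z : W => κ (‖z‖ ^ 2)) ((2 * κ' (‖z‖ ^ 2)) • innerSL ℝ z) z := by
  have h1 : HasFDerivAt (fun z : W => ‖z‖ ^ 2) (2 • innerSL ℝ z) z := (hasStrictFDerivAt_norm_sq z).hasFDerivAt
  have h2 := (h (‖z‖ ^ 2) (sq_nonneg _)).comp_hasFDerivAt z h1
  have e : (2 * κ' (‖z‖ ^ 2)) • innerSL ℝ z = κ' (‖z‖ ^ 2) • (2 • innerSL ℝ z) := by
    ext y; simp; ring
  rw [e]; exact h2

theorem rad_smul_fderiv (h : ∀ s, 0 ≤ s → HasDerivAt κ (κ' s) s) (z : W) :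
    HasFDerivAt (fun z : W => κ (‖z‖ ^ 2) • z)
      (κ (‖z‖ ^ 2) • ContinuousLinearMap.id ℝ W + ((2 * κ' (‖z‖ ^ 2)) • innerSL ℝ z).smulRight z) z :=
  (rad_fderiv h z).smul (hasFDerivAt_id z)

theorem nsq_comp (h : ContinuousOn κ (Ici 0)) : Continuous (fun z : W => κ (‖z‖ ^ 2)) :=
  h.comp_continuous (by fun_prop) (fun z => mem_Ici.2 (sq_nonneg _))

theorem rad_cd (h : ∀ s, 0 ≤ s → HasDerivAt κ (κ' s) s) (hc : ContinuousOn κ' (Ici 0)) :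
    ContDiff ℝ 1 (fun z : W => κ (‖z‖ ^ 2)) := by
  refine contDiff_one_iff_hasFDerivAt.2 ⟨_, ?_, rad_fderiv h⟩
  exact (continuous_const.mul (nsq_comp hc)).smul (innerSL ℝ).continuous

theorem rad_smul_cd (h : ∀ s, 0 ≤ s → HasDerivAt κ (κ' s) s) (hc : ContinuousOn κ' (Ici 0)) :
    ContDiff ℝ 1 (fun z : W => κ (‖z‖ ^ 2) • z) := (rad_cd h hc).smul contDiff_id
end radial
end DP

namespace DP
set_option linter.unusedSectionVars false
set_option linter.unusedVariables false
open Set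
open scoped RealInnerProductSpace Topology

section tl
variable {X : Type*} [MeasurableSpace X] {μ : Measure X} {W : Type*} [NormedAddCommGroup W] [InnerProductSpace ℝ W]
  {W' : Type*} [NormedAddCommGroup W'] [InnerProductSpace ℝ W']

theorem TL.lip {Φ : W → W'} {C : ℝ} (hΦ : ∀ a b, ‖Φ b - Φ a‖ ≤ C * ‖b - a‖) {f : ℕ → X → W} {g : X → W}
    (h : TL μ f g) : TL μ (fun j x => Φ (f j x)) (fun x => Φ (g x)) := by
  have h1 : ∀ j, eLpNorm (fun x => Φ (f j x) - Φ (g x)) 2 μ ≤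
      ENNReal.ofReal C * eLpNorm (fun x => f j x - g x) 2 μ := fun j =>
    eLpNorm_le_mul_eLpNorm_of_ae_le_mul (Eventually.of_forall fun x => hΦ _ _) _
  have h2 : Tendsto (fun j => ENNReal.ofReal C * eLpNorm (fun x => f j x - g x) 2 μ) atTop (𝓝 0) := by
    have := ENNReal.Tendsto.const_mul (a := ENNReal.ofReal C) (h : Tendsto _ _ _) (Or.inr ENNReal.ofReal_ne_top)
    simpa using this
  exact tendsto_of_tendsto_of_tendsto_of_le_of_le tendsto_const_nhds h2 (fun _ => bot_le) h1

theorem memLp_lip {Φ : W → W'} {C : ℝ} (hΦ : ∀ a b, ‖Φ b - Φ a‖ ≤ C * ‖b - a‖) (h0 : Φ 0 = 0) (hc : Continuous Φ) {f : X → W}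
    (hf : MemLp f 2 μ) : MemLp (fun x => Φ (f x)) 2 μ := by
  refine (hf.norm.const_mul C).mono (hc.comp_aestronglyMeasurable hf.1) ?_
  filter_upwards with x
  refine le_trans ?_ (le_abs_self _)
  have := hΦ 0 (f x)
  simpa [h0] using this

theorem TL.sum {ι : Type*} (s : Finset ι) {f : ι → ℕ → X → W} {g : ι → X → W} (h : ∀ i, TL μ (f i) (g i))
    (hf : ∀ i j, MemLp (f i j) 2 μ) (hg : ∀ i, MemLp (g i) 2 μ) :
    TL μ (fun j x => ∑ i ∈ s, f i j x) (fun x => ∑ i ∈ s, g i x) := by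
  classical
  induction s using Finset.induction_on with
  | empty => simp [TL]
  | insert a s ha ih =>
    simp only [Finset.sum_insert ha]
    exact TL.add (h a) ih (hf a) (hg a) (fun j => memLp_finsetSum _ fun i _ => hf i j) (memLp_finsetSum _ fun i _ => hg i)

theorem lip_of_fderiv {Φ : W → W'} (h : ContDiff ℝ 1 Φ) {C : ℝ} (hC : ∀ z, ‖fderiv ℝ Φ z‖ ≤ C) (a b : W) :
    ‖Φ b - Φ a‖ ≤ C * ‖b - a‖ :=
  Convex.norm_image_sub_le_of_norm_fderiv_le (𝕜 := ℝ) (fun x _ => h.differentiable one_ne_zero x) (fun x _ => hC x)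
    convex_univ (mem_univ a) (mem_univ b)
end tl

section cid
variable {n : ℕ} {W0 W1 : Type*} [NormedAddCommGroup W0] [InnerProductSpace ℝ W0] [NormedAddCommGroup W1] [InnerProductSpace ℝ W1] [FiniteDimensional ℝ W0] [FiniteDimensional ℝ W1] [CompleteSpace W0] [CompleteSpace W1] (S : Sys n W0 W1)

theorem TF.pd_bdd {W : Type*} [NormedAddCommGroup W] [InnerProductSpace ℝ W] {O : Set (En n)} {η : En n → W} (hη : TF O η) : ∃ C, 0 ≤ C ∧ (∀ x, ‖η x‖ ≤ C) ∧ ∀ (i : Fin n) x, ‖DP.pd i η x‖ ≤ C := by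
  obtain ⟨C, hC⟩ := hη.1.continuous.bounded_above_of_compact_support hη.2.1
  choose D hD using fun i => (hη.pd i).1.continuous.bounded_above_of_compact_support (hη.pd i).2.1
  have hD0 : ∀ i, 0 ≤ D i := fun i => (norm_nonneg _).trans (hD i 0)
  have hC0 : 0 ≤ C := (norm_nonneg _).trans (hC 0)
  have hs : 0 ≤ ∑ i, D i := Finset.sum_nonneg fun i _ => hD0 i
  refine ⟨C + ∑ i, D i, by positivity, fun x => (hC x).trans (by linarith), fun i x => (hD i x).trans ?_⟩
  have := Finset.single_le_sum (fun i _ => hD0 i) (Finset.mem_univ i)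
  linarith

theorem cacc_id {A : W1 → W1} {O : Set (En n)} {Z : En n → W1} {g : Fin n → En n → W1} {Zj : ℕ → En n → W1}
    (hR : Reg S A O Z g Zj) (hA1 : ContDiff ℝ 1 A) {Λ : ℝ} (hAΛ : ∀ z, ‖fderiv ℝ A z‖ ≤ Λ)
    {Ψ : W1 → W1} (hΨ : ContDiff ℝ 1 Ψ) (hΨ0 : Ψ 0 = 0) {C : ℝ} (hΨC : ∀ z, ‖fderiv ℝ Ψ z‖ ≤ C)
    {η : En n → ℝ} (hη : TF O η) (s : Fin n) :
    Integrable (fun x => ⟪fderiv ℝ A (Z x) (g s x), ∑ i, ((η x ^ 2) • S.e i (S.es s (fderiv ℝ Ψ (Z x) (g i x))) +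
      (2 * η x * pd i η x) • S.e i (S.es s (Ψ (Z x))))⟫) ∧
    ∫ x, ⟪fderiv ℝ A (Z x) (g s x), ∑ i, ((η x ^ 2) • S.e i (S.es s (fderiv ℝ Ψ (Z x) (g i x))) +
      (2 * η x * pd i η x) • S.e i (S.es s (Ψ (Z x))))⟫ = 0 := by
  obtain ⟨B, hB0, hB1, hB2⟩ := hη.pd_bdd
  have hη1 : ContDiff ℝ 1 η := hη.1.of_le (by exact_mod_cast le_top)
  have hΨl := lip_of_fderiv hΨ hΨC
  have hΨc : Continuous (fderiv ℝ Ψ) := hΨ.continuous_fderiv one_ne_zero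
  have hAc : Continuous (fderiv ℝ A) := hA1.continuous_fderiv one_ne_zero
  have hC0 : 0 ≤ C := (norm_nonneg _).trans (hΨC 0)
  -- multipliers
  set L : Fin n → (W1 →L[ℝ] W1) := fun i => (S.e i).comp (S.es s) with hL
  set M1 : Fin n → (En n → W1) → En n → (W1 →L[ℝ] W1) := fun i f x => (η x ^ 2) • (L i).comp (fderiv ℝ Ψ (f x)) with hM1
  set M2 : Fin n → En n → (W1 →L[ℝ] W1) := fun i x => (2 * η x * pd i η x) • L i with hM2
  have bM1 : ∀ i f x, ‖M1 i f x‖ ≤ B ^ 2 * (‖L i‖ * C) := by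
    intro i f x
    simp only [hM1]
    rw [norm_smul, norm_pow]
    have h1 := (ContinuousLinearMap.opNorm_comp_le (L i) (fderiv ℝ Ψ (f x))).trans
      (mul_le_mul_of_nonneg_left (hΨC (f x)) (norm_nonneg _))
    have h2 := hB1 x
    gcongr
  have bM2 : ∀ i x, ‖M2 i x‖ ≤ (2 * B * B) * ‖L i‖ := by
    intro i x
    simp only [hM2]
    rw [norm_smul, norm_mul, norm_mul]
    have h2 := hB1 x
    have h3 := hB2 i x
    gcongr
    simp
  have cη2 : AEStronglyMeasurable (fun x => η x ^ 2) (volume : Measure (En n)) := (hη1.continuous.pow 2).aestronglyMeasurable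
  have mM1 : ∀ i f, AEStronglyMeasurable f volume → AEStronglyMeasurable (M1 i f) volume := by
    intro i f hf
    refine cη2.smul ?_
    have : Continuous fun z => (L i).comp (fderiv ℝ Ψ z) := continuous_const.clm_comp hΨc
    exact this.comp_aestronglyMeasurable hf
  have cM2 : ∀ i, AEStronglyMeasurable (M2 i) volume := by
    intro i
    exact (((continuous_const.mul hη1.continuous).mul (pd_cont hη1 i)).smul continuous_const).aestronglyMeasurable
  have m1 : ∀ i, MemLp (fun x => M1 i Z x (g i x)) 2 volume := fun i =>
    memLp_clm_apply (hR.mg i) (mM1 i Z hR.mZ.1) (Eventually.of_forall fun x => bM1 i Z x)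
  have m1j : ∀ i j, MemLp (fun x => M1 i (Zj j) x (pd i (Zj j) x)) 2 volume := fun i j =>
    memLp_clm_apply (hR.mgj i j) (mM1 i _ (hR.mZj j).1) (Eventually.of_forall fun x => bM1 i _ x)
  have m2 : ∀ i, MemLp (fun x => M2 i x (Ψ (Z x))) 2 volume := fun i =>
    memLp_clm_apply (memLp_lip hΨl hΨ0 hΨ.continuous hR.mZ) (cM2 i) (Eventually.of_forall fun x => bM2 i x)
  have m2j : ∀ i j, MemLp (fun x => M2 i x (Ψ (Zj j x))) 2 volume := fun i j =>
    memLp_clm_apply (memLp_lip hΨl hΨ0 hΨ.continuous (hR.mZj j)) (cM2 i) (Eventually.of_forall fun x => bM2 i x)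
  have t1 : ∀ i, TL volume (fun j x => M1 i (Zj j) x (pd i (Zj j) x)) (fun x => M1 i Z x (g i x)) := by
    intro i
    refine TL.mul (hR.tg i) (hR.mgj i) (hR.mg i) (fun j => mM1 i _ (hR.mZj j).1) (mM1 i Z hR.mZ.1)
      (fun j x => bM1 i _ x) ?_
    filter_upwards [hR.ae] with x hx
    have h0 : Continuous fun z => (L i).comp (fderiv ℝ Ψ z) := continuous_const.clm_comp hΨc
    exact ((h0.tendsto _).comp hx).const_smul (η x ^ 2)
  have t2 : ∀ i, TL volume (fun j x => M2 i x (Ψ (Zj j x))) (fun x => M2 i x (Ψ (Z x))) := by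
    intro i
    exact TL.mul (TL.lip hΨl hR.tZ) (fun j => memLp_lip hΨl hΨ0 hΨ.continuous (hR.mZj j)) (memLp_lip hΨl hΨ0 hΨ.continuous hR.mZ)
      (fun j => cM2 i) (cM2 i) (fun j x => bM2 i x) (Eventually.of_forall fun x => tendsto_const_nhds)
  have t3 := TL.sum Finset.univ (fun i => TL.add (t1 i) (t2 i) (m1j i) (m1 i) (m2j i) (m2 i))
    (fun i j => (m1j i j).add (m2j i j)) (fun i => (m1 i).add (m2 i))
  have mA : MemLp (fun x => fderiv ℝ A (Z x) (g s x)) 2 volume :=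
    memLp_clm_apply (hR.mg s) (hAc.comp_aestronglyMeasurable hR.mZ.1) (Eventually.of_forall fun x => hAΛ _)
  have mS : MemLp (fun x => ∑ i, (M1 i Z x (g i x) + M2 i x (Ψ (Z x)))) 2 volume :=
    memLp_finsetSum _ (fun i _ => (m1 i).add (m2 i))
  have l1 := TL.inner (TL_const (fun x => fderiv ℝ A (Z x) (g s x))) t3 (fun _ => mA) mA
    (fun j => memLp_finsetSum _ (fun i _ => (m1j i j).add (m2j i j))) mS
  have e1 : ∀ j, ∫ x, ⟪fderiv ℝ A (Z x) (g s x), ∑ i, (M1 i (Zj j) x (pd i (Zj j) x) + M2 i x (Ψ (Zj j x)))⟫ = 0 := by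
    intro j
    have hv : ContDiff ℝ 1 (fun x => S.es s (Ψ (Zj j x))) := (S.es s).contDiff.comp (hΨ.comp (hR.sm j))
    have hφ : TF1 O (fun x => η x ^ 2 • S.es s (Ψ (Zj j x))) := by
      have hsup : tsupport (fun x => η x ^ 2 • S.es s (Ψ (Zj j x))) ⊆ tsupport η := by
        refine closure_mono fun x hx h0 => hx ?_
        simp [h0]
      exact ⟨(hη1.pow 2).smul hv, hη.2.1.of_isClosed_subset (isClosed_tsupport _) hsup, hsup.trans hη.2.2⟩
    rw [← hR.eq s _ hφ]
    congr 1
    funext x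
    congr 1
    rw [Sys.d_mul S ((hη1.pow 2).differentiable one_ne_zero x) (hv.differentiable one_ne_zero x), Sys.d, Finset.smul_sum,
      ← Finset.sum_add_distrib]
    refine Finset.sum_congr rfl fun i _ => ?_
    have h4 : HasFDerivAt (fun y => S.es s (Ψ (Zj j y))) ((S.es s).comp ((fderiv ℝ Ψ (Zj j x)).comp (fderiv ℝ (Zj j) x))) x :=
      (S.es s).hasFDerivAt.comp x ((hΨ.differentiable one_ne_zero _).hasFDerivAt.comp x ((hR.sm j).differentiable one_ne_zero x).hasFDerivAt)
    have h5 : pd i (fun x => S.es s (Ψ (Zj j x))) x = S.es s (fderiv ℝ Ψ (Zj j x) (pd i (Zj j) x)) :=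
      congrArg (fun L => L (basisVec i)) h4.fderiv
    have h6 : pd i (fun x => η x ^ 2) x = 2 * η x * pd i η x := by
      have : HasFDerivAt (fun x => η x ^ 2) ((2 * η x) • fderiv ℝ η x) x := by
        have h0 := (hη1.differentiable one_ne_zero x).hasFDerivAt
        have := h0.fun_mul h0
        simp only [← sq] at this
        rwa [← add_smul, ← two_mul] at this
      exact (congrArg (fun L => L (basisVec i)) this.fderiv)
    rw [h5, h6]
    simp [hM1, hM2, hL]
  simp_rw [e1] at l1
  have := tendsto_nhds_unique l1 tendsto_const_nhds
  have hI := inner_intble mA mS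
  simp only [hM1, hM2, hL, smul_apply, ContinuousLinearMap.comp_apply] at this hI
  exact ⟨hI, this⟩

/-- translation bound for `f = η Φ(Z)` -/
theorem fk_trans {A : W1 → W1} {O : Set (En n)} {Z : En n → W1} {g : Fin n → En n → W1} {Zj : ℕ → En n → W1}
    (hR : Reg S A O Z g Zj) 
    {Φ : W1 → ℝ} (hΦ : ContDiff ℝ 1 Φ) (hΦ0 : Φ 0 = 0) {C : ℝ} (hΦC : ∀ z, ‖fderiv ℝ Φ z‖ ≤ C)
    {η : En n → ℝ} (hη : TF O η) :
    MemLp (fun x => η x * Φ (Z x)) 2 volume ∧ 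
    (∀ i, MemLp (fun x => pd i η x * Φ (Z x) + η x * fderiv ℝ Φ (Z x) (g i x)) 2 volume) ∧ ∀ h : En n,
    ∫ x, ‖η (x + h) * Φ (Z (x + h)) - η x * Φ (Z x)‖ ^ 2 ≤
      ‖h‖ ^ 2 * ∫ x, ∑ i, (pd i η x * Φ (Z x) + η x * fderiv ℝ Φ (Z x) (g i x)) ^ 2 := by
  obtain ⟨B, hB0, hB1, hB2⟩ := hη.pd_bdd
  have hη1 : ContDiff ℝ 1 η := hη.1.of_le (by exact_mod_cast le_top)
  have hΦl := lip_of_fderiv hΦ hΦC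
  have hΦc : Continuous (fderiv ℝ Φ) := hΦ.continuous_fderiv one_ne_zero
  have hC0 : 0 ≤ C := (norm_nonneg _).trans (hΦC 0)
  have mΦ := memLp_lip hΦl hΦ0 hΦ.continuous hR.mZ
  have mΦj := fun j => memLp_lip hΦl hΦ0 hΦ.continuous (hR.mZj j)
  have tΦ : TL volume (fun j x => Φ (Zj j x)) (fun x => Φ (Z x)) := TL.lip hΦl hR.tZ
  -- scalar multipliers
  have msc : ∀ {c : En n → ℝ} (hc : Continuous c) {D : ℝ} (hD : ∀ x, ‖c x‖ ≤ D) {f : En n → ℝ} (hf : MemLp f 2 volume),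
      MemLp (fun x => c x * f x) 2 volume := by
    intro c hc D hD f hf
    refine (hf.norm.const_mul D).mono (hc.aestronglyMeasurable.mul hf.1) ?_
    filter_upwards with x
    refine le_trans ?_ (le_abs_self _)
    rw [norm_mul]; gcongr; exact hD x
  have tsc : ∀ {c : En n → ℝ} (hc : Continuous c) {D : ℝ} (hD : ∀ x, ‖c x‖ ≤ D) {f : ℕ → En n → ℝ} {f' : En n → ℝ}
      (hf : TL volume f f'), TL volume (fun j x => c x * f j x) (fun x => c x * f' x) := by
    intro c hc D hD f f' hf
    have h1 : ∀ j, eLpNorm (fun x => c x * f j x - c x * f' x) 2 volume ≤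
        ENNReal.ofReal D * eLpNorm (fun x => f j x - f' x) 2 volume := fun j =>
      eLpNorm_le_mul_eLpNorm_of_ae_le_mul (Eventually.of_forall fun x => by
        rw [← mul_sub, norm_mul]; gcongr; exact hD x) _
    have h2 : Tendsto (fun j => ENNReal.ofReal D * eLpNorm (fun x => f j x - f' x) 2 volume) atTop (𝓝 0) := by
      have := ENNReal.Tendsto.const_mul (a := ENNReal.ofReal D) (hf : Tendsto _ _ _) (Or.inr ENNReal.ofReal_ne_top)
      simpa using this
    exact tendsto_of_tendsto_of_tendsto_of_le_of_le tendsto_const_nhds h2 (fun _ => bot_le) h1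
  have mD : ∀ i, MemLp (fun x => fderiv ℝ Φ (Z x) (g i x)) 2 volume := fun i =>
    memLp_clm_apply (hR.mg i) (hΦc.comp_aestronglyMeasurable hR.mZ.1) (Eventually.of_forall fun x => hΦC _)
  have mDj : ∀ i j, MemLp (fun x => fderiv ℝ Φ (Zj j x) (pd i (Zj j) x)) 2 volume := fun i j =>
    memLp_clm_apply (hR.mgj i j) (hΦc.comp_aestronglyMeasurable (hR.mZj j).1) (Eventually.of_forall fun x => hΦC _)
  have tD : ∀ i, TL volume (fun j x => fderiv ℝ Φ (Zj j x) (pd i (Zj j) x)) (fun x => fderiv ℝ Φ (Z x) (g i x)) := by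
    intro i
    refine TL.mul (hR.tg i) (hR.mgj i) (hR.mg i) (fun j => hΦc.comp_aestronglyMeasurable (hR.mZj j).1)
      (hΦc.comp_aestronglyMeasurable hR.mZ.1) (fun j x => hΦC _) ?_
    filter_upwards [hR.ae] with x hx
    exact (hΦc.tendsto _).comp hx
  have mF : ∀ i, MemLp (fun x => pd i η x * Φ (Z x) + η x * fderiv ℝ Φ (Z x) (g i x)) 2 volume := fun i =>
    (msc (pd_cont hη1 i) (hB2 i) mΦ).add (msc hη1.continuous hB1 (mD i))
  have mFj : ∀ i j, MemLp (fun x => pd i η x * Φ (Zj j x) + η x * fderiv ℝ Φ (Zj j x) (pd i (Zj j) x)) 2 volume := fun i j =>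
    (msc (pd_cont hη1 i) (hB2 i) (mΦj j)).add (msc hη1.continuous hB1 (mDj i j))
  have tF : ∀ i, TL volume (fun j x => pd i η x * Φ (Zj j x) + η x * fderiv ℝ Φ (Zj j x) (pd i (Zj j) x))
      (fun x => pd i η x * Φ (Z x) + η x * fderiv ℝ Φ (Z x) (g i x)) := fun i =>
    TL.add (tsc (pd_cont hη1 i) (hB2 i) tΦ) (tsc hη1.continuous hB1 (tD i)) 
      (fun j => msc (pd_cont hη1 i) (hB2 i) (mΦj j)) (msc (pd_cont hη1 i) (hB2 i) mΦ)
      (fun j => msc hη1.continuous hB1 (mDj i j)) (msc hη1.continuous hB1 (mD i))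
  have mf := msc hη1.continuous hB1 mΦ
  have mfj := fun j => msc hη1.continuous hB1 (mΦj j)
  have tf := tsc hη1.continuous hB1 tΦ
  refine ⟨mf, mF, fun h => ?_⟩
  -- difference
  have tsh : TL volume (fun j x => η (x + h) * Φ (Zj j (x + h)) - η x * Φ (Zj j x)) (fun x => η (x + h) * Φ (Z (x + h)) - η x * Φ (Z x)) := by
    have a1 : TL volume (fun j x => η (x + h) * Φ (Zj j (x + h))) (fun x => η (x + h) * Φ (Z (x + h))) := by
      have : ∀ j, eLpNorm (fun x => η (x + h) * Φ (Zj j (x + h)) - η (x + h) * Φ (Z (x + h))) 2 volume =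
        eLpNorm (fun x => η x * Φ (Zj j x) - η x * Φ (Z x)) 2 volume := fun j =>
          eLpNorm_trans ((mfj j).sub mf).1 2 h
      unfold TL at tf ⊢
      simpa only [this] using tf
    have a2 : TL volume (fun j x => (-1 : ℝ) * (η x * Φ (Zj j x))) (fun x => (-1 : ℝ) * (η x * Φ (Z x))) :=
      tsc continuous_const (D := 1) (by simp) tf
    have := TL.add a1 a2 (fun j => memLp_trans (mfj j) h) (memLp_trans mf h) (fun j => (mfj j).const_mul _) (mf.const_mul _)
    simpa [sub_eq_add_neg] using this
  have l1 := TL.normsq tsh (fun j => (memLp_trans (mfj j) h).sub (mfj j)) ((memLp_trans mf h).sub mf)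
  have l2 : Tendsto (fun j => ‖h‖ ^ 2 * ∑ i, ∫ x, ‖pd i η x * Φ (Zj j x) + η x * fderiv ℝ Φ (Zj j x) (pd i (Zj j) x)‖ ^ 2) atTop
      (𝓝 (‖h‖ ^ 2 * ∑ i, ∫ x, ‖pd i η x * Φ (Z x) + η x * fderiv ℝ Φ (Z x) (g i x)‖ ^ 2)) :=
    (tendsto_finsetSum _ fun i _ => TL.normsq (tF i) (mFj i) (mF i)).const_mul _
  have e0 : ∫ x, ∑ i, (pd i η x * Φ (Z x) + η x * fderiv ℝ Φ (Z x) (g i x)) ^ 2 =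
      ∑ i, ∫ x, ‖pd i η x * Φ (Z x) + η x * fderiv ℝ Φ (Z x) (g i x)‖ ^ 2 := by
    rw [← integral_finsetSum _ fun i _ => normsq_intble (mF i)]
    simp
  rw [e0]
  refine le_of_tendsto_of_tendsto' l1 l2 fun j => ?_
  have hG : ContDiff ℝ 1 (fun x => η x * Φ (Zj j x)) := hη1.mul (hΦ.comp (hR.sm j))
  have hfd : ∀ x, fderiv ℝ (fun x => η x * Φ (Zj j x)) x h = ∑ i, h i * (pd i η x * Φ (Zj j x) + η x * fderiv ℝ Φ (Zj j x) (pd i (Zj j) x)) := by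
    intro x
    have hb : h = ∑ i, h i • basisVec i := by
      have := (EuclideanSpace.basisFun (Fin n) ℝ).sum_repr h
      simpa [basisVec] using this.symm
    conv_lhs => rw [hb]
    rw [map_sum]
    refine Finset.sum_congr rfl fun i _ => ?_
    rw [map_smul, smul_eq_mul]
    congr 1
    have h4 : HasFDerivAt (fun y => Φ (Zj j y)) ((fderiv ℝ Φ (Zj j x)).comp (fderiv ℝ (Zj j) x)) x :=
      (hΦ.differentiable one_ne_zero _).hasFDerivAt.comp x ((hR.sm j).differentiable one_ne_zero x).hasFDerivAt
    have h5 := (hη1.differentiable one_ne_zero x).hasFDerivAt.fun_mul h4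
    rw [h5.fderiv]
    simp [pd]
    ring
  have mfd : MemLp (fun x => fderiv ℝ (fun x => η x * Φ (Zj j x)) x h) 2 volume := by
    simp_rw [hfd]
    exact memLp_finsetSum _ fun i _ => (mFj i j).const_mul _
  have h7 := trans_le hG h (C := eLpNorm (fun y => fderiv ℝ (fun x => η x * Φ (Zj j x)) y h) 2 volume) le_rfl
  have mdf : MemLp (fun x => η (x + h) * Φ (Zj j (x + h)) - η x * Φ (Zj j x)) 2 volume := (memLp_trans (mfj j) h).sub (mfj j)
  rw [← eLpNorm_sq mdf]
  have h8 := ENNReal.toReal_mono mfd.2.ne h7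
  have h9 := pow_le_pow_left₀ ENNReal.toReal_nonneg h8 2
  refine h9.trans ?_
  rw [eLpNorm_sq mfd, ← integral_finsetSum _ fun i _ => normsq_intble (mFj i j), ← integral_const_mul]
  refine integral_mono (normsq_intble mfd) ((integrable_finsetSum _ fun i _ => normsq_intble (mFj i j)).const_mul _) fun x => ?_
  simp only [hfd, Real.norm_eq_abs, sq_abs]
  rw [EuclideanSpace.real_norm_sq_eq]
  exact Finset.sum_mul_sq_le_sq_mul_sq _ _ _
end cid
end DP

namespace DP
set_option linter.unusedSectionVars false
set_option linter.unusedVariables false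
open Set
open scoped RealInnerProductSpace Topology

section pw
variable {n : ℕ} {W0 W1 : Type*} [NormedAddCommGroup W0] [InnerProductSpace ℝ W0] [NormedAddCommGroup W1] [InnerProductSpace ℝ W1] [FiniteDimensional ℝ W0] [FiniteDimensional ℝ W1] [CompleteSpace W0] [CompleteSpace W1] (S : Sys n W0 W1)

def Sys.C (z : W1) (b : Fin n → ℝ) : W0 := ∑ i, b i • S.es i z

def Sys.Ce : ℝ := √(∑ i, ‖S.es i‖ ^ 2)

theorem Sys.Ce_nonneg : 0 ≤ S.Ce := Real.sqrt_nonneg _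

theorem Sys.C_le (z : W1) (b : Fin n → ℝ) : ‖S.C z b‖ ≤ √(∑ i, b i ^ 2) * (S.Ce * ‖z‖) := by
  have h1 : ‖S.C z b‖ ≤ (∑ i, |b i| * ‖S.es i‖) * ‖z‖ := by
    rw [Finset.sum_mul]
    refine (norm_sum_le _ _).trans (Finset.sum_le_sum fun i _ => ?_)
    rw [norm_smul, Real.norm_eq_abs, mul_assoc]
    gcongr
    exact (S.es i).le_opNorm z
  have h2 : (∑ i, |b i| * ‖S.es i‖) ≤ √(∑ i, b i ^ 2) * S.Ce := by
    rw [Sys.Ce, ← Real.sqrt_mul (Finset.sum_nonneg fun i _ => sq_nonneg _)]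
    refine Real.le_sqrt_of_sq_le ?_
    have := Finset.sum_mul_sq_le_sq_mul_sq Finset.univ (fun i => |b i|) (fun i => ‖S.es i‖)
    simpa using this
  calc _ ≤ _ := h1
    _ ≤ (√(∑ i, b i ^ 2) * S.Ce) * ‖z‖ := by gcongr
    _ = _ := by ring

theorem Sys.C_inner (z : W1) (b c : Fin n → ℝ) :
    ∑ s, ∑ i, b s * (c i * ⟪z, S.e i (S.es s z)⟫) = ⟪S.C z c, S.C z b⟫ := by
  rw [Sys.C, Sys.C, sum_inner, Finset.sum_comm]
  refine Finset.sum_congr rfl fun i _ => ?_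
  rw [inner_sum]
  refine Finset.sum_congr rfl fun s _ => ?_
  rw [real_inner_smul_left, real_inner_smul_right, S.adj']
  ring

theorem pw_id (z : W1) (g : Fin n → W1) (hc : ∀ i, ∑ s, S.e s (S.es i (g s)) = g i) (c : Fin n → ℝ) (η G G' κ k' : ℝ) :
    ∑ s, ⟪G • g s + (2 * G' * ⟪z, g s⟫) • z, ∑ i, ((η ^ 2) • S.e i (S.es s (κ • g i + (2 * k' * ⟪z, g i⟫) • z)) +
      (2 * η * c i) • S.e i (S.es s (κ • z)))⟫ =
    η ^ 2 * (κ * G * (∑ i, ‖g i‖ ^ 2) + 2 * k' * G * (∑ i, ⟪z, g i⟫ ^ 2)) +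
    η ^ 2 * (2 * G' * κ * (∑ i, ⟪z, g i⟫ ^ 2) + 4 * G' * k' * ‖S.C z (fun i => ⟪z, g i⟫)‖ ^ 2) +
    2 * η * κ * (G * (∑ i, c i * ⟪z, g i⟫) + 2 * G' * ⟪S.C z c, S.C z (fun i => ⟪z, g i⟫)⟫) := by
  set τ : Fin n → ℝ := fun i => ⟪z, g i⟫ with hτ
  set y : Fin n → W1 := fun i => (η ^ 2 * κ) • g i + (η ^ 2 * (2 * k' * τ i) + 2 * η * c i * κ) • z with hy
  have e1 : ∀ s i, (η ^ 2) • S.e i (S.es s (κ • g i + (2 * k' * ⟪z, g i⟫) • z)) +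
      (2 * η * c i) • S.e i (S.es s (κ • z)) = S.e i (S.es s (y i)) := by
    intro s i
    simp only [hy, hτ, map_add, map_smul, smul_add, smul_smul, add_smul]
    rw [add_assoc]
  simp_rw [e1]
  have l1 : ∑ s, ∑ i, ⟪g s, S.e i (S.es s (y i))⟫ = ∑ i, ⟪g i, y i⟫ := by
    rw [Finset.sum_comm]
    refine Finset.sum_congr rfl fun i _ => ?_
    conv_rhs => rw [← hc i, sum_inner]
    refine Finset.sum_congr rfl fun s _ => ?_
    rw [S.adj', S.adj]
  have l2 : ∑ s, ∑ i, τ s * ⟪z, S.e i (S.es s (g i))⟫ = ∑ s, τ s ^ 2 := by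
    refine Finset.sum_congr rfl fun s _ => ?_
    rw [← Finset.mul_sum, ← inner_sum, hc s, sq]
  have l3 := S.C_inner z τ (fun i => η ^ 2 * (2 * k' * τ i) + 2 * η * c i * κ)
  have l4 : S.C z (fun i => η ^ 2 * (2 * k' * τ i) + 2 * η * c i * κ) = (η ^ 2 * (2 * k')) • S.C z τ + (2 * η * κ) • S.C z c := by
    simp only [Sys.C, Finset.smul_sum, ← Finset.sum_add_distrib, smul_smul, ← add_smul]
    refine Finset.sum_congr rfl fun i _ => ?_
    congr 1; ring
  rw [l4, inner_add_left, real_inner_smul_left, real_inner_smul_left, real_inner_self_eq_norm_sq] at l3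
  have l5 : ∑ i, ⟪g i, y i⟫ = η ^ 2 * κ * (∑ i, ‖g i‖ ^ 2) + η ^ 2 * (2 * k') * (∑ i, τ i ^ 2) + 2 * η * κ * ∑ i, c i * τ i := by
    simp only [Finset.mul_sum, ← Finset.sum_add_distrib]
    refine Finset.sum_congr rfl fun i _ => ?_
    simp only [hy, hτ, inner_add_right, real_inner_smul_right, real_inner_self_eq_norm_sq]
    rw [real_inner_comm z (g i)]
    ring
  have l6 : ∑ s, ⟪G • g s + (2 * G' * ⟪z, g s⟫) • z, ∑ i, S.e i (S.es s (y i))⟫ =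
      G * (∑ s, ∑ i, ⟪g s, S.e i (S.es s (y i))⟫) + 2 * G' * ((η ^ 2 * κ) * (∑ s, ∑ i, τ s * ⟪z, S.e i (S.es s (g i))⟫) +
        ∑ s, ∑ i, τ s * ((η ^ 2 * (2 * k' * τ i) + 2 * η * c i * κ) * ⟪z, S.e i (S.es s z)⟫)) := by
    simp only [Finset.mul_sum, ← Finset.sum_add_distrib]
    refine Finset.sum_congr rfl fun s _ => ?_
    rw [inner_sum]
    refine Finset.sum_congr rfl fun i _ => ?_
    rw [inner_add_left, real_inner_smul_left, real_inner_smul_left]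
    simp only [hy, map_add, map_smul, inner_add_right, real_inner_smul_right, hτ]
    ring
  rw [l6, l1, l2, l3, l5]
  ring

/-- the pointwise inequality -/
theorem pw_ineq {q G G' κ kp x lp lm s Ce η : ℝ} {sg st sc cc cz ip : ℝ} 
    (hq : 0 ≤ q) (hG : 0 ≤ G) (hG' : 0 ≤ G') (hs : 0 < s) (hsG : s * G' ≤ q * G)
    (hκ : 0 ≤ κ) (hkp : 0 ≤ kp) (h1 : κ * √(s * G) = lm) (h2 : κ + 2 * (s * G * kp) = lp) (h3 : lm ^ 2 ≤ lp * x ^ 2) (hx : 0 ≤ x)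
    (hst : 0 ≤ st) (hsts : st ≤ s * sg) (hsc : 0 ≤ sc) (hcc : |cc| ≤ √sc * √st) (hCe : 0 ≤ Ce)
    (hip : |ip| ≤ (√sc * (Ce * √s)) * (√st * (Ce * √s))) :
    lp * (G * st) ≤ s * (κ * G * sg + 2 * (kp * (G + s * G')) * G * st) ∧ 
    η ^ 2 / 2 * (κ * G * sg + 2 * (kp * (G + s * G')) * G * st) - 2 * (1 + 2 * q * Ce ^ 2) ^ 2 * (sc * x ^ 2) ≤
    η ^ 2 * (κ * G * sg + 2 * (kp * (G + s * G')) * G * st) + η ^ 2 * (2 * G' * κ * st + 4 * G' * (kp * (G + s * G')) * cz ^ 2) +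
      2 * η * κ * (G * cc + 2 * G' * ip) := by
  set D := κ * G * sg + 2 * (kp * (G + s * G')) * G * st with hD
  have hsg : 0 ≤ sg := by
    by_contra h
    push Not at h
    nlinarith
  have hD0 : 0 ≤ D := by positivity
  have a1 : lp * (G * st) ≤ s * D := by
    have e1 : lp * (G * st) = κ * G * st + 2 * (s * G * kp) * (G * st) := by rw [← h2]; ring
    have e2 : s * D = κ * G * (s * sg) + 2 * (s * G * kp) * (G * st) + 2 * (kp * (s * G')) * G * st * s := by rw [hD]; ring
    rw [e1, e2]
    have e3 : κ * G * st ≤ κ * G * (s * sg) := by gcongr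
    have e4 : 0 ≤ 2 * (kp * (s * G')) * G * st * s := by positivity
    linarith
  refine ⟨a1, ?_⟩
  -- (κ G √st)^2 ≤ x^2 D
  have a2 : (κ * G * √st) ^ 2 ≤ x ^ 2 * D := by
    have e1 : s * (κ * G * √st) ^ 2 = lm ^ 2 * (G * st) := by
      rw [← h1, mul_pow, mul_pow, mul_pow, Real.sq_sqrt hst, Real.sq_sqrt (by positivity)]; ring
    have e2 : s * (κ * G * √st) ^ 2 ≤ s * (x ^ 2 * D) := by
      rw [e1]
      calc lm ^ 2 * (G * st) ≤ lp * x ^ 2 * (G * st) := by gcongr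
        _ = x ^ 2 * (lp * (G * st)) := by ring
        _ ≤ x ^ 2 * (s * D) := by gcongr
        _ = _ := by ring
    exact le_of_mul_le_mul_left e2 hs
  have a3 : κ * G * √st ≤ x * √D := by
    rw [← Real.sqrt_sq (show 0 ≤ κ * G * √st by positivity)]
    rw [← Real.sqrt_sq hx, ← Real.sqrt_mul (sq_nonneg _)]
    exact Real.sqrt_le_sqrt a2
  have a4 : |G * cc + 2 * G' * ip| ≤ (1 + 2 * q * Ce ^ 2) * (√sc * (G * √st)) := by
    have e1 : |G * cc| ≤ G * (√sc * √st) := by rw [abs_mul, abs_of_nonneg hG]; gcongr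
    have e2 : |2 * G' * ip| ≤ 2 * (s * G') * Ce ^ 2 * (√sc * √st) := by
      rw [abs_mul, abs_of_nonneg (by positivity)]
      calc 2 * G' * |ip| ≤ 2 * G' * ((√sc * (Ce * √s)) * (√st * (Ce * √s))) := by gcongr
        _ = 2 * (√s ^ 2 * G') * Ce ^ 2 * (√sc * √st) := by ring
        _ = _ := by rw [Real.sq_sqrt hs.le]
    have e3 : 2 * (s * G') * Ce ^ 2 * (√sc * √st) ≤ 2 * (q * G) * Ce ^ 2 * (√sc * √st) := by gcongr
    calc _ ≤ |G * cc| + |2 * G' * ip| := abs_add_le _ _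
      _ ≤ G * (√sc * √st) + 2 * (q * G) * Ce ^ 2 * (√sc * √st) := by linarith
      _ = _ := by ring
  set K := 1 + 2 * q * Ce ^ 2 with hK
  have hK0 : 0 ≤ K := by positivity
  have a5 : |2 * η * κ * (G * cc + 2 * G' * ip)| ≤ 2 * (|η| * √D) * (K * (√sc * x)) := by
    rw [abs_mul, abs_mul, abs_mul, abs_of_nonneg hκ, abs_of_pos (two_pos)]
    calc 2 * |η| * κ * |G * cc + 2 * G' * ip| ≤ 2 * |η| * κ * (K * (√sc * (G * √st))) := by gcongr
      _ = 2 * |η| * K * √sc * (κ * G * √st) := by ring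
      _ ≤ 2 * |η| * K * √sc * (x * √D) := by gcongr
      _ = _ := by ring
  have a6 : 2 * (|η| * √D) * (K * (√sc * x)) ≤ η ^ 2 * D / 2 + 2 * K ^ 2 * (sc * x ^ 2) := by
    have e1 : (|η| * √D) ^ 2 = η ^ 2 * D := by rw [mul_pow, sq_abs, Real.sq_sqrt hD0]
    have e2 : (K * (√sc * x)) ^ 2 = K ^ 2 * (sc * x ^ 2) := by rw [mul_pow, mul_pow, Real.sq_sqrt hsc]
    nlinarith [sq_nonneg ((|η| * √D) - 2 * (K * (√sc * x)))]
  have a7 := neg_abs_le (2 * η * κ * (G * cc + 2 * G' * ip))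
  have a8 : 0 ≤ η ^ 2 * (2 * G' * κ * st + 4 * G' * (kp * (G + s * G')) * cz ^ 2) := by positivity
  linarith
end pw
end DP

namespace DP
set_option linter.unusedSectionVars false
set_option linter.unusedVariables false
open Set
open scoped RealInnerProductSpace Topology

section cc
variable {n : ℕ} {W0 W1 : Type*} [NormedAddCommGroup W0] [InnerProductSpace ℝ W0] [NormedAddCommGroup W1] [InnerProductSpace ℝ W1] [FiniteDimensional ℝ W0] [FiniteDimensional ℝ W1] [CompleteSpace W0] [CompleteSpace W1] (S : Sys n W0 W1)

def caccK (q : ℝ) : ℝ := 2 + 8 * (1 + q) ^ 2 * (1 + 2 * q * S.Ce ^ 2) ^ 2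

section funs
variable {q ε T m δ : ℝ} (hq : 0 < q) (hε : 0 < ε) (hT : 0 < T) (hm : 0 < m) (hδ : 0 < δ)
include hq hε hT hm hδ

theorem comp_v {κ κ' : ℝ → ℝ} (h : ∀ v, HasDerivAt κ (κ' v) v) {s : ℝ} (hs : 0 ≤ s) :
    HasDerivAt (fun s => κ (s * gR q ε T s)) (κ' (s * gR q ε T s) * (gR q ε T s + s * gR' q ε T s)) s := by
  have h1 : HasDerivAt (fun s => s * gR q ε T s) (1 * gR q ε T s + s * gR' q ε T s) s :=
    (hasDerivAt_id s).fun_mul (gR_deriv hε hT hs)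
  rw [one_mul] at h1
  exact (h _).comp s h1

theorem comp_v_cont {κ' : ℝ → ℝ} (h : Continuous κ') :
    ContinuousOn (fun s => κ' (s * gR q ε T s) * (gR q ε T s + s * gR' q ε T s)) (Ici 0) := by
  have h1 := (gfun_gR hq hε hT).cont
  have h2 := gR'_cont (q := q) hε hT
  exact (h.comp_continuousOn (continuousOn_id.mul h1)).mul (h1.add (continuousOn_id.mul h2))
end funs

theorem norm_rad (κ k' : ℝ) (z : W1) : ‖κ • ContinuousLinearMap.id ℝ W1 + ((2 * k') • innerSL ℝ z).smulRight z‖ ≤ |κ| + 2 * (‖z‖ ^ 2 * |k'|) := by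
  refine ContinuousLinearMap.opNorm_le_bound _ (by positivity) fun y => ?_
  simp only [add_apply, smul_apply, ContinuousLinearMap.id_apply, ContinuousLinearMap.smulRight_apply, innerSL_apply_apply]
  refine (norm_add_le _ _).trans ?_
  rw [norm_smul, norm_smul, smul_eq_mul, norm_mul, norm_mul]
  simp only [Real.norm_eq_abs, abs_two]
  have := abs_real_inner_le_norm z y
  calc |κ| * ‖y‖ + 2 * |k'| * |⟪z, y⟫| * ‖z‖ ≤ |κ| * ‖y‖ + 2 * |k'| * (‖z‖ * ‖y‖) * ‖z‖ := by gcongr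
    _ = _ := by ring

theorem sq_aux (a l η k t : ℝ) : (a * l + η * (2 * k * t)) ^ 2 ≤ 2 * l ^ 2 * a ^ 2 + 2 * η ^ 2 * (4 * k ^ 2 * t ^ 2) := by
  nlinarith [sq_nonneg (a * l - η * (2 * k * t))]

set_option maxHeartbeats 1000000 in
theorem cacc_fk {q ε T m δ : ℝ} (hq : 0 < q) (hε : 0 < ε) (hT : 0 < T) (hm : 0 < m) (hδ : 0 < δ)
    {O : Set (En n)} {Z : En n → W1} {g : Fin n → En n → W1} {Zj : ℕ → En n → W1}
    (hR : Reg S (gA (gR q ε T)) O Z g Zj) {η : En n → ℝ} (hη : TF O η) :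
    MemLp (fun x => η x * lam m δ ‖gV (gR q ε T) (Z x)‖) 2 volume ∧
    Integrable (fun x => (∑ i, pd i η x ^ 2) * (max (‖gV (gR q ε T) (Z x)‖ - m) 0) ^ 2) ∧
    ∀ h : En n, ∫ x, ‖η (x + h) * lam m δ ‖gV (gR q ε T) (Z (x + h))‖ - η x * lam m δ ‖gV (gR q ε T) (Z x)‖‖ ^ 2 ≤
      ‖h‖ ^ 2 * (caccK S q * ∫ x, (∑ i, pd i η x ^ 2) * (max (‖gV (gR q ε T) (Z x)‖ - m) 0) ^ 2) := by
  have hgf := gfun_gR hq hε hT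
  set G := gR q ε T with hG
  set G' := gR' q ε T with hG'
  have hG0 : ∀ s, 0 ≤ s → 0 ≤ G s := hgf.nonneg
  have hG'0 : ∀ s, 0 ≤ s → 0 ≤ G' s := fun s hs => gR'_nonneg hq hε hT hs
  have hsG : ∀ s, 0 ≤ s → s * G' s ≤ q * G s := fun s hs => gR'_le hq hε hT hs
  have hGd : ∀ s, 0 ≤ s → HasDerivAt G (G' s) s := fun s hs => gR_deriv hε hT hs
  set Λ := (ε + T) ^ q with hΛ
  have hGΛ : ∀ s, 0 ≤ s → G s ≤ Λ := fun s hs => gR_le hq hε hT hs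
  have hΛ0 : 0 ≤ Λ := (hG0 0 le_rfl).trans (hGΛ 0 le_rfl)
  set κ : ℝ → ℝ := fun s => kf m δ (s * G s) with hκ
  set κ' : ℝ → ℝ := fun s => kf' m δ (s * G s) * (G s + s * G' s) with hκ'
  set ℓ : ℝ → ℝ := fun s => Lf m δ (s * G s) with hℓ
  set ℓ' : ℝ → ℝ := fun s => Lf' m δ (s * G s) * (G s + s * G' s) with hℓ'
  have dκ : ∀ s, 0 ≤ s → HasDerivAt κ (κ' s) s := fun s hs => comp_v hq hε hT hm hδ (kf_deriv hδ hm) hs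
  have dℓ : ∀ s, 0 ≤ s → HasDerivAt ℓ (ℓ' s) s := fun s hs => comp_v hq hε hT hm hδ (Lf_deriv hδ hm) hs
  have cκ : ContinuousOn κ' (Ici 0) := comp_v_cont hq hε hT hm hδ (kf'_cont hδ hm)
  have cℓ : ContinuousOn ℓ' (Ici 0) := comp_v_cont hq hε hT hm hδ (Lf'_cont hδ hm)
  have nv : ∀ z : W1, ‖gV G z‖ = √(‖z‖ ^ 2 * G (‖z‖ ^ 2)) := fun z => by
    rw [← Real.sqrt_sq (norm_nonneg (gV G z)), norm_gV_sq hgf, mul_comm]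
  set A := gA (W := W1) G with hA
  set Ψ : W1 → W1 := fun z => κ (‖z‖ ^ 2) • z with hΨ
  set Φ : W1 → ℝ := fun z => ℓ (‖z‖ ^ 2) with hΦ
  have fA : ∀ z, fderiv ℝ A z = G (‖z‖ ^ 2) • ContinuousLinearMap.id ℝ W1 + ((2 * G' (‖z‖ ^ 2)) • innerSL ℝ z).smulRight z :=
    fun z => (rad_smul_fderiv hGd z).fderiv
  have fΨ : ∀ z, fderiv ℝ Ψ z = κ (‖z‖ ^ 2) • ContinuousLinearMap.id ℝ W1 + ((2 * κ' (‖z‖ ^ 2)) • innerSL ℝ z).smulRight z :=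
    fun z => (rad_smul_fderiv dκ z).fderiv
  have fΦ : ∀ z, fderiv ℝ Φ z = (2 * ℓ' (‖z‖ ^ 2)) • innerSL ℝ z := fun z => (rad_fderiv dℓ z).fderiv
  have kff := fun (s : ℝ) (hs : 0 ≤ s) => kf_facts hδ hm (mul_nonneg hs (hG0 s hs))
  have hA1 : ContDiff ℝ 1 A := rad_smul_cd hGd (gR'_cont hε hT)
  have hΨ1 : ContDiff ℝ 1 Ψ := rad_smul_cd dκ cκ
  have hΦ1 : ContDiff ℝ 1 Φ := rad_cd dℓ cℓ
  have hGG : ∀ s, 0 ≤ s → G s + s * G' s ≤ (1 + q) * G s := fun s hs => by have := hsG s hs; linarith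
  have hGG0 : ∀ s, 0 ≤ s → 0 ≤ G s + s * G' s := fun s hs => add_nonneg (hG0 s hs) (mul_nonneg hs (hG'0 s hs))
  have bA : ∀ z, ‖fderiv ℝ A z‖ ≤ (1 + 2 * q) * Λ := by
    intro z
    have hs := sq_nonneg ‖z‖
    rw [fA]
    refine (norm_rad _ _ z).trans ?_
    rw [abs_of_nonneg (hG0 _ hs), abs_of_nonneg (hG'0 _ hs)]
    have h1 := hsG _ hs
    have h2 := hGΛ _ hs
    nlinarith
  have bΨ : ∀ z, ‖fderiv ℝ Ψ z‖ ≤ 1 + (1 + q) := by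
    intro z
    have hs := sq_nonneg ‖z‖
    obtain ⟨k1, k2, k3, k4, k5, k6, k7, k8⟩ := kff _ hs
    rw [fΨ]
    refine (norm_rad _ _ z).trans ?_
    have hp : 0 ≤ κ' (‖z‖ ^ 2) := mul_nonneg k4 (hGG0 _ hs)
    rw [abs_of_nonneg k1, abs_of_nonneg hp]
    have h3 : 2 * (‖z‖ ^ 2 * κ' (‖z‖ ^ 2)) ≤ (1 + q) * (2 * (‖z‖ ^ 2 * G (‖z‖ ^ 2) * kf' m δ (‖z‖ ^ 2 * G (‖z‖ ^ 2)))) := by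
      simp only [hκ']
      calc _ ≤ 2 * (‖z‖ ^ 2 * (kf' m δ (‖z‖ ^ 2 * G (‖z‖ ^ 2)) * ((1 + q) * G (‖z‖ ^ 2)))) := by
            have := hGG _ hs
            gcongr
        _ = _ := by ring
    have h4 : (1 + q) * (2 * (‖z‖ ^ 2 * G (‖z‖ ^ 2) * kf' m δ (‖z‖ ^ 2 * G (‖z‖ ^ 2)))) ≤ (1 + q) * 1 := by gcongr
    linarith
  have bℓ : ∀ z : W1, 4 * (‖z‖ ^ 2 * G (‖z‖ ^ 2)) * ℓ' (‖z‖ ^ 2) ^ 2 ≤ lam' m δ ‖gV G z‖ * ((1 + q) * G (‖z‖ ^ 2)) ^ 2 := by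
    intro z
    have hs := sq_nonneg ‖z‖
    obtain ⟨k1, k2, k3, k4, k5, k6, k7, k8⟩ := kff _ hs
    obtain ⟨l1, l2, l3, l4, l5, l6, l7⟩ := lam_facts hδ hm.le (norm_nonneg (gV G z))
    rw [nv] at l3 l4 ⊢
    have hv := mul_nonneg hs (hG0 _ hs)
    set v := ‖z‖ ^ 2 * G (‖z‖ ^ 2)
    have e1 : 4 * v * ℓ' (‖z‖ ^ 2) ^ 2 = (2 * √v * Lf' m δ v) ^ 2 * (G (‖z‖ ^ 2) + ‖z‖ ^ 2 * G' (‖z‖ ^ 2)) ^ 2 := by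
      simp only [hℓ', mul_pow, Real.sq_sqrt hv]; ring
    rw [e1, k8]
    have h1 := hGG _ hs
    have h2 := hGG0 _ hs
    have h3 : lam' m δ √v ^ 2 ≤ lam' m δ √v := by nlinarith
    gcongr
  have bΦ : ∀ z, ‖fderiv ℝ Φ z‖ ≤ (1 + q) * √Λ := by
    intro z
    have hs := sq_nonneg ‖z‖
    rw [fΦ, norm_smul, innerSL_apply_norm]
    refine abs_le_of_sq_le_sq' ?_ (by positivity) |>.2
    rcases eq_or_lt_of_le (norm_nonneg z) with hz | hz
    · rw [← hz]; simp; positivity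
    have hGp : 0 < G (‖z‖ ^ 2) := lt_of_lt_of_le (Real.rpow_pos_of_pos hε q) (gR_ge hq hε hT hs)
    have h1 := bℓ z
    obtain ⟨l1, l2, l3, l4, l5, l6, l7⟩ := lam_facts hδ hm.le (norm_nonneg (gV G z))
    have h2 : lam' m δ ‖gV G z‖ * ((1 + q) * G (‖z‖ ^ 2)) ^ 2 ≤ 1 * ((1 + q) * G (‖z‖ ^ 2)) ^ 2 := by gcongr
    have h3 : G (‖z‖ ^ 2) * (4 * ‖z‖ ^ 2 * ℓ' (‖z‖ ^ 2) ^ 2) ≤ G (‖z‖ ^ 2) * ((1 + q) ^ 2 * G (‖z‖ ^ 2)) := by nlinarith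
    have h4 := le_of_mul_le_mul_left h3 hGp
    rw [mul_pow, mul_pow, Real.norm_eq_abs, sq_abs, mul_pow, Real.sq_sqrt hΛ0]
    have h5 : (1 + q) ^ 2 * G (‖z‖ ^ 2) ≤ (1 + q) ^ 2 * Λ := by gcongr; exact hGΛ _ hs
    linarith
  have Φeq : ∀ z, Φ z = lam m δ ‖gV G z‖ := fun z => by simp only [hΦ, hℓ, Lf, nv]
  have hΨ0 : Ψ 0 = 0 := by simp [hΨ]
  have hΦ0 : Φ 0 = 0 := by rw [Φeq, gV_zero]; exact lam_of_le (by simpa using hm.le)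
  obtain ⟨f1, f2, f3⟩ := fk_trans S hR hΦ1 hΦ0 bΦ hη
  simp only [Φeq] at f1 f2 f3
  obtain ⟨B, hB0, hB1, hB2⟩ := hη.pd_bdd
  have hη1 : ContDiff ℝ 1 η := hη.1.of_le (by exact_mod_cast le_top)
  have mV : MemLp (fun x => √Λ * ‖Z x‖) 2 volume := hR.mZ.norm.const_mul _
  have vΛ : ∀ z : W1, ‖gV G z‖ ≤ √Λ * ‖z‖ := fun z => by
    rw [norm_gV hgf]; gcongr; exact hGΛ _ (sq_nonneg _)
  have cV : Continuous (gV (W := W1) G) := by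
    have : Continuous fun z : W1 => √(G (‖z‖ ^ 2)) := (nsq_comp hgf.cont).sqrt
    exact this.smul continuous_id
  have mX : MemLp (fun x => max (‖gV G (Z x)‖ - m) 0) 2 volume := by
    refine mV.mono ?_ ?_
    · exact ((cV.norm.sub continuous_const).max continuous_const).comp_aestronglyMeasurable hR.mZ.1
    · filter_upwards with x
      rw [Real.norm_of_nonneg (le_max_right _ _), Real.norm_of_nonneg (by positivity)]
      exact max_le (by linarith [vΛ (Z x)]) (by positivity)
  have mI : Integrable (fun x => (∑ i, pd i η x ^ 2) * (max (‖gV G (Z x)‖ - m) 0) ^ 2) := by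
    have h1 := normsq_intble mX
    have hcont : Continuous fun x => ∑ i, pd i η x ^ 2 := continuous_finsetSum _ fun i _ => (pd_cont hη1 i).pow 2
    refine (h1.const_mul (∑ i : Fin n, B ^ 2)).mono (hcont.aestronglyMeasurable.mul ?_) ?_
    · exact ((((cV.norm.sub continuous_const).max continuous_const).pow 2)).comp_aestronglyMeasurable hR.mZ.1
    · filter_upwards with x
      rw [norm_mul, norm_mul]
      have : ‖∑ i, pd i η x ^ 2‖ ≤ ‖∑ i : Fin n, B ^ 2‖ := by
        rw [Real.norm_of_nonneg (Finset.sum_nonneg fun i _ => sq_nonneg _), Real.norm_of_nonneg (Finset.sum_nonneg fun i _ => sq_nonneg _)]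
        refine Finset.sum_le_sum fun i _ => ?_
        rw [← sq_abs]
        exact pow_le_pow_left₀ (abs_nonneg _) (hB2 i x) 2
      refine mul_le_mul this ?_ (norm_nonneg _) (norm_nonneg _)
      simp
  refine ⟨f1, mI, fun h => (f3 h).trans ?_⟩
  refine mul_le_mul_of_nonneg_left ?_ (sq_nonneg _)
  -- the main integral inequality
  have ci := fun s => cacc_id S hR hA1 bA hΨ1 hΨ0 bΨ hη s
  set P : Fin n → En n → ℝ := fun s x => ⟪fderiv ℝ A (Z x) (g s x), ∑ i, ((η x ^ 2) • S.e i (S.es s (fderiv ℝ Ψ (Z x) (g i x))) +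
      (2 * η x * pd i η x) • S.e i (S.es s (Ψ (Z x))))⟫ with hP
  have PI : Integrable (fun x => ∑ s, P s x) := integrable_finsetSum _ fun s _ => (ci s).1
  have P0 : ∫ x, ∑ s, P s x = 0 := by
    rw [integral_finsetSum _ fun s _ => (ci s).1]
    exact Finset.sum_eq_zero fun s _ => (ci s).2
  have goal : ∀ᵐ x, ∑ i, (pd i η x * lam m δ ‖gV G (Z x)‖ + η x * fderiv ℝ Φ (Z x) (g i x)) ^ 2 ≤
      4 * (1 + q) ^ 2 * (∑ s, P s x) + caccK S q * ((∑ i, pd i η x ^ 2) * (max (‖gV G (Z x)‖ - m) 0) ^ 2) := by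
    filter_upwards [hR.closed] with x hx
    by_cases hxO : x ∈ O
    swap
    · have h1 : η x = 0 := image_eq_zero_of_notMem_tsupport fun h => hxO (hη.2.2 h)
      have h2 : ∀ i, pd i η x = 0 := fun i => image_eq_zero_of_notMem_tsupport fun h => hxO ((hη.pd i).2.2 h)
      simp [h1, h2, hP]
    have hc := hx hxO
    have eP : ∀ s, P s x = ⟪G (‖Z x‖ ^ 2) • g s x + (2 * G' (‖Z x‖ ^ 2) * ⟪Z x, g s x⟫) • Z x,
        ∑ i, ((η x ^ 2) • S.e i (S.es s (κ (‖Z x‖ ^ 2) • g i x + (2 * κ' (‖Z x‖ ^ 2) * ⟪Z x, g i x⟫) • Z x)) +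
        (2 * η x * pd i η x) • S.e i (S.es s (κ (‖Z x‖ ^ 2) • Z x)))⟫ := by
      intro s
      have a1 : ∀ y, fderiv ℝ A (Z x) y = G (‖Z x‖ ^ 2) • y + (2 * G' (‖Z x‖ ^ 2) * ⟪Z x, y⟫) • Z x := fun y => by rw [fA]; rfl
      have a2 : ∀ y, fderiv ℝ Ψ (Z x) y = κ (‖Z x‖ ^ 2) • y + (2 * κ' (‖Z x‖ ^ 2) * ⟪Z x, y⟫) • Z x := fun y => by rw [fΨ]; rfl
      have a3 : Ψ (Z x) = κ (‖Z x‖ ^ 2) • Z x := rfl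
      simp only [hP]
      simp only [a1, a2, a3]
    simp_rw [eP]
    rw [pw_id S (Z x) (fun i => g i x) hc (fun i => pd i η x)]
    simp only [fΦ, smul_apply, innerSL_apply_apply, smul_eq_mul]
    have hs := sq_nonneg ‖Z x‖
    obtain ⟨l1, l2, l3, l4, l5, l6, l7⟩ := lam_facts hδ hm.le (norm_nonneg (gV G (Z x)))
    obtain ⟨k1, k2, k3, k4, k5, k6, k7, k8⟩ := kff _ hs
    rcases eq_or_lt_of_le (norm_nonneg (Z x)) with hz | hz
    · have hz' : Z x = 0 := norm_eq_zero.1 hz.symm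
      have hl0 : lam m δ ‖gV G (Z x)‖ = 0 := by rw [hz', gV_zero]; exact lam_of_le (by simpa using hm.le)
      have hκ0 : κ (‖Z x‖ ^ 2) = 0 := by
        change kf m δ (‖Z x‖ ^ 2 * G (‖Z x‖ ^ 2)) = 0
        rw [kf, ← nv, hl0, zero_div]
      have hc0 : S.C (Z x) (fun i => ⟪Z x, g i x⟫) = 0 := by simp [Sys.C, hz']
      have t0 : ∀ i, ⟪Z x, g i x⟫ = 0 := fun i => by rw [hz', inner_zero_left]
      have hn : 0 ≤ (∑ i, pd i η x ^ 2) * (max (‖gV G (Z x)‖ - m) 0) ^ 2 :=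
        mul_nonneg (Finset.sum_nonneg fun i _ => sq_nonneg _) (sq_nonneg _)
      have hK : 0 ≤ caccK S q := by unfold caccK; positivity
      rw [hl0, hκ0, hc0]
      simp only [t0]
      have := mul_nonneg hK hn
      simpa using this
    have hs' : 0 < ‖Z x‖ ^ 2 := by positivity
    have hGp : 0 < G (‖Z x‖ ^ 2) := lt_of_lt_of_le (Real.rpow_pos_of_pos hε q) (gR_ge hq hε hT hs)
    have bl := bℓ (Z x)
    rw [← nv] at k3 k5
    have hsqrt : √(‖Z x‖ ^ 2) = ‖Z x‖ := Real.sqrt_sq (norm_nonneg _)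
    obtain ⟨r1, r2⟩ := pw_ineq (x := max (‖gV G (Z x)‖ - m) 0) (η := η x) (Ce := S.Ce) (sg := ∑ i, ‖g i x‖ ^ 2) (st := ∑ i, ⟪Z x, g i x⟫ ^ 2)
      (sc := ∑ i, pd i η x ^ 2) (cc := ∑ i, pd i η x * ⟪Z x, g i x⟫) (cz := ‖S.C (Z x) (fun i => ⟪Z x, g i x⟫)‖)
      (ip := ⟪S.C (Z x) (fun i => pd i η x), S.C (Z x) (fun i => ⟪Z x, g i x⟫)⟫)
      hq.le hGp.le (hG'0 _ hs) hs' (hsG _ hs) k1 k4 (by rw [← nv]; exact k3) k5 l5 (le_max_right _ _)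
      (Finset.sum_nonneg fun i _ => sq_nonneg _) (by
        rw [Finset.mul_sum]
        refine Finset.sum_le_sum fun i _ => ?_
        rw [← mul_pow, ← sq_abs]
        exact pow_le_pow_left₀ (abs_nonneg _) (abs_real_inner_le_norm _ _) 2)
      (Finset.sum_nonneg fun i _ => sq_nonneg _) (by
        rw [← Real.sqrt_mul (Finset.sum_nonneg fun i _ => sq_nonneg _)]
        refine Real.abs_le_sqrt ?_
        exact Finset.sum_mul_sq_le_sq_mul_sq _ _ _)
      S.Ce_nonneg (by
        rw [hsqrt]
        refine (abs_real_inner_le_norm _ _).trans ?_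
        exact mul_le_mul (S.C_le _ _) (S.C_le _ _) (norm_nonneg _) (mul_nonneg (Real.sqrt_nonneg _) (mul_nonneg S.Ce_nonneg (norm_nonneg _))))
    change lam' m δ ‖gV G (Z x)‖ * _ ≤ ‖Z x‖ ^ 2 * (κ (‖Z x‖ ^ 2) * G (‖Z x‖ ^ 2) * _ + 2 * κ' (‖Z x‖ ^ 2) * G (‖Z x‖ ^ 2) * _) at r1
    change η x ^ 2 / 2 * (κ (‖Z x‖ ^ 2) * G (‖Z x‖ ^ 2) * _ + 2 * κ' (‖Z x‖ ^ 2) * G (‖Z x‖ ^ 2) * _) - _ ≤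
      η x ^ 2 * (κ (‖Z x‖ ^ 2) * G (‖Z x‖ ^ 2) * _ + 2 * κ' (‖Z x‖ ^ 2) * G (‖Z x‖ ^ 2) * _) + η x ^ 2 * (2 * G' (‖Z x‖ ^ 2) * κ (‖Z x‖ ^ 2) * _ +
      4 * G' (‖Z x‖ ^ 2) * κ' (‖Z x‖ ^ 2) * _) + 2 * η x * κ (‖Z x‖ ^ 2) * _ at r2
    set X := max (‖gV G (Z x)‖ - m) 0
    set sc := ∑ i, pd i η x ^ 2 with hsc
    set st := ∑ i, ⟪Z x, g i x⟫ ^ 2 with hst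
    set D := κ (‖Z x‖ ^ 2) * G (‖Z x‖ ^ 2) * (∑ i, ‖g i x‖ ^ 2) + 2 * κ' (‖Z x‖ ^ 2) * G (‖Z x‖ ^ 2) * st with hD
    have hst0 : 0 ≤ st := Finset.sum_nonneg fun i _ => sq_nonneg _
    have hsc0 : 0 ≤ sc := Finset.sum_nonneg fun i _ => sq_nonneg _
    have u1 : 4 * ℓ' (‖Z x‖ ^ 2) ^ 2 * st ≤ (1 + q) ^ 2 * D := by
      have hp := mul_pos hs' hGp
      refine le_of_mul_le_mul_left ?_ hp
      calc _ = (4 * (‖Z x‖ ^ 2 * G (‖Z x‖ ^ 2)) * ℓ' (‖Z x‖ ^ 2) ^ 2) * st := by ring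
        _ ≤ (lam' m δ ‖gV G (Z x)‖ * ((1 + q) * G (‖Z x‖ ^ 2)) ^ 2) * st := by gcongr
        _ = (1 + q) ^ 2 * G (‖Z x‖ ^ 2) * (lam' m δ ‖gV G (Z x)‖ * (G (‖Z x‖ ^ 2) * st)) := by ring
        _ ≤ (1 + q) ^ 2 * G (‖Z x‖ ^ 2) * (‖Z x‖ ^ 2 * D) := by gcongr
        _ = _ := by ring
    have u2 : ∑ i, (pd i η x * lam m δ ‖gV G (Z x)‖ + η x * (2 * ℓ' (‖Z x‖ ^ 2) * ⟪Z x, g i x⟫)) ^ 2 ≤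
        2 * lam m δ ‖gV G (Z x)‖ ^ 2 * sc + 2 * η x ^ 2 * (4 * ℓ' (‖Z x‖ ^ 2) ^ 2 * st) := by
      rw [hsc, hst]
      simp only [Finset.mul_sum, ← Finset.sum_add_distrib]
      refine Finset.sum_le_sum fun i _ => ?_
      exact sq_aux _ _ _ _ _
    have u3 : 2 * lam m δ ‖gV G (Z x)‖ ^ 2 * sc ≤ 2 * X ^ 2 * sc := by gcongr
    have u4 : 2 * η x ^ 2 * (4 * ℓ' (‖Z x‖ ^ 2) ^ 2 * st) ≤ 2 * η x ^ 2 * ((1 + q) ^ 2 * D) := by gcongr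
    refine u2.trans ((add_le_add u3 u4).trans ?_)
    have r3 := mul_le_mul_of_nonneg_left r2 (show 0 ≤ 4 * (1 + q) ^ 2 by positivity)
    unfold caccK
    linarith
  have hI2 : Integrable (fun x => ∑ i, (pd i η x * lam m δ ‖gV G (Z x)‖ + η x * fderiv ℝ Φ (Z x) (g i x)) ^ 2) := by
    refine integrable_finsetSum _ fun i _ => ?_
    simpa using normsq_intble (f2 i)
  have := integral_mono_ae hI2 ((PI.const_mul _).add (mI.const_mul _)) goal
  refine this.trans (le_of_eq ?_)
  simp only [Pi.add_apply]
  rw [integral_add (PI.const_mul _) (mI.const_mul _), integral_const_mul, integral_const_mul, P0]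
  simp
end cc
end DP

namespace DP
set_option linter.unusedSectionVars false
set_option linter.unusedVariables false
open Set
open scoped RealInnerProductSpace Topology

section fk
variable {n : ℕ}

theorem fk_meas {f : En n → ℝ} (hm : Measurable f) (hf : MemLp f 2 volume) {s : Set (En n)} (hs : ∀ᵐ x, x ∉ s → f x = 0)
    {ρ K : ℝ} (hρ : 0 < ρ) (hK : 0 ≤ K) (hv : 2 * volume s ≤ volume (ball (0 : En n) ρ))
    (ht : ∀ y : En n, ∫ x, ‖f (x + y) - f x‖ ^ 2 ≤ ‖y‖ ^ 2 * K) : ∫ x, ‖f x‖ ^ 2 ≤ ρ ^ 2 * K := by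
  set I := ∫ x, ‖f x‖ ^ 2 with hI
  have hI0 : 0 ≤ I := integral_nonneg fun x => sq_nonneg _
  set c := I - ρ ^ 2 * K / 2 with hc
  have hB : volume (ball (0 : En n) ρ) ≠ ⊤ := measure_ball_lt_top.ne
  have hB0 : volume (ball (0 : En n) ρ) ≠ 0 := (measure_ball_pos _ _ hρ).ne'
  -- lower bound
  have low : ∀ y ∈ ball (0 : En n) ρ, ENNReal.ofReal c ≤ ∫⁻ x, ‖f (x + y)‖ₑ * ‖f x‖ₑ := by
    intro y hy
    have hfy := memLp_trans hf y
    have i1 : Integrable (fun x => f (x + y) * f x) := by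
      have := inner_intble hf hfy
      simpa using this
    have i2 : ∫ x, ‖f (x + y)‖ ^ 2 = I := integral_add_right_eq_self (fun x => ‖f x‖ ^ 2) y
    have i3 : ∫ x, ‖f (x + y) - f x‖ ^ 2 = 2 * I - 2 * ∫ x, f (x + y) * f x := by
      have e : ∀ x, ‖f (x + y) - f x‖ ^ 2 = ‖f (x + y)‖ ^ 2 + ‖f x‖ ^ 2 - 2 * (f (x + y) * f x) := fun x => by
        simp only [Real.norm_eq_abs, sq_abs]; ring
      simp_rw [e]
      have j1 : Integrable (fun x => ‖f (x + y)‖ ^ 2 + ‖f x‖ ^ 2) := (normsq_intble hfy).add (normsq_intble hf)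
      rw [integral_sub j1 (i1.const_mul 2), integral_add (normsq_intble hfy) (normsq_intble hf),
        i2, integral_const_mul]
      ring
    have i4 := ht y
    rw [i3] at i4
    have hy' : ‖y‖ ^ 2 ≤ ρ ^ 2 := by
      have : ‖y‖ < ρ := by simpa using hy
      exact pow_le_pow_left₀ (norm_nonneg _) this.le 2
    have i5 : c ≤ ∫ x, f (x + y) * f x := by
      have := mul_le_mul_of_nonneg_right hy' hK
      rw [hc]; linarith
    have i6 : ∫ x, f (x + y) * f x ≤ ∫ x, ‖f (x + y) * f x‖ := integral_mono i1 i1.norm fun x => Real.le_norm_self _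
    calc ENNReal.ofReal c ≤ ENNReal.ofReal (∫ x, ‖f (x + y) * f x‖) := ENNReal.ofReal_le_ofReal (i5.trans i6)
      _ = ∫⁻ x, ‖f (x + y) * f x‖ₑ := ofReal_integral_norm_eq_lintegral_enorm i1
      _ = _ := by simp_rw [enorm_mul]
  have hm2 : Measurable (Function.uncurry fun (y x : En n) => ‖f (x + y)‖ₑ * ‖f x‖ₑ) := by
    have h1 : Measurable fun p : En n × En n => f (p.2 + p.1) := hm.comp (measurable_snd.add measurable_fst)
    exact h1.enorm.mul (hm.comp measurable_snd).enorm
  have up : ∫⁻ y in ball (0 : En n) ρ, ∫⁻ x, ‖f (x + y)‖ₑ * ‖f x‖ₑ ≤ (∫⁻ x, ‖f x‖ₑ) ^ 2 := by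
    calc _ ≤ ∫⁻ y, ∫⁻ x, ‖f (x + y)‖ₑ * ‖f x‖ₑ := setLIntegral_le_lintegral _ _
      _ = ∫⁻ x, ∫⁻ y, ‖f (x + y)‖ₑ * ‖f x‖ₑ := lintegral_lintegral_swap hm2.aemeasurable
      _ = ∫⁻ x, (∫⁻ y, ‖f y‖ₑ) * ‖f x‖ₑ := by
          congr 1; funext x
          rw [lintegral_mul_const' _ _ enorm_ne_top, lintegral_add_left_eq_self (fun y => ‖f y‖ₑ) x]
      _ = _ := by rw [lintegral_const_mul _ hm.enorm, sq]
  -- Hölder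
  set s' := toMeasurable volume s with hs'
  have hsv : volume s' = volume s := measure_toMeasurable s
  have ho : (∫⁻ x, ‖f x‖ₑ) ^ 2 ≤ volume s * ENNReal.ofReal I := by
    have e1 : ∫⁻ x, ‖f x‖ₑ = eLpNorm f 1 (volume.restrict s') := by
      rw [eLpNorm_one_eq_lintegral_enorm, ← lintegral_indicator (measurableSet_toMeasurable _ _)]
      refine lintegral_congr_ae ?_
      filter_upwards [hs] with x hx
      by_cases h : x ∈ s'
      · rw [indicator_of_mem h]
      · rw [indicator_of_notMem h, hx fun h' => h (subset_toMeasurable _ _ h')]; simp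
    have e2 := eLpNorm_le_eLpNorm_mul_rpow_measure_univ (p := 1) (q := 2) (μ := volume.restrict s') (by norm_num) (f := f) hf.1.restrict
    have e3 : eLpNorm f 2 (volume.restrict s') ≤ eLpNorm f 2 volume := eLpNorm_mono_measure _ Measure.restrict_le_self
    have e4 : eLpNorm f 2 volume ^ 2 = ENNReal.ofReal I := by
      rw [hI, ← eLpNorm_sq hf, ENNReal.ofReal_pow ENNReal.toReal_nonneg, ENNReal.ofReal_toReal hf.2.ne]
    rw [e1]
    calc _ ≤ (eLpNorm f 2 volume * (volume s) ^ (1 / 2 : ℝ)) ^ 2 := by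
          gcongr
          refine e2.trans ?_
          rw [Measure.restrict_apply_univ, hsv]
          norm_num
          gcongr
      _ = _ := by
          rw [mul_pow, e4, ← ENNReal.rpow_natCast, ← ENNReal.rpow_mul]
          norm_num
          rw [mul_comm]
  have fin : volume (ball (0 : En n) ρ) * (2 * ENNReal.ofReal c) ≤ volume (ball (0 : En n) ρ) * ENNReal.ofReal I := by
    calc volume (ball (0 : En n) ρ) * (2 * ENNReal.ofReal c) = 2 * ∫⁻ y in ball (0 : En n) ρ, ENNReal.ofReal c := by
          rw [setLIntegral_const]; ring
      _ ≤ 2 * ∫⁻ y in ball (0 : En n) ρ, ∫⁻ x, ‖f (x + y)‖ₑ * ‖f x‖ₑ := by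
          gcongr 2 * ?_
          exact setLIntegral_mono' measurableSet_ball low
      _ ≤ 2 * (volume s * ENNReal.ofReal I) := by gcongr; exact up.trans ho
      _ = 2 * volume s * ENNReal.ofReal I := by ring
      _ ≤ _ := by gcongr
  have f2 := (ENNReal.mul_le_mul_iff_right hB0 hB).1 fin
  have f3 : ENNReal.ofReal (2 * c) ≤ ENNReal.ofReal I := by
    rw [ENNReal.ofReal_mul (by norm_num)]
    simpa using f2
  have f4 := (ENNReal.ofReal_le_ofReal_iff hI0).1 f3
  rw [hc] at f4
  linarith

theorem fk {f : En n → ℝ} (hf : MemLp f 2 volume) {s : Set (En n)} (hs : ∀ x, x ∉ s → f x = 0)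
    {ρ K : ℝ} (hρ : 0 < ρ) (hK : 0 ≤ K) (hv : 2 * volume s ≤ volume (ball (0 : En n) ρ))
    (ht : ∀ y : En n, ∫ x, ‖f (x + y) - f x‖ ^ 2 ≤ ‖y‖ ^ 2 * K) : ∫ x, ‖f x‖ ^ 2 ≤ ρ ^ 2 * K := by
  have h1 := hf.1.ae_eq_mk
  set f' := hf.1.mk f with hf'
  have e1 : ∫ x, ‖f x‖ ^ 2 = ∫ x, ‖f' x‖ ^ 2 := by
    refine integral_congr_ae ?_
    filter_upwards [h1] with x hx
    rw [hx]
  rw [e1]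
  refine fk_meas hf.1.stronglyMeasurable_mk.measurable ((memLp_congr_ae h1).1 hf) ?_ hρ hK hv fun y => ?_
  · filter_upwards [h1] with x hx h
    exact hx.symm.trans (hs x h)
  · refine le_trans (le_of_eq ?_) (ht y)
    refine integral_congr_ae ?_
    have h2 := (measurePreserving_add_right volume y).quasiMeasurePreserving.ae_eq_comp h1
    filter_upwards [h1, h2] with x hx hx2
    simp only [Function.comp_apply] at hx2
    rw [hx, hx2]
end fk

section dg
variable {n : ℕ}
def vB (n : ℕ) : ℝ := volume.real (ball (0 : En n) 1)

theorem vB_pos : 0 < vB n := ENNReal.toReal_pos (measure_ball_pos _ _ one_pos).ne' measure_ball_lt_top.ne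

theorem vol_ball (x : En n) {r : ℝ} (hr : 0 < r) : volume.real (ball x r) = r ^ n * vB n := by
  rw [Measure.real, Measure.addHaar_ball_of_pos volume x hr, ENNReal.toReal_mul, ENNReal.toReal_ofReal (by positivity)]
  simp [vB, Measure.real]

theorem degiorgi {C : ℝ} (hC : 0 < C) : ∃ b, 0 < b ∧ ∀ (x : En n) (r : ℝ) (U : En n → ℝ), 0 < r → 
    MemLp U 2 (volume.restrict (ball x r)) →
    (∀ m r1 r2 ρ, 0 < m → 0 < r1 → r1 < r2 → r2 ≤ r → 0 < ρ → 2 * volume.real (ball x r2 ∩ {y | m < U y}) ≤ ρ ^ n * vB n →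
      ∫ y in ball x r1, (max (U y - m) 0) ^ 2 ≤ C * ρ ^ 2 / (r2 - r1) ^ 2 * ∫ y in ball x r2, (max (U y - m) 0) ^ 2) →
    ∀ m d, 0 ≤ m → 0 < d → ∫ y in ball x r, (max (U y - m) 0) ^ 2 ≤ b * r ^ n * d ^ 2 →
      ∀ᵐ y ∂(volume.restrict (ball x (r / 2))), U y ≤ m + d := by
  set μ : ℝ := (1 / 2) ^ n / 4 with hμ
  have hμ0 : 0 < μ := by positivity
  set σ : ℝ := √(μ / (16 * C)) with hσ
  have hσ0 : 0 < σ := Real.sqrt_pos.2 (by positivity)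
  have hσ2 : 16 * C * σ ^ 2 = μ := by rw [hσ, Real.sq_sqrt (by positivity)]; field_simp
  refine ⟨σ ^ n * vB n / 8, by have := vB_pos (n := n); positivity, fun x r U hr hU H m d hm hd hY => ?_⟩
  have hvB := vB_pos (n := n)
  set k : ℕ → ℝ := fun j => m + d * (1 - (1 / 2) ^ j) with hk
  set R : ℕ → ℝ := fun j => r * (1 / 2 + (1 / 2) ^ (j + 1)) with hR
  have hp : ∀ j : ℕ, (0:ℝ) < (1 / 2) ^ j := fun j => by positivity
  have hR0 : ∀ j, 0 < R j := fun j => by have := hp (j + 1); positivity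
  have hRr : ∀ j, R j ≤ r := fun j => by
    have : ((1:ℝ) / 2) ^ (j + 1) ≤ 1 / 2 := by rw [pow_succ]; have := pow_le_one₀ (n := j) (show (0:ℝ) ≤ 1 / 2 by norm_num) (by norm_num); linarith
    simp only [hR]; nlinarith
  have hRl : ∀ j, r / 2 ≤ R j := fun j => by have := mul_pos hr (hp (j + 1)); simp only [hR]; linarith
  have hUr : ∀ j, MemLp U 2 (volume.restrict (ball x (R j))) := fun j => hU.mono_measure (Measure.restrict_mono (ball_subset_ball (hRr j)) le_rfl)
  have hfin : ∀ j, IsFiniteMeasure (volume.restrict (ball x (R j))) := fun j => ⟨by simpa using measure_ball_lt_top⟩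
  have hI : ∀ j (l : ℝ), 0 ≤ l → IntegrableOn (fun y => (max (U y - l) 0) ^ 2) (ball x (R j)) := by
    intro j l hl
    have h1 : MemLp (fun y => max (U y - l) 0) 2 (volume.restrict (ball x (R j))) := by
      refine (hUr j).mono ?_ ?_
      · exact ((continuous_id.sub continuous_const).max continuous_const).comp_aestronglyMeasurable (hUr j).1
      · filter_upwards with y
        rw [Real.norm_of_nonneg (le_max_right _ _)]
        exact max_le (by linarith [Real.le_norm_self (U y)]) (norm_nonneg _)
    have h2 := h1.integrable_norm_pow (p := 2) (by norm_num)
    unfold IntegrableOn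
    simpa using h2
  set Y := ∫ y in ball x r, (max (U y - m) 0) ^ 2 with hYd
  have hY0 : 0 ≤ Y := integral_nonneg fun y => sq_nonneg _
  have mono1 : ∀ j (l l' : ℝ), 0 ≤ l → l ≤ l' → ∫ y in ball x (R j), (max (U y - l') 0) ^ 2 ≤ ∫ y in ball x (R j), (max (U y - l) 0) ^ 2 := by
    intro j l l' h0 h1
    refine setIntegral_mono (hI j l' (h0.trans h1)) (hI j l h0) fun y => ?_
    exact pow_le_pow_left₀ (le_max_right _ _) (max_le_max (by linarith) le_rfl) 2
  have hk0 : ∀ j, 0 ≤ k j := fun j => by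
    have : ((1:ℝ) / 2) ^ j ≤ 1 := pow_le_one₀ (by norm_num) (by norm_num)
    simp only [hk]; nlinarith
  have hkk : ∀ j, k (j + 1) - k j = d * (1 / 2) ^ (j + 1) := fun j => by simp only [hk, pow_succ]; ring
  have key : ∀ j, ∫ y in ball x (R j), (max (U y - k j) 0) ^ 2 ≤ Y * μ ^ j := by
    intro j
    induction j with
    | zero => simp [hk, hR, hYd]; norm_num
    | succ j ih =>
      have hkp : 0 < k (j + 1) := by
        have := hkk j
        have h2 := mul_pos hd (hp (j + 1))
        linarith [hk0 j]
      have hrr : R j - R (j + 1) = r * (1 / 2) ^ (j + 2) := by simp only [hR, pow_succ]; ring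
      set ρ := σ * r * (1 / 2) ^ j with hρ
      have hρ0 : 0 < ρ := by have := hp j; positivity
      have cheb : 2 * volume.real (ball x (R j) ∩ {y | k (j + 1) < U y}) ≤ ρ ^ n * vB n := by
        have := hfin j
        have c1 := mul_meas_ge_le_integral_of_nonneg (μ := volume.restrict (ball x (R j)))
          (f := fun y => (max (U y - k j) 0) ^ 2) (Eventually.of_forall fun y => sq_nonneg _) (hI j _ (hk0 j)) ((d * (1 / 2) ^ (j + 1)) ^ 2)
        have c2 : volume.real (ball x (R j) ∩ {y | k (j + 1) < U y}) ≤
            (volume.restrict (ball x (R j))).real {y | (d * (1 / 2) ^ (j + 1)) ^ 2 ≤ (max (U y - k j) 0) ^ 2} := by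
          have c3 : volume (ball x (R j) ∩ {y | k (j + 1) < U y}) ≤
            (volume.restrict (ball x (R j))) {y | (d * (1 / 2) ^ (j + 1)) ^ 2 ≤ (max (U y - k j) 0) ^ 2} := by
            rw [Measure.restrict_apply' measurableSet_ball, inter_comm]
            refine measure_mono (inter_subset_inter_left _ fun y hy => ?_)
            simp only [mem_ofPred_eq] at hy ⊢
            refine pow_le_pow_left₀ (mul_pos hd (hp _)).le ?_ 2
            refine le_trans ?_ (le_max_left _ _)
            linarith [hkk j]
          exact ENNReal.toReal_mono (measure_ne_top _ _) c3
        set v := volume.real (ball x (R j) ∩ {y | k (j + 1) < U y})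
        have c4 : (d * (1 / 2) ^ (j + 1)) ^ 2 * v ≤ Y * μ ^ j := by
          refine le_trans ?_ (c1.trans ih)
          gcongr
        have c5 : (d * (1 / 2) ^ (j + 1)) ^ 2 = d ^ 2 * (1 / 4) ^ j / 4 := by
          rw [mul_pow, ← pow_mul, mul_comm (j + 1) 2, pow_mul, pow_succ]; norm_num; ring
        have c6 : μ ^ j = ((1 / 2) ^ j) ^ n * (1 / 4) ^ j := by
          rw [hμ, div_eq_mul_one_div, mul_pow, ← pow_mul, ← pow_mul, mul_comm n j]
        rw [c5, c6] at c4
        have hq : (0:ℝ) < (1 / 4) ^ j := by positivity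
        have c7 : d ^ 2 * v ≤ 4 * (Y * ((1 / 2) ^ j) ^ n) := by
          refine le_of_mul_le_mul_right ?_ hq
          linarith
        have c8 : 4 * (Y * ((1 / 2) ^ j) ^ n) ≤ 4 * ((σ ^ n * vB n / 8 * r ^ n * d ^ 2) * ((1 / 2) ^ j) ^ n) := by gcongr
        have c9 : d ^ 2 * (2 * v) ≤ d ^ 2 * (ρ ^ n * vB n) := by
          have : ρ ^ n = σ ^ n * r ^ n * ((1 / 2) ^ j) ^ n := by rw [hρ, mul_pow, mul_pow]
          rw [this]
          linarith
        exact le_of_mul_le_mul_left c9 (by positivity)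
      have st := H (k (j + 1)) (R (j + 1)) (R j) ρ hkp (hR0 _) (by have := mul_pos hr (hp (j + 2)); linarith) (hRr j) hρ0 cheb
      refine st.trans ?_
      have e1 : C * ρ ^ 2 / (R j - R (j + 1)) ^ 2 = μ := by
        rw [← hσ2, hrr, hρ]
        have := hp j
        have e : ((1:ℝ) / 2) ^ (j + 2) = (1 / 2) ^ j / 4 := by rw [pow_add]; norm_num; ring
        rw [e]
        field_simp
        norm_num
      rw [e1, pow_succ]
      have e2 := mono1 j (k j) (k (j + 1)) (hk0 j) (by have := hkk j; have := mul_pos hd (hp (j + 1)); linarith)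
      calc _ ≤ μ * (Y * μ ^ j) := by gcongr; exact e2.trans ih
        _ = _ := by ring
  have hμ1 : μ < 1 := by
    have : ((1:ℝ) / 2) ^ n ≤ 1 := pow_le_one₀ (by norm_num) (by norm_num)
    rw [hμ]; linarith
  have hlim : Tendsto (fun j => Y * μ ^ j) atTop (𝓝 0) := by
    simpa using (tendsto_pow_atTop_nhds_zero_of_lt_one hμ0.le hμ1).const_mul Y
  have hI' : IntegrableOn (fun y => (max (U y - (m + d)) 0) ^ 2) (ball x (r / 2)) :=
    (hI 0 (m + d) (by positivity)).mono_set (ball_subset_ball (hRl 0))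
  have hle : ∫ y in ball x (r / 2), (max (U y - (m + d)) 0) ^ 2 ≤ 0 := by
    refine ge_of_tendsto' hlim fun j => ?_
    refine le_trans ?_ ((mono1 j (k j) (m + d) (hk0 j) ?_).trans (key j))
    · exact setIntegral_mono_set (hI j (m + d) (by positivity)) (Eventually.of_forall fun y => sq_nonneg _) (ball_subset_ball (hRl j)).eventuallyLE
    · simp only [hk]; have := mul_pos hd (hp j); linarith
  have h0 := (integral_eq_zero_iff_of_nonneg (fun y => sq_nonneg _) hI').1 (le_antisymm hle (integral_nonneg fun y => sq_nonneg _))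
  filter_upwards [h0] with y hy
  have : max (U y - (m + d)) 0 = 0 := by simpa using hy
  have := le_max_left (U y - (m + d)) 0
  linarith
end dg
end DP

namespace DP
set_option linter.unusedSectionVars false
set_option linter.unusedVariables false
open Set
open scoped RealInnerProductSpace Topology


section cut
variable {n : ℕ}

theorem st_deriv_bdd : ∃ K, 0 < K ∧ ∀ s, |deriv Real.smoothTransition s| ≤ K := by
  have hc : Continuous (deriv Real.smoothTransition) :=
    (Real.smoothTransition.contDiff (n := 1)).continuous_deriv le_rfl
  obtain ⟨K, hK⟩ := isCompact_Icc.exists_bound_of_continuousOn (s := Icc (0:ℝ) 1) hc.continuousOn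
  refine ⟨max K 1, by positivity, fun s => ?_⟩
  by_cases h : s ∈ Icc (0:ℝ) 1
  · exact (hK s h).trans (le_max_left _ _)
  · have h0 : deriv Real.smoothTransition s = 0 := by
      rw [mem_Icc, not_and_or, not_le, not_le] at h
      rcases h with h | h
      · have : Real.smoothTransition =ᶠ[𝓝 s] fun _ => 0 := by
          filter_upwards [eventually_lt_nhds h] with t ht
          exact Real.smoothTransition.zero_of_nonpos ht.le
        rw [this.deriv_eq]; simp
      · have : Real.smoothTransition =ᶠ[𝓝 s] fun _ => 1 := by
          filter_upwards [eventually_gt_nhds h] with t ht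
          exact Real.smoothTransition.one_of_one_le ht.le
        rw [this.deriv_eq]; simp
    rw [h0, abs_zero]; positivity

theorem exists_cut : ∃ K, 0 < K ∧ ∀ (x : En n) (r1 r2 : ℝ), 0 < r1 → r1 < r2 → ∃ η : En n → ℝ, TF (ball x r2) η ∧
    (∀ y, 0 ≤ η y) ∧ (∀ y, η y ≤ 1) ∧ (∀ y ∈ ball x r1, η y = 1) ∧ (∀ y, y ∉ ball x r2 → η y = 0) ∧
    (∀ y, ∑ i, pd i η y ^ 2 ≤ K / (r2 - r1) ^ 2) ∧ (∀ y, y ∉ ball x r2 → ∑ i, pd i η y ^ 2 = 0) := by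
  obtain ⟨K, hK, hKb⟩ := st_deriv_bdd
  refine ⟨16 * K ^ 2, by positivity, fun x r1 r2 h1 h12 => ?_⟩
  set t := (r1 + r2) / 2 with ht
  have ht1 : r1 < t := by rw [ht]; linarith
  have ht2 : t < r2 := by rw [ht]; linarith
  set D := t ^ 2 - r1 ^ 2 with hD
  have hDe : D = (t - r1) * (t + r1) := by rw [hD]; ring
  have hD0 : 0 < D := by rw [hDe]; exact mul_pos (by linarith) (by linarith)
  set η : En n → ℝ := fun y => Real.smoothTransition ((t ^ 2 - ‖y - x‖ ^ 2) / D) with hη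
  have hz : ∀ y, y ∉ closedBall x t → η y = 0 := by
    intro y hy
    rw [mem_closedBall, dist_eq_norm, not_le] at hy
    refine Real.smoothTransition.zero_of_nonpos (div_nonpos_of_nonpos_of_nonneg ?_ hD0.le)
    have := pow_le_pow_left₀ (by linarith) hy.le 2
    linarith
  have hts : tsupport η ⊆ closedBall x t := closure_minimal (fun y hy => by
    by_contra h; exact hy (hz y h)) isClosed_closedBall
  have hcd : ContDiff ℝ (⊤ : ℕ∞) η := by
    refine Real.smoothTransition.contDiff.comp ?_
    exact (contDiff_const.sub ((contDiff_id.sub contDiff_const).norm_sq ℝ)).div_const _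
  have hcs : HasCompactSupport η := HasCompactSupport.of_support_subset_isCompact (isCompact_closedBall x t) ((subset_tsupport _).trans hts)
  have hpd : ∀ i y, pd i η y = deriv Real.smoothTransition ((t ^ 2 - ‖y - x‖ ^ 2) / D) * (-2 * (y - x) i / D) := by
    intro i y
    have a1 : HasFDerivAt (fun y : En n => ‖y - x‖ ^ 2) ((2 : ℝ) • innerSL ℝ (y - x)) y := by
      simpa [two_smul] using ((hasFDerivAt_id y).sub_const x).norm_sq
    have a2 : HasFDerivAt (fun y : En n => (t ^ 2 - ‖y - x‖ ^ 2) / D) (D⁻¹ • (-((2 : ℝ) • innerSL ℝ (y - x)))) y := by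
      simpa [div_eq_inv_mul] using (a1.const_sub (t ^ 2)).const_mul D⁻¹
    have a3 : HasDerivAt Real.smoothTransition (deriv Real.smoothTransition ((t ^ 2 - ‖y - x‖ ^ 2) / D)) ((t ^ 2 - ‖y - x‖ ^ 2) / D) :=
      ((Real.smoothTransition.contDiff (n := 1)).differentiable one_ne_zero _).hasDerivAt
    have a4 : HasFDerivAt η (deriv Real.smoothTransition ((t ^ 2 - ‖y - x‖ ^ 2) / D) • (D⁻¹ • (-((2 : ℝ) • innerSL ℝ (y - x))))) y := by
      have a6 := HasDerivAt.comp_hasFDerivAt (f := fun y : En n => (t ^ 2 - ‖y - x‖ ^ 2) / D) y a3 a2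
      exact a6
    have a5 := congrArg (fun L => L (basisVec i)) a4.fderiv
    simp only [pd]
    rw [a5]
    simp [basisVec, EuclideanSpace.inner_single_right]
    ring
  have hout : ∀ y, y ∉ closedBall x t → ∀ i, pd i η y = 0 := by
    intro y hy i
    have : fderiv ℝ η y = 0 := fderiv_of_notMem_tsupport ℝ (fun h => hy (hts h))
    simp [pd, this]
  refine ⟨η, ⟨hcd, hcs, hts.trans (closedBall_subset_ball ht2)⟩, fun y => Real.smoothTransition.nonneg _,
    fun y => Real.smoothTransition.le_one _, ?_, fun y hy => hz y fun h => hy (closedBall_subset_ball ht2 h), ?_,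
    fun y hy => Finset.sum_eq_zero fun i _ => by rw [hout y (fun h => hy (closedBall_subset_ball ht2 h))]; simp⟩
  · intro y hy
    rw [mem_ball, dist_eq_norm] at hy
    refine Real.smoothTransition.one_of_one_le ((one_le_div hD0).2 ?_)
    have := pow_le_pow_left₀ (norm_nonneg _) hy.le 2
    rw [hD]; linarith
  · intro y
    by_cases hy : y ∈ closedBall x t
    · rw [mem_closedBall, dist_eq_norm] at hy
      set s := (t ^ 2 - ‖y - x‖ ^ 2) / D with hs
      have e1 : ∑ i, pd i η y ^ 2 = deriv Real.smoothTransition s ^ 2 * (4 * ‖y - x‖ ^ 2 / D ^ 2) := by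
        simp_rw [hpd, EuclideanSpace.real_norm_sq_eq, Finset.mul_sum, Finset.sum_div, Finset.mul_sum]
        refine Finset.sum_congr rfl fun i _ => ?_
        rw [hs, EuclideanSpace.real_norm_sq_eq]
        ring
      have e2 : deriv Real.smoothTransition s ^ 2 ≤ K ^ 2 := by
        rw [← sq_abs]; exact pow_le_pow_left₀ (abs_nonneg _) (hKb s) 2
      have e3 : 4 * ‖y - x‖ ^ 2 / D ^ 2 ≤ 16 / (r2 - r1) ^ 2 := by
        have h3 : 0 < r2 - r1 := by linarith
        rw [div_le_div_iff₀ (by positivity) (by positivity)]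
        have h4 : ‖y - x‖ * (r2 - r1) ≤ 2 * D := by
          calc ‖y - x‖ * (r2 - r1) ≤ t * (r2 - r1) := by gcongr
            _ ≤ 2 * D := by
              rw [hDe, ht]
              nlinarith
        have := pow_le_pow_left₀ (by positivity) h4 2
        nlinarith
      rw [e1]
      calc _ ≤ K ^ 2 * (16 / (r2 - r1) ^ 2) := by gcongr
        _ = _ := by ring
    · rw [Finset.sum_eq_zero fun i _ => by rw [hout y hy]; simp]
      positivity
end cut

section sup
variable {n : ℕ} {W0 W1 : Type*} [NormedAddCommGroup W0] [InnerProductSpace ℝ W0] [NormedAddCommGroup W1] [InnerProductSpace ℝ W1] [FiniteDimensional ℝ W0] [FiniteDimensional ℝ W1] [CompleteSpace W0] [CompleteSpace W1] (S : Sys n W0 W1)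

theorem gV_memLp {q ε T : ℝ} (hq : 0 < q) (hε : 0 < ε) (hT : 0 < T) {H : En n → W1} (hH : MemLp H 2 volume) :
    MemLp (fun y => ‖gV (gR q ε T) (H y)‖) 2 volume := by
  have hG := gfun_gR hq hε hT
  have hc : Continuous (fun z : W1 => √(gR q ε T (‖z‖ ^ 2)) • z) :=
    (Real.continuous_sqrt.comp (nsq_comp hG.cont)).smul continuous_id
  refine MemLp.norm (hH.of_le_mul (c := √((ε + T) ^ q)) (hc.comp_aestronglyMeasurable hH.1) ?_)
  filter_upwards with y
  show ‖√(gR q ε T (‖H y‖ ^ 2)) • H y‖ ≤ _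
  rw [norm_smul, Real.norm_of_nonneg (Real.sqrt_nonneg _)]
  gcongr
  exact gR_le hq hε hT (sq_nonneg _)

theorem intOn_pos {U : En n → ℝ} (hU : MemLp U 2 volume) (m : ℝ) (hm : 0 ≤ m) : Integrable (fun y => (max (U y - m) 0) ^ 2) ∧
    MemLp (fun y => max (U y - m) 0) 2 volume := by
  have h1 : MemLp (fun y => max (U y - m) 0) 2 volume := by
    refine hU.mono ?_ ?_
    · exact ((continuous_id.sub continuous_const).max continuous_const).comp_aestronglyMeasurable hU.1
    · filter_upwards with y
      rw [Real.norm_of_nonneg (le_max_right _ _)]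
      exact max_le (by linarith [Real.le_norm_self (U y)]) (norm_nonneg _)
  have h2 := h1.integrable_norm_pow (p := 2) (by norm_num)
  exact ⟨by simpa using h2, h1⟩

set_option maxHeartbeats 1000000 in
theorem step : ∃ K, 0 < K ∧ ∀ (q ε T : ℝ) (hq : 0 < q) (hε : 0 < ε) (hT : 0 < T) (x : En n) (r : ℝ) (H : En n → W1), MemLp H 2 volume →
    WC S (ball x r) H → (∀ X, InX S (ball x r) X → ∫ y, ⟪gA (gR q ε T) (H y), X y⟫ = 0) →
    ∀ m r1 r2 ρ, 0 < m → 0 < r1 → r1 < r2 → r2 ≤ r → 0 < ρ →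
      2 * volume.real (ball x r2 ∩ {y | m < ‖gV (gR q ε T) (H y)‖}) ≤ ρ ^ n * vB n →
      ∫ y in ball x r1, (max (‖gV (gR q ε T) (H y)‖ - m) 0) ^ 2 ≤
        (caccK S q * K) * ρ ^ 2 / (r2 - r1) ^ 2 * ∫ y in ball x r2, (max (‖gV (gR q ε T) (H y)‖ - m) 0) ^ 2 := by
  obtain ⟨K, hK, hcut⟩ := exists_cut (n := n)
  refine ⟨4 * K, by positivity, ?_⟩
  intro q ε T hq hε hT x r H hH hW ho m r1 r2 ρ hm h1 h12 h2r hρ hv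
  have hG := gfun_gR hq hε hT
  set t := (r1 + r2) / 2 with ht
  have ht1 : r1 < t := by rw [ht]; linarith
  have ht2 : t < r2 := by rw [ht]; linarith
  obtain ⟨η, hη, hη0, hη1, hηe, hηz, hηd, hηdz⟩ := hcut x r1 t h1 ht1
  obtain ⟨χ, hχ, -, -, hχe, -⟩ := hcut x t r2 (by linarith) ht2
  have hA1 : ContDiff ℝ 1 (gA (W := W1) (gR q ε T)) := rad_smul_cd (fun s hs => gR_deriv hε hT hs) (gR'_cont hε hT)
  have hεq : 0 < ε ^ q := Real.rpow_pos_of_pos hε q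
  have hmono : ∀ a b : W1, ε ^ q * ‖b - a‖ ^ 2 ≤ ⟪gA (gR q ε T) b - gA (gR q ε T) a, b - a⟫ := fun a b => by
    refine le_trans ?_ (hG.mono_A a b)
    gcongr
    have e1 := gR_ge hq hε hT (sq_nonneg ‖a‖)
    have e2 := gR_ge hq hε hT (sq_nonneg ‖b‖)
    linarith
  have hlip := fun a b : W1 => hG.A_lip (Λ := (ε + T) ^ q) (fun s hs => gR_le hq hε hT hs) a b
  obtain ⟨Z, g, Zj, hR, hZH⟩ := reg_exists S hA1 (by simp [gA]) hεq (by positivity) hmono hlip isOpen_ball isOpen_ball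
    (ball_subset_ball (ht2.le.trans h2r)) hH hW ho (χ := χ) ⟨hχ.1, hχ.2.1, hχ.2.2.trans (ball_subset_ball h2r)⟩ hχe
  set U : En n → ℝ := fun y => ‖gV (gR q ε T) (H y)‖ with hU
  have hUm : MemLp U 2 volume := gV_memLp hq hε hT hH
  obtain ⟨hP, hPm⟩ := intOn_pos hUm m hm.le
  have hP1 : IntegrableOn (fun y => max (U y - m) 0) (ball x r1) := by
    have hfin : IsFiniteMeasure (volume.restrict (ball x r1)) := ⟨by simpa using measure_ball_lt_top⟩
    exact (hPm.restrict _).integrable (by norm_num)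
  have hC0 : 0 ≤ caccK S q := by unfold caccK; positivity
  set I2 := ∫ y in ball x r2, (max (U y - m) 0) ^ 2 with hI2
  have hr : 0 < r2 - r1 := by linarith
  have key : ∀ δ : ℝ, 0 < δ → ∫ y in ball x r1, (max (U y - m) 0) ^ 2 ≤ (caccK S q * (4 * K)) * ρ ^ 2 / (r2 - r1) ^ 2 * I2 +
      2 * δ * ∫ y in ball x r1, max (U y - m) 0 := by
    intro δ hδ
    obtain ⟨k1, k2, k3⟩ := cacc_fk S hq hε hT hm hδ hR hη
    set f : En n → ℝ := fun x => η x * lam m δ ‖gV (gR q ε T) (Z x)‖ with hf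
    have hI : 0 ≤ ∫ x, (∑ i, pd i η x ^ 2) * (max (‖gV (gR q ε T) (Z x)‖ - m) 0) ^ 2 :=
      integral_nonneg fun y => mul_nonneg (Finset.sum_nonneg fun i _ => sq_nonneg _) (sq_nonneg _)
    have hvol : 2 * volume (ball x r2 ∩ {y | m < U y}) ≤ volume (ball (0 : En n) ρ) := by
      have hfin : volume (ball x r2 ∩ {y | m < U y}) ≠ ⊤ := ((measure_mono inter_subset_left).trans_lt measure_ball_lt_top).ne
      rw [← vol_ball (0 : En n) hρ] at hv
      refine (ENNReal.toReal_le_toReal (ENNReal.mul_ne_top (by norm_num) hfin) measure_ball_lt_top.ne).1 ?_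
      rw [ENNReal.toReal_mul]
      exact hv
    have hs : ∀ y, y ∉ ball x r2 ∩ {y | m < U y} → f y = 0 := by
      intro y hy
      by_cases hyt : y ∈ ball x t
      · have : ¬ m < U y := fun h => hy ⟨ball_subset_ball ht2.le hyt, h⟩
        rw [hf]
        simp only
        rw [hZH y hyt, lam_of_le (not_lt.1 this), mul_zero]
      · simp [hf, hηz y hyt]
    have f1 := fk k1 hs hρ (mul_nonneg hC0 hI) hvol k3
    have f2 : ∫ x, (∑ i, pd i η x ^ 2) * (max (‖gV (gR q ε T) (Z x)‖ - m) 0) ^ 2 ≤ 4 * K / (r2 - r1) ^ 2 * I2 := by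
      rw [hI2, ← integral_const_mul, ← integral_indicator measurableSet_ball]
      refine integral_mono k2 ((hP.const_mul _).indicator measurableSet_ball) fun y => ?_
      by_cases hyt : y ∈ ball x t
      · rw [indicator_of_mem (ball_subset_ball ht2.le hyt)]
        simp only
        rw [hZH y hyt]
        refine mul_le_mul_of_nonneg_right ((hηd y).trans (le_of_eq ?_)) (sq_nonneg _)
        have : t - r1 = (r2 - r1) / 2 := by rw [ht]; ring
        rw [this]; field_simp; norm_num
      · simp only
        rw [hηdz y hyt, zero_mul]
        exact indicator_nonneg (fun y _ => by positivity) _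
    have f3 : ∫ y in ball x r1, (max (U y - m) 0) ^ 2 ≤ ∫ y in ball x r1, (‖f y‖ ^ 2 + 2 * δ * max (U y - m) 0) := by
      refine setIntegral_mono_on hP.integrableOn ((normsq_intble k1).integrableOn.add (hP1.const_mul _)) measurableSet_ball fun y hy => ?_
      have l1 := lam_facts hδ hm.le (norm_nonneg (gV (gR q ε T) (H y)))
      have : f y = lam m δ (U y) := by
        simp only [hf]
        rw [hηe y hy, hZH y (ball_subset_ball ht1.le hy), one_mul]
      rw [this, Real.norm_eq_abs, sq_abs]
      have l0 : 0 ≤ max (U y - m) 0 := le_max_right _ _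
      have l2 : max (U y - m) 0 - δ ≤ lam m δ (U y) := l1.2.2.2.2.2.1
      have l3 : 0 ≤ lam m δ (U y) := l1.1
      rcases le_total (max (U y - m) 0) δ with h | h
      · nlinarith [mul_le_mul_of_nonneg_left h l0]
      · have := pow_le_pow_left₀ (sub_nonneg.2 h) l2 2
        nlinarith
    have f4 : ∫ y in ball x r1, (‖f y‖ ^ 2 + 2 * δ * max (U y - m) 0) = (∫ y in ball x r1, ‖f y‖ ^ 2) + 2 * δ * ∫ y in ball x r1, max (U y - m) 0 := by
      rw [integral_add (normsq_intble k1).integrableOn (hP1.const_mul _), integral_const_mul]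
    have f5 : ∫ y in ball x r1, ‖f y‖ ^ 2 ≤ ∫ y, ‖f y‖ ^ 2 :=
      setIntegral_le_integral (normsq_intble k1) (Eventually.of_forall fun y => sq_nonneg _)
    have f6 : ρ ^ 2 * (caccK S q * ∫ x, (∑ i, pd i η x ^ 2) * (max (‖gV (gR q ε T) (Z x)‖ - m) 0) ^ 2) ≤
        (caccK S q * (4 * K)) * ρ ^ 2 / (r2 - r1) ^ 2 * I2 := by
      calc _ ≤ ρ ^ 2 * (caccK S q * (4 * K / (r2 - r1) ^ 2 * I2)) := by gcongr
        _ = _ := by ring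
    linarith
  have hlim : Tendsto (fun δ : ℝ => (caccK S q * (4 * K)) * ρ ^ 2 / (r2 - r1) ^ 2 * I2 +
      2 * δ * ∫ y in ball x r1, max (U y - m) 0) (𝓝[>] 0) (𝓝 ((caccK S q * (4 * K)) * ρ ^ 2 / (r2 - r1) ^ 2 * I2)) := by
    have : ContinuousAt (fun δ : ℝ => (caccK S q * (4 * K)) * ρ ^ 2 / (r2 - r1) ^ 2 * I2 +
      2 * δ * ∫ y in ball x r1, max (U y - m) 0) 0 := by fun_prop
    have h := this.tendsto.mono_left (nhdsWithin_le_nhds (s := Ioi 0))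
    simpa using h
  refine ge_of_tendsto hlim ?_
  filter_upwards [self_mem_nhdsWithin] with δ hδ using key δ hδ

theorem supbound {q : ℝ} (hq : 0 < q) : ∃ b, 0 < b ∧ ∀ (ε T : ℝ) (hε : 0 < ε) (hT : 0 < T) (x : En n) (r : ℝ) (hr : 0 < r) (H : En n → W1), MemLp H 2 volume →
    WC S (ball x r) H → (∀ X, InX S (ball x r) X → ∫ y, ⟪gA (gR q ε T) (H y), X y⟫ = 0) →
    ∀ m d, 0 ≤ m → 0 < d → ∫ y in ball x r, (max (‖gV (gR q ε T) (H y)‖ - m) 0) ^ 2 ≤ b * r ^ n * d ^ 2 →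
      ∀ᵐ y ∂(volume.restrict (ball x (r / 2))), ‖gV (gR q ε T) (H y)‖ ≤ m + d := by
  obtain ⟨K, hK, hst⟩ := step S
  have hC0 : 0 < caccK S q := by unfold caccK; positivity
  obtain ⟨b, hb, hdg⟩ := degiorgi (n := n) (mul_pos hC0 hK)
  refine ⟨b, hb, fun ε T hε hT x r hr H hH hW ho m d hm hd h => ?_⟩
  exact hdg x r (fun y => ‖gV (gR q ε T) (H y)‖) hr ((gV_memLp hq hε hT hH).restrict _)
    (fun m r1 r2 ρ h1 h2 h3 h4 h5 h6 => hst q ε T hq hε hT x r H hH hW ho m r1 r2 ρ h1 h2 h3 h4 h5 h6) m d hm hd h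
end sup
end DP

namespace DP
set_option linter.unusedSectionVars false
set_option linter.unusedVariables false
open Set
open scoped RealInnerProductSpace Topology


theorem num_iter {Λ θ δ : ℝ} (hΛ : 1 ≤ Λ) (hδ : 0 < δ) (hθ : 6 * Λ ^ 2 * θ ≤ 1) {a t e : ℕ → ℝ}
    (ha : ∀ j, 0 ≤ a j) (ht : ∀ j, 0 ≤ t j) (hs : ∀ J, ∑ j ∈ Finset.range J, t j ≤ θ)
    (he : ∀ j, e j = t j * a j + δ / 2 ^ j)
    (h : ∀ j, a (j + 1) ≤ Λ * (Λ * (a 0 + ∑ i ∈ Finset.range j, e i + ∑ i ∈ Finset.range (j + 1), e i) + e j)) (j : ℕ) :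
    a j ≤ 2 * Λ ^ 2 * (a 0 + 6 * δ) := by
  have hgeo : ∀ J, ∑ i ∈ Finset.range J, δ / 2 ^ i ≤ 2 * δ := by
    intro J
    have : ∑ i ∈ Finset.range J, δ / 2 ^ i = 2 * δ - 2 * δ / 2 ^ J := by
      induction J with
      | zero => simp
      | succ J ih => rw [Finset.sum_range_succ, ih, pow_succ]; field_simp; ring
    rw [this]
    have : 0 < 2 * δ / 2 ^ J := by positivity
    linarith
  have hΛ2 : 1 ≤ Λ ^ 2 := one_le_pow₀ hΛ
  have he0 : ∀ j, 0 ≤ e j := fun j => by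
    rw [he]
    have := mul_nonneg (ht j) (ha j)
    positivity
  set A := 2 * Λ ^ 2 * (a 0 + 6 * δ) with hA
  have ha0 := ha 0
  have hA0 : 0 ≤ A := by positivity
  induction j using Nat.strong_induction_on with
  | _ j ih =>
    rcases j with _ | j
    · rw [hA]; nlinarith
    · have hle : ∀ J ≤ j + 1, ∑ i ∈ Finset.range J, e i ≤ θ * A + 2 * δ := by
        intro J hJ
        calc ∑ i ∈ Finset.range J, e i ≤ ∑ i ∈ Finset.range J, (t i * A + δ / 2 ^ i) := by
              refine Finset.sum_le_sum fun i hi => ?_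
              rw [he]
              have := mul_le_mul_of_nonneg_left (ih i (by have := Finset.mem_range.1 hi; omega)) (ht i)
              linarith
          _ = (∑ i ∈ Finset.range J, t i) * A + ∑ i ∈ Finset.range J, δ / 2 ^ i := by
              rw [Finset.sum_add_distrib, Finset.sum_mul]
          _ ≤ _ := by
              have := mul_le_mul_of_nonneg_right (hs J) hA0
              have := hgeo J
              linarith
      set X := θ * A + 2 * δ with hX
      have h1 := hle j (by omega)
      have h2 := hle (j + 1) le_rfl
      have h3 : e j ≤ X := (Finset.single_le_sum (f := e) (fun i _ => he0 i) (Finset.self_mem_range_succ j)).trans h2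
      have hX0 : 0 ≤ X := (he0 j).trans h3
      calc a (j + 1) ≤ Λ * (Λ * (a 0 + X + X) + X) := by
            refine (h j).trans ?_
            gcongr
        _ ≤ Λ * (Λ * (a 0 + X + X) + Λ * X) := by
            gcongr
            nlinarith
        _ = Λ ^ 2 * (a 0 + 6 * δ) + (6 * Λ ^ 2 * θ) * (A / 2) := by rw [hX]; ring
        _ ≤ Λ ^ 2 * (a 0 + 6 * δ) + 1 * (A / 2) := by gcongr
        _ = A := by rw [hA]; ring

section iter
variable {n : ℕ} {W0 W1 : Type*} [NormedAddCommGroup W0] [InnerProductSpace ℝ W0] [NormedAddCommGroup W1] [InnerProductSpace ℝ W1] [FiniteDimensional ℝ W0] [FiniteDimensional ℝ W1] [CompleteSpace W0] [CompleteSpace W1] (S : Sys n W0 W1)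

theorem sq2 (a b : ℝ) : (a + b) ^ 2 ≤ 2 * a ^ 2 + 2 * b ^ 2 := by nlinarith [sq_nonneg (a - b)]

set_option maxHeartbeats 2000000 in
theorem iter {q : ℝ} (hq : 0 < q) : ∃ θ C : ℝ, 0 < θ ∧ 0 < C ∧ ∀ (x : En n) (R R' Cb : ℝ) (F : En n → W1) (b : En n → ℝ) (κ : ℕ → ℝ),
    0 < R → R < R' → MemLp F (ENNReal.ofReal (2 * q + 2)) volume → AEStronglyMeasurable b volume → (∀ y, |b y| ≤ Cb) →
    (∀ j, 0 ≤ κ j) → (∀ J, ∑ j ∈ Finset.range J, κ j ≤ θ) → (∀ j, ∀ y ∈ ball x (R / 2 ^ j), |1 - b y| ≤ κ j) →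
    WC S (ball x R') F → (∀ φ, TF (ball x R') φ → ∫ y, ⟪b y • gA (fun s => s ^ q) (F y), S.d φ y⟫ = 0) →
    ∀ j : ℕ, (∫ y in ball x (R / 2 ^ j), ‖F y‖ ^ (2 * q + 2)) / (R / 2 ^ j) ^ n ≤ C * ((∫ y in ball x R, ‖F y‖ ^ (2 * q + 2)) / R ^ n) := by
  obtain ⟨β, hβ, hsup⟩ := supbound S hq
  have hvB := vB_pos (n := n)
  set C1 := 16 * CV q * 2 ^ q with hC1
  have hC10 : 0 < C1 := by have := CV_pos hq; positivity
  have h2n : (0:ℝ) < 2 ^ (n + 1) := by positivity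
  have hp2 : (2:ℝ) ^ (n + 1) = 2 ^ n * 2 := pow_succ _ _
  set Λ : ℝ := 1 + 2 ^ (n + 1) / β + 2 * vB n + 2 ^ (n + 1) with hΛ
  have hd0 : 0 < (2:ℝ) ^ (n + 1) / β := by positivity
  have hΛ1 : 1 ≤ Λ := by rw [hΛ]; linarith
  have hΛΛ : Λ ≤ Λ ^ 2 := by nlinarith
  have hL1 : 2 ^ (n + 1) ≤ β * Λ ^ 2 := by
    have : (2:ℝ) ^ (n + 1) / β ≤ Λ ^ 2 := by linarith
    rw [div_le_iff₀ hβ] at this; linarith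
  have hL2 : 2 * vB n ≤ Λ ^ 2 := by linarith
  have hL3 : 2 ^ (n + 1) ≤ Λ ^ 2 := by linarith
  refine ⟨1 / (6 * Λ ^ 2 * √C1), 4 * Λ ^ 4, by positivity, by positivity, ?_⟩
  intro x R R' Cb F b κ hR hRR hF hb hCb hκ hκs hbk hW hco j0
  have hgp := gfun_rpow hq
  set r : ℕ → ℝ := fun j => R / 2 ^ j with hr
  have hr0 : ∀ j, 0 < r j := fun j => by positivity
  have hrR : ∀ j, r j ≤ R := fun j => div_le_self hR.le (one_le_pow₀ (by norm_num))
  have hrs : ∀ j, r (j + 1) = r j / 2 := fun j => by simp only [hr, pow_succ]; field_simp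
  have hrn : ∀ j, r j ^ n = 2 ^ n * r (j + 1) ^ n := fun j => by rw [hrs j, div_pow (r j) 2 n, mul_div_cancel₀ _ (by positivity)]
  set Φ : En n → ℝ := fun y => ‖gV (fun s => s ^ q) (F y)‖ with hΦ
  have hΦ2 : ∀ y, ‖F y‖ ^ (2 * q + 2) = Φ y ^ 2 := by
    intro y
    rw [hΦ]
    simp only
    rw [norm_gV_sq hgp, ← Real.rpow_natCast ‖F y‖ 2, ← Real.rpow_mul (norm_nonneg _), ← Real.rpow_add_of_nonneg (norm_nonneg _) (by positivity) (by positivity)]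
    norm_num
  simp_rw [hΦ2]
  have hΦi : Integrable (fun y => Φ y ^ 2) := by
    have := hF.integrable_norm_rpow (by simp; linarith) ENNReal.ofReal_ne_top
    rw [ENNReal.toReal_ofReal (by linarith)] at this
    simpa only [hΦ2] using this
  set G : ℕ → ℝ := fun j => ∫ y in ball x (r j), Φ y ^ 2 with hG
  have hG0 : ∀ j, 0 ≤ G j := fun j => integral_nonneg fun y => sq_nonneg _
  set a : ℕ → ℝ := fun j => √(G j / r j ^ n) with ha
  have ha0 : ∀ j, 0 ≤ a j := fun j => Real.sqrt_nonneg _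
  have ha2 : ∀ j, a j ^ 2 = G j / r j ^ n := fun j => Real.sq_sqrt (div_nonneg (hG0 j) (by have := hr0 j; positivity))
  have hGa : ∀ j, G j = a j ^ 2 * r j ^ n := fun j => by
    have := hr0 j
    rw [ha2]; field_simp
  -- main claim for each δ
  have key : ∀ δ : ℝ, 0 < δ → a j0 ≤ 2 * Λ ^ 2 * (a 0 + 6 * δ) := by
    intro δ hδ
    set e : ℕ → ℝ := fun j => (√C1 * κ j) * a j + δ / 2 ^ j with he
    have he0 : ∀ j, 0 < e j := fun j => by
      have := mul_nonneg (mul_nonneg (Real.sqrt_nonneg C1) (hκ j)) (ha0 j)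
      have : 0 < δ / 2 ^ j := by positivity
      simp only [he]; linarith
    have hex := fun j => compare S hq ((hrR j).trans_lt hRR) hF hb hCb (hκ j) (hbk j) hW hco
      (δ := (δ / 2 ^ j) ^ 2 * r j ^ n) (by have := hr0 j; positivity)
    choose ε T hε hT H hH hWH hoH hDi hD using hex
    set D : ℕ → En n → ℝ := fun j y => ‖gV (gR q (ε j) (T j)) (H j y) - gV (fun s => s ^ q) (F y)‖ with hDd
    set U : ℕ → En n → ℝ := fun j y => ‖gV (gR q (ε j) (T j)) (H j y)‖ with hUd
    have hUm : ∀ j, MemLp (U j) 2 volume := fun j => gV_memLp (hq) (hε j) (hT j) (hH j)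
    have hD0 : ∀ j y, 0 ≤ D j y := fun j y => norm_nonneg _
    have hU0 : ∀ j y, 0 ≤ U j y := fun j y => norm_nonneg _
    have hΦ0 : ∀ y, 0 ≤ Φ y := fun y => norm_nonneg _
    have hUΦ : ∀ j y, U j y ≤ Φ y + D j y := fun j y => by
      have := norm_sub_norm_le (gV (gR q (ε j) (T j)) (H j y)) (gV (fun s => s ^ q) (F y))
      simp only [hUd, hΦ, hDd]; linarith
    have hΦU : ∀ j y, Φ y ≤ U j y + D j y := fun j y => by
      have := norm_sub_norm_le (gV (fun s => s ^ q) (F y)) (gV (gR q (ε j) (T j)) (H j y))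
      rw [norm_sub_rev] at this
      simp only [hUd, hΦ, hDd]; linarith
    have hDe : ∀ j, ∫ y in ball x (r j), D j y ^ 2 ≤ e j ^ 2 * r j ^ n := by
      intro j
      refine (hD j).trans ?_
      have g1 : ∫ y in ball x (r j), ‖F y‖ ^ (2 * q + 2) = a j ^ 2 * r j ^ n := by
        simp_rw [hΦ2]; exact hGa j
      have g1' : ∫ y in ball x (r j), Φ y ^ 2 = a j ^ 2 * r j ^ n := hGa j
      have g2 : √C1 ^ 2 = C1 := Real.sq_sqrt hC10.le
      have g3 : C1 * κ j ^ 2 * (a j ^ 2 * r j ^ n) = (√C1 * κ j * a j) ^ 2 * r j ^ n := by rw [mul_pow, mul_pow, g2]; ring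
      have g4 := mul_nonneg (mul_nonneg (Real.sqrt_nonneg C1) (hκ j)) (ha0 j)
      have g5 : 0 < δ / 2 ^ j := by positivity
      have g6 := pow_pos (hr0 j) n
      have g7 := mul_nonneg (mul_nonneg g4 g5.le) g6.le
      rw [g1, g3]
      simp only [he]
      nlinarith
    have hDe' : ∀ j, ∫ y in ball x (r (j + 1)), D j y ^ 2 ≤ 2 ^ n * e j ^ 2 * r (j + 1) ^ n := by
      intro j
      have : ∫ y in ball x (r (j + 1)), D j y ^ 2 ≤ ∫ y in ball x (r j), D j y ^ 2 :=
        setIntegral_mono_set (hDi j) (Eventually.of_forall fun y => sq_nonneg _)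
          (ball_subset_ball (by rw [hrs]; linarith [hr0 j])).eventuallyLE
      have h2 := hDe j
      rw [hrn] at h2
      linarith
    have hDi' : ∀ j, IntegrableOn (fun y => D j y ^ 2) (ball x (r (j + 1))) := fun j =>
      (hDi j).mono_set (ball_subset_ball (by rw [hrs]; linarith [hr0 j]))
    set M : ℕ → ℝ := fun j => Λ * (a 0 + ∑ i ∈ Finset.range j, e i + ∑ i ∈ Finset.range (j + 1), e i) with hM
    have hM0 : ∀ j, 0 ≤ M j := fun j => by
      have h1 := Finset.sum_nonneg (s := Finset.range j) fun i _ => (he0 i).le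
      have h2 := Finset.sum_nonneg (s := Finset.range (j + 1)) fun i _ => (he0 i).le
      have := ha0 0
      positivity
    have hMs : ∀ j, M (j + 1) = M j + Λ * (e j + e (j + 1)) := fun j => by
      simp only [hM, Finset.sum_range_succ]; ring
    have claim : ∀ j, ∀ᵐ y ∂(volume.restrict (ball x (r (j + 1)))), U j y ≤ M j := by
      intro j
      induction j with
      | zero =>
        have hd : 0 < Λ * (a 0 + e 0) := by have := he0 0; have := ha0 0; positivity
        have hM00 : M 0 = 0 + Λ * (a 0 + e 0) := by simp [hM]
        rw [hM00, hrs]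
        refine hsup (ε 0) (T 0) (hε 0) (hT 0) x (r 0) (hr0 0) (H 0) (hH 0) (hWH 0) (hoH 0) 0 _ le_rfl hd ?_
        have s1 : ∫ y in ball x (r 0), (max (U 0 y - 0) 0) ^ 2 ≤ ∫ y in ball x (r 0), (2 * Φ y ^ 2 + 2 * D 0 y ^ 2) := by
          refine setIntegral_mono (intOn_pos (hUm 0) 0 le_rfl).1.integrableOn ((hΦi.integrableOn.const_mul 2).add ((hDi 0).const_mul 2)) fun y => ?_
          simp only [sub_zero]
          rw [max_eq_left (hU0 0 y)]
          exact (pow_le_pow_left₀ (hU0 0 y) (hUΦ 0 y) 2).trans (sq2 _ _)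
        have s2 : ∫ y in ball x (r 0), (2 * Φ y ^ 2 + 2 * D 0 y ^ 2) = 2 * G 0 + 2 * ∫ y in ball x (r 0), D 0 y ^ 2 := by
          rw [integral_add (hΦi.integrableOn.const_mul 2) ((hDi 0).const_mul 2), integral_const_mul, integral_const_mul]
        refine s1.trans ?_
        rw [s2, hGa]
        have s3 := hDe 0
        have s4 := pow_pos (hr0 0) n
        have s5 : 2 * (a 0 ^ 2 + e 0 ^ 2) ≤ β * Λ ^ 2 * (a 0 + e 0) ^ 2 := by
          have hh : (2:ℝ) ≤ β * Λ ^ 2 := le_trans (by rw [pow_succ]; nlinarith [one_le_pow₀ (n := n) (show (1:ℝ) ≤ 2 by norm_num)]) hL1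
          calc 2 * (a 0 ^ 2 + e 0 ^ 2) ≤ 2 * (a 0 + e 0) ^ 2 := by nlinarith [mul_nonneg (ha0 0) (he0 0).le]
            _ ≤ _ := by gcongr
        have s6 := mul_le_mul_of_nonneg_right s5 s4.le
        rw [mul_pow]
        linarith
      | succ j ih =>
        have hd : 0 < Λ * (e j + e (j + 1)) := by have := he0 j; have := he0 (j + 1); positivity
        rw [hMs, hrs]
        refine hsup (ε (j + 1)) (T (j + 1)) (hε _) (hT _) x (r (j + 1)) (hr0 _) (H (j + 1)) (hH _) (hWH _) (hoH _) (M j) _ (hM0 j) hd ?_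
        have s1 : ∫ y in ball x (r (j + 1)), (max (U (j + 1) y - M j) 0) ^ 2 ≤ ∫ y in ball x (r (j + 1)), (2 * D j y ^ 2 + 2 * D (j + 1) y ^ 2) := by
          refine integral_mono_ae (intOn_pos (hUm _) _ (hM0 j)).1.integrableOn (((hDi' j).const_mul 2).add ((hDi (j + 1)).const_mul 2)) ?_
          filter_upwards [ih] with y hy
          refine le_trans (pow_le_pow_left₀ (le_max_right _ _) (max_le ?_ ?_) 2) (sq2 _ _)
          · have := hUΦ (j + 1) y
            have := hΦU j y
            linarith
          · exact add_nonneg (hD0 _ _) (hD0 _ _)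
        have s2 : ∫ y in ball x (r (j + 1)), (2 * D j y ^ 2 + 2 * D (j + 1) y ^ 2) = 2 * (∫ y in ball x (r (j + 1)), D j y ^ 2) + 2 * ∫ y in ball x (r (j + 1)), D (j + 1) y ^ 2 := by
          rw [integral_add ((hDi' j).const_mul 2) ((hDi (j + 1)).const_mul 2), integral_const_mul, integral_const_mul]
        refine s1.trans ?_
        rw [s2]
        have s3 := hDe (j + 1)
        have s3' := hDe' j
        have s4 := pow_pos (hr0 (j + 1)) n
        have s5 : 2 * (2 ^ n * e j ^ 2 + e (j + 1) ^ 2) ≤ β * Λ ^ 2 * (e j + e (j + 1)) ^ 2 := by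
          calc 2 * (2 ^ n * e j ^ 2 + e (j + 1) ^ 2) ≤ 2 * (2 ^ n * e j ^ 2 + 2 ^ n * e (j + 1) ^ 2) := by
                have := one_le_pow₀ (n := n) (show (1:ℝ) ≤ 2 by norm_num)
                nlinarith [sq_nonneg (e (j + 1))]
            _ ≤ 2 ^ (n + 1) * (e j + e (j + 1)) ^ 2 := by
                have h1 := mul_nonneg (he0 j).le (he0 (j + 1)).le
                have h2 : e j ^ 2 + e (j + 1) ^ 2 ≤ (e j + e (j + 1)) ^ 2 := by nlinarith
                have h3 := mul_le_mul_of_nonneg_left h2 h2n.le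
                rw [hp2] at h3 ⊢
                linarith
            _ ≤ _ := by gcongr
        have s6 := mul_le_mul_of_nonneg_right s5 s4.le
        rw [mul_pow]
        linarith
    refine num_iter (t := fun j => √C1 * κ j) (e := e) (θ := 1 / (6 * Λ ^ 2)) hΛ1 hδ (by field_simp; norm_num) ha0
      (fun j => mul_nonneg (Real.sqrt_nonneg _) (hκ j)) (fun J => ?_) (fun j => rfl) (fun j => ?_) j0
    · rw [← Finset.mul_sum]
      have hsq := Real.sqrt_pos.2 hC10
      calc _ ≤ √C1 * (1 / (6 * Λ ^ 2 * √C1)) := by gcongr; exact hκs J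
        _ = _ := by field_simp
    · show a (j + 1) ≤ Λ * (M j + e j)
      have hMe : 0 ≤ M j + e j := add_nonneg (hM0 j) (he0 j).le
      refine Real.sqrt_le_iff.2 ⟨by positivity, ?_⟩
      have s4 := pow_pos (hr0 (j + 1)) n
      rw [div_le_iff₀ s4]
      have ic : IntegrableOn (fun _ : En n => 2 * M j ^ 2) (ball x (r (j + 1))) := integrableOn_const measure_ball_lt_top.ne
      have s1 : G (j + 1) ≤ ∫ y in ball x (r (j + 1)), (2 * M j ^ 2 + 2 * D j y ^ 2) := by
        refine integral_mono_ae hΦi.integrableOn (ic.add ((hDi' j).const_mul 2)) ?_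
        filter_upwards [claim j] with y hy
        have := hΦU j y
        exact (pow_le_pow_left₀ (hΦ0 y) (this.trans (by linarith : _ ≤ M j + D j y)) 2).trans (sq2 _ _)
      have s2 : ∫ y in ball x (r (j + 1)), (2 * M j ^ 2 + 2 * D j y ^ 2) = r (j + 1) ^ n * vB n * (2 * M j ^ 2) + 2 * ∫ y in ball x (r (j + 1)), D j y ^ 2 := by
        rw [integral_add ic ((hDi' j).const_mul 2), setIntegral_const, integral_const_mul, vol_ball x (hr0 _), smul_eq_mul]
      have s3 := hDe' j
      have s5 : 2 * vB n * M j ^ 2 + 2 ^ (n + 1) * e j ^ 2 ≤ Λ ^ 2 * (M j + e j) ^ 2 := by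
        calc _ ≤ Λ ^ 2 * M j ^ 2 + Λ ^ 2 * e j ^ 2 := by gcongr
          _ ≤ _ := by
            have h1 := mul_nonneg (sq_nonneg Λ) (mul_nonneg (hM0 j) (he0 j).le)
            nlinarith
      have s6 := mul_le_mul_of_nonneg_right s5 s4.le
      rw [hp2] at s6
      rw [mul_pow]
      linarith
  have fin : a j0 ≤ 2 * Λ ^ 2 * a 0 := by
    have hlim : Tendsto (fun δ : ℝ => 2 * Λ ^ 2 * (a 0 + 6 * δ)) (𝓝[>] 0) (𝓝 (2 * Λ ^ 2 * a 0)) := by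
      have : ContinuousAt (fun δ : ℝ => 2 * Λ ^ 2 * (a 0 + 6 * δ)) 0 := by fun_prop
      have h := this.tendsto.mono_left (nhdsWithin_le_nhds (s := Ioi 0))
      simpa using h
    refine ge_of_tendsto hlim ?_
    filter_upwards [self_mem_nhdsWithin] with δ hδ using key δ hδ
  have f2 := pow_le_pow_left₀ (ha0 j0) fin 2
  rw [mul_pow, ha2, ha2] at f2
  have hr00 : r 0 = R := by simp [hr]
  calc _ ≤ _ := f2
    _ = _ := by rw [hr00]; simp only [hG, hr00]; ring
end iter
end DP

namespace DP
set_option linter.unusedSectionVars false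
set_option linter.unusedVariables false
open Set
open scoped RealInnerProductSpace Topology


section car
variable {n : ℕ}

def sgn (i : Fin n) (t : Finset (Fin n)) : ℝ := (-1 : ℝ) ^ (t.filter (fun j => j < i)).card

def sg (j i : Fin n) : ℝ := if j < i then -1 else 1

theorem sgn_prod (i : Fin n) (t : Finset (Fin n)) : sgn i t = ∏ j ∈ t, sg j i := by
  simp [sgn, sg, Finset.prod_ite]

theorem sg_sq (j i : Fin n) : sg j i * sg j i = 1 := by unfold sg; split_ifs <;> norm_num

theorem sg_self (i : Fin n) : sg i i = 1 := by simp [sg]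

theorem sg_mul {i j : Fin n} (h : i ≠ j) : sg i j * sg j i = -1 := by
  unfold sg
  rcases lt_or_gt_of_ne h with h | h
  · simp [h, h.le, not_lt.2 h.le]
  · simp [h, h.le, not_lt.2 h.le]

theorem sgn_sq (i : Fin n) (t : Finset (Fin n)) : sgn i t * sgn i t = 1 := by
  unfold sgn; rw [← mul_pow]; norm_num

theorem sgn_erase {s : Fin n} (i : Fin n) {t : Finset (Fin n)} (h : s ∈ t) : sgn i (t.erase s) = sg s i * sgn i t := by
  rw [sgn_prod, sgn_prod, ← Finset.mul_prod_erase t _ h, ← mul_assoc, sg_sq, one_mul]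

theorem sgn_insert {s : Fin n} (i : Fin n) {t : Finset (Fin n)} (h : s ∉ t) : sgn i (insert s t) = sg s i * sgn i t := by
  rw [sgn_prod, sgn_prod, Finset.prod_insert h]

def fE (i : Fin n) (f : Finset (Fin n) → ℝ) (t : Finset (Fin n)) : ℝ := if i ∈ t then sgn i t * f (t.erase i) else 0

def fI (i : Fin n) (f : Finset (Fin n) → ℝ) (t : Finset (Fin n)) : ℝ := if i ∈ t then 0 else sgn i t * f (insert i t)

theorem sg_add {i j : Fin n} (h : i ≠ j) : sg i j + sg j i = 0 := by
  unfold sg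
  rcases lt_or_gt_of_ne h with h | h
  · simp [h, not_lt.2 h.le]
  · simp [h, not_lt.2 h.le]

theorem car (s i : Fin n) (f : Finset (Fin n) → ℝ) (t : Finset (Fin n)) :
    fE s (fI i f) t + fI i (fE s f) t = if i = s then f t else 0 := by
  by_cases h : i = s
  · subst h
    by_cases hi : i ∈ t
    · simp [fE, fI, hi, sgn_erase, sg_self, ← mul_assoc, sgn_sq, Finset.insert_erase]
    · simp [fE, fI, hi, sgn_insert, sg_self, ← mul_assoc, sgn_sq]
  · have h' : s ≠ i := fun e => h e.symm
    by_cases hi : i ∈ t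
    · by_cases hs : s ∈ t
      · simp [fE, fI, hi, hs, h]
      · simp [fE, fI, hi, hs, h]
    · by_cases hs : s ∈ t
      · have e1 : (insert i t).erase s = insert i (t.erase s) := Finset.erase_insert_of_ne h
        simp only [fE, fI, hi, hs, h, if_true, if_false, Finset.mem_erase, Finset.mem_insert, or_true, and_false]
        rw [e1, sgn_erase i hs, sgn_insert s hi]
        linear_combination (sgn s t * sgn i t * f (insert i (t.erase s))) * sg_add h
      · simp [fE, fI, hi, hs, h, h']

theorem anti (s j : Fin n) (f : Finset (Fin n) → ℝ) (t : Finset (Fin n)) :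
    fE s (fE j f) t + fE j (fE s f) t = 0 := by
  by_cases h : j = s
  · subst h; simp [fE]
  · have h' : s ≠ j := fun e => h e.symm
    by_cases hi : j ∈ t
    · by_cases hs : s ∈ t
      · simp only [fE, hi, hs, h, h', if_true, Finset.mem_erase, and_true, ne_eq, not_false_iff]
        rw [Finset.erase_right_comm, sgn_erase j hs, sgn_erase s hi]
        have := sg_add h'
        linear_combination (sgn s t * sgn j t * f ((t.erase j).erase s)) * this
      · simp [fE, hi, hs]
    · simp [fE, hi]

theorem fE_add (i : Fin n) (f g : Finset (Fin n) → ℝ) (t) : fE i (fun t => f t + g t) t = fE i f t + fE i g t := by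
  unfold fE; split_ifs <;> ring

theorem fJ (i j s : Fin n) (f : Finset (Fin n) → ℝ) (t : Finset (Fin n)) :
    fE s (fI i (fE j f)) t + fE j (fI i (fE s f)) t = (if i = s then fE j f t else 0) + (if i = j then fE s f t else 0) := by
  have h1 : fI i (fE j f) = fun t => (if i = j then f t else 0) - fE j (fI i f) t := by
    funext t; have := car j i f t; linarith
  have h2 : fI i (fE s f) = fun t => (if i = s then f t else 0) - fE s (fI i f) t := by
    funext t; have := car s i f t; linarith
  have a := anti s j (fI i f) t
  rw [h1, h2]
  have e : ∀ (m : Fin n) (P : Prop) [Decidable P] (g h : Finset (Fin n) → ℝ), fE m (fun t => (if P then g t else 0) - h t) t =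
    (if P then fE m g t else 0) - fE m h t := by
    intro m P _ g h
    unfold fE; split_ifs <;> ring
  rw [e, e]
  linear_combination -a
end car

section sys
variable (n N k : ℕ)

def sysE (i : Fin n) : EuclideanSpace ℝ (FormIdx n k × Fin N) →ₗ[ℝ] EuclideanSpace ℝ (FormIdx n (k + 1) × Fin N) where
  toFun v := WithLp.toLp 2 fun q =>
    if h : i ∈ q.1.1 then
      (-1 : ℝ) ^ (q.1.1.filter (fun j => j < i)).card *
        v (⟨q.1.1.erase i, by simp [Finset.card_erase_of_mem h, q.1.2]⟩, q.2)
    else 0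
  map_add' v w := by
    ext q; simp only [PiLp.add_apply]; split_ifs <;> ring
  map_smul' c v := by
    ext q; simp only [PiLp.smul_apply, smul_eq_mul, RingHom.id_apply]; split_ifs <;> ring

def sysI (i : Fin n) : EuclideanSpace ℝ (FormIdx n (k + 1) × Fin N) →ₗ[ℝ] EuclideanSpace ℝ (FormIdx n k × Fin N) where
  toFun v := WithLp.toLp 2 fun q =>
      if h : i ∈ q.1.1 then 0
      else
        (-1 : ℝ) ^ (q.1.1.filter (fun j => j < i)).card *
          v (⟨insert i q.1.1, by simp [Finset.card_insert_of_notMem h, q.1.2]⟩, q.2)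
  map_add' v w := by
    ext q; simp only [PiLp.add_apply]; split_ifs <;> ring
  map_smul' c v := by
    ext q; simp only [PiLp.smul_apply, smul_eq_mul, RingHom.id_apply]; split_ifs <;> ring

variable {n N k}

def ext0 (m : Fin N) (v : EuclideanSpace ℝ (FormIdx n k × Fin N)) (t : Finset (Fin n)) : ℝ :=
  if h : t.card = k then v (⟨t, h⟩, m) else 0

theorem ext_E (i : Fin n) (m : Fin N) (v : EuclideanSpace ℝ (FormIdx n k × Fin N)) :
    ext0 m (sysE n N k i v) = fE i (ext0 m v) := by
  funext t
  unfold ext0 fE sgn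
  by_cases hi : i ∈ t
  · have hc := Finset.card_erase_add_one hi
    by_cases ht : t.card = k + 1
    · have : (t.erase i).card = k := by omega
      simp [sysE, ht, hi, this]
    · have : ¬ (t.erase i).card = k := by omega
      rw [dif_neg ht, if_pos hi]; change (0:ℝ) = _ * dite _ _ _; rw [dif_neg this, mul_zero]
  · simp [sysE, hi]

theorem ext_I (i : Fin n) (m : Fin N) (v : EuclideanSpace ℝ (FormIdx n (k + 1) × Fin N)) :
    ext0 m (sysI n N k i v) = fI i (ext0 m v) := by
  funext t
  unfold ext0 fI sgn
  by_cases hi : i ∈ t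
  · simp [sysI, hi]
  · have hc := Finset.card_insert_of_notMem hi
    by_cases ht : t.card = k
    · have : (insert i t).card = k + 1 := by omega
      simp [sysI, ht, hi, this]
    · have : ¬ (insert i t).card = k + 1 := by omega
      simp [ht, hi, this]

theorem ext_apply (v : EuclideanSpace ℝ (FormIdx n k × Fin N)) (q : FormIdx n k × Fin N) : v q = ext0 q.2 v q.1.1 := by
  simp [ext0, q.1.2]

theorem sys_adj (i : Fin n) (x : EuclideanSpace ℝ (FormIdx n k × Fin N)) (y : EuclideanSpace ℝ (FormIdx n (k + 1) × Fin N)) :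
    ⟪sysE n N k i x, y⟫ = ⟪x, sysI n N k i y⟫ := by
  have hsum : ∀ (k : ℕ) (f : Finset (Fin n) → Fin N → ℝ), ∑ q : FormIdx n k × Fin N, f q.1.1 q.2 =
      ∑ m, ∑ t : Finset (Fin n), if t.card = k then f t m else 0 := by
    intro k f
    rw [Fintype.sum_prod_type_right]
    refine Finset.sum_congr rfl fun m _ => ?_
    rw [← Finset.sum_filter]
    exact (Finset.sum_subtype (Finset.univ.filter fun t : Finset (Fin n) => t.card = k) (by simp) (fun t => f t m)).symm
  have h1 : ⟪sysE n N k i x, y⟫ = ∑ m, ∑ t : Finset (Fin n), fE i (ext0 m x) t * ext0 m y t := by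
    rw [PiLp.inner_apply]
    calc _ = ∑ q : FormIdx n (k + 1) × Fin N, (fun t m => fE i (ext0 m x) t * ext0 m y t) q.1.1 q.2 := by
          refine Finset.sum_congr rfl fun q _ => ?_
          rw [ext_apply (sysE n N k i x), ext_apply y, ext_E]
          simp [mul_comm]
      _ = _ := by
          refine (hsum (k + 1) (fun t m => fE i (ext0 m x) t * ext0 m y t)).trans ?_
          refine Finset.sum_congr rfl fun m _ => Finset.sum_congr rfl fun t _ => ?_
          by_cases h : t.card = k + 1
          · simp [h]
          · have : ext0 m y t = 0 := by simp [ext0, h]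
            simp [h, this]
  have h2 : ⟪x, sysI n N k i y⟫ = ∑ m, ∑ t : Finset (Fin n), ext0 m x t * fI i (ext0 m y) t := by
    rw [PiLp.inner_apply]
    calc _ = ∑ q : FormIdx n k × Fin N, (fun t m => ext0 m x t * fI i (ext0 m y) t) q.1.1 q.2 := by
          refine Finset.sum_congr rfl fun q _ => ?_
          rw [ext_apply (sysI n N k i y), ext_apply x, ext_I]
          simp [mul_comm]
      _ = _ := by
          refine (hsum k (fun t m => ext0 m x t * fI i (ext0 m y) t)).trans ?_
          refine Finset.sum_congr rfl fun m _ => Finset.sum_congr rfl fun t _ => ?_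
          by_cases h : t.card = k
          · simp [h]
          · have : ext0 m x t = 0 := by simp [ext0, h]
            simp [h, this]
  rw [h1, h2]
  refine Finset.sum_congr rfl fun m _ => ?_
  set f := ext0 m x
  set g := ext0 m y
  have e1 : ∑ t, fE i f t * g t = ∑ t ∈ Finset.univ.filter (fun t : Finset (Fin n) => i ∈ t), sgn i t * f (t.erase i) * g t := by
    rw [Finset.sum_filter]
    refine Finset.sum_congr rfl fun t _ => ?_
    unfold fE; split_ifs <;> ring
  have e2 : ∑ t, f t * fI i g t = ∑ t ∈ Finset.univ.filter (fun t : Finset (Fin n) => i ∉ t), f t * (sgn i t * g (insert i t)) := by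
    rw [Finset.sum_filter]
    refine Finset.sum_congr rfl fun t _ => ?_
    unfold fI
    by_cases h : i ∈ t <;> simp [h]
  rw [e1, e2]
  refine Finset.sum_bij' (fun t _ => t.erase i) (fun t _ => insert i t) (by simp) (by simp) ?_ ?_ ?_
  · intro t ht; exact Finset.insert_erase (by simpa using ht)
  · intro t ht; exact Finset.erase_insert (by simpa using ht)
  · intro t ht
    have ht' : i ∈ t := by simpa using ht
    rw [Finset.insert_erase ht', sgn_erase i ht', sg_self]
    ring

variable (n N k)
def sys : Sys n (EuclideanSpace ℝ (FormIdx n k × Fin N)) (EuclideanSpace ℝ (FormIdx n (k + 1) × Fin N)) where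
  e i := LinearMap.toContinuousLinearMap (sysE n N k i)
  es i := LinearMap.toContinuousLinearMap (sysI n N k i)
  adj i x y := sys_adj i x y
  J i j s v := by
    ext q
    have h := fJ i j s (ext0 q.2 v) q.1.1
    simp only [← ext_E, ← ext_I, ← ext_apply] at h
    simp only [LinearMap.coe_toContinuousLinearMap', PiLp.add_apply]
    rw [h]
    split_ifs <;> simp
end sys
end DP

namespace DP
set_option linter.unusedSectionVars false
set_option linter.unusedVariables false
open Set
open scoped RealInnerProductSpace Topology

section weak
variable {n : ℕ} {W0 W1 : Type*} [NormedAddCommGroup W0] [InnerProductSpace ℝ W0] [NormedAddCommGroup W1] [InnerProductSpace ℝ W1] [FiniteDimensional ℝ W0] [FiniteDimensional ℝ W1] [CompleteSpace W0] [CompleteSpace W1] (S : Sys n W0 W1)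

theorem Sys.J' (i j s : Fin n) (v : W1) : S.es j (S.e i (S.es s v)) + S.es s (S.e i (S.es j v)) =
    (if i = s then S.es j v else 0) + (if i = j then S.es s v else 0) := by
  refine ext_inner_left ℝ fun x => ?_
  have h := congrArg (fun z => ⟪z, v⟫) (S.J i j s x)
  have e0 : ∀ (P : Prop) [Decidable P] (m : Fin n), ⟪(if P then S.e m x else 0), v⟫ = ⟪x, (if P then S.es m v else 0)⟫ := by
    intro P _ m
    split_ifs
    · exact S.adj _ _ _
    · simp
  have e1 : ∀ a b : Fin n, ⟪S.e a (S.es i (S.e b x)), v⟫ = ⟪x, S.es b (S.e i (S.es a v))⟫ := by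
    intro a b
    rw [S.adj, ← S.adj', real_inner_comm, S.adj', real_inner_comm, real_inner_comm]
  simp only [inner_add_left, e0, e1] at h
  simp only [inner_add_right]
  linarith

theorem co_closed {O : Set (En n)} {ψ : En n → W1} (hψ : TF O ψ) (i : Fin n) (x : En n) :
    ∑ m, pd m (fun y => S.es m (pd i ψ y - ∑ s, S.e i (S.es s (pd s ψ y)))) x = 0 := by
  have h2 : ContDiff ℝ 2 ψ := contDiff_infty.1 hψ.1 2
  have hd : ∀ s, DifferentiableAt ℝ (pd s ψ) x := fun s =>
    ((pd_contDiff h2 (k := 1) (by norm_num) s).differentiable (by norm_num)) x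
  have e : ∀ m, pd m (fun y => S.es m (pd i ψ y - ∑ s, S.e i (S.es s (pd s ψ y)))) x
      = S.es m (pd m (pd i ψ) x) - ∑ s, S.es m (S.e i (S.es s (pd m (pd s ψ) x))) := by
    intro m
    have k1 : HasFDerivAt (fun y => S.es m (pd i ψ y - ∑ s, S.e i (S.es s (pd s ψ y))))
        ((S.es m).comp (fderiv ℝ (pd i ψ) x - ∑ s, (S.e i).comp ((S.es s).comp (fderiv ℝ (pd s ψ) x)))) x :=
      (S.es m).hasFDerivAt.comp x ((hd i).hasFDerivAt.sub (HasFDerivAt.fun_sum fun s _ =>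
        (S.e i).hasFDerivAt.comp x ((S.es s).hasFDerivAt.comp x (hd s).hasFDerivAt)))
    have := congrArg (fun L => L (basisVec m)) k1.fderiv
    simp only [pd] at this ⊢
    rw [this]
    simp [map_sum]
  simp only [e]
  rw [Finset.sum_sub_distrib]
  have key : (2:ℝ) • ∑ m, ∑ s, S.es m (S.e i (S.es s (pd m (pd s ψ) x))) = (2:ℝ) • ∑ m, S.es m (pd m (pd i ψ) x) := by
    have c : ∑ m, ∑ s, S.es m (S.e i (S.es s (pd m (pd s ψ) x))) = ∑ m, ∑ s, S.es s (S.e i (S.es m (pd m (pd s ψ) x))) := by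
      rw [Finset.sum_comm]
      refine Finset.sum_congr rfl fun m _ => Finset.sum_congr rfl fun s _ => ?_
      rw [pd_symm h2]
    rw [two_smul]
    nth_rewrite 2 [c]
    simp only [← Finset.sum_add_distrib]
    simp only [S.J']
    simp only [Finset.sum_add_distrib]
    rw [two_smul]
    congr 1
    · refine Finset.sum_congr rfl fun m _ => ?_
      simp
    · rw [Finset.sum_comm]
      refine Finset.sum_congr rfl fun m _ => ?_
      simp [pd_symm h2 i m]
  have := smul_right_injective W0 (two_ne_zero (α := ℝ)) key
  rw [this, sub_self]

theorem WC_of_weak {O : Set (En n)} {w : En n → W0} {G : Fin n → En n → W0} (hw : LocallyIntegrable w volume)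
    (hG : ∀ m, LocallyIntegrable (G m) volume)
    (h : ∀ m Ψ, TF O Ψ → ∫ x, ⟪G m x, Ψ x⟫ = - ∫ x, ⟪w x, pd m Ψ x⟫) :
    WC S O (fun y => ∑ m, S.e m (G m y)) := by
  intro i ψ hψ
  have hT := WC_test_TF S hψ i
  have hTm : ∀ m, TF O (fun x => S.es m (pd i ψ x - ∑ s, S.e i (S.es s (pd s ψ x)))) := fun m =>
    hT.of_zero ((S.es m).contDiff.comp hT.1) (fun x hx => by rw [hx, map_zero])
  have hI : ∀ (f : En n → W0) (Ψ : En n → W0), LocallyIntegrable f volume → TF O Ψ → Integrable (fun x => ⟪f x, Ψ x⟫) volume := by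
    intro f Ψ hf hΨ
    have hc := hΨ.1.continuous
    obtain ⟨C, hC⟩ := hc.bounded_above_of_compact_support hΨ.2.1
    have h1 : IntegrableOn (fun x => ⟪f x, Ψ x⟫) (tsupport Ψ) volume := by
      refine Integrable.mono' ((hf.integrableOn_isCompact hΨ.2.1).norm.mul_const C) ?_ (Eventually.of_forall fun x => ?_)
      · exact hf.aestronglyMeasurable.restrict.inner hc.aestronglyMeasurable
      · exact (norm_inner_le_norm _ _).trans (by gcongr; exact hC x)
    refine (integrableOn_iff_integrable_of_support_subset ?_).1 h1
    intro x hx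
    apply subset_tsupport
    intro h0; exact hx (by simp [h0])
  calc _ = ∫ x, ∑ m, ⟪G m x, S.es m (pd i ψ x - ∑ s, S.e i (S.es s (pd s ψ x)))⟫ := by
        refine integral_congr_ae (Eventually.of_forall fun x => ?_)
        simp only [sum_inner, S.adj]
    _ = ∑ m, ∫ x, ⟪G m x, S.es m (pd i ψ x - ∑ s, S.e i (S.es s (pd s ψ x)))⟫ :=
        integral_finsetSum _ fun m _ => hI _ _ (hG m) (hTm m)
    _ = - ∑ m, ∫ x, ⟪w x, pd m (fun x => S.es m (pd i ψ x - ∑ s, S.e i (S.es s (pd s ψ x)))) x⟫ := by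
        rw [← Finset.sum_neg_distrib]
        exact Finset.sum_congr rfl fun m _ => h m _ (hTm m)
    _ = - ∫ x, ∑ m, ⟪w x, pd m (fun x => S.es m (pd i ψ x - ∑ s, S.e i (S.es s (pd s ψ x)))) x⟫ := by
        rw [integral_finsetSum _ fun m _ => hI _ _ hw ((hTm m).pd m)]
    _ = 0 := by
        simp only [← inner_sum]
        simp only [co_closed S hψ i, inner_zero_right, integral_zero, neg_zero]
end weak
end DP

namespace DP
set_option linter.unusedSectionVars false
set_option linter.unusedVariables false
open Set
open scoped RealInnerProductSpace Topology

section bridge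
variable {n N k : ℕ}

theorem fnorm_eq (v : Form n N k) : fnorm v = ‖WithLp.toLp 2 v‖ := by
  rw [EuclideanSpace.norm_eq]; simp [fnorm]

theorem finner_eq (v w : Form n N k) : finner v w = ⟪WithLp.toLp 2 v, WithLp.toLp 2 w⟫ := by
  rw [PiLp.inner_apply]; simp [finner, mul_comm]

theorem extD_eq (G : Fin n → Form n N k) : WithLp.toLp 2 (extD G) = ∑ i, (sys n N k).e i (WithLp.toLp 2 (G i)) := by
  ext q
  simp [extD, sys, sysE]

theorem le_gnorm (G : Fin n → Form n N k) (i : Fin n) : ‖WithLp.toLp 2 (G i)‖ ≤ gnorm G := by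
  rw [← fnorm_eq]
  unfold fnorm gnorm
  apply Real.sqrt_le_sqrt
  exact Finset.single_le_sum (f := fun i => ∑ q, G i q ^ 2) (fun i _ => Finset.sum_nonneg fun q _ => sq_nonneg _) (Finset.mem_univ i)

theorem TF.test {O : Set (En n)} {φ : En n → EuclideanSpace ℝ (FormIdx n k × Fin N)} (h : TF O φ) :
    IsTestForm O (fun x => (φ x).ofLp) := by
  have hs : tsupport (fun x => (φ x).ofLp) = tsupport φ := by
    unfold tsupport
    congr 1
    ext x
    simp
  refine ⟨fun q => (contDiff_euclidean.1 h.1) q, ?_, ?_⟩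
  · unfold HasCompactSupport; rw [hs]; exact h.2.1
  · rw [hs]; exact h.2.2

theorem TF.grad {O : Set (En n)} {φ : En n → EuclideanSpace ℝ (FormIdx n k × Fin N)} (h : TF O φ) (x : En n) (i : Fin n)
    (q : FormIdx n k × Fin N) : fderiv ℝ (fun y => φ y q) x (basisVec i) = DP.pd i φ x q := by
  have h1 : DifferentiableAt ℝ φ x := (h.1.differentiable (by simp)) x
  exact pd_clm h1 (EuclideanSpace.proj q : EuclideanSpace ℝ (FormIdx n k × Fin N) →L[ℝ] ℝ) i

theorem TF.comp_q {O : Set (En n)} {φ : En n → EuclideanSpace ℝ (FormIdx n k × Fin N)} (h : TF O φ)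
    (q : FormIdx n k × Fin N) : TF O (fun y => φ y q) :=
  h.of_zero ((contDiff_euclidean.1 h.1) q) (fun x hx => by simp [hx])

theorem TF.dform {O : Set (En n)} {φ : En n → EuclideanSpace ℝ (FormIdx n k × Fin N)} (h : TF O φ) (x : En n) :
    WithLp.toLp 2 (extD (smoothGrad (fun y => (φ y).ofLp) x)) = (sys n N k).d φ x := by
  rw [extD_eq]
  unfold Sys.d
  refine Finset.sum_congr rfl fun i _ => ?_
  congr 1
  ext q
  exact h.grad x i q

theorem TF.zero_off {W : Type*} [NormedAddCommGroup W] [InnerProductSpace ℝ W] {O : Set (En n)} {φ : En n → W} (h : TF O φ)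
    {x : En n} (hx : x ∉ O) : φ x = 0 := image_eq_zero_of_notMem_tsupport fun h' => hx (h.2.2 h')

theorem TF.int_inner {W : Type*} [NormedAddCommGroup W] [InnerProductSpace ℝ W] {O : Set (En n)} {f Ψ : En n → W}
    (hf : LocallyIntegrable f volume) (hΨ : TF O Ψ) : Integrable (fun x => ⟪f x, Ψ x⟫) volume := by
  have hc := hΨ.1.continuous
  obtain ⟨C, hC⟩ := hc.bounded_above_of_compact_support hΨ.2.1
  have h1 : IntegrableOn (fun x => ⟪f x, Ψ x⟫) (tsupport Ψ) volume := by
    refine Integrable.mono' ((hf.integrableOn_isCompact hΨ.2.1).norm.mul_const C) ?_ (Eventually.of_forall fun x => ?_)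
    · exact hf.aestronglyMeasurable.restrict.inner hc.aestronglyMeasurable
    · exact (norm_inner_le_norm _ _).trans (by gcongr; exact hC x)
  refine (integrableOn_iff_integrable_of_support_subset ?_).1 h1
  intro x hx
  apply subset_tsupport
  intro h0; exact hx (by simp [h0])

theorem weak_vec {Ω O K : Set (En n)} (hOK : O ⊆ K) (hK : K ⊆ Ω)
    {w : En n → Form n N k} {Gw : En n → Fin n → Form n N k} (hG : HasWeakGrad Ω w Gw)
    (hw : LocallyIntegrable (K.indicator fun y => WithLp.toLp 2 (w y)) volume)
    (hGm : ∀ m, LocallyIntegrable (K.indicator fun y => WithLp.toLp 2 (Gw y m)) volume)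
    (m : Fin n) (Ψ : En n → EuclideanSpace ℝ (FormIdx n k × Fin N)) (hΨ : TF O Ψ) :
    ∫ x, ⟪K.indicator (fun y => WithLp.toLp 2 (Gw y m)) x, Ψ x⟫ = - ∫ x, ⟪K.indicator (fun y => WithLp.toLp 2 (w y)) x, pd m Ψ x⟫ := by
  have hcomp : ∀ (u : En n → EuclideanSpace ℝ (FormIdx n k × Fin N)) (q), LocallyIntegrable u volume →
      LocallyIntegrable (fun y => u y q) volume := by
    intro u q hu x
    obtain ⟨s, hs, h⟩ := hu x
    exact ⟨s, hs, (EuclideanSpace.proj q : EuclideanSpace ℝ (FormIdx n k × Fin N) →L[ℝ] ℝ).integrable_comp h⟩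
  have main : ∀ (u Φ : En n → EuclideanSpace ℝ (FormIdx n k × Fin N)), LocallyIntegrable u volume → TF O Φ →
      ∫ x, ⟪u x, Φ x⟫ = ∑ q, ∫ x, ⟪u x q, Φ x q⟫ := by
    intro u Φ hu hΦ
    rw [← integral_finsetSum _ fun q _ => TF.int_inner (hcomp u q hu) (hΦ.comp_q q)]
    refine integral_congr_ae (Eventually.of_forall fun x => ?_)
    simp only [PiLp.inner_apply]
  have loc : ∀ (f g : En n → ℝ) (v : En n → EuclideanSpace ℝ (FormIdx n k × Fin N)) (q), (∀ x, x ∉ O → g x = 0) → (∀ x, v x q = f x) →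
      ∫ x, ⟪K.indicator v x q, g x⟫ = ∫ x in Ω, f x * g x := by
    intro f g v q hg hv
    rw [setIntegral_eq_integral_of_forall_compl_eq_zero]
    · refine integral_congr_ae (Eventually.of_forall fun x => ?_)
      by_cases hx : x ∈ K
      · simp [hx, hv, mul_comm]
      · simp [hg x (fun h => hx (hOK h))]
    · intro x hx
      rw [hg x (fun h => hx (hK (hOK h))), mul_zero]
  rw [main _ _ (hGm m) hΨ, main _ _ hw (hΨ.pd m), ← Finset.sum_neg_distrib]
  refine Finset.sum_congr rfl fun q _ => ?_
  rw [loc (fun x => Gw x m q) (fun x => Ψ x q) _ q (fun x hx => by simp [hΨ.zero_off hx]) (fun x => rfl)]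
  rw [loc (fun x => w x q) (fun x => pd m Ψ x q) _ q (fun x hx => by simp [(hΨ.pd m).zero_off hx]) (fun x => rfl)]
  have hq := hΨ.comp_q q
  have := hG m q (fun x => Ψ x q) ⟨hq.1, hq.2.1, hq.2.2.trans (hOK.trans hK)⟩
  simp only [hΨ.grad] at this
  rw [this, neg_neg]

theorem memLp_form {K Ω : Set (En n)} (hK : IsCompact K) (hKΩ : K ⊆ Ω) {p : ℝ} (hp : 0 < p) {u : En n → Form n N k} {g : En n → ℝ}
    (hm : ∀ q, AEStronglyMeasurable (fun x => u x q) (volume.restrict Ω)) (hg : IntegrableOn (fun x => g x ^ p) K volume)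
    (hle : ∀ x, ‖WithLp.toLp 2 (u x)‖ ≤ g x) :
    MemLp (K.indicator fun y => WithLp.toLp 2 (u y)) (ENNReal.ofReal p) volume := by
  rw [memLp_indicator_iff_restrict hK.measurableSet]
  have m1 : AEStronglyMeasurable (fun y => WithLp.toLp 2 (u y)) (volume.restrict K) := by
    have : AEMeasurable u (volume.restrict K) := aemeasurable_pi_iff.2 fun q => ((hm q).mono_measure (Measure.restrict_mono hKΩ le_rfl)).aemeasurable
    exact (PiLp.continuous_toLp 2 _).comp_aestronglyMeasurable this.aestronglyMeasurable
  rw [← integrable_norm_rpow_iff m1 (by simpa using hp) (by simp)]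
  rw [ENNReal.toReal_ofReal hp.le]
  refine Integrable.mono' hg (m1.norm.aemeasurable.pow_const p).aestronglyMeasurable (Eventually.of_forall fun x => ?_)
  rw [Real.norm_of_nonneg (by positivity)]
  gcongr
  exact hle x

theorem modulus_cont {ω : ℝ → ℝ} (hω : IsDiniModulus ω) {a : En n → ℝ} {Ω : Set (En n)} (h : IsModulusFor ω a Ω) : ContinuousOn a Ω := by
  rw [Metric.continuousOn_iff]
  intro y hy ε hε
  have := hω.2.2.2.eventually (gt_mem_nhds hε)
  rw [eventually_nhdsWithin_iff, Metric.eventually_nhds_iff] at this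
  obtain ⟨δ, hδ, h1⟩ := this
  refine ⟨δ, hδ, fun z hz hd => ?_⟩
  by_cases e : z = y
  · subst e; simpa using hε
  · rw [Real.dist_eq]
    refine (h z hz y hy).trans_lt (h1 ?_ (norm_pos_iff.2 (sub_ne_zero.2 e)))
    rw [Real.dist_eq, sub_zero, abs_of_nonneg (norm_nonneg _), ← dist_eq_norm]; exact hd
end bridge
end DP

namespace DP
set_option linter.unusedSectionVars false
set_option linter.unusedVariables false
open Set
open scoped RealInnerProductSpace Topology

section core

set_option maxHeartbeats 1000000 in
theorem core (n N k : ℕ) {q : ℝ} (hq : 0 < q) : ∃ θ C : ℝ, 0 < θ ∧ 0 < C ∧ ∀ (γ L : ℝ) (ω : ℝ → ℝ), 0 < γ → IsDiniModulus ω →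
    ∀ (Ω : Set (En n)) (a : En n → ℝ) (w : En n → Form n N k) (Gw : En n → Fin n → Form n N k),
      HomogeneousDiniSetting n N k (2 * q + 2) γ L ω Ω a w Gw →
      ∀ (x : En n) (R : ℝ) (κ : ℕ → ℝ), 0 < R → ball x (2 * R) ⊆ Ω → (∀ j, 0 ≤ κ j) →
        (∀ J, ∑ j ∈ Finset.range J, κ j ≤ θ) →
        (∀ j, ∀ y ∈ ball x (R / 2 ^ j), |a x - a y| ≤ γ * κ j) →
        IntegrableOn (fun y => fnorm (extD (Gw y)) ^ (2 * q + 2)) (ball x R) volume ∧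
        (AEStronglyMeasurable (fun y => WithLp.toLp 2 (extD (Gw y))) (volume.restrict (ball x R))) ∧
        ∀ j : ℕ, (∫ y in ball x (R / 2 ^ j), fnorm (extD (Gw y)) ^ (2 * q + 2)) / (R / 2 ^ j) ^ n ≤
          C * ((∫ y in ball x R, fnorm (extD (Gw y)) ^ (2 * q + 2)) / R ^ n) := by
  obtain ⟨θ, C, hθ, hC, H⟩ := iter (sys n N k) hq
  refine ⟨θ, C, hθ, hC, ?_⟩
  intro γ L ω hγ hω Ω a w Gw hS x R κ hR hball hκ0 hκ hκa
  obtain ⟨hO, hmod, haI, ⟨hwg, hwm, hGm, hint⟩, hsol, -⟩ := hS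
  set R' := 3 * R / 2 with hR'
  have hRR : R < R' := by rw [hR']; linarith
  set K := closedBall x R' with hKdef
  have hKΩ : K ⊆ Ω := (closedBall_subset_ball (by rw [hR']; linarith)).trans hball
  have hKc : IsCompact K := isCompact_closedBall x R'
  have hOK : ball x R' ⊆ K := ball_subset_closedBall
  have hp : 0 < 2 * q + 2 := by linarith
  have hp1 : (1 : ℝ≥0∞) ≤ ENNReal.ofReal (2 * q + 2) := by
    rw [← ENNReal.ofReal_one]; exact ENNReal.ofReal_le_ofReal (by linarith)
  obtain ⟨hi1, hi2⟩ := hint K hKΩ hKc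
  have mw := memLp_form hKc hKΩ hp hwm hi1 (fun y => (fnorm_eq (w y)).ge)
  have mG : ∀ m, MemLp (K.indicator fun y => WithLp.toLp 2 (Gw y m)) (ENNReal.ofReal (2 * q + 2)) volume := fun m =>
    memLp_form (u := fun y => Gw y m) hKc hKΩ hp (hGm m) hi2 (fun y => le_gnorm _ _)
  set F : En n → EuclideanSpace ℝ (FormIdx n (k + 1) × Fin N) :=
    fun y => ∑ m, (sys n N k).e m (K.indicator (fun y => WithLp.toLp 2 (Gw y m)) y) with hF
  have FK : ∀ y ∈ K, F y = WithLp.toLp 2 (extD (Gw y)) := by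
    intro y hy
    rw [extD_eq, hF]
    simp only [indicator_of_mem hy]
  have hFm : MemLp F (ENNReal.ofReal (2 * q + 2)) volume :=
    memLp_finsetSum _ fun m _ => ((sys n N k).e m).comp_memLp' (mG m)
  have hFW : WC (sys n N k) (ball x R') F :=
    WC_of_weak _ (mw.locallyIntegrable hp1) (fun m => (mG m).locallyIntegrable hp1)
      (weak_vec hOK hKΩ hwg (mw.locallyIntegrable hp1) (fun m => (mG m).locallyIntegrable hp1))
  have hxΩ : x ∈ Ω := hball (mem_ball_self (by linarith))
  have hax : γ ≤ a x := (haI x hxΩ).1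
  have hax0 : 0 < a x := hγ.trans_le hax
  classical
  set b : En n → ℝ := Ω.piecewise (fun y => a y / a x) (fun _ => 1) with hb
  have hbm : AEStronglyMeasurable b volume :=
    (ContinuousOn.measurable_piecewise ((modulus_cont hω hmod).div_const _) continuousOn_const hO.measurableSet).aestronglyMeasurable
  have hbΩ : ∀ y ∈ Ω, b y = a y / a x := fun y hy => Set.piecewise_eq_of_mem _ _ _ hy
  have hbb : ∀ y, |b y| ≤ |L| / γ + 1 := by
    intro y
    have h0 : 0 ≤ |L| / γ := by positivity
    by_cases hy : y ∈ Ω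
    · rw [hbΩ y hy, abs_div, abs_of_pos hax0]
      have h1 : |a y| ≤ |L| := by
        rw [abs_of_pos (hγ.trans_le (haI y hy).1)]; exact (haI y hy).2.trans (le_abs_self L)
      have : |a y| / a x ≤ |L| / γ := by gcongr
      linarith
    · rw [hb, Set.piecewise_eq_of_notMem _ _ _ hy, abs_one]; linarith
  have hbκ : ∀ j : ℕ, ∀ y ∈ ball x (R / 2 ^ j), |1 - b y| ≤ κ j := by
    intro j y hy
    have hyR : y ∈ ball x (2 * R) := ball_subset_ball ((div_le_self hR.le (one_le_pow₀ (by norm_num))).trans (by linarith)) hy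
    rw [hbΩ y (hball hyR)]
    have e : 1 - a y / a x = (a x - a y) / a x := by field_simp
    rw [e, abs_div, abs_of_pos hax0, div_le_iff₀ hax0]
    refine (hκa j y hy).trans ?_
    rw [mul_comm]
    exact mul_le_mul_of_nonneg_left hax (hκ0 j)
  have hweak : ∀ φ, TF (ball x R') φ → ∫ y, ⟪b y • gA (fun s => s ^ q) (F y), (sys n N k).d φ y⟫ = 0 := by
    intro φ hφ
    have hφ' : TF Ω φ := hφ.mono (hOK.trans hKΩ)
    have h0 := hsol (fun y => (φ y).ofLp) hφ'.test
    have h1 : ∫ y in Ω, finner (nl (2 * q + 2) (a y) (extD (Gw y))) (extD (smoothGrad (fun y => (φ y).ofLp) y))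
        = ∫ y, a x * ⟪b y • gA (fun s => s ^ q) (F y), (sys n N k).d φ y⟫ := by
      have hd := Sys.d_TF (sys n N k) hφ
      rw [setIntegral_eq_integral_of_forall_compl_eq_zero]
      · refine integral_congr_ae (Eventually.of_forall fun y => ?_)
        simp only [finner_eq, hφ.dform]
        by_cases hy : y ∈ K
        · rw [hbΩ y (hKΩ hy), FK y hy, real_inner_smul_left, gA]
          have e : WithLp.toLp 2 (nl (2 * q + 2) (a y) (extD (Gw y))) =
              (a y * fnorm (extD (Gw y)) ^ (2 * q)) • WithLp.toLp 2 (extD (Gw y)) := by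
            ext r
            simp [nl]
          rw [e, real_inner_smul_left, real_inner_smul_left, ← fnorm_eq]
          have e2 : (fnorm (extD (Gw y)) ^ 2) ^ q = fnorm (extD (Gw y)) ^ (2 * q) := by
            rw [Real.rpow_mul (by rw [fnorm_eq]; positivity)]; norm_num
          simp only [e2]
          field_simp
        · rw [hd.zero_off (fun h => hy (hOK h))]; simp
      · intro y hy
        rw [finner_eq, hφ.dform, hd.zero_off (fun h => hy (hKΩ (hOK h))), inner_zero_right]
    rw [h1, integral_const_mul] at h0
    have h2 : ∫ y in Ω, finner (0 : Form n N k) ((φ y).ofLp) = 0 := by simp [finner]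
    rw [h2] at h0
    exact (mul_eq_zero.1 h0).resolve_left hax0.ne'
  have key := H x R R' _ F b κ hR hRR hFm hbm hbb hκ0 hκ hbκ hFW hweak
  have hsub : ∀ j : ℕ, ball x (R / 2 ^ j) ⊆ ball x R := fun j =>
    ball_subset_ball (div_le_self hR.le (one_le_pow₀ (by norm_num)))
  have hRK : ball x R ⊆ K := (ball_subset_ball hRR.le).trans hOK
  have hpt : ∀ y ∈ ball x R, ‖F y‖ ^ (2 * q + 2) = fnorm (extD (Gw y)) ^ (2 * q + 2) := by
    intro y hy; rw [FK y (hRK hy), fnorm_eq]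
  have hint : Integrable (fun y => ‖F y‖ ^ (2 * q + 2)) volume := by
    have := hFm.integrable_norm_rpow (by simpa using hp) (by simp)
    rwa [ENNReal.toReal_ofReal hp.le] at this
  refine ⟨hint.integrableOn.congr_fun hpt measurableSet_ball, ?_, fun j => ?_⟩
  · refine hFm.1.restrict.congr ?_
    filter_upwards [ae_restrict_mem measurableSet_ball] with y hy using FK y (hRK hy)
  · have := key j
    rw [setIntegral_congr_fun measurableSet_ball (fun y hy => hpt y (hsub j hy)), setIntegral_congr_fun measurableSet_ball hpt] at this
    exact this

end core
end DP

namespace DP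
set_option linter.unusedSectionVars false
set_option linter.unusedVariables false
open Set
open scoped RealInnerProductSpace Topology

section fin
variable {n N k : ℕ}

theorem leb {p M R : ℝ} (hp : 1 < p) (hR : 0 < R) {F : En n → Form n N k} {x : En n}
    (hint : IntegrableOn (fun y => fnorm (F y) ^ p) (ball x R) volume)
    (hm : AEStronglyMeasurable (fun y => WithLp.toLp 2 (F y)) (volume.restrict (ball x R)))
    (hM : ∀ j : ℕ, (⨍ y in ball x (R / 2 ^ j), fnorm (F y) ^ p) ≤ M) (hL : IsLebesguePoint F x) : fnorm (F x) ≤ M ^ (1 / p) := by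
  have hp0 : 0 < p := by linarith
  have hr : ∀ j : ℕ, 0 < R / 2 ^ j := fun j => by positivity
  have hsub : ∀ j : ℕ, ball x (R / 2 ^ j) ⊆ ball x R := fun j =>
    ball_subset_ball (div_le_self hR.le (one_le_pow₀ (by norm_num)))
  have hFi : IntegrableOn (fun y => WithLp.toLp 2 (F y)) (ball x R) volume := by
    have : IsFiniteMeasure (volume.restrict (ball x R)) := ⟨by simpa using measure_ball_lt_top⟩
    have : MemLp (fun y => WithLp.toLp 2 (F y)) (ENNReal.ofReal p) (volume.restrict (ball x R)) := by
      rw [← integrable_norm_rpow_iff hm (by simpa using hp0) (by simp), ENNReal.toReal_ofReal hp0.le]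
      have hint' := hint
      simp only [fnorm_eq] at hint'
      exact hint'
    exact this.integrable (by rw [← ENNReal.ofReal_one]; exact ENNReal.ofReal_le_ofReal hp.le)
  have t0 : Tendsto (fun j : ℕ => R / 2 ^ j) atTop (nhdsWithin 0 (Set.Ioi 0)) := by
    refine tendsto_nhdsWithin_iff.2 ⟨?_, Eventually.of_forall hr⟩
    have := (tendsto_pow_atTop_nhds_zero_of_lt_one (r := (1 / 2 : ℝ)) (by norm_num) (by norm_num)).const_mul R
    simpa [div_eq_mul_inv] using this
  have t1 := (hL.comp t0).add_const (M ^ (1 / p))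
  rw [zero_add] at t1
  refine ge_of_tendsto t1 (Eventually.of_forall fun j => ?_)
  have hfin : volume (ball x (R / 2 ^ j)) ≠ ⊤ := measure_ball_lt_top.ne
  have hne : volume (ball x (R / 2 ^ j)) ≠ 0 := (measure_ball_pos _ _ (hr j)).ne'
  have i1 : IntegrableOn (fun y => fnorm (F y)) (ball x (R / 2 ^ j)) volume := by
    simp only [fnorm_eq]; exact (hFi.mono_set (hsub j)).norm
  have ic : IntegrableOn (fun _ => WithLp.toLp 2 (F x)) (ball x (R / 2 ^ j)) volume := integrableOn_const hfin
  have ic' : IntegrableOn (fun _ => fnorm (F x)) (ball x (R / 2 ^ j)) volume := integrableOn_const hfin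
  have i2 : IntegrableOn (fun y => fnorm (F y - F x)) (ball x (R / 2 ^ j)) volume := by
    simp only [fnorm_eq, WithLp.toLp_sub]
    exact ((hFi.mono_set (hsub j)).sub ic).norm
  have jensen : (⨍ y in ball x (R / 2 ^ j), fnorm (F y)) ≤ M ^ (1 / p) := by
    have h1 := ConvexOn.map_set_average_le (g := fun s : ℝ => s ^ p) (s := Set.Ici 0) (f := fun y => fnorm (F y)) (convexOn_rpow hp.le)
      (Real.continuous_rpow_const hp0.le).continuousOn isClosed_Ici hne hfin
      (Eventually.of_forall fun y => Set.mem_Ici.2 (by rw [fnorm_eq]; positivity)) i1 (hint.mono_set (hsub j))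
    have h2 := h1.trans (hM j)
    have h3 : 0 ≤ ⨍ y in ball x (R / 2 ^ j), fnorm (F y) := by
      rw [setAverage_eq, smul_eq_mul]
      exact mul_nonneg (by positivity) (integral_nonneg fun y => by simp only [fnorm_eq]; positivity)
    have h4 := Real.rpow_le_rpow (by positivity) h2 (z := 1 / p) (by positivity)
    rwa [← Real.rpow_mul h3, mul_one_div_cancel hp0.ne', Real.rpow_one] at h4
  have hv : 0 < volume.real (ball x (R / 2 ^ j)) := ENNReal.toReal_pos hne hfin
  have tri : fnorm (F x) ≤ (⨍ y in ball x (R / 2 ^ j), fnorm (F y - F x)) + ⨍ y in ball x (R / 2 ^ j), fnorm (F y) := by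
    simp only [setAverage_eq, smul_eq_mul]
    rw [← mul_add, ← integral_add i2 i1, inv_mul_eq_div, le_div_iff₀ hv]
    have : ∫ y in ball x (R / 2 ^ j), fnorm (F x) = fnorm (F x) * volume.real (ball x (R / 2 ^ j)) := by
      rw [setIntegral_const, smul_eq_mul, mul_comm]
    rw [← this]
    refine setIntegral_mono ic' (i2.add i1) fun y => ?_
    simp only [fnorm_eq, WithLp.toLp_sub]
    have := norm_sub_le (WithLp.toLp 2 (F y)) (WithLp.toLp 2 (F y) - WithLp.toLp 2 (F x))
    rw [sub_sub_cancel] at this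
    linarith
  simp only [Function.comp]
  linarith

theorem dini {ω : ℝ → ℝ} (hω : IsDiniModulus ω) {θ : ℝ} (hθ : 0 < θ) : ∃ R₁ : ℝ, 0 < R₁ ∧ ∀ R, 0 < R → 2 * R ≤ R₁ → ∀ J : ℕ,
    ∑ j ∈ Finset.range J, ω (R / 2 ^ j) ≤ θ := by
  obtain ⟨h0, hmono, hI, -⟩ := hω
  have hc := intervalIntegral.continuousOn_primitive ((integrableOn_Icc_iff_integrableOn_Ioc (by simp)).2 hI)
  have hc0 : Tendsto (fun s => ∫ t in Set.Ioc 0 s, ω t / t) (nhdsWithin 0 (Set.Icc 0 1)) (nhds 0) := by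
    have := hc 0 (by simp)
    unfold ContinuousWithinAt at this
    simpa using this
  have hev := hc0.eventually (gt_mem_nhds (half_pos hθ))
  rw [eventually_nhdsWithin_iff, Metric.eventually_nhds_iff] at hev
  obtain ⟨δ, hδ, h1⟩ := hev
  set R₁ := min 1 (δ / 2) with hR1
  have hR1p : 0 < R₁ := by rw [hR1]; positivity
  have hR11 : R₁ ≤ 1 := min_le_left _ _
  have hR1s := h1 (y := R₁) (by
    rw [Real.dist_eq, sub_zero, abs_of_pos hR1p]; exact (min_le_right _ _).trans_lt (by linarith)) ⟨hR1p.le, hR11⟩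
  refine ⟨R₁, hR1p, fun R hR hRR J => ?_⟩
  have hii : ∀ u v : ℝ, 0 ≤ u → u ≤ v → v ≤ 1 → IntervalIntegrable (fun t => ω t / t) volume u v := fun u v hu huv hv =>
    (intervalIntegrable_iff_integrableOn_Ioc_of_le huv).2 (hI.mono_set (Set.Ioc_subset_Ioc hu hv))
  have hr : ∀ j : ℕ, 2 * R / 2 ^ j ≤ 2 * R := fun j => div_le_self (by linarith) (one_le_pow₀ (by norm_num))
  have ind : ∑ j ∈ Finset.range J, ω (R / 2 ^ j) ≤ 2 * ∫ t in (2 * R / 2 ^ J)..(2 * R), ω t / t := by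
    induction J with
    | zero => simp
    | succ J ih =>
      rw [Finset.sum_range_succ]
      set r := R / 2 ^ J with hrJ
      have hrp : 0 < r := by positivity
      have e1 : 2 * R / 2 ^ (J + 1) = r := by rw [hrJ, pow_succ]; field_simp
      have e2 : 2 * R / 2 ^ J = 2 * r := by rw [hrJ]; ring
      have hr2 : 2 * r ≤ 2 * R := e2 ▸ hr J
      rw [e1]
      rw [e2] at ih
      rw [← intervalIntegral.integral_add_adjacent_intervals (hii r (2 * r) hrp.le (by linarith) (by linarith))
        (hii (2 * r) (2 * R) (by linarith) hr2 (by linarith))]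
      have : ω r / 2 ≤ ∫ t in r..(2 * r), ω t / t := by
        have h2 : ∫ t in r..(2 * r), ω r / (2 * r) ≤ ∫ t in r..(2 * r), ω t / t := by
          refine intervalIntegral.integral_mono_on (by linarith) intervalIntegrable_const (hii r (2 * r) hrp.le (by linarith) (by linarith)) fun t ht => ?_
          have ht0 : 0 < t := hrp.trans_le ht.1
          exact div_le_div₀ (h0 t) (hmono (Set.mem_Ici.2 hrp.le) (Set.mem_Ici.2 ht0.le) ht.1) ht0 ht.2
        rw [intervalIntegral.integral_const, smul_eq_mul] at h2
        refine le_trans (le_of_eq ?_) h2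
        field_simp
        ring
      linarith
  have hp : 0 < 2 * R / 2 ^ J := by positivity
  have hle : ∫ t in (2 * R / 2 ^ J)..(2 * R), ω t / t ≤ ∫ t in (0 : ℝ)..R₁, ω t / t := by
    refine intervalIntegral.integral_mono_interval hp.le (hr J) hRR ?_ (hii 0 R₁ le_rfl hR1p.le hR11)
    filter_upwards [ae_restrict_mem measurableSet_Ioc] with t ht using div_nonneg (h0 t) ht.1.le
  rw [intervalIntegral.integral_of_le hR1p.le] at hle
  linarith
end fin
end DP

/-- **Pointwise bound for the homogeneous system with Dini coefficients (`p > 2`).**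
There exist `c = c(n,N,k,p,γ,L,ω) ≥ 1` and `R₁ = R₁(n,N,k,p,γ,L,ω) > 0` such that the
pointwise estimate `|dw(x)| ≤ c (⨍_{B(x,R)} |dw|^p)^{1/p}` holds whenever
`B(x,2R) ⊆ Ω`, `2R ≤ R₁` and `x` is a Lebesgue point of `dw`; if `a` is constant, the
estimate holds with no restriction on `R`. -/
theorem pointwise_bound_homogeneous_dini
    (n N k : ℕ) (p γ L : ℝ) (hp : 2 < p) (hγ : 0 < γ) (hγL : γ < L)
    (ω : ℝ → ℝ) (hω : IsDiniModulus ω) :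
    ∃ c : ℝ, 1 ≤ c ∧ ∃ R₁ : ℝ, 0 < R₁ ∧
      ∀ (Ω : Set (En n)) (a : En n → ℝ) (w : En n → Form n N k)
        (Gw : En n → Fin n → Form n N k),
        HomogeneousDiniSetting n N k p γ L ω Ω a w Gw →
        ((∀ (x : En n) (R : ℝ), 0 < R → ball x (2 * R) ⊆ Ω → 2 * R ≤ R₁ →
            IsLebesguePoint (fun y => extD (Gw y)) x →
            fnorm (extD (Gw x)) ≤ c * (⨍ y in ball x R, fnorm (extD (Gw y)) ^ p) ^ (1 / p)) ∧
          ((∀ x ∈ Ω, ∀ y ∈ Ω, a x = a y) →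
            ∀ (x : En n) (R : ℝ), 0 < R → ball x (2 * R) ⊆ Ω →
              IsLebesguePoint (fun y => extD (Gw y)) x →
              fnorm (extD (Gw x)) ≤
                c * (⨍ y in ball x R, fnorm (extD (Gw y)) ^ p) ^ (1 / p))) := by
  obtain ⟨q, hq, rfl⟩ : ∃ q : ℝ, 0 < q ∧ p = 2 * q + 2 := ⟨(p - 2) / 2, by linarith, by ring⟩
  obtain ⟨θ, C, hθ, hC, H⟩ := DP.core n N k hq
  obtain ⟨R₁, hR₁, hD⟩ := DP.dini hω (mul_pos hθ hγ)
  refine ⟨max 1 (C ^ (1 / (2 * q + 2))), le_max_left _ _, R₁, hR₁, ?_⟩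
  intro Ω a w Gw hS
  have main : ∀ (x : En n) (R : ℝ) (κ : ℕ → ℝ), 0 < R → ball x (2 * R) ⊆ Ω → (∀ j, 0 ≤ κ j) →
        (∀ J, ∑ j ∈ Finset.range J, κ j ≤ θ) →
        (∀ j, ∀ y ∈ ball x (R / 2 ^ j), |a x - a y| ≤ γ * κ j) →
        IsLebesguePoint (fun y => extD (Gw y)) x →
        fnorm (extD (Gw x)) ≤ max 1 (C ^ (1 / (2 * q + 2))) *
          (⨍ y in ball x R, fnorm (extD (Gw y)) ^ (2 * q + 2)) ^ (1 / (2 * q + 2)) := by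
    intro x R κ hR hball h1 h2 h3 hL
    obtain ⟨k1, k2, k3⟩ := H γ L ω hγ hω Ω a w Gw hS x R κ hR hball h1 h2 h3
    have av : ∀ r : ℝ, 0 < r → (⨍ y in ball x r, fnorm (extD (Gw y)) ^ (2 * q + 2)) =
        (∫ y in ball x r, fnorm (extD (Gw y)) ^ (2 * q + 2)) / r ^ n / DP.vB n := by
      intro r hr
      rw [setAverage_eq, smul_eq_mul, DP.vol_ball x hr, inv_mul_eq_div, div_div]
    have hv := DP.vB_pos (n := n)
    have hM : ∀ j : ℕ, (⨍ y in ball x (R / 2 ^ j), fnorm (extD (Gw y)) ^ (2 * q + 2)) ≤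
        C * ⨍ y in ball x R, fnorm (extD (Gw y)) ^ (2 * q + 2) := by
      intro j
      rw [av _ (by positivity), av _ hR, ← mul_div_assoc]
      exact div_le_div_of_nonneg_right (k3 j) hv.le
    have hA : 0 ≤ ⨍ y in ball x R, fnorm (extD (Gw y)) ^ (2 * q + 2) := by
      rw [setAverage_eq, smul_eq_mul]
      exact mul_nonneg (by positivity) (integral_nonneg fun y => by simp only [DP.fnorm_eq]; positivity)
    have h4 := DP.leb (by linarith) hR k1 k2 hM hL
    rw [Real.mul_rpow hC.le hA] at h4
    refine h4.trans ?_
    gcongr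
    exact le_max_right _ _
  have hmod := hS.2.1
  refine ⟨fun x R hR hball hRR hL => ?_, fun hc x R hR hball hL => ?_⟩
  · refine main x R (fun j => ω (R / 2 ^ j) / γ) hR hball (fun j => div_nonneg (hω.1 _) hγ.le) (fun J => ?_) (fun j y hy => ?_) hL
    · rw [← Finset.sum_div, div_le_iff₀ hγ]
      exact hD R hR hRR J
    · rw [mul_div_cancel₀ _ hγ.ne']
      have hjR : R / 2 ^ j ≤ R := div_le_self hR.le (one_le_pow₀ (by norm_num))
      refine (hmod x (hball (mem_ball_self (by linarith))) y (hball (ball_subset_ball (by linarith) hy))).trans ?_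
      refine hω.2.1 (Set.mem_Ici.2 (norm_nonneg _)) (Set.mem_Ici.2 (by positivity)) ?_
      rw [mem_ball', dist_eq_norm] at hy
      exact hy.le
  · refine main x R (fun _ => 0) hR hball (fun j => le_rfl) (fun J => by simpa using hθ.le) (fun j y hy => ?_) hL
    have hjR : R / 2 ^ j ≤ R := div_le_self hR.le (one_le_pow₀ (by norm_num))
    rw [hc x (hball (mem_ball_self (by linarith))) y (hball (ball_subset_ball (by linarith) hy))]
    simp
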